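/- Assume 1/(1−α) ∉ ℤ, let m ≥ 1 be the unique integer with m < 1/(1−α) < m+1, and set β = 1/(1−α) − m ∈ (0,1). There exists a constant C depending only on α and d (independent of ν and a) such that for every a > 0 and all t₁, t₂ ∈ [a M₁^{−2/(1+α)} ν^{(1−α)/(1+α)}, T): |x^{(m)}(t₁) − x^{(m)}(t₂)| ≤ C (a^{−m} + 1) M₁^{1/(1−α)} |t₁ − t₂|^β. -/

import Mathlib

open MeasureTheory Set

noncomputable def heatKernel (d : ℕ) (s : ℝ) (y : EuclideanSpace ℝ (Fin d)) : ℝ :=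
  (4 * Real.pi * s) ^ (-(d : ℝ) / 2) * Real.exp (-(‖y‖ ^ 2) / (4 * s))

set_option linter.unusedSectionVars false

section Differences

variable {E : Type*} [NormedAddCommGroup E] [NormedSpace ℝ E]


lemma fwdDiff_iter_succ_apply' (h : ℝ) (f : ℝ → E) (n : ℕ) (t : ℝ) :
    (fwdDiff h)^[n + 1] f t = (fwdDiff h)^[n] f (t + h) - (fwdDiff h)^[n] f t := by
  rw [Function.iterate_succ_apply', fwdDiff]

lemma fwdDiff_iter_shift (h a : ℝ) (f : ℝ → E) (n : ℕ) (t : ℝ) :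
    (fwdDiff h)^[n] (fun s => f (s + a)) t = (fwdDiff h)^[n] f (t + a) := by
  induction n generalizing t with
  | zero => rfl
  | succ n ih =>
    rw [fwdDiff_iter_succ_apply', fwdDiff_iter_succ_apply', ih, ih, add_right_comm]

lemma fwdDiff_iter_add_fun (h : ℝ) (f g : ℝ → E) (n : ℕ) (t : ℝ) :
    (fwdDiff h)^[n] (fun s => f s + g s) t = (fwdDiff h)^[n] f t + (fwdDiff h)^[n] g t := by
  induction n generalizing t with
  | zero => rfl
  | succ n ih =>
    simp only [fwdDiff_iter_succ_apply', ih]; abel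

lemma fwdDiff_iter_neg (h : ℝ) (f : ℝ → E) (n : ℕ) (t : ℝ) :
    (fwdDiff (-h))^[n] f t = (-1 : ℝ) ^ n • (fwdDiff h)^[n] f (t - n * h) := by
  induction n generalizing t with
  | zero => simp
  | succ n ih =>
    rw [fwdDiff_iter_succ_apply', fwdDiff_iter_succ_apply', ih, ih, pow_succ, mul_neg_one,
      neg_smul, ← smul_neg, ← smul_sub]
    congr 1
    push_cast
    rw [neg_sub, show t + -h - n * h = t - (n + 1) * h by ring,
      show t - (n + 1) * h + h = t - n * h by ring]

lemma norm_fwdDiff_iter_sub_pow_smul_le (h : ℝ) (n : ℕ) {fs : ℕ → ℝ → E} {S : Set ℝ}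
    (hS : S.OrdConnected) {K : ℝ} {c : E} {t : ℝ}
    (hd : ∀ i < n, ∀ s ∈ S, HasDerivAt (fs i) (fs (i + 1) s) s)
    (hK : ∀ s ∈ S, ‖fs n s - c‖ ≤ K) (ht : t ∈ S) (htn : t + n * h ∈ S) :
    ‖(fwdDiff h)^[n] (fs 0) t - h ^ n • c‖ ≤ |h| ^ n * K := by
  induction n generalizing fs S K c with
  | zero => simpa using hK t ht
  | succ n ih =>
    have hconv : ∀ s ∈ S, ∀ s' ∈ S, uIcc s s' ⊆ S := fun s hs s' hs' => hS.uIcc_subset hs hs'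
    have hmem : ∀ θ : ℝ, 0 ≤ θ → θ ≤ n + 1 → t + θ * h ∈ S := by
      intro θ h0 h1
      apply hconv _ ht _ htn
      push_cast
      rcases le_total 0 h with hh | hh
      · exact mem_uIcc_of_le (by nlinarith) (by nlinarith)
      · exact mem_uIcc_of_ge (by nlinarith) (by nlinarith)
    have hSm : {s | s ∈ S ∧ s + h ∈ S}.OrdConnected := by
      refine ⟨fun x hx y hy z hz => ⟨hS.out hx.1 hy.1 hz, hS.out hx.2 hy.2 ?_⟩⟩
      exact ⟨by linarith [hz.1], by linarith [hz.2]⟩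
    have := ih (fs := fun i => fwdDiff h (fs i)) (S := {s | s ∈ S ∧ s + h ∈ S})
      (K := |h| * K) (c := h • c) hSm ?_ ?_ ?_ ?_
    · rw [Function.iterate_succ_apply, pow_succ, pow_succ, mul_smul, mul_assoc]
      exact this
    · intro i hi s hs
      exact ((hd i (by omega) (s + h) hs.2).comp_add_const s h).sub (hd i (by omega) s hs.1)
    · rintro s ⟨hs, hs'⟩
      have hfun : ∀ y ∈ uIcc s (s + h), HasDerivWithinAt (fun y => fs n y - y • c)
          (fs (n + 1) y - c) (uIcc s (s + h)) y := by
        intro y hy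
        have h1 := hd n (by omega) y (hconv _ hs _ hs' hy)
        have h2 := (hasDerivAt_id y).smul_const c
        simpa using (h1.fun_sub h2).hasDerivWithinAt
      have := (convex_uIcc s (s + h)).norm_image_sub_le_of_norm_hasDerivWithin_le hfun
        (fun y hy => hK y (hconv _ hs _ hs' hy)) left_mem_uIcc right_mem_uIcc
      simp only [add_sub_cancel_left, Real.norm_eq_abs] at this
      rw [mul_comm |h|]
      convert this using 2
      simp only [fwdDiff, add_smul]; abel
    · exact ⟨ht, by simpa using hmem 1 zero_le_one (by linarith [(n.cast_nonneg : (0:ℝ) ≤ n)])⟩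
    · refine ⟨hmem n n.cast_nonneg (by linarith), ?_⟩
      simpa [add_mul, add_assoc] using htn

lemma norm_fwdDiff_two_mul_sub_le (h : ℝ) (k : ℕ) {f : ℝ → E} {t K : ℝ}
    (hK : ∀ j < k, ‖(fwdDiff h)^[k + 1] f (t + j * h)‖ ≤ K) :
    ‖(fwdDiff (2 * h))^[k] f t - (2 : ℝ) ^ k • (fwdDiff h)^[k] f t‖ ≤ k * 2 ^ k * K := by
  induction k generalizing f K with
  | zero => simp
  | succ k ih =>
    have hg : fwdDiff (2 * h) f = fun s => fwdDiff h f (s + h) + fwdDiff h f s := by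
      funext s
      simp only [fwdDiff, show s + 2 * h = s + h + h by ring]; abel
    have key : ∀ n s, (fwdDiff h)^[n] (fwdDiff (2 * h) f) s
        = (fwdDiff h)^[n + 1] f (s + h) + (fwdDiff h)^[n + 1] f s := by
      intro n s
      rw [hg, fwdDiff_iter_add_fun, fwdDiff_iter_shift, ← Function.iterate_succ_apply]
    have h1 := ih (f := fwdDiff (2 * h) f) (K := 2 * K) (by
      intro j hj
      rw [key]
      have e1 := hK j (by omega)
      have e2 := hK (j + 1) (by omega)
      push_cast at e2
      rw [add_mul, one_mul, ← add_assoc] at e2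
      exact (norm_add_le _ _).trans (by linarith))
    have h2 := hK 0 (by omega)
    rw [fwdDiff_iter_succ_apply'] at h2
    simp only [Nat.cast_zero, zero_mul, add_zero] at h2
    rw [key] at h1
    rw [Function.iterate_succ_apply]
    set X := (fwdDiff (2 * h))^[k] (fwdDiff (2 * h) f) t
    set P := (fwdDiff h)^[k + 1] f (t + h)
    set Q := (fwdDiff h)^[k + 1] f t
    have e : X - (2 : ℝ) ^ (k + 1) • Q = (X - (2 : ℝ) ^ k • (P + Q)) + (2 : ℝ) ^ k • (P - Q) := by
      module
    have hK0 : 0 ≤ K := (norm_nonneg _).trans h2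
    rw [e]
    refine (norm_add_le _ _).trans ?_
    rw [norm_smul, norm_pow, Real.norm_two]
    have : (2 : ℝ) ^ k * ‖P - Q‖ ≤ 2 ^ k * K := by gcongr
    have h3 : 0 ≤ (2 : ℝ) ^ k * K := by positivity
    push_cast
    rw [pow_succ]
    nlinarith

/-- The rescaled `m`-th difference is close to the `m`-th derivative when differences of order
`m + 1` are small. -/
lemma norm_fwdDiff_sub_deriv_le {m : ℕ} {γ : ℝ} (hγ : m < γ) {fs : ℕ → ℝ → E} {S : Set ℝ}
    (hS : S.OrdConnected) (hd : ∀ i < m + 1, ∀ s ∈ S, HasDerivAt (fs i) (fs (i + 1) s) s)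
    {B : ℝ} (hB : ∀ t h, h ≠ 0 → t ∈ S → t + (m + 1) * h ∈ S →
      ‖(fwdDiff h)^[m + 1] (fs 0) t‖ ≤ B * |h| ^ γ)
    {t h : ℝ} (hh : h ≠ 0) (ht : t ∈ S) (htm : t + m * h ∈ S) :
    ‖(h ^ m)⁻¹ • (fwdDiff h)^[m] (fs 0) t - fs m t‖ ≤
      m * B * |h| ^ (γ - m) / (1 - (1 / 2) ^ (γ - m)) := by
  have hmem : ∀ θ : ℝ, 0 ≤ θ → θ ≤ m → t + θ * h ∈ S := by
    intro θ h0 h1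
    apply hS.uIcc_subset ht htm
    rcases le_total 0 h with hh | hh
    · exact mem_uIcc_of_le (by nlinarith) (by nlinarith)
    · exact mem_uIcc_of_ge (by nlinarith) (by nlinarith)
  let k : ℕ → ℝ := fun n => h * (1 / 2) ^ n
  have hk0 : ∀ n, k n ≠ 0 := fun n => by simp [k, hh]
  have habs : ∀ n, |k n| = |h| * (1 / 2) ^ n := fun n => by
    simp [k, abs_mul]
  have hk2 : ∀ n, k n = 2 * k (n + 1) := fun n => by simp only [k, pow_succ]; ring
  have hpow1 : ∀ n : ℕ, ((1 / 2 : ℝ)) ^ n ≤ 1 := fun n => pow_le_one₀ (by norm_num) (by norm_num)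
  let D : ℕ → E := fun n => ((k n) ^ m)⁻¹ • (fwdDiff (k n))^[m] (fs 0) t
  have halg : ∀ {a : ℝ}, a ≠ 0 → (a ^ m)⁻¹ = ((2 * a) ^ m)⁻¹ * 2 ^ m := by
    intro a ha
    rw [mul_pow]
    field_simp
  have hstep : ∀ n, dist (D n) (D (n + 1)) ≤ (m * B * |h| ^ (γ - m)) * ((1 / 2 : ℝ) ^ (γ - m)) ^ n := by
    intro n
    rcases Nat.eq_zero_or_pos m with hm0 | hm0
    · subst hm0; simp [D]
    have hs : ∀ j < m, ‖(fwdDiff (k (n + 1)))^[m + 1] (fs 0) (t + j * k (n + 1))‖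
        ≤ B * |k (n + 1)| ^ γ := by
      intro j hj
      have hj' : (j : ℝ) + 1 ≤ m := by exact_mod_cast hj
      have hp : (1 / 2 : ℝ) ^ (n + 1) ≤ 1 / 2 := by
        rw [pow_succ]; linarith [hpow1 n]
      have hp0 : 0 < (1 / 2 : ℝ) ^ (n + 1) := by positivity
      have hj0 : (0 : ℝ) ≤ j := j.cast_nonneg
      refine hB _ _ (hk0 _) ?_ ?_
      · rw [show (j : ℝ) * k (n + 1) = (j * (1 / 2) ^ (n + 1)) * h by simp only [k]; ring]
        exact hmem _ (by positivity) (by nlinarith)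
      · rw [show t + (j : ℝ) * k (n + 1) + (m + 1) * k (n + 1)
          = t + ((j + m + 1) * (1 / 2) ^ (n + 1)) * h by simp only [k]; ring]
        exact hmem _ (by positivity) (by nlinarith)
    have h1 := norm_fwdDiff_two_mul_sub_le (k (n + 1)) m hs
    rw [← hk2] at h1
    have e : D n - D (n + 1) = ((k n) ^ m)⁻¹ • ((fwdDiff (k n))^[m] (fs 0) t
        - (2 : ℝ) ^ m • (fwdDiff (k (n + 1)))^[m] (fs 0) t) := by
      simp only [D, smul_sub, smul_smul]
      rw [halg (hk0 (n + 1)), ← hk2]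
    rw [dist_eq_norm, e, norm_smul, norm_inv, norm_pow, Real.norm_eq_abs]
    have hkp : 0 < |k n| := abs_pos.2 (hk0 n)
    have hkp' : 0 < |k (n + 1)| := abs_pos.2 (hk0 (n + 1))
    have hB0 : 0 ≤ B := by
      have := (norm_nonneg _).trans (hs 0 hm0)
      exact nonneg_of_mul_nonneg_left this (by positivity)
    calc (|k n| ^ m)⁻¹ * _ ≤ (|k n| ^ m)⁻¹ * (m * 2 ^ m * (B * |k (n + 1)| ^ γ)) := by gcongr
      _ = m * B * |k (n + 1)| ^ (γ - m) := by
        rw [hk2 n, abs_mul, abs_two, mul_pow, Real.rpow_sub hkp', Real.rpow_natCast]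
        field_simp
      _ ≤ m * B * |k n| ^ (γ - m) := by
        have : |k (n + 1)| ≤ |k n| := by
          have := (congrArg abs (hk2 n)).trans (abs_mul _ _)
          rw [abs_two] at this; linarith
        have : 0 ≤ γ - m := by linarith
        gcongr
      _ = _ := by
        rw [habs, Real.mul_rpow (abs_nonneg _) (by positivity), ← Real.rpow_natCast (1 / 2),
          ← Real.rpow_mul (by norm_num), ← Real.rpow_natCast ((1 / 2) ^ _),
          ← Real.rpow_mul (by norm_num), mul_comm (n : ℝ)]
        ring
  have hlim : Filter.Tendsto D Filter.atTop (nhds (fs m t)) := by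
    rw [Metric.tendsto_nhds]
    intro ε hε
    have hc : ContinuousAt (fs m) t := (hd m (by omega) t ht).continuousAt
    obtain ⟨δ, hδ, hδ'⟩ := Metric.continuousAt_iff.1 hc (ε / 2) (by linarith)
    have hk : Filter.Tendsto (fun n => |k n| * m) Filter.atTop (nhds 0) := by
      simp only [habs]
      have := ((tendsto_pow_atTop_nhds_zero_of_lt_one (r := (1 / 2 : ℝ)) (by norm_num)
        (by norm_num)).const_mul |h|).mul_const (m : ℝ)
      simpa using this
    filter_upwards [hk.eventually (gt_mem_nhds hδ)] with n hn
    have hend : t + m * k n ∈ S := by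
      rw [show (m : ℝ) * k n = (m * (1 / 2) ^ n) * h by simp only [k]; ring]
      exact hmem _ (by positivity) (by nlinarith [hpow1 n, (m.cast_nonneg : (0:ℝ) ≤ m)])
    have := norm_fwdDiff_iter_sub_pow_smul_le (k n) m (fs := fs) (S := uIcc t (t + m * k n))
      (K := ε / 2) (c := fs m t) (t := t) ordConnected_uIcc
      (fun i hi s hs => hd i (by omega) s (hS.uIcc_subset ht hend hs)) ?_
      left_mem_uIcc right_mem_uIcc
    · have e : D n - fs m t = ((k n) ^ m)⁻¹ • ((fwdDiff (k n))^[m] (fs 0) t - (k n) ^ m • fs m t) := by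
        rw [smul_sub, inv_smul_smul₀ (pow_ne_zero m (hk0 n))]
      have hkp : 0 < |k n| := abs_pos.2 (hk0 n)
      rw [dist_eq_norm, e, norm_smul, norm_inv, norm_pow, Real.norm_eq_abs,
        inv_mul_lt_iff₀ (by positivity)]
      have : 0 < |k n| ^ m := by positivity
      nlinarith
    · intro s hs
      rw [← dist_eq_norm]
      refine (hδ' ?_).le
      have := abs_sub_left_of_mem_uIcc hs
      rw [Real.dist_eq]
      refine this.trans_lt ?_
      rwa [add_sub_cancel_left, abs_mul, Nat.abs_cast, mul_comm]
  have hr : (1 / 2 : ℝ) ^ (γ - m) < 1 :=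
    Real.rpow_lt_one (by norm_num) (by norm_num) (by linarith)
  have := dist_le_of_le_geometric_of_tendsto₀ _ _ hr hstep hlim
  simpa [D, k, dist_eq_norm] using this

/-- Zygmund regularity of order `γ ∈ (m, m + 1)` implies Hölder regularity of the `m`-th
derivative. -/
theorem exists_holder_of_zygmund (m : ℕ) {γ : ℝ} (hγ : m < γ) :
    ∃ C : ℝ, 0 < C ∧ ∀ {fs : ℕ → ℝ → E} {S : Set ℝ}, S.OrdConnected →
      (∀ i < m + 1, ∀ s ∈ S, HasDerivAt (fs i) (fs (i + 1) s) s) →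
      ∀ {B : ℝ}, 0 ≤ B → (∀ t h, 0 < h → t ∈ S → t + (m + 1) * h ∈ S →
        ‖(fwdDiff h)^[m + 1] (fs 0) t‖ ≤ B * h ^ γ) →
      ∀ t₁ ∈ S, ∀ t₂ ∈ S, ‖fs m t₁ - fs m t₂‖ ≤ C * B * |t₁ - t₂| ^ (γ - m) := by
  have hr : (1 / 2 : ℝ) ^ (γ - m) < 1 :=
    Real.rpow_lt_one (by norm_num) (by norm_num) (by linarith)
  have hr' : 0 < 1 - (1 / 2 : ℝ) ^ (γ - m) := by linarith
  refine ⟨2 * (m / (1 - (1 / 2 : ℝ) ^ (γ - m))) + 1, by positivity, ?_⟩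
  intro fs S hS hd B hB0 hB
  have hBs : ∀ t h, h ≠ 0 → t ∈ S → t + (m + 1) * h ∈ S →
      ‖(fwdDiff h)^[m + 1] (fs 0) t‖ ≤ B * |h| ^ γ := by
    intro t h hh ht hth
    rcases lt_or_gt_of_ne hh with hneg | hpos
    · have := hB (t + (m + 1) * h) (-h) (by linarith) hth
        (by rwa [show t + (m + 1) * h + (m + 1) * -h = t by ring])
      rw [fwdDiff_iter_neg, norm_smul, norm_pow, norm_neg, norm_one, one_pow, one_mul] at this
      rw [abs_of_neg hneg]
      convert this using 4
      push_cast; ring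
    · rw [abs_of_pos hpos]; exact hB t h hpos ht hth
  have main : ∀ t₁ ∈ S, ∀ t₂ ∈ S, t₁ < t₂ → ‖fs m t₁ - fs m t₂‖ ≤
      (2 * (m / (1 - (1 / 2 : ℝ) ^ (γ - m))) + 1) * B * |t₁ - t₂| ^ (γ - m) := by
    intro t₁ ht₁ t₂ ht₂ hlt
    set h := (t₂ - t₁) / (m + 1) with hdef
    have hm0 : (0 : ℝ) ≤ m := m.cast_nonneg
    have hh : 0 < h := div_pos (by linarith) (by positivity)
    have ht2 : t₂ = t₁ + (m + 1) * h := by rw [hdef]; field_simp; ring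
    have hle : h ≤ t₂ - t₁ := by rw [ht2]; nlinarith
    have h1 := norm_fwdDiff_sub_deriv_le hγ hS hd hBs hh.ne' ht₁
      (hS.out ht₁ ht₂ ⟨by nlinarith, by nlinarith⟩)
    have h2 := norm_fwdDiff_sub_deriv_le hγ hS hd hBs (neg_ne_zero.2 hh.ne') ht₂
      (hS.out ht₁ ht₂ ⟨by nlinarith, by nlinarith⟩)
    have h3 := hB t₁ h hh ht₁ (ht2 ▸ ht₂)
    rw [abs_neg, abs_of_pos hh] at h2
    rw [abs_of_pos hh] at h1
    have e : ((-h) ^ m)⁻¹ • (fwdDiff (-h))^[m] (fs 0) t₂ =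
        (h ^ m)⁻¹ • (fwdDiff h)^[m] (fs 0) (t₁ + h) := by
      rw [fwdDiff_iter_neg, smul_smul, show t₂ - m * h = t₁ + h by rw [ht2]; ring]
      congr 1
      rw [neg_pow, mul_inv, mul_right_comm, inv_mul_cancel₀ (by simp), one_mul]
    rw [e] at h2
    have hq : 0 < h ^ m := by positivity
    have h4 : ‖(h ^ m)⁻¹ • (fwdDiff h)^[m] (fs 0) (t₁ + h) - (h ^ m)⁻¹ • (fwdDiff h)^[m] (fs 0) t₁‖
        ≤ B * h ^ (γ - m) := by
      rw [← smul_sub, ← fwdDiff_iter_succ_apply', norm_smul, norm_inv, Real.norm_of_nonneg hq.le,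
        Real.rpow_sub hh, Real.rpow_natCast, inv_mul_le_iff₀ hq]
      refine h3.trans (le_of_eq ?_)
      field_simp
    set P := (h ^ m)⁻¹ • (fwdDiff h)^[m] (fs 0) (t₁ + h)
    set Q := (h ^ m)⁻¹ • (fwdDiff h)^[m] (fs 0) t₁
    have e2 : fs m t₁ - fs m t₂ = -(Q - fs m t₁) + (P - fs m t₂) - (P - Q) := by abel
    rw [e2]
    refine (norm_sub_le _ _).trans ((add_le_add (norm_add_le _ _) le_rfl).trans ?_)
    rw [norm_neg]
    have h5 : h ^ (γ - m) ≤ |t₁ - t₂| ^ (γ - m) := by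
      rw [abs_sub_comm, abs_of_pos (by linarith : 0 < t₂ - t₁)]
      exact Real.rpow_le_rpow hh.le hle (by linarith)
    calc _ ≤ (2 * (m / (1 - (1 / 2 : ℝ) ^ (γ - m))) + 1) * B * h ^ (γ - m) := by
          refine (add_le_add (add_le_add h1 h2) h4).trans (le_of_eq ?_)
          ring
      _ ≤ _ := by gcongr
  intro t₁ ht₁ t₂ ht₂
  rcases lt_trichotomy t₁ t₂ with h | h | h
  · exact main t₁ ht₁ t₂ ht₂ h
  · subst h
    simp only [sub_self, norm_zero]
    positivity
  · rw [norm_sub_rev, abs_sub_comm]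
    exact main t₂ ht₂ t₁ ht₁ h

end Differences

section Symbols

variable {F G H : Type*} [NormedAddCommGroup F] [NormedSpace ℝ F]
  [NormedAddCommGroup G] [NormedSpace ℝ G] [NormedAddCommGroup H] [NormedSpace ℝ H]

/-- The curve `f` is `n` times continuously differentiable on `(-1, 1)`, and its `i`-th derivative
is bounded there by `κ i`, for `i ≤ n`. -/
def DerivBound : ℕ → (ℕ → ℝ) → (ℝ → F) → Prop
  | 0, κ, f => ContinuousOn f (Ioo (-1) 1) ∧ ∀ t ∈ Ioo (-1 : ℝ) 1, ‖f t‖ ≤ κ 0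
  | n + 1, κ, f => (∀ t ∈ Ioo (-1 : ℝ) 1, ‖f t‖ ≤ κ 0) ∧
      (∀ t ∈ Ioo (-1 : ℝ) 1, HasDerivAt f (deriv f t) t) ∧
      DerivBound n (fun i => κ (i + 1)) (deriv f)

namespace DerivBound

lemma bound {n : ℕ} {κ : ℕ → ℝ} {f : ℝ → F} (h : DerivBound n κ f) :
    ∀ t ∈ Ioo (-1 : ℝ) 1, ‖f t‖ ≤ κ 0 := by
  cases n with
  | zero => exact h.2
  | succ n => exact h.1

lemma cont {n : ℕ} {κ : ℕ → ℝ} {f : ℝ → F} (h : DerivBound n κ f) :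
    ContinuousOn f (Ioo (-1) 1) := by
  cases n with
  | zero => exact h.1
  | succ n => exact fun t ht => (h.2.1 t ht).continuousAt.continuousWithinAt

lemma congr {n : ℕ} {κ : ℕ → ℝ} {f g : ℝ → F} (h : DerivBound n κ f)
    (hfg : EqOn g f (Ioo (-1) 1)) : DerivBound n κ g := by
  induction n generalizing κ f g with
  | zero => exact ⟨h.1.congr hfg, fun t ht => by rw [hfg ht]; exact h.2 t ht⟩
  | succ n ih =>
    have hev : ∀ t ∈ Ioo (-1 : ℝ) 1, g =ᶠ[nhds t] f := fun t ht =>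
      Filter.eventuallyEq_of_mem (isOpen_Ioo.mem_nhds ht) hfg
    refine ⟨fun t ht => by rw [hfg ht]; exact h.1 t ht, fun t ht => ?_, ih h.2.2 fun t ht => ?_⟩
    · rw [(hev t ht).deriv_eq]
      exact (h.2.1 t ht).congr_of_eventuallyEq (hev t ht)
    · exact (hev t ht).deriv_eq

lemma succ_intro {n : ℕ} {κ : ℕ → ℝ} {f f' : ℝ → F} (h0 : ∀ t ∈ Ioo (-1 : ℝ) 1, ‖f t‖ ≤ κ 0)
    (hd : ∀ t ∈ Ioo (-1 : ℝ) 1, HasDerivAt f (f' t) t)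
    (h : DerivBound n (fun i => κ (i + 1)) f') : DerivBound (n + 1) κ f :=
  ⟨h0, fun t ht => by rw [(hd t ht).deriv]; exact hd t ht, h.congr fun t ht => (hd t ht).deriv⟩

lemma mono {n : ℕ} {κ κ' : ℕ → ℝ} {f : ℝ → F} (h : DerivBound n κ f)
    (hκ : ∀ i ≤ n, κ i ≤ κ' i) : DerivBound n κ' f := by
  induction n generalizing κ κ' f with
  | zero => exact ⟨h.1, fun t ht => (h.2 t ht).trans (hκ 0 le_rfl)⟩
  | succ n ih =>
    exact ⟨fun t ht => (h.1 t ht).trans (hκ 0 (by omega)), h.2.1,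
      ih h.2.2 fun i hi => hκ (i + 1) (by omega)⟩

lemma of_succ {n : ℕ} {κ : ℕ → ℝ} {f : ℝ → F} (h : DerivBound (n + 1) κ f) : DerivBound n κ f := by
  induction n generalizing κ f with
  | zero => exact ⟨h.cont, h.1⟩
  | succ n ih => exact ⟨h.1, h.2.1, ih h.2.2⟩

lemma of_le {n k : ℕ} (hkn : k ≤ n) {κ : ℕ → ℝ} {f : ℝ → F} (h : DerivBound n κ f) :
    DerivBound k κ f := by
  induction n, hkn using Nat.le_induction with
  | base => exact h
  | succ n _ ih => exact ih h.of_succ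

lemma min {n : ℕ} {κ κ' : ℕ → ℝ} {f : ℝ → F} (h : DerivBound n κ f) (h' : DerivBound n κ' f) :
    DerivBound n (fun i => Min.min (κ i) (κ' i)) f := by
  induction n generalizing κ κ' f with
  | zero => exact ⟨h.1, fun t ht => le_min (h.2 t ht) (h'.2 t ht)⟩
  | succ n ih => exact ⟨fun t ht => le_min (h.1 t ht) (h'.1 t ht), h.2.1, ih h.2.2 h'.2.2⟩

lemma add {n : ℕ} {κ κ' : ℕ → ℝ} {f g : ℝ → F} (h : DerivBound n κ f) (h' : DerivBound n κ' g) :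
    DerivBound n (fun i => κ i + κ' i) (fun t => f t + g t) := by
  induction n generalizing κ κ' f g with
  | zero => exact ⟨h.1.add h'.1, fun t ht => (norm_add_le _ _).trans (add_le_add (h.2 t ht) (h'.2 t ht))⟩
  | succ n ih =>
    exact succ_intro (fun t ht => (norm_add_le _ _).trans (add_le_add (h.1 t ht) (h'.1 t ht)))
      (fun t ht => (h.2.1 t ht).fun_add (h'.2.1 t ht)) (ih h.2.2 h'.2.2)

lemma neg {n : ℕ} {κ : ℕ → ℝ} {f : ℝ → F} (h : DerivBound n κ f) :
    DerivBound n κ (fun t => - f t) := by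
  induction n generalizing κ f with
  | zero => exact ⟨h.1.neg, fun t ht => by rw [norm_neg]; exact h.2 t ht⟩
  | succ n ih =>
    exact succ_intro (fun t ht => by rw [norm_neg]; exact h.1 t ht)
      (fun t ht => (h.2.1 t ht).fun_neg) (ih h.2.2)

lemma sub {n : ℕ} {κ κ' : ℕ → ℝ} {f g : ℝ → F} (h : DerivBound n κ f) (h' : DerivBound n κ' g) :
    DerivBound n (fun i => κ i + κ' i) (fun t => f t - g t) := by
  simpa only [sub_eq_add_neg] using h.add h'.neg

lemma const_smul {n : ℕ} {κ : ℕ → ℝ} {f : ℝ → F} (h : DerivBound n κ f) (c : ℝ) :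
    DerivBound n (fun i => |c| * κ i) (fun t => c • f t) := by
  induction n generalizing κ f with
  | zero =>
    refine ⟨h.1.const_smul c, fun t ht => ?_⟩
    rw [norm_smul, Real.norm_eq_abs]
    exact mul_le_mul_of_nonneg_left (h.2 t ht) (abs_nonneg c)
  | succ n ih =>
    refine succ_intro (fun t ht => ?_) (fun t ht => (h.2.1 t ht).fun_const_smul c) (ih h.2.2)
    rw [norm_smul, Real.norm_eq_abs]
    exact mul_le_mul_of_nonneg_left (h.1 t ht) (abs_nonneg c)

lemma deriv_bound {n : ℕ} {κ : ℕ → ℝ} {f : ℝ → F} (h : DerivBound n κ f) :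
    (∀ i < n, ∀ t ∈ Ioo (-1 : ℝ) 1, HasDerivAt (deriv^[i] f) (deriv^[i + 1] f t) t) ∧
      ∀ i ≤ n, ∀ t ∈ Ioo (-1 : ℝ) 1, ‖deriv^[i] f t‖ ≤ κ i := by
  induction n generalizing κ f with
  | zero => exact ⟨by simp, fun i hi => by obtain rfl : i = 0 := by omega
                                           exact h.2⟩
  | succ n ih =>
    obtain ⟨h1, h2⟩ := ih h.2.2
    constructor
    · intro i hi
      cases i with
      | zero => exact h.2.1
      | succ i =>
        intro t ht
        simpa only [Function.iterate_succ_apply] using h1 i (by omega) t ht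
    · intro i hi
      cases i with
      | zero => exact h.1
      | succ i =>
        intro t ht
        simpa only [Function.iterate_succ_apply] using h2 i (by omega) t ht

end DerivBound

/-- Geometric derivative bounds `‖f⁽ⁱ⁾‖ ≤ K qⁱ`. -/
abbrev GeomBound (n : ℕ) (K q : ℝ) (f : ℝ → F) : Prop := DerivBound n (fun i => K * q ^ i) f

namespace GeomBound

lemma bound {n : ℕ} {K q : ℝ} {f : ℝ → F} (h : GeomBound n K q f) :
    ∀ t ∈ Ioo (-1 : ℝ) 1, ‖f t‖ ≤ K := by
  simpa using DerivBound.bound h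

lemma shift_iff {n : ℕ} {K q : ℝ} {f : ℝ → F} :
    DerivBound n (fun i => K * q ^ (i + 1)) f ↔ GeomBound n (K * q) q f := by
  unfold GeomBound
  simp only [pow_succ, mul_assoc, mul_comm q]

lemma succ_intro {n : ℕ} {K q : ℝ} {f f' : ℝ → F} (h0 : ∀ t ∈ Ioo (-1 : ℝ) 1, ‖f t‖ ≤ K)
    (hd : ∀ t ∈ Ioo (-1 : ℝ) 1, HasDerivAt f (f' t) t)
    (h : GeomBound n (K * q) q f') : GeomBound (n + 1) K q f :=
  DerivBound.succ_intro (by simpa using h0) hd (shift_iff.2 h)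

lemma mono {n : ℕ} {K K' q q' : ℝ} {f : ℝ → F} (h : GeomBound n K q f) (hK : K ≤ K')
    (hK' : 0 ≤ K') (hq : 0 ≤ q) (hqq : q ≤ q') : GeomBound n K' q' f :=
  DerivBound.mono h fun i _ => by
    have : 0 ≤ q ^ i := by positivity
    gcongr

lemma nonneg {n : ℕ} {K q : ℝ} {f : ℝ → F} (h : GeomBound n K q f) : 0 ≤ K :=
  (norm_nonneg _).trans (h.bound 0 (by norm_num))

lemma add {n : ℕ} {K K' q : ℝ} {f g : ℝ → F} (h : GeomBound n K q f) (h' : GeomBound n K' q g) :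
    GeomBound n (K + K') q (fun t => f t + g t) := by
  simpa only [GeomBound, add_mul] using DerivBound.add h h'

lemma sub {n : ℕ} {K K' q : ℝ} {f g : ℝ → F} (h : GeomBound n K q f) (h' : GeomBound n K' q g) :
    GeomBound n (K + K') q (fun t => f t - g t) := by
  simpa only [GeomBound, add_mul] using DerivBound.sub h h'

lemma const_smul {n : ℕ} {K q : ℝ} {f : ℝ → F} (h : GeomBound n K q f) (c : ℝ) :
    GeomBound n (|c| * K) q (fun t => c • f t) := by
  simpa only [GeomBound, mul_assoc] using DerivBound.const_smul h c

lemma bilin (L : F →L[ℝ] G →L[ℝ] H) {n : ℕ} {K K' q : ℝ} (hq : 0 ≤ q) {f : ℝ → F} {g : ℝ → G}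
    (h : GeomBound n K q f) (h' : GeomBound n K' q g) :
    GeomBound n (2 ^ n * ‖L‖ * (K * K')) q (fun t => L (f t) (g t)) := by
  have h0 : ∀ {K K' : ℝ} {f : ℝ → F} {g : ℝ → G}, (∀ t ∈ Ioo (-1 : ℝ) 1, ‖f t‖ ≤ K) →
      (∀ t ∈ Ioo (-1 : ℝ) 1, ‖g t‖ ≤ K') → 0 ≤ K → ∀ t ∈ Ioo (-1 : ℝ) 1,
      ‖L (f t) (g t)‖ ≤ ‖L‖ * (K * K') := by
    intro K K' f g hf hg hK t ht
    refine (L.le_opNorm₂ _ _).trans ?_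
    rw [mul_assoc]
    gcongr
    exacts [hf t ht, hg t ht]
  induction n generalizing K K' f g with
  | zero =>
    refine ⟨?_, ?_⟩
    · exact (L.continuous.comp_continuousOn h.cont).clm_apply h'.cont
    · simpa using h0 h.bound h'.bound h.nonneg
  | succ n ih =>
    have hf' := shift_iff.1 h.2.2
    have hg' := shift_iff.1 h'.2.2
    refine succ_intro (f' := fun t => L (deriv f t) (g t) + L (f t) (deriv g t)) (fun t ht => ?_)
      (fun t ht => ?_) ?_
    · have h1 := h0 h.bound h'.bound h.nonneg t ht
      have h2 : (1 : ℝ) ≤ 2 ^ (n + 1) := one_le_pow₀ (by norm_num)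
      have h3 : 0 ≤ ‖L‖ * (K * K') := (norm_nonneg _).trans h1
      rw [mul_assoc]
      nlinarith
    · have := (L.hasFDerivAt.comp_hasDerivAt t (h.2.1 t ht)).clm_apply (h'.2.1 t ht)
      simpa using this
    · have := (ih hf' h'.of_succ).add (ih h.of_succ hg')
      refine GeomBound.mono this (le_of_eq (by ring)) ?_ hq le_rfl
      have := h.nonneg
      have := h'.nonneg
      positivity

end GeomBound

/-- Two curves with geometric bounds whose difference is smaller by a factor `η`. -/
structure PairBound (n : ℕ) (K q η : ℝ) (f g : ℝ → F) : Prop where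
  left : GeomBound n K q f
  right : GeomBound n K q g
  diff : GeomBound n (K * η) q (fun t => f t - g t)

namespace PairBound

lemma mono {n : ℕ} {K K' q q' η : ℝ} {f g : ℝ → F} (h : PairBound n K q η f g) (hK : K ≤ K')
    (hη : 0 ≤ η) (hq : 0 ≤ q) (hqq : q ≤ q') : PairBound n K' q' η f g := by
  have hK' := h.left.nonneg.trans hK
  exact ⟨h.left.mono hK hK' hq hqq, h.right.mono hK hK' hq hqq,
    h.diff.mono (by gcongr) (by positivity) hq hqq⟩

lemma add {n : ℕ} {K K' q η : ℝ} {f g f' g' : ℝ → F} (h : PairBound n K q η f g)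
    (h' : PairBound n K' q η f' g') :
    PairBound n (K + K') q η (fun t => f t + f' t) (fun t => g t + g' t) := by
  refine ⟨h.left.add h'.left, h.right.add h'.right, ?_⟩
  have := h.diff.add h'.diff
  rw [← add_mul] at this
  exact this.congr fun t _ => by simp only; abel

lemma const_smul {n : ℕ} {K q η : ℝ} {f g : ℝ → F} (h : PairBound n K q η f g) (c : ℝ) :
    PairBound n (|c| * K) q η (fun t => c • f t) (fun t => c • g t) := by
  refine ⟨h.left.const_smul c, h.right.const_smul c, ?_⟩
  have := h.diff.const_smul c
  rw [← mul_assoc] at this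
  exact this.congr fun t _ => by simp only [smul_sub]

lemma bilin (L : F →L[ℝ] G →L[ℝ] H) {n : ℕ} {K K' q η : ℝ} (hq : 0 ≤ q) (hη : 0 ≤ η)
    {f₁ f₂ : ℝ → F} {g₁ g₂ : ℝ → G}
    (h : PairBound n K q η f₁ f₂) (h' : PairBound n K' q η g₁ g₂) :
    PairBound n (2 ^ (n + 1) * ‖L‖ * (K * K')) q η (fun t => L (f₁ t) (g₁ t))
      (fun t => L (f₂ t) (g₂ t)) := by
  have := h.left.nonneg
  have := h'.left.nonneg
  have hle : 2 ^ n * ‖L‖ * (K * K') ≤ 2 ^ (n + 1) * ‖L‖ * (K * K') := by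
    have : (2 : ℝ) ^ n ≤ 2 ^ (n + 1) := pow_le_pow_right₀ (by norm_num) (by omega)
    gcongr
  have hle' : 0 ≤ 2 ^ (n + 1) * ‖L‖ * (K * K') := by positivity
  refine ⟨(GeomBound.bilin L hq h.left h'.left).mono hle hle' hq le_rfl,
    (GeomBound.bilin L hq h.right h'.right).mono hle hle' hq le_rfl, ?_⟩
  have := (GeomBound.bilin L hq h.diff h'.left).add (GeomBound.bilin L hq h.right h'.diff)
  refine (GeomBound.mono this (le_of_eq (by ring)) (by positivity) hq le_rfl).congr fun t _ => ?_
  simp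

lemma clm_apply {n : ℕ} {K K' q η : ℝ} (hq : 0 ≤ q) (hη : 0 ≤ η)
    {f₁ f₂ : ℝ → G →L[ℝ] H} {g₁ g₂ : ℝ → G}
    (h : PairBound n K q η f₁ f₂) (h' : PairBound n K' q η g₁ g₂) :
    PairBound n (2 ^ (n + 1) * (K * K')) q η (fun t => f₁ t (g₁ t)) (fun t => f₂ t (g₂ t)) := by
  have := h.left.nonneg
  have := h'.left.nonneg
  refine (bilin (ContinuousLinearMap.id ℝ (G →L[ℝ] H)) hq hη h h').mono ?_ hη hq le_rfl
  have : ‖ContinuousLinearMap.id ℝ (G →L[ℝ] H)‖ ≤ 1 := ContinuousLinearMap.norm_id_le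
  have : (2 : ℝ) ^ (n + 1) * ‖ContinuousLinearMap.id ℝ (G →L[ℝ] H)‖ ≤ 2 ^ (n + 1) :=
    mul_le_of_le_one_right (by positivity) this
  gcongr

end PairBound

section Integral

variable {X : Type*} [MeasurableSpace X] {μ : Measure X}

lemma DerivBound.integral {n : ℕ} {κ : X → ℕ → ℝ} {f : X → ℝ → F}
    (h : ∀ x, DerivBound n (κ x) (f x)) (hκ : ∀ i ≤ n, Integrable (fun x => κ x i) μ)
    (hm : ∀ t ∈ Ioo (-1 : ℝ) 1, AEStronglyMeasurable (fun x => f x t) μ) :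
    DerivBound n (fun i => ∫ x, κ x i ∂μ) (fun t => ∫ x, f x t ∂μ) := by
  have hb : ∀ {κ : X → ℕ → ℝ} {f : X → ℝ → F}, (∀ x, ∀ t ∈ Ioo (-1 : ℝ) 1, ‖f x t‖ ≤ κ x 0) →
      Integrable (fun x => κ x 0) μ → ∀ t ∈ Ioo (-1 : ℝ) 1, ‖∫ x, f x t ∂μ‖ ≤ ∫ x, κ x 0 ∂μ :=
    fun h hi t ht => norm_integral_le_of_norm_le hi (.of_forall fun x => h x t ht)
  induction n generalizing κ f with
  | zero =>
    refine ⟨?_, hb (fun x => (h x).2) (hκ 0 le_rfl)⟩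
    exact continuousOn_of_dominated (bound := fun x => κ x 0) hm
      (fun t ht => .of_forall fun x => (h x).2 t ht) (hκ 0 le_rfl) (.of_forall fun x => (h x).1)
  | succ n ih =>
    have hm' : ∀ t ∈ Ioo (-1 : ℝ) 1, AEStronglyMeasurable (fun x => deriv (f x) t) μ := by
      intro t ht
      have hlim : Filter.Tendsto (fun k : ℕ => t + (1 / ((k : ℝ) + 1))) Filter.atTop (nhds t) := by
        simpa using tendsto_one_div_add_atTop_nhds_zero_nat.const_add t
      obtain ⟨N, hN⟩ := Filter.eventually_atTop.1 (hlim.eventually (isOpen_Ioo.mem_nhds ht))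
      refine aestronglyMeasurable_of_tendsto_ae Filter.atTop
        (f := fun (k : ℕ) x => slope (f x) t (t + 1 / (((k + N : ℕ) : ℝ) + 1))) (fun k => ?_) ?_
      · simp only [slope_def_module]
        exact (((hm _ (hN (k + N) (by omega))).sub (hm t ht))).const_smul _
      · refine .of_forall fun x => ?_
        refine (hasDerivAt_iff_tendsto_slope.1 ((h x).2.1 t ht)).comp ?_
        refine tendsto_nhdsWithin_iff.2 ⟨?_, .of_forall fun k => ?_⟩
        · exact hlim.comp (Filter.tendsto_add_atTop_nat N)
        · simp only [mem_compl_iff, mem_singleton_iff, add_eq_left]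
          positivity
    refine succ_intro (f' := fun t => ∫ x, deriv (f x) t ∂μ) (hb (fun x => (h x).1) (hκ 0 (by omega)))
      (fun t ht => ?_) (ih (fun x => (h x).2.2) (fun i hi => hκ (i + 1) (by omega)) hm')
    refine (hasDerivAt_integral_of_dominated_loc_of_deriv_le (bound := fun x => κ x 1)
      (F := fun t x => f x t) (F' := fun t x => deriv (f x) t)
      (isOpen_Ioo.mem_nhds ht) ?_ ?_ (hm' t ht) ?_ (hκ 1 (by omega)) ?_).2
    · filter_upwards [isOpen_Ioo.mem_nhds ht] with s hs using hm s hs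
    · exact (hκ 0 (by omega)).mono' (hm t ht) (.of_forall fun x => (h x).1 t ht)
    · exact .of_forall fun x s hs => (h x).2.2.bound s hs
    · exact .of_forall fun x s hs => (h x).2.1 s hs

end Integral

end Symbols

section Kernels

universe v
variable {E F G H : Type v} [NormedAddCommGroup E] [NormedSpace ℝ E] [NormedAddCommGroup F]
  [NormedSpace ℝ F] [NormedAddCommGroup G] [NormedSpace ℝ G] [NormedAddCommGroup H]
  [NormedSpace ℝ H]

/-- Smooth kernels of order `-a`: each derivative gains one power of decay. -/
def KernelDecay (a : ℝ) (K : E → F) : Prop :=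
  ContDiff ℝ (⊤ : ℕ∞) K ∧ ∀ i : ℕ, ∃ C : ℝ, 0 ≤ C ∧ ∀ y,
    ‖iteratedFDeriv ℝ i K y‖ ≤ C * (1 + ‖y‖) ^ (-a - i)

namespace KernelDecay

lemma fderiv {a : ℝ} {K : E → F} (h : KernelDecay a K) : KernelDecay (a + 1) (fderiv ℝ K) := by
  refine ⟨h.1.fderiv_right (by simp), fun i => ?_⟩
  obtain ⟨C, hC0, hC⟩ := h.2 (i + 1)
  refine ⟨C, hC0, fun y => ?_⟩
  rw [norm_iteratedFDeriv_fderiv]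
  refine (hC y).trans_eq ?_
  push_cast; ring_nf

lemma bound {a : ℝ} {K : E → F} (h : KernelDecay a K) :
    ∃ C : ℝ, 0 ≤ C ∧ ∀ y, ‖K y‖ ≤ C * (1 + ‖y‖) ^ (-a) := by
  obtain ⟨C, hC0, hC⟩ := h.2 0
  exact ⟨C, hC0, fun y => by simpa using hC y⟩

lemma differentiable {a : ℝ} {K : E → F} (h : KernelDecay a K) : Differentiable ℝ K :=
  h.1.differentiable (by simp)

lemma mono {a b : ℝ} (hab : a ≤ b) {K : E → F} (h : KernelDecay b K) : KernelDecay a K := by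
  refine ⟨h.1, fun i => ?_⟩
  obtain ⟨C, hC0, hC⟩ := h.2 i
  refine ⟨C, hC0, fun y => (hC y).trans ?_⟩
  have : 1 ≤ 1 + ‖y‖ := by linarith [norm_nonneg y]
  gcongr

lemma add {a : ℝ} {K L : E → F} (h : KernelDecay a K) (h' : KernelDecay a L) :
    KernelDecay a (fun y => K y + L y) := by
  refine ⟨h.1.add h'.1, fun i => ?_⟩
  obtain ⟨C, hC0, hC⟩ := h.2 i
  obtain ⟨C', hC0', hC'⟩ := h'.2 i
  refine ⟨C + C', by positivity, fun y => ?_⟩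
  have := iteratedFDeriv_add (i := i) (h.1.of_le (by exact_mod_cast le_top)) (h'.1.of_le (by exact_mod_cast le_top))
  have e : (fun y => K y + L y) = K + L := rfl
  rw [e, this, add_mul]
  exact (norm_add_le _ _).trans (add_le_add (hC y) (hC' y))

lemma clm_comp (T : F →L[ℝ] G) {a : ℝ} {K : E → F} (h : KernelDecay a K) :
    KernelDecay a (fun y => T (K y)) := by
  refine ⟨T.contDiff.comp h.1, fun i => ?_⟩
  obtain ⟨C, hC0, hC⟩ := h.2 i
  refine ⟨‖T‖ * C, by positivity, fun y => ?_⟩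
  have := T.norm_iteratedFDeriv_comp_left (n := i) (h.1.contDiffAt (x := y))
    (by exact_mod_cast le_top)
  rw [mul_assoc]
  exact this.trans (by gcongr; exact hC y)

lemma bilin (B : F →L[ℝ] G →L[ℝ] H) {a b : ℝ} {K : E → F} {L : E → G} (h : KernelDecay a K)
    (h' : KernelDecay b L) : KernelDecay (a + b) (fun y => B (K y) (L y)) := by
  refine ⟨(B.contDiff.comp h.1).clm_apply h'.1, fun i => ?_⟩
  choose C hC0 hC using h.2
  choose C' hC0' hC' using h'.2
  refine ⟨‖B‖ * ∑ j ∈ Finset.range (i + 1), (i.choose j : ℝ) * C j * C' (i - j),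
    mul_nonneg (norm_nonneg B) (Finset.sum_nonneg fun j _ =>
      mul_nonneg (mul_nonneg (by positivity) (hC0 j)) (hC0' _)), fun y => ?_⟩
  have hy : 0 < 1 + ‖y‖ := by positivity
  refine (B.norm_iteratedFDeriv_le_of_bilinear h.1 h'.1 y (n := i)
    (by exact_mod_cast le_top)).trans ?_
  rw [mul_assoc, Finset.sum_mul]
  refine mul_le_mul_of_nonneg_left (Finset.sum_le_sum fun j hj => ?_) (norm_nonneg B)
  have hj' : j ≤ i := by simpa [Nat.lt_succ_iff] using hj
  have e : (1 + ‖y‖) ^ (-(a + b) - i) = (1 + ‖y‖) ^ (-a - j) * (1 + ‖y‖) ^ (-b - ((i - j : ℕ) : ℝ)) := by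
    rw [← Real.rpow_add hy, Nat.cast_sub hj']; ring_nf
  rw [e]
  calc _ ≤ (i.choose j : ℝ) * (C j * (1 + ‖y‖) ^ (-a - j)) *
        (C' (i - j) * (1 + ‖y‖) ^ (-b - ((i - j : ℕ) : ℝ))) := by
        gcongr
        · exact mul_nonneg (by positivity) (mul_nonneg (hC0 j) (by positivity))
        · exact hC j y
        · exact hC' _ y
    _ = _ := by ring

end KernelDecay

/-- Two curves at distance about `r` from the origin, moving at speed at most about `V`, whose
separation is smaller by a factor `η`. -/
structure CurvePair (n : ℕ) (C₁ r V q η : ℝ) (ζ₁ ζ₂ ζ₁' ζ₂' : ℝ → E) : Prop where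
  r_pos : 0 < r
  V_nonneg : 0 ≤ V
  q_nonneg : 0 ≤ q
  η_nonneg : 0 ≤ η
  V_le : V ≤ r * q
  deriv₁ : ∀ t ∈ Ioo (-1 : ℝ) 1, HasDerivAt ζ₁ (ζ₁' t) t
  deriv₂ : ∀ t ∈ Ioo (-1 : ℝ) 1, HasDerivAt ζ₂ (ζ₂' t) t
  far₁ : ∀ t ∈ Ioo (-1 : ℝ) 1, r ≤ C₁ * (1 + ‖ζ₁ t‖)
  far₂ : ∀ t ∈ Ioo (-1 : ℝ) 1, r ≤ C₁ * (1 + ‖ζ₂ t‖)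
  close : ∀ t ∈ Ioo (-1 : ℝ) 1, ‖ζ₁ t - ζ₂ t‖ ≤ C₁ * r * η
  velocity : PairBound n (C₁ * V) q η ζ₁' ζ₂'

lemma CurvePair.of_succ {n : ℕ} {C₁ r V q η : ℝ} {ζ₁ ζ₂ ζ₁' ζ₂' : ℝ → E}
    (h : CurvePair (n + 1) C₁ r V q η ζ₁ ζ₂ ζ₁' ζ₂') : CurvePair n C₁ r V q η ζ₁ ζ₂ ζ₁' ζ₂' :=
  { h with velocity := ⟨h.velocity.left.of_succ, h.velocity.right.of_succ, h.velocity.diff.of_succ⟩ }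

lemma rpow_neg_le_of_le_mul {C₁ a r z : ℝ} (hC : 0 < C₁) (ha : 0 ≤ a) (hr : 0 < r)
    (h : r ≤ C₁ * z) : z ^ (-a) ≤ C₁ ^ a * r ^ (-a) := by
  have h1 : r / C₁ ≤ z := by rwa [div_le_iff₀' hC]
  have h2 := Real.rpow_le_rpow_of_nonpos (by positivity) h1 (neg_nonpos.2 ha)
  refine h2.trans_eq ?_
  rw [Real.div_rpow hr.le hC.le, Real.rpow_neg hC.le a]
  field_simp

namespace KernelDecay

lemma exists_comp_bound {a : ℝ} (ha : 0 ≤ a) {K : E → F} (h : KernelDecay a K) {C₁ : ℝ}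
    (hC₁ : 0 < C₁) : ∃ C : ℝ, 0 ≤ C ∧ ∀ {r : ℝ} {z : E}, 0 < r → r ≤ C₁ * (1 + ‖z‖) →
      ‖K z‖ ≤ C * r ^ (-a) := by
  obtain ⟨C, hC0, hC⟩ := h.bound
  refine ⟨C * C₁ ^ a, by positivity, fun {r z} hr hz => (hC z).trans ?_⟩
  rw [mul_assoc]
  gcongr
  exact rpow_neg_le_of_le_mul hC₁ ha hr hz

lemma exists_comp_sub_bound {a : ℝ} (ha : 0 ≤ a) {K : E → F} (h : KernelDecay a K) {C₁ : ℝ}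
    (hC₁ : 0 < C₁) : ∃ C : ℝ, 0 ≤ C ∧ ∀ {r η : ℝ} {z w : E}, 0 < r → 0 ≤ η →
      r ≤ C₁ * (1 + ‖z‖) → r ≤ C₁ * (1 + ‖w‖) → ‖z - w‖ ≤ C₁ * r * η →
      ‖K z - K w‖ ≤ C * r ^ (-a) * η := by
  obtain ⟨C, hC0, hC⟩ := h.exists_comp_bound ha hC₁
  obtain ⟨C', hC0', hC'⟩ := h.fderiv.exists_comp_bound (by linarith) (C₁ := 2 * C₁) (by linarith)
  refine ⟨4 * C * C₁ ^ 2 + C' * C₁, by positivity, fun {r η z w} hr hη hz hw hzw => ?_⟩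
  have hra : 0 < r ^ (-a) := by positivity
  by_cases hcase : 1 ≤ 2 * C₁ ^ 2 * η
  · calc ‖K z - K w‖ ≤ C * r ^ (-a) + C * r ^ (-a) :=
          (norm_sub_le _ _).trans (add_le_add (hC hr hz) (hC hr hw))
      _ ≤ (C * r ^ (-a) + C * r ^ (-a)) * (2 * C₁ ^ 2 * η) :=
          le_mul_of_one_le_right (by positivity) hcase
      _ ≤ _ := by
        have : 0 ≤ C' * C₁ * r ^ (-a) * η := by positivity
        nlinarith
  · push Not at hcase
    have hseg : ∀ y ∈ segment ℝ z w, ‖_root_.fderiv ℝ K y‖ ≤ C' * r ^ (-(a + 1)) := by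
      intro y hy
      refine hC' hr ?_
      have h1 : ‖y - z‖ ≤ ‖z - w‖ := by
        obtain ⟨θ, hθ, rfl⟩ := (segment_eq_image' ℝ z w ▸ hy)
        rw [add_sub_cancel_left, norm_smul, Real.norm_of_nonneg hθ.1, norm_sub_rev]
        exact mul_le_of_le_one_left (norm_nonneg _) hθ.2
      have h2 : ‖z‖ ≤ ‖y‖ + ‖z - w‖ := by
        have := norm_sub_norm_le z y
        rw [norm_sub_rev] at this
        linarith
      nlinarith
    have := (convex_segment z w).norm_image_sub_le_of_norm_fderiv_le (𝕜 := ℝ)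
      (fun y _ => h.differentiable y) hseg (right_mem_segment ℝ z w) (left_mem_segment ℝ z w)
    refine this.trans ?_
    have e : r ^ (-(a + 1)) * r = r ^ (-a) := by
      rw [← Real.rpow_add_one hr.ne']; ring_nf
    calc C' * r ^ (-(a + 1)) * ‖z - w‖ ≤ C' * r ^ (-(a + 1)) * (C₁ * r * η) := by gcongr
      _ = C' * C₁ * (r ^ (-(a + 1)) * r) * η := by ring
      _ ≤ _ := by
        rw [e]
        have : 0 ≤ 4 * C * C₁ ^ 2 * r ^ (-a) * η := by positivity
        nlinarith

theorem exists_pairBound_comp (n : ℕ) {a : ℝ} (ha : 0 ≤ a) {K : E → F} (h : KernelDecay a K)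
    {C₁ : ℝ} (hC₁ : 0 < C₁) : ∃ C : ℝ, 0 ≤ C ∧
      ∀ {r V q η : ℝ} {ζ₁ ζ₂ ζ₁' ζ₂' : ℝ → E}, CurvePair n C₁ r V q η ζ₁ ζ₂ ζ₁' ζ₂' →
      PairBound n (C * r ^ (-a)) q η (fun t => K (ζ₁ t)) (fun t => K (ζ₂ t)) := by
  induction n generalizing a F with
  | zero =>
    obtain ⟨C, hC0, hC⟩ := h.exists_comp_bound ha hC₁
    obtain ⟨C', hC0', hC'⟩ := h.exists_comp_sub_bound ha hC₁
    refine ⟨C + C', by positivity, fun {r V q η ζ₁ ζ₂ ζ₁' ζ₂'} hp => ?_⟩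
    have hr := hp.r_pos
    have hη := hp.η_nonneg
    have hra : 0 < r ^ (-a) := by positivity
    have hc₁ : ContinuousOn (fun t => K (ζ₁ t)) (Ioo (-1) 1) :=
      h.1.continuous.comp_continuousOn fun t ht => (hp.deriv₁ t ht).continuousAt.continuousWithinAt
    have hc₂ : ContinuousOn (fun t => K (ζ₂ t)) (Ioo (-1) 1) :=
      h.1.continuous.comp_continuousOn fun t ht => (hp.deriv₂ t ht).continuousAt.continuousWithinAt
    refine ⟨⟨hc₁, fun t ht => ?_⟩, ⟨hc₂, fun t ht => ?_⟩, ⟨hc₁.sub hc₂, fun t ht => ?_⟩⟩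
    · have := hC hr (hp.far₁ t ht)
      simp only [pow_zero, mul_one]; nlinarith
    · have := hC hr (hp.far₂ t ht)
      simp only [pow_zero, mul_one]; nlinarith
    · have := hC' hr hη (hp.far₁ t ht) (hp.far₂ t ht) (hp.close t ht)
      have : 0 ≤ C * r ^ (-a) * η := by positivity
      simp only [pow_zero, mul_one]; nlinarith
  | succ n ih =>
    obtain ⟨C, hC0, hC⟩ := ih ha h
    obtain ⟨C', hC0', hC'⟩ := ih (by linarith) h.fderiv
    refine ⟨C + 2 ^ (n + 1) * (C' * C₁), by positivity, fun {r V q η ζ₁ ζ₂ ζ₁' ζ₂'} hp => ?_⟩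
    have hr := hp.r_pos
    have hη := hp.η_nonneg
    have hq := hp.q_nonneg
    have hV := hp.V_nonneg
    have hra : 0 < r ^ (-a) := by positivity
    have h0 := (hC hp.of_succ).mono (K' := (C + 2 ^ (n + 1) * (C' * C₁)) * r ^ (-a)) (by
      have : 0 ≤ 2 ^ (n + 1) * (C' * C₁) * r ^ (-a) := by positivity
      nlinarith) hη hq le_rfl
    have h1 := (PairBound.clm_apply hq hη (hC' hp.of_succ) hp.of_succ.velocity).mono
      (K' := (C + 2 ^ (n + 1) * (C' * C₁)) * r ^ (-a) * q) (by
      have e : r ^ (-(a + 1)) * r = r ^ (-a) := by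
        rw [← Real.rpow_add_one hr.ne']; ring_nf
      calc 2 ^ (n + 1) * (C' * r ^ (-(a + 1)) * (C₁ * V))
          ≤ 2 ^ (n + 1) * (C' * r ^ (-(a + 1)) * (C₁ * (r * q))) := by
            gcongr; exact hp.V_le
        _ = 2 ^ (n + 1) * (C' * C₁) * (r ^ (-(a + 1)) * r) * q := by ring
        _ ≤ _ := by
          rw [e]
          have : 0 ≤ C * r ^ (-a) * q := by positivity
          nlinarith) hη hq le_rfl
    have hd₁ : ∀ t ∈ Ioo (-1 : ℝ) 1, HasDerivAt (fun t => K (ζ₁ t))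
        (_root_.fderiv ℝ K (ζ₁ t) (ζ₁' t)) t := fun t ht =>
      (h.differentiable (ζ₁ t)).hasFDerivAt.comp_hasDerivAt t (hp.deriv₁ t ht)
    have hd₂ : ∀ t ∈ Ioo (-1 : ℝ) 1, HasDerivAt (fun t => K (ζ₂ t))
        (_root_.fderiv ℝ K (ζ₂ t) (ζ₂' t)) t := fun t ht =>
      (h.differentiable (ζ₂ t)).hasFDerivAt.comp_hasDerivAt t (hp.deriv₂ t ht)
    refine ⟨GeomBound.succ_intro h0.left.bound hd₁ h1.left,
      GeomBound.succ_intro h0.right.bound hd₂ h1.right,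
      GeomBound.succ_intro h0.diff.bound (fun t ht => (hd₁ t ht).fun_sub (hd₂ t ht)) ?_⟩
    refine h1.diff.mono (le_of_eq (by ring)) ?_ hq le_rfl
    have := h0.diff.nonneg
    positivity

end KernelDecay

/-- The integrand of the evolution law of mollified velocities. -/
noncomputable def interaction (𝒦 : E → E →L[ℝ] E →L[ℝ] E) (ν : ℝ) (ℬ : E → E →L[ℝ] E) (y w : E) : E :=
  𝒦 y w w + ν • ℬ y w

theorem exists_pairBound_interaction (n : ℕ) {a : ℝ} (ha : 0 ≤ a) {𝒦 : E → E →L[ℝ] E →L[ℝ] E}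
    {ℬ : E → E →L[ℝ] E} (h𝒦 : KernelDecay a 𝒦) (hℬ : KernelDecay a ℬ) {C₁ : ℝ} (hC₁ : 0 < C₁) :
    ∃ C : ℝ, 0 ≤ C ∧ ∀ {r V q η ν : ℝ} {ζ₁ ζ₂ ζ₁' ζ₂' : ℝ → E}, 0 ≤ ν →
      CurvePair n C₁ r V q η ζ₁ ζ₂ ζ₁' ζ₂' →
      PairBound n (C * (r ^ (-a) * V * (V + ν))) q η (fun t => interaction 𝒦 ν ℬ (ζ₁ t) (ζ₁' t))
        (fun t => interaction 𝒦 ν ℬ (ζ₂ t) (ζ₂' t)) := by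
  obtain ⟨C, hC0, hC⟩ := h𝒦.exists_pairBound_comp n ha hC₁
  obtain ⟨C', hC0', hC'⟩ := hℬ.exists_pairBound_comp n ha hC₁
  refine ⟨2 ^ (n + 1) * (2 ^ (n + 1) * (C * C₁) * C₁) + 2 ^ (n + 1) * (C' * C₁),
    by positivity, fun {r V q η ν ζ₁ ζ₂ ζ₁' ζ₂'} hν hp => ?_⟩
  have hr := hp.r_pos
  have hη := hp.η_nonneg
  have hq := hp.q_nonneg
  have hV := hp.V_nonneg
  have h1 := PairBound.clm_apply hq hη (PairBound.clm_apply hq hη (hC hp) hp.velocity) hp.velocity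
  have h2 := (PairBound.clm_apply hq hη (hC' hp) hp.velocity).const_smul ν
  refine (h1.add h2).mono ?_ hη hq le_rfl
  rw [abs_of_nonneg hν]
  set A := 2 ^ (n + 1) * (2 ^ (n + 1) * (C * C₁) * C₁)
  set B := 2 ^ (n + 1) * (C' * C₁)
  have hra : 0 < r ^ (-a) := by positivity
  calc _ = A * (r ^ (-a) * V * V) + B * (r ^ (-a) * V * ν) := by ring
    _ ≤ A * (r ^ (-a) * V * (V + ν)) + B * (r ^ (-a) * V * (V + ν)) := by
      have : 0 ≤ A := by positivity
      have : 0 ≤ B := by positivity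
      gcongr <;> linarith
    _ = _ := by ring

end Kernels

section WeightedIntegrals

variable {E : Type*} [NormedAddCommGroup E] [InnerProductSpace ℝ E] [FiniteDimensional ℝ E]
  [MeasurableSpace E] [BorelSpace E]

lemma integrable_one_add_norm_sub_rpow {s : ℝ} (hs : 0 < s) (b : E) :
    Integrable (fun x : E => (1 + ‖x - b‖) ^ (-(Module.finrank ℝ E : ℝ) - s)) := by
  have h := integrable_one_add_norm (E := E) (μ := volume)
    (r := (Module.finrank ℝ E : ℝ) + s) (by linarith)
  have := h.comp_sub_right b
  refine this.congr (Filter.Eventually.of_forall fun x => ?_)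
  simp only
  congr 1; ring

lemma exists_integral_far_le {s : ℝ} (hs : 0 < s) :
    ∃ C : ℝ, 0 ≤ C ∧ ∀ R : ℝ, 1 ≤ R → ∀ b : E,
      ∫ x, {x : E | R ≤ 1 + ‖x - b‖}.indicator
        (fun x => (1 + ‖x - b‖) ^ (-(Module.finrank ℝ E : ℝ) - s)) x ≤ C * R ^ (-s) := by
  set n : ℝ := (Module.finrank ℝ E : ℝ) with hn
  have hn0 : 0 ≤ n := by positivity
  refine ⟨2 ^ (n + s) * ∫ x : E, (1 + ‖x‖) ^ (-n - s), ?_, fun R hR b => ?_⟩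
  · exact mul_nonneg (by positivity) (integral_nonneg fun x => by positivity)
  have hR0 : 0 < R := by linarith
  have h0 : Integrable (fun x : E => (1 + ‖x‖) ^ (-n - s)) := by
    simpa using integrable_one_add_norm_sub_rpow hs (0 : E)
  have h1 : Integrable (fun x : E => (1 + ‖R⁻¹ • x‖) ^ (-n - s)) :=
    h0.comp_smul (inv_ne_zero hR0.ne')
  have h2 : Integrable (fun x : E => (1 + ‖R⁻¹ • (x - b)‖) ^ (-n - s)) := h1.comp_sub_right b
  calc _ ≤ ∫ x, 2 ^ (n + s) * R ^ (-n - s) * (1 + ‖R⁻¹ • (x - b)‖) ^ (-n - s) := by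
        refine integral_mono_of_nonneg (Filter.Eventually.of_forall fun x => ?_)
          (h2.const_mul _) (Filter.Eventually.of_forall fun x => ?_)
        · exact indicator_nonneg (fun x _ => by positivity) x
        · refine indicator_apply_le' (fun hx => ?_) fun _ => by positivity
          have hx : R ≤ 1 + ‖x - b‖ := hx
          have e : (2 : ℝ) ^ (n + s) = (2⁻¹ : ℝ) ^ (-n - s) := by
            rw [← Real.rpow_neg_eq_inv_rpow]; congr 1; ring
          simp only
          rw [e, ← Real.mul_rpow (by norm_num) hR0.le, ← Real.mul_rpow (by positivity) (by positivity)]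
          refine Real.rpow_le_rpow_of_nonpos (by positivity) ?_ (by linarith)
          rw [norm_smul, Real.norm_of_nonneg (by positivity)]
          field_simp
          linarith
    _ = 2 ^ (n + s) * R ^ (-n - s) * (R ^ n * ∫ x : E, (1 + ‖x‖) ^ (-n - s)) := by
        rw [integral_const_mul, integral_sub_right_eq_self (fun x : E => (1 + ‖R⁻¹ • x‖) ^ (-n - s)),
          Measure.integral_comp_inv_smul_of_nonneg volume (fun x : E => (1 + ‖x‖) ^ (-n - s)) hR0.le,
          hn, Real.rpow_natCast, smul_eq_mul]
    _ = _ := by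
        have : R ^ (-n - s) * R ^ n = R ^ (-s) := by
          rw [← Real.rpow_add hR0]; congr 1; ring
        rw [← this]; ring

lemma integrable_near_one_add_norm_rpow (p ρ : ℝ) (b : E) :
    Integrable ({x : E | 1 + ‖x - b‖ ≤ ρ}.indicator (fun x => (1 + ‖x - b‖) ^ p)) := by
  have hc : IsCompact {x : E | 1 + ‖x - b‖ ≤ ρ} := by
    have : {x : E | 1 + ‖x - b‖ ≤ ρ} = Metric.closedBall b (ρ - 1) := by
      ext x; simp [dist_eq_norm, le_sub_iff_add_le']
    rw [this]; exact isCompact_closedBall _ _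
  rw [integrable_indicator_iff hc.measurableSet]
  refine ContinuousOn.integrableOn_compact hc (ContinuousOn.rpow_const (by fun_prop) fun x _ => ?_)
  left; positivity

lemma integrable_near_norm_rpow [Nontrivial E] {s : ℝ} (hs : 0 < s) (A : ℝ) :
    Integrable ({x : E | ‖x‖ ≤ A}.indicator
      (fun x => ‖x‖ ^ (-(Module.finrank ℝ E : ℝ) + s))) := by
  have key := (integrable_fun_norm_addHaar (E := E) (volume)
    (f := (Iic A).indicator (fun y : ℝ => y ^ (-(Module.finrank ℝ E : ℝ) + s)))).2 ?_
  · refine key.congr (Filter.Eventually.of_forall fun x => ?_)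
    simp [indicator]
  have h : IntegrableOn (fun y : ℝ => y ^ (s - 1)) (Ioc 0 (max A 0)) := by
    rw [← intervalIntegrable_iff_integrableOn_Ioc_of_le (le_max_right _ _)]
    exact intervalIntegral.intervalIntegrable_rpow' (by linarith)
  rw [← integrable_indicator_iff measurableSet_Ioi]
  rw [← integrable_indicator_iff measurableSet_Ioc] at h
  refine h.congr (Filter.Eventually.of_forall fun y => ?_)
  simp only [indicator, mem_Ioc, mem_Ioi, mem_Iic, le_max_iff]
  by_cases hy : 0 < y
  · by_cases hyA : y ≤ A
    · simp only [hy, hyA, true_or, and_true, if_true, smul_eq_mul]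
      have : 1 ≤ Module.finrank ℝ E := Module.finrank_pos
      rw [← Real.rpow_natCast, ← Real.rpow_add hy]
      congr 1
      push_cast [this]
      ring
    · simp [hy, hyA, not_le.2 hy]
  · simp [hy]

lemma exists_integral_near_le [Nontrivial E] {s : ℝ} (hs : 0 < s)
    (hs' : s ≤ Module.finrank ℝ E) (A : ℝ) :
    ∃ C : ℝ, 0 ≤ C ∧ ∀ R : ℝ, 0 < R → ∀ b : E,
      ∫ x, {x : E | 1 + ‖x - b‖ ≤ A * R}.indicator
        (fun x => (1 + ‖x - b‖) ^ (-(Module.finrank ℝ E : ℝ) + s)) x ≤ C * R ^ s := by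
  set n : ℝ := (Module.finrank ℝ E : ℝ) with hn
  set f : E → ℝ := {x : E | ‖x‖ ≤ A}.indicator (fun x => ‖x‖ ^ (-n + s)) with hf
  have hf0 : ∀ x, 0 ≤ f x := fun x => indicator_nonneg (fun x _ => by positivity) x
  have hfi : Integrable f := integrable_near_norm_rpow hs A
  refine ⟨∫ x, f x, integral_nonneg hf0, fun R hR b => ?_⟩
  have h1 : Integrable (fun x : E => f (R⁻¹ • x)) := hfi.comp_smul (inv_ne_zero hR.ne')
  have h2 : Integrable (fun x : E => f (R⁻¹ • (x - b))) := h1.comp_sub_right b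
  calc _ ≤ ∫ x, R ^ (-n + s) * f (R⁻¹ • (x - b)) := by
        refine integral_mono_of_nonneg (Filter.Eventually.of_forall fun x => ?_)
          (h2.const_mul _) ?_
        · exact indicator_nonneg (fun x _ => by positivity) x
        · have hne : ∀ᵐ x : E, x ≠ b := Measure.ae_ne volume b
          filter_upwards [hne] with x hxb
          have hpos : 0 < ‖x - b‖ := norm_pos_iff.2 (sub_ne_zero.2 hxb)
          refine indicator_apply_le' (fun hx => ?_) fun _ => mul_nonneg (by positivity) (hf0 _)
          have hx : 1 + ‖x - b‖ ≤ A * R := hx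
          have hm : R⁻¹ • (x - b) ∈ {x : E | ‖x‖ ≤ A} := by
            simp only [mem_ofPred_eq, norm_smul, norm_inv, Real.norm_of_nonneg hR.le]
            rw [inv_mul_le_iff₀ hR]; linarith
          rw [hf, indicator_of_mem hm, ← Real.mul_rpow hR.le (norm_nonneg _)]
          rw [norm_smul, norm_inv, Real.norm_of_nonneg hR.le, mul_inv_cancel_left₀ hR.ne']
          exact Real.rpow_le_rpow_of_nonpos hpos (by linarith) (by linarith)
    _ = R ^ (-n + s) * (R ^ n * ∫ x : E, f x) := by
        rw [integral_const_mul, integral_sub_right_eq_self (fun x : E => f (R⁻¹ • x)),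
          Measure.integral_comp_inv_smul_of_nonneg volume f hR.le,
          hn, Real.rpow_natCast, smul_eq_mul]
    _ = _ := by
        have : R ^ (-n + s) * R ^ n = R ^ s := by
          rw [← Real.rpow_add hR]; congr 1; ring
        rw [← this]; ring

end WeightedIntegrals

section Picard

variable {E : Type*} [NormedAddCommGroup E] [InnerProductSpace ℝ E] [FiniteDimensional ℝ E]
  [MeasurableSpace E] [BorelSpace E]

/-- The acceleration at the label `b` in a configuration with positions `Z`, velocities `W`. -/
noncomputable def drift (𝒦 : E → E →L[ℝ] E →L[ℝ] E) (ν : ℝ) (ℬ : E → E →L[ℝ] E) (Z W : E → E)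
    (b : E) : E :=
  ∫ x, interaction 𝒦 ν ℬ (Z x - Z b) (W x - W b)

/-- Labelled trajectories `Z` with velocities `W` whose relative motion of two labels at
distance `r` obeys `j` derivative bounds of geometric type. -/
structure LabelledMotion (j : ℕ) (α M μ ν C : ℝ) (Z W : ℝ → E → E) : Prop where
  M_pos : 0 < M
  M_le : M ≤ μ
  μ_le : μ ≤ 1
  ν_nonneg : 0 ≤ ν
  ν_le : ν ≤ μ
  hasDeriv : ∀ t ∈ Ioo (-1 : ℝ) 1, ∀ b, HasDerivAt (fun s => Z s b) (W t b) t
  cont : ∀ t ∈ Ioo (-1 : ℝ) 1, Continuous (Z t)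
  cont_velocity : ∀ t ∈ Ioo (-1 : ℝ) 1, Continuous (W t)
  far : ∀ t ∈ Ioo (-1 : ℝ) 1, ∀ b b', 1 + ‖b - b'‖ ≤ C * (1 + ‖Z t b - Z t b'‖)
  lip : ∀ t ∈ Ioo (-1 : ℝ) 1, ∀ b b', ‖Z t b - Z t b'‖ ≤ C * (1 + ‖b - b'‖)
  bdd : ∃ D : ℝ, 0 ≤ D ∧ ∀ b, GeomBound j D D (fun t => W t b)
  pair : ∀ b b', GeomBound j (C * (M * (1 + ‖b - b'‖) ^ α)) (μ * (1 + ‖b - b'‖) ^ (α - 1))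
    (fun t => W t b - W t b')

namespace LabelledMotion

variable {j : ℕ} {α M μ ν C : ℝ} {Z W : ℝ → E → E}

lemma μ_pos (h : LabelledMotion j α M μ ν C Z W) : 0 < μ := h.M_pos.trans_le h.M_le

lemma C_pos (h : LabelledMotion j α M μ ν C Z W) : 0 < C := by
  have := h.far 0 (by norm_num) 0 0
  simp at this
  linarith

lemma mono_C (h : LabelledMotion j α M μ ν C Z W) {C' : ℝ} (hC : C ≤ C') :
    LabelledMotion j α M μ ν C' Z W :=
  { h with
    far := fun t ht b b' => (h.far t ht b b').trans (by gcongr)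
    lip := fun t ht b b' => (h.lip t ht b b').trans (by gcongr)
    pair := fun b b' => (h.pair b b').mono (by have := h.M_pos; gcongr)
      (by have := h.M_pos; have := h.C_pos.trans_le hC; positivity)
      (by have := h.μ_pos; positivity) le_rfl }

lemma of_le (h : LabelledMotion j α M μ ν C Z W) {k : ℕ} (hk : k ≤ j) :
    LabelledMotion k α M μ ν C Z W :=
  { h with
    bdd := by
      obtain ⟨D, hD, hb⟩ := h.bdd
      exact ⟨D, hD, fun b => DerivBound.of_le hk (hb b)⟩
    pair := fun b b' => DerivBound.of_le hk (h.pair b b') }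

end LabelledMotion

lemma GeomBound.pairBound_self {n : ℕ} {K q : ℝ} {f : ℝ → E} (h : GeomBound n K q f) :
    PairBound n K q 0 f f :=
  ⟨h, h, by
    have := (h.const_smul 0)
    simpa using this⟩

section Interaction

variable {𝒦 : E → E →L[ℝ] E →L[ℝ] E} {ℬ : E → E →L[ℝ] E}

lemma continuous_interaction (h𝒦 : Continuous 𝒦) (hℬ : Continuous ℬ) (ν : ℝ) {f g : E → E}
    (hf : Continuous f) (hg : Continuous g) : Continuous (fun x => interaction 𝒦 ν ℬ (f x) (g x)) := by
  unfold interaction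
  fun_prop

/-- Quantitative bound for the interaction of two labels. -/
lemma exists_geomBound_interaction (j : ℕ)
    (h𝒦 : KernelDecay ((Module.finrank ℝ E : ℝ) + 1) 𝒦)
    (hℬ : KernelDecay ((Module.finrank ℝ E : ℝ) + 1) ℬ) {α : ℝ} (hα : 0 < α) {C : ℝ}
    (hC : 0 < C) : ∃ C' : ℝ, 0 ≤ C' ∧ ∀ {M μ ν : ℝ} {Z W : ℝ → E → E},
      LabelledMotion j α M μ ν C Z W → ∀ b b',
      GeomBound j (C' * (M * μ * (1 + ‖b - b'‖) ^ (-(Module.finrank ℝ E : ℝ) - 1 + 2 * α)))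
        (μ * (1 + ‖b - b'‖) ^ (α - 1))
        (fun t => interaction 𝒦 ν ℬ (Z t b - Z t b') (W t b - W t b')) := by
  obtain ⟨C', hC0, hC'⟩ := exists_pairBound_interaction j (by positivity) h𝒦 hℬ hC
  refine ⟨2 * C', by positivity, fun {M μ ν Z W} h b b' => ?_⟩
  have hM := h.M_pos
  have hμ := h.μ_pos
  set r := 1 + ‖b - b'‖ with hr
  have hr1 : 1 ≤ r := by linarith [norm_nonneg (b - b')]
  have hr0 : 0 < r := by linarith
  have key := (hC' (r := r) (V := M * r ^ α) (q := μ * r ^ (α - 1)) (η := 0) h.ν_nonneg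
    (ζ₁ := fun t => Z t b - Z t b') (ζ₂ := fun t => Z t b - Z t b')
    (ζ₁' := fun t => W t b - W t b') (ζ₂' := fun t => W t b - W t b')
    { r_pos := hr0
      V_nonneg := by positivity
      q_nonneg := by positivity
      η_nonneg := le_rfl
      V_le := by
        have : r * (μ * r ^ (α - 1)) = μ * r ^ α := by
          rw [Real.rpow_sub_one hr0.ne']; field_simp
        rw [this]
        gcongr; exact h.M_le
      deriv₁ := fun t ht => (h.hasDeriv t ht b).fun_sub (h.hasDeriv t ht b')
      deriv₂ := fun t ht => (h.hasDeriv t ht b).fun_sub (h.hasDeriv t ht b')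
      far₁ := fun t ht => h.far t ht b b'
      far₂ := fun t ht => h.far t ht b b'
      close := fun t ht => by simp
      velocity := (h.pair b b').pairBound_self }).left
  refine key.mono ?_ (by positivity) (by positivity) le_rfl
  have h1 : M * r ^ α + ν ≤ 2 * (μ * r ^ α) := by
    have : 1 ≤ r ^ α := Real.one_le_rpow hr1 hα.le
    have := mul_le_mul_of_nonneg_right h.M_le (show 0 ≤ r ^ α by positivity)
    nlinarith [h.ν_le]
  calc C' * (r ^ (-((Module.finrank ℝ E : ℝ) + 1)) * (M * r ^ α) * (M * r ^ α + ν))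
      ≤ C' * (r ^ (-((Module.finrank ℝ E : ℝ) + 1)) * (M * r ^ α) * (2 * (μ * r ^ α))) := by gcongr
    _ = _ := by
      have : r ^ (-(Module.finrank ℝ E : ℝ) - 1 + 2 * α)
          = r ^ (-((Module.finrank ℝ E : ℝ) + 1)) * r ^ α * r ^ α := by
        rw [← Real.rpow_add hr0, ← Real.rpow_add hr0]; congr 1; ring
      rw [this]; ring

/-- Qualitative bound for the interaction of two labels. -/
lemma LabelledMotion.exists_geomBound_interaction_bdd {j : ℕ} {α M μ ν C : ℝ} {Z W : ℝ → E → E}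
    (h : LabelledMotion j α M μ ν C Z W)
    (h𝒦 : KernelDecay ((Module.finrank ℝ E : ℝ) + 1) 𝒦)
    (hℬ : KernelDecay ((Module.finrank ℝ E : ℝ) + 1) ℬ) : ∃ D : ℝ, 0 ≤ D ∧ ∀ b b',
      GeomBound j (D * (1 + ‖b - b'‖) ^ (-(Module.finrank ℝ E : ℝ) - 1)) D
        (fun t => interaction 𝒦 ν ℬ (Z t b - Z t b') (W t b - W t b')) := by
  obtain ⟨D, hD, hb⟩ := h.bdd
  obtain ⟨C', hC0, hC'⟩ := exists_pairBound_interaction j (by positivity) h𝒦 hℬ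
    (show 0 < C + 2 by linarith [h.C_pos])
  refine ⟨C' * (D * (D + ν)) + D, by have := h.ν_nonneg; positivity, fun b b' => ?_⟩
  have hν := h.ν_nonneg
  have hC := h.C_pos
  set r := 1 + ‖b - b'‖ with hr
  have hr1 : 1 ≤ r := by linarith [norm_nonneg (b - b')]
  have hr0 : 0 < r := by linarith
  have key := (hC' (r := r) (V := D) (q := D) (η := 0) h.ν_nonneg
    (ζ₁ := fun t => Z t b - Z t b') (ζ₂ := fun t => Z t b - Z t b')
    (ζ₁' := fun t => W t b - W t b') (ζ₂' := fun t => W t b - W t b')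
    { r_pos := hr0
      V_nonneg := by positivity
      q_nonneg := by positivity
      η_nonneg := le_rfl
      V_le := le_mul_of_one_le_left hD hr1
      deriv₁ := fun t ht => (h.hasDeriv t ht b).fun_sub (h.hasDeriv t ht b')
      deriv₂ := fun t ht => (h.hasDeriv t ht b).fun_sub (h.hasDeriv t ht b')
      far₁ := fun t ht => (h.far t ht b b').trans (by gcongr; linarith)
      far₂ := fun t ht => (h.far t ht b b').trans (by gcongr; linarith)
      close := fun t ht => by simp
      velocity := (((hb b).sub (hb b')).mono (by nlinarith) (by positivity) hD
        le_rfl).pairBound_self }).left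
  have e : -((Module.finrank ℝ E : ℝ) + 1) = -(Module.finrank ℝ E : ℝ) - 1 := by ring
  rw [e] at key
  refine key.mono ?_ (by positivity) (by positivity) (by linarith [show 0 ≤ C' * (D * (D + ν)) by positivity])
  have : 0 ≤ D * r ^ (-(Module.finrank ℝ E : ℝ) - 1) := by positivity
  nlinarith

lemma LabelledMotion.exists_geomBound_drift {j : ℕ} {α M μ ν C : ℝ} {Z W : ℝ → E → E}
    (h : LabelledMotion j α M μ ν C Z W)
    (h𝒦 : KernelDecay ((Module.finrank ℝ E : ℝ) + 1) 𝒦)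
    (hℬ : KernelDecay ((Module.finrank ℝ E : ℝ) + 1) ℬ) :
    (∃ D : ℝ, 0 ≤ D ∧ ∀ b, GeomBound j D D (fun t => drift 𝒦 ν ℬ (Z t) (W t) b)) ∧
    (∀ t ∈ Ioo (-1 : ℝ) 1, Continuous (drift 𝒦 ν ℬ (Z t) (W t))) ∧
    ∀ t ∈ Ioo (-1 : ℝ) 1, ∀ b,
      Integrable (fun x => interaction 𝒦 ν ℬ (Z t x - Z t b) (W t x - W t b)) := by
  obtain ⟨D, hD, hb⟩ := h.exists_geomBound_interaction_bdd h𝒦 hℬ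
  have hci : ∀ t ∈ Ioo (-1 : ℝ) 1, ∀ b,
      Continuous (fun x => interaction 𝒦 ν ℬ (Z t x - Z t b) (W t x - W t b)) := fun t ht b =>
    continuous_interaction h𝒦.1.continuous hℬ.1.continuous ν
      ((h.cont t ht).sub continuous_const) ((h.cont_velocity t ht).sub continuous_const)
  have hI := fun b : E => integrable_one_add_norm_sub_rpow (E := E) one_pos b
  refine ⟨⟨(D * ∫ x : E, (1 + ‖x‖) ^ (-(Module.finrank ℝ E : ℝ) - 1)) + D,
    add_nonneg (mul_nonneg hD (integral_nonneg fun x => by positivity)) hD, fun b => ?_⟩, ?_, ?_⟩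
  · have key := DerivBound.integral (μ := volume) (n := j) (fun x => hb x b)
      (fun i _ => ((hI b).const_mul D).mul_const (D ^ i))
      (fun t ht => (hci t ht b).aestronglyMeasurable)
    have h2 : GeomBound j (D * ∫ x : E, (1 + ‖x‖) ^ (-(Module.finrank ℝ E : ℝ) - 1)) D
        (fun t => drift 𝒦 ν ℬ (Z t) (W t) b) := by
      refine DerivBound.mono key fun i _ => le_of_eq ?_
      rw [integral_mul_const, integral_const_mul, integral_sub_right_eq_self
        (fun x : E => (1 + ‖x‖) ^ (-(Module.finrank ℝ E : ℝ) - 1))]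
    have h3 : 0 ≤ D * ∫ x : E, (1 + ‖x‖) ^ (-(Module.finrank ℝ E : ℝ) - 1) :=
      mul_nonneg hD (integral_nonneg fun x => by positivity)
    exact h2.mono (by linarith) (by linarith) hD (by linarith)
  · intro t ht
    have e : drift 𝒦 ν ℬ (Z t) (W t) = fun b => ∫ x, interaction 𝒦 ν ℬ (Z t (x + b) - Z t b)
        (W t (x + b) - W t b) := by
      ext1 b
      exact (integral_add_right_eq_self (fun x => interaction 𝒦 ν ℬ (Z t x - Z t b)
        (W t x - W t b)) b).symm
    rw [e]
    have hZ := h.cont t ht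
    have hW := h.cont_velocity t ht
    refine continuous_of_dominated (bound := fun x => D * (1 + ‖x‖) ^ (-(Module.finrank ℝ E : ℝ) - 1))
      (fun b => ?_) (fun b => .of_forall fun x => ?_) ?_ (.of_forall fun x => ?_)
    · exact ((hci t ht b).comp (continuous_add_const b)).aestronglyMeasurable
    · simpa using (hb (x + b) b).bound t ht
    · simpa using (hI 0).const_mul D
    · exact continuous_interaction h𝒦.1.continuous hℬ.1.continuous ν (by fun_prop) (by fun_prop)
  · intro t ht b
    exact ((hI b).const_mul D).mono' (hci t ht b).aestronglyMeasurable
      (.of_forall fun x => (hb x b).bound t ht)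

end Interaction
end Picard

section Picard

variable {E : Type*} [NormedAddCommGroup E] [InnerProductSpace ℝ E] [FiniteDimensional ℝ E]
  [MeasurableSpace E] [BorelSpace E]
variable {𝒦 : E → E →L[ℝ] E →L[ℝ] E} {ℬ : E → E →L[ℝ] E}

/-- Two nearby motions have nearby accelerations. -/
lemma exists_drift_sub_le
    (h𝒦 : KernelDecay ((Module.finrank ℝ E : ℝ) + 1) 𝒦)
    (hℬ : KernelDecay ((Module.finrank ℝ E : ℝ) + 1) ℬ) {α : ℝ} (hα : 0 < α) (hα1 : α < 1)
    {C : ℝ} (hC : 0 < C) : ∃ C' : ℝ, 0 ≤ C' ∧ ∀ {M μ ν e : ℝ} {Z W Y V : ℝ → E → E}, 0 ≤ e →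
      LabelledMotion 0 α M μ ν C Z W → LabelledMotion 0 α M μ ν C Y V →
      (∀ t ∈ Ioo (-1 : ℝ) 1, ∀ b, ‖Z t b - Y t b‖ ≤ e) →
      (∀ t ∈ Ioo (-1 : ℝ) 1, ∀ b, ‖W t b - V t b‖ ≤ e) →
      ∀ t ∈ Ioo (-1 : ℝ) 1, ∀ b,
        ‖drift 𝒦 ν ℬ (Z t) (W t) b - drift 𝒦 ν ℬ (Y t) (V t) b‖ ≤ C' * e := by
  obtain ⟨C', hC0, hC'⟩ := exists_pairBound_interaction 0 (by positivity) h𝒦 hℬ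
    (show 0 < C + 2 by linarith)
  set I : ℝ := ∫ x : E, (1 + ‖x‖) ^ (-(Module.finrank ℝ E : ℝ) - (1 - α)) with hI
  have hI0 : 0 ≤ I := integral_nonneg fun x => by positivity
  refine ⟨2 * C' * I, by positivity, fun {M μ ν e Z W Y V} he hZ hY hcl hcl' t ht b => ?_⟩
  obtain ⟨-, -, hiZ⟩ := hZ.exists_geomBound_drift h𝒦 hℬ
  obtain ⟨-, -, hiY⟩ := hY.exists_geomBound_drift h𝒦 hℬ
  have hM := hZ.M_pos
  have hμ := hZ.μ_pos
  have hν := hZ.ν_nonneg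
  unfold drift
  rw [← integral_sub (hiZ t ht b) (hiY t ht b)]
  have hInt := (integrable_one_add_norm_sub_rpow (E := E) (show 0 < 1 - α by linarith) b).const_mul
    (2 * C' * e)
  refine (norm_integral_le_of_norm_le hInt (.of_forall fun x => ?_)).trans_eq ?_
  · set r := 1 + ‖x - b‖ with hr
    have hr1 : 1 ≤ r := by linarith [norm_nonneg (x - b)]
    have hr0 : 0 < r := by linarith
    have hrα : 1 ≤ r ^ α := Real.one_le_rpow hr1 hα.le
    have hcle : ∀ {a b c d : E}, ‖a - c‖ ≤ e → ‖b - d‖ ≤ e → ‖(a - b) - (c - d)‖ ≤ 2 * e := by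
      intro a b c d h1 h2
      have : (a - b) - (c - d) = (a - c) - (b - d) := by abel
      rw [this]
      exact (norm_sub_le _ _).trans (by linarith)
    have key := (hC' (r := r) (V := M * r ^ α) (q := μ * r ^ (α - 1)) (η := e / (M * r ^ α)) hν
      (ζ₁ := fun t => Z t x - Z t b) (ζ₂ := fun t => Y t x - Y t b)
      (ζ₁' := fun t => W t x - W t b) (ζ₂' := fun t => V t x - V t b)
      { r_pos := hr0
        V_nonneg := by positivity
        q_nonneg := by positivity
        η_nonneg := by positivity
        V_le := by
          have : r * (μ * r ^ (α - 1)) = μ * r ^ α := by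
            rw [Real.rpow_sub_one hr0.ne']; field_simp
          rw [this]
          gcongr; exact hZ.M_le
        deriv₁ := fun t ht => (hZ.hasDeriv t ht x).fun_sub (hZ.hasDeriv t ht b)
        deriv₂ := fun t ht => (hY.hasDeriv t ht x).fun_sub (hY.hasDeriv t ht b)
        far₁ := fun t ht => (hZ.far t ht x b).trans (by gcongr; linarith)
        far₂ := fun t ht => (hY.far t ht x b).trans (by gcongr; linarith)
        close := fun t ht => by
          refine (hcle (hcl t ht x) (hcl t ht b)).trans ?_
          have h1 : M * r ^ α ≤ r := by
            have := hZ.M_le.trans hZ.μ_le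
            have h2 : r ^ α ≤ r ^ (1 : ℝ) := Real.rpow_le_rpow_of_exponent_le hr1 hα1.le
            rw [Real.rpow_one] at h2
            nlinarith
          have h2 : e ≤ r * (e / (M * r ^ α)) := by
            rw [mul_div_assoc', le_div_iff₀ (by positivity)]
            nlinarith
          have h3 : 0 ≤ r * (e / (M * r ^ α)) := by positivity
          nlinarith
        velocity := ⟨(hZ.pair x b).mono (by gcongr; linarith) (by positivity) (by positivity) le_rfl,
          (hY.pair x b).mono (by gcongr; linarith) (by positivity) (by positivity) le_rfl, by
          refine ⟨((hZ.pair x b).sub (hY.pair x b)).cont, fun t ht => ?_⟩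
          refine (hcle (hcl' t ht x) (hcl' t ht b)).trans ?_
          simp only [pow_zero, mul_one]
          rw [mul_assoc (C + 2), mul_div_cancel₀ _ (by positivity)]
          gcongr; linarith⟩ }).diff.bound t ht
    refine key.trans ?_
    have h1 : M * r ^ α + ν ≤ 2 * r ^ α := by
      have := hZ.M_le.trans hZ.μ_le
      nlinarith [hZ.ν_le.trans hZ.μ_le]
    calc C' * (r ^ (-((Module.finrank ℝ E : ℝ) + 1)) * (M * r ^ α) * (M * r ^ α + ν)) *
          (e / (M * r ^ α))
        = C' * (r ^ (-((Module.finrank ℝ E : ℝ) + 1)) * (M * r ^ α + ν)) * e := by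
          field_simp
      _ ≤ C' * (r ^ (-((Module.finrank ℝ E : ℝ) + 1)) * (2 * r ^ α)) * e := by gcongr
      _ = _ := by
        have : r ^ (-(Module.finrank ℝ E : ℝ) - (1 - α))
            = r ^ (-((Module.finrank ℝ E : ℝ) + 1)) * r ^ α := by
          rw [← Real.rpow_add hr0]; congr 1; ring
        rw [this]; ring
  · rw [integral_const_mul, integral_sub_right_eq_self
        (fun x : E => (1 + ‖x‖) ^ (-(Module.finrank ℝ E : ℝ) - (1 - α)))]
    ring

/-- Interactions of a far label with two labels at distance `R`. -/
lemma exists_geomBound_interaction_sub_far (j : ℕ)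
    (h𝒦 : KernelDecay ((Module.finrank ℝ E : ℝ) + 1) 𝒦)
    (hℬ : KernelDecay ((Module.finrank ℝ E : ℝ) + 1) ℬ) {α : ℝ} (hα : 0 < α) (hα1 : α < 1)
    {C : ℝ} (hC : 0 < C) : ∃ C' : ℝ, 0 ≤ C' ∧ ∀ {M μ ν : ℝ} {Z W : ℝ → E → E},
      LabelledMotion j α M μ ν C Z W → ∀ x b b', 3 * (1 + ‖b - b'‖) ≤ 1 + ‖x - b‖ →
      GeomBound j (C' * (M * μ * (1 + ‖b - b'‖) ^ α *
          (1 + ‖x - b‖) ^ (-(Module.finrank ℝ E : ℝ) - (1 - α))))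
        (μ * (1 + ‖b - b'‖) ^ (α - 1))
        (fun t => interaction 𝒦 ν ℬ (Z t x - Z t b') (W t x - W t b') -
          interaction 𝒦 ν ℬ (Z t x - Z t b) (W t x - W t b)) := by
  obtain ⟨C', hC0, hC'⟩ := exists_pairBound_interaction j (by positivity) h𝒦 hℬ
    (show 0 < 2 * C by linarith)
  refine ⟨2 * C', by positivity, fun {M μ ν Z W} h x b b' hfar => ?_⟩
  have hM := h.M_pos
  have hμ := h.μ_pos
  have hν := h.ν_nonneg
  set r := 1 + ‖x - b‖ with hr
  set R := 1 + ‖b - b'‖ with hR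
  set r' := 1 + ‖x - b'‖ with hr'
  have hR1 : 1 ≤ R := by linarith [norm_nonneg (b - b')]
  have hR0 : 0 < R := by linarith
  have hr0 : 0 < r := by linarith
  have hr1 : 1 ≤ r := by linarith
  have hrα : 1 ≤ r ^ α := Real.one_le_rpow hr1 hα.le
  have h1 : r ≤ r' + R := by
    have := norm_sub_le (x - b') (b - b')
    have e : x - b' - (b - b') = x - b := by abel
    rw [e] at this; linarith
  have h2 : r' ≤ r + R := by
    have := norm_add_le (x - b) (b - b')
    have e : x - b + (b - b') = x - b' := by abel
    rw [e] at this; linarith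
  have hRr : R ≤ r' := by linarith
  have hrr' : r ≤ 2 * r' := by linarith
  have hr'r : r' ≤ 2 * r := by linarith
  have hr'0 : 0 < r' := by linarith
  have hη : r * (R / r) ^ α ≥ R := by
    have h3 : R / r ≤ 1 := (div_le_one hr0).2 (by linarith)
    have h4 : (R / r) ^ (1 : ℝ) ≤ (R / r) ^ α :=
      Real.rpow_le_rpow_of_exponent_ge (by positivity) h3 hα1.le
    rw [Real.rpow_one, div_le_iff₀ hr0] at h4
    linarith
  have hηα : r ^ α * (R / r) ^ α = R ^ α := by
    rw [Real.div_rpow hR0.le hr0.le]; field_simp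
  have h2α : (2 : ℝ) ^ α ≤ 2 := by
    have := Real.rpow_le_rpow_of_exponent_le (x := 2) (by norm_num) hα1.le
    rwa [Real.rpow_one] at this
  have hr'α : r' ^ α ≤ 2 * r ^ α := by
    calc r' ^ α ≤ (2 * r) ^ α := by gcongr
      _ = 2 ^ α * r ^ α := Real.mul_rpow (by norm_num) hr0.le
      _ ≤ _ := by gcongr
  have hRrpow : ∀ {y}, R ≤ y → y ^ (α - 1) ≤ R ^ (α - 1) := fun hy =>
    Real.rpow_le_rpow_of_nonpos hR0 hy (by linarith)
  have key := (hC' (r := r) (V := M * r ^ α) (q := μ * R ^ (α - 1)) (η := (R / r) ^ α) hν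
    (ζ₁ := fun t => Z t x - Z t b') (ζ₂ := fun t => Z t x - Z t b)
    (ζ₁' := fun t => W t x - W t b') (ζ₂' := fun t => W t x - W t b)
    { r_pos := hr0
      V_nonneg := by positivity
      q_nonneg := by positivity
      η_nonneg := by positivity
      V_le := by
        have h3 : r * (μ * r ^ (α - 1)) = μ * r ^ α := by
          rw [Real.rpow_sub_one hr0.ne']; field_simp
        have h4 : r * (μ * r ^ (α - 1)) ≤ r * (μ * R ^ (α - 1)) := by
          exact mul_le_mul_of_nonneg_left
            (mul_le_mul_of_nonneg_left (hRrpow (by linarith)) hμ.le) hr0.le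
        have := mul_le_mul_of_nonneg_right h.M_le (show 0 ≤ r ^ α by positivity)
        linarith
      deriv₁ := fun t ht => (h.hasDeriv t ht x).fun_sub (h.hasDeriv t ht b')
      deriv₂ := fun t ht => (h.hasDeriv t ht x).fun_sub (h.hasDeriv t ht b)
      far₁ := fun t ht => by
        have := h.far t ht x b'
        linarith
      far₂ := fun t ht => by
        have := h.far t ht x b
        have : 0 ≤ C * (1 + ‖Z t x - Z t b‖) := by positivity
        linarith
      close := fun t ht => by
        have h3 := h.lip t ht b b'
        have e : Z t x - Z t b' - (Z t x - Z t b) = Z t b - Z t b' := by abel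
        rw [e, mul_assoc]
        have : 0 ≤ r * (R / r) ^ α := by positivity
        nlinarith
      velocity := ⟨(h.pair x b').mono (by
            calc C * (M * r' ^ α) ≤ C * (M * (2 * r ^ α)) := by gcongr
              _ = _ := by ring) (by positivity) (by positivity) 
            (mul_le_mul_of_nonneg_left (hRrpow hRr) hμ.le),
          (h.pair x b).mono (by gcongr; linarith) (by positivity) (by positivity)
            (mul_le_mul_of_nonneg_left (hRrpow (by linarith)) hμ.le), by
          have e : (fun t => W t x - W t b' - (W t x - W t b)) = fun t => W t b - W t b' := by
            ext1 t; abel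
          rw [e]
          refine (h.pair b b').mono ?_ (by positivity) (by positivity) le_rfl
          have e2 : 2 * C * (M * r ^ α) * (R / r) ^ α = 2 * (C * (M * R ^ α)) := by
            rw [← hηα]; ring
          rw [e2]
          have : 0 ≤ C * (M * R ^ α) := by positivity
          linarith⟩ }).diff
  refine key.mono ?_ (by positivity) (by positivity) le_rfl
  have h5 : M * r ^ α + ν ≤ 2 * (μ * r ^ α) := by
    have := mul_le_mul_of_nonneg_right h.M_le (show 0 ≤ r ^ α by positivity)
    nlinarith [h.ν_le]
  calc C' * (r ^ (-((Module.finrank ℝ E : ℝ) + 1)) * (M * r ^ α) * (M * r ^ α + ν)) * (R / r) ^ α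
      ≤ C' * (r ^ (-((Module.finrank ℝ E : ℝ) + 1)) * (M * r ^ α) * (2 * (μ * r ^ α))) *
        (R / r) ^ α := by gcongr
    _ = 2 * C' * (M * μ * (r ^ α * (R / r) ^ α) * (r ^ (-((Module.finrank ℝ E : ℝ) + 1)) * r ^ α)) := by
        ring
    _ = _ := by
        rw [hηα, ← Real.rpow_add hr0]
        congr 3; ring

/-- Accelerations of two labels at distance `R` differ by the natural amount. -/
lemma exists_geomBound_drift_sub [Nontrivial E] {j : ℕ}
    (h𝒦 : KernelDecay ((Module.finrank ℝ E : ℝ) + 1) 𝒦)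
    (hℬ : KernelDecay ((Module.finrank ℝ E : ℝ) + 1) ℬ) {α : ℝ} (hα : 0 < α) (hα1 : α < 1)
    (hj : 0 < 1 - (j + 2) * (1 - α)) {C : ℝ} (hC : 0 < C) :
    ∃ C' : ℝ, 0 ≤ C' ∧ ∀ {M μ ν : ℝ} {Z W : ℝ → E → E},
      LabelledMotion j α M μ ν C Z W → ∀ b b',
      GeomBound j (C' * (M * μ * (1 + ‖b - b'‖) ^ (2 * α - 1))) (μ * (1 + ‖b - b'‖) ^ (α - 1))
        (fun t => drift 𝒦 ν ℬ (Z t) (W t) b - drift 𝒦 ν ℬ (Z t) (W t) b') := by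
  obtain ⟨C₁, hC₁0, hC₁⟩ := exists_geomBound_interaction j h𝒦 hℬ hα hC
  obtain ⟨C₂, hC₂0, hC₂⟩ := exists_geomBound_interaction_sub_far j h𝒦 hℬ hα hα1 hC
  have hn1 : (1 : ℝ) ≤ Module.finrank ℝ E := by exact_mod_cast Module.finrank_pos (R := ℝ) (M := E)
  set n : ℝ := (Module.finrank ℝ E : ℝ) with hn
  have hs : ∀ i ≤ j, 0 < 1 - ((i : ℝ) + 2) * (1 - α) ∧ 1 - ((i : ℝ) + 2) * (1 - α) ≤ n := by
    intro i hi
    have : (i : ℝ) ≤ j := by exact_mod_cast hi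
    constructor <;> nlinarith [show (0 : ℝ) ≤ i by positivity]
  have hN : ∀ i : ℕ, ∃ N : ℝ, 0 ≤ N ∧ (i ≤ j → ∀ R : ℝ, 0 < R → ∀ b : E,
      ∫ x, {x : E | 1 + ‖x - b‖ ≤ 4 * R}.indicator
        (fun x => (1 + ‖x - b‖) ^ (-n + (1 - ((i : ℝ) + 2) * (1 - α)))) x
          ≤ N * R ^ (1 - ((i : ℝ) + 2) * (1 - α))) := by
    intro i
    by_cases hi : i ≤ j
    · obtain ⟨N, h0, h⟩ := exists_integral_near_le (hs i hi).1 (hs i hi).2 (E := E) 4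
      exact ⟨N, h0, fun _ => h⟩
    · exact ⟨0, le_rfl, fun h => absurd h hi⟩
  choose N hN0 hN using hN
  obtain ⟨P, hP0, hP⟩ := exists_integral_far_le (E := E) (show 0 < 1 - α by linarith)
  refine ⟨2 * C₁ * (∑ i ∈ Finset.range (j + 1), N i) + C₂ * P,
    add_nonneg (mul_nonneg (by positivity) (Finset.sum_nonneg fun i _ => hN0 i)) (by positivity),
    fun {M μ ν Z W} h b b' => ?_⟩
  have hM := h.M_pos
  have hμ := h.μ_pos
  obtain ⟨-, -, hi⟩ := h.exists_geomBound_drift h𝒦 hℬ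
  set R := 1 + ‖b - b'‖ with hR
  have hR1 : 1 ≤ R := by linarith [norm_nonneg (b - b')]
  have hR0 : 0 < R := by linarith
  set near : ℕ → E → E → ℝ := fun i b => {x : E | 1 + ‖x - b‖ ≤ 4 * R}.indicator
        (fun x => (1 + ‖x - b‖) ^ (-n + (1 - ((i : ℝ) + 2) * (1 - α)))) with hnear
  set far : E → ℝ := {x : E | R ≤ 1 + ‖x - b‖}.indicator
        (fun x => (1 + ‖x - b‖) ^ (-n - (1 - α))) with hfar
  have hnear0 : ∀ i b x, 0 ≤ near i b x := fun i b x => indicator_nonneg (fun x _ => by positivity) x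
  have hfar0 : ∀ x, 0 ≤ far x := fun x => indicator_nonneg (fun x _ => by positivity) x
  have hnearI : ∀ i b, Integrable (near i b) := fun i b =>
    integrable_near_one_add_norm_rpow _ _ b
  have hfarI : Integrable far := by
    refine (integrable_one_add_norm_sub_rpow (show 0 < 1 - α by linarith) b).indicator ?_
    exact measurableSet_le measurable_const (by fun_prop)
  set κ : E → ℕ → ℝ := fun x i => C₁ * (M * μ * μ ^ i) * (near i b x + near i b' x) +
    C₂ * (M * μ * R ^ α) * (μ * R ^ (α - 1)) ^ i * far x with hκ
  have hpt : ∀ x, DerivBound j (κ x) (fun t => interaction 𝒦 ν ℬ (Z t x - Z t b') (W t x - W t b') -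
          interaction 𝒦 ν ℬ (Z t x - Z t b) (W t x - W t b)) := by
    intro x
    by_cases hx : 1 + ‖x - b‖ ≤ 3 * R
    · have hx' : 1 + ‖x - b'‖ ≤ 4 * R := by
        have := norm_add_le (x - b) (b - b')
        have e : x - b + (b - b') = x - b' := by abel
        rw [e] at this; linarith
      have e : ∀ i : ℕ, ∀ c : E, 1 + ‖x - c‖ ≤ 4 * R →
          C₁ * (M * μ * (1 + ‖x - c‖) ^ (-n - 1 + 2 * α)) * (μ * (1 + ‖x - c‖) ^ (α - 1)) ^ i
          = C₁ * (M * μ * μ ^ i) * near i c x := by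
        intro i c hc
        have hp : 0 < 1 + ‖x - c‖ := by positivity
        have h6 : near i c x = (1 + ‖x - c‖) ^ (-n + (1 - ((i : ℝ) + 2) * (1 - α))) :=
          indicator_of_mem (s := {x : E | 1 + ‖x - c‖ ≤ 4 * R}) hc _
        rw [h6, mul_pow, ← Real.rpow_mul_natCast hp.le]
        have h7 : (-n + (1 - ((i : ℝ) + 2) * (1 - α))) = (-n - 1 + 2 * α) + (α - 1) * i := by ring
        rw [h7, Real.rpow_add hp (-n - 1 + 2 * α)]; ring
      refine DerivBound.mono (DerivBound.sub (hC₁ h x b') (hC₁ h x b)) fun i _ => ?_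
      rw [e i b' hx', e i b (by linarith)]
      have : 0 ≤ C₂ * (M * μ * R ^ α) * (μ * R ^ (α - 1)) ^ i * far x :=
        mul_nonneg (by positivity) (hfar0 x)
      simp only [hκ]
      linarith
    · refine DerivBound.mono (hC₂ h x b b' (not_le.1 hx).le) fun i _ => ?_
      have hm : far x = (1 + ‖x - b‖) ^ (-n - (1 - α)) :=
        indicator_of_mem (s := {x : E | R ≤ 1 + ‖x - b‖}) (by
          change R ≤ 1 + ‖x - b‖; linarith) _
      simp only [hκ]
      rw [hm]
      have : 0 ≤ C₁ * (M * μ * μ ^ i) * (near i b x + near i b' x) :=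
        mul_nonneg (by positivity) (add_nonneg (hnear0 _ _ _) (hnear0 _ _ _))
      refine (le_of_eq ?_).trans (le_add_of_nonneg_left this)
      ring
  have hκI : ∀ i ≤ j, Integrable (fun x => κ x i) := fun i _ =>
    (((hnearI i b).add (hnearI i b')).const_mul _).add (hfarI.const_mul _)
  have key := DerivBound.integral (μ := volume) hpt hκI fun t ht =>
    ((hi t ht b').sub (hi t ht b)).aestronglyMeasurable
  have key2 : DerivBound j (fun i => ∫ x, κ x i) (fun t => drift 𝒦 ν ℬ (Z t) (W t) b -
      drift 𝒦 ν ℬ (Z t) (W t) b') := by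
    refine key.neg.congr fun t ht => ?_
    simp only [drift]
    rw [integral_sub (hi t ht b') (hi t ht b), neg_sub]
  refine DerivBound.mono key2 fun i hij => ?_
  have hRi : R ^ (1 - ((i : ℝ) + 2) * (1 - α)) = R ^ (2 * α - 1) * (R ^ (α - 1)) ^ i := by
    rw [← Real.rpow_mul_natCast hR0.le, ← Real.rpow_add hR0]; congr 1; ring
  have hRα : R ^ α * R ^ (-(1 - α)) = R ^ (2 * α - 1) := by
    rw [← Real.rpow_add hR0]; congr 1; ring
  have hNi : N i ≤ ∑ i ∈ Finset.range (j + 1), N i :=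
    Finset.single_le_sum (fun i _ => hN0 i) (Finset.mem_range.2 (by omega))
  calc ∫ x, κ x i = C₁ * (M * μ * μ ^ i) * ((∫ x, near i b x) + ∫ x, near i b' x) +
        C₂ * (M * μ * R ^ α) * (μ * R ^ (α - 1)) ^ i * ∫ x, far x := by
        rw [← integral_add (hnearI i b) (hnearI i b'), ← integral_const_mul, ← integral_const_mul]
        exact integral_add (((hnearI i b).add (hnearI i b')).const_mul _) (hfarI.const_mul _)
    _ ≤ C₁ * (M * μ * μ ^ i) * (N i * R ^ (1 - ((i : ℝ) + 2) * (1 - α)) +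
          N i * R ^ (1 - ((i : ℝ) + 2) * (1 - α))) +
        C₂ * (M * μ * R ^ α) * (μ * R ^ (α - 1)) ^ i * (P * R ^ (-(1 - α))) := by
        gcongr
        · exact hN i hij R hR0 b
        · exact hN i hij R hR0 b'
        · exact hP R hR1 b
    _ = (2 * C₁ * N i + C₂ * P) * (M * μ * R ^ (2 * α - 1)) * (μ * R ^ (α - 1)) ^ i := by
        rw [hRi, ← hRα, mul_pow]; ring
    _ ≤ _ := by gcongr

/-- At the critical level the acceleration of a single label is controlled. -/
lemma exists_norm_iterate_deriv_drift_le [Nontrivial E] {j : ℕ}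
    (h𝒦 : KernelDecay ((Module.finrank ℝ E : ℝ) + 1) 𝒦)
    (hℬ : KernelDecay ((Module.finrank ℝ E : ℝ) + 1) ℬ) {α : ℝ} (hα : 0 < α)
    (hj : 1 - (j + 2) * (1 - α) < 0) {C : ℝ} (hC : 0 < C) :
    ∃ C' : ℝ, 0 ≤ C' ∧ ∀ {M μ ν : ℝ} {Z W : ℝ → E → E},
      LabelledMotion j α M μ ν C Z W → ∀ b,
      (∀ i < j, ∀ t ∈ Ioo (-1 : ℝ) 1, HasDerivAt (deriv^[i] (fun t => drift 𝒦 ν ℬ (Z t) (W t) b))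
        (deriv^[i + 1] (fun t => drift 𝒦 ν ℬ (Z t) (W t) b) t) t) ∧
      ∀ t ∈ Ioo (-1 : ℝ) 1,
        ‖deriv^[j] (fun t => drift 𝒦 ν ℬ (Z t) (W t) b) t‖ ≤ C' * (M * μ ^ (j + 1)) := by
  obtain ⟨C₁, hC₁0, hC₁⟩ := exists_geomBound_interaction j h𝒦 hℬ hα hC
  set n : ℝ := (Module.finrank ℝ E : ℝ) with hn
  set s : ℝ := -(1 - (j + 2) * (1 - α)) with hs
  have hs0 : 0 < s := by linarith
  set I : ℝ := ∫ x : E, (1 + ‖x‖) ^ (-n - s) with hI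
  have hI0 : 0 ≤ I := integral_nonneg fun x => by positivity
  refine ⟨C₁ * I, by positivity, fun {M μ ν Z W} h b => ?_⟩
  have hM := h.M_pos
  have hμ := h.μ_pos
  obtain ⟨-, -, hi⟩ := h.exists_geomBound_drift h𝒦 hℬ
  obtain ⟨D, hD, hb⟩ := h.exists_geomBound_interaction_bdd h𝒦 hℬ
  have hrp : ∀ p : ℝ, Continuous fun x : E => (1 + ‖x - b‖) ^ p := fun p =>
    Continuous.rpow_const (by fun_prop) fun x => Or.inl (by positivity)
  have hDI : ∀ i : ℕ, Integrable fun x : E => D * (1 + ‖x - b‖) ^ (-n - 1) * D ^ i := fun i =>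
    ((integrable_one_add_norm_sub_rpow one_pos b).const_mul D).mul_const _
  have hκI : ∀ i ≤ j, Integrable fun x : E => Min.min
      (C₁ * (M * μ * (1 + ‖x - b‖) ^ (-n - 1 + 2 * α)) * (μ * (1 + ‖x - b‖) ^ (α - 1)) ^ i)
      (D * (1 + ‖x - b‖) ^ (-n - 1) * D ^ i) := by
    intro i _
    have := hrp (-n - 1 + 2 * α)
    have := hrp (α - 1)
    have := hrp (-n - 1)
    refine (hDI i).mono' (by fun_prop) (.of_forall fun x => ?_)
    rw [Real.norm_of_nonneg (le_min (by positivity) (by positivity))]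
    exact min_le_right _ _
  have key := (DerivBound.integral (μ := volume) (n := j)
    (fun x => DerivBound.min (hC₁ h x b) (hb x b)) hκI
      fun t ht => (hi t ht b).aestronglyMeasurable).deriv_bound
  refine ⟨key.1, fun t ht => (key.2 j le_rfl t ht).trans ?_⟩
  have e : ∀ x : E, C₁ * (M * μ * (1 + ‖x - b‖) ^ (-n - 1 + 2 * α)) *
      (μ * (1 + ‖x - b‖) ^ (α - 1)) ^ j = C₁ * (M * μ ^ (j + 1)) * (1 + ‖x - b‖) ^ (-n - s) := by
    intro x
    have hp : 0 < 1 + ‖x - b‖ := by positivity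
    have h7 : -n - s = (-n - 1 + 2 * α) + (α - 1) * j := by rw [hs]; ring
    rw [h7, Real.rpow_add hp (-n - 1 + 2 * α), mul_pow, ← Real.rpow_mul_natCast hp.le]; ring
  have hQ := (integrable_one_add_norm_sub_rpow hs0 b).const_mul (C₁ * (M * μ ^ (j + 1)))
  refine (integral_mono (hκI j le_rfl) hQ fun x => ?_).trans_eq ?_
  · exact (min_le_left _ _).trans_eq (e x)
  · rw [integral_const_mul, integral_sub_right_eq_self (fun x : E => (1 + ‖x‖) ^ (-n - s))]
    ring

end Picard

section Picard

variable {E : Type*} [NormedAddCommGroup E] [InnerProductSpace ℝ E] [FiniteDimensional ℝ E]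
  [MeasurableSpace E] [BorelSpace E]

lemma norm_fwdDiff_iter_le {S : Set ℝ} (hS : S.OrdConnected) {f : ℝ → E} {K : ℝ}
    (hf : ∀ s ∈ S, ‖f s‖ ≤ K) {h : ℝ} (hh : 0 ≤ h) (n : ℕ) {t : ℝ} (ht : t ∈ S)
    (htn : t + n * h ∈ S) : ‖(fwdDiff h)^[n] f t‖ ≤ 2 ^ n * K := by
  induction n generalizing t with
  | zero => simpa using hf t ht
  | succ n ih =>
    push_cast at htn
    have hn : 0 ≤ (n : ℝ) * h := by positivity
    rw [fwdDiff_iter_succ_apply']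
    refine (norm_sub_le _ _).trans ((add_le_add (ih (t := t + h) ?_ ?_) (ih ht ?_)).trans_eq
      (by ring))
    · exact hS.out ht htn ⟨by linarith, by nlinarith⟩
    · convert htn using 1; ring
    · exact hS.out ht htn ⟨by linarith, by nlinarith⟩

lemma hasDerivAt_intervalIntegral_of_continuousOn_Ioo {f : ℝ → E}
    (hf : ContinuousOn f (Ioo (-1) 1)) {t : ℝ} (ht : t ∈ Ioo (-1 : ℝ) 1) :
    HasDerivAt (fun s => ∫ τ in (0 : ℝ)..s, f τ) (f t) t := by
  have hsub : uIcc 0 t ⊆ Ioo (-1 : ℝ) 1 :=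
    ordConnected_Ioo.uIcc_subset (by norm_num) ht
  exact intervalIntegral.integral_hasDerivAt_right (hf.mono hsub).intervalIntegrable
    (hf.stronglyMeasurableAtFilter isOpen_Ioo t ht) (hf.continuousAt (isOpen_Ioo.mem_nhds ht))

lemma norm_le_of_hasDerivAt_of_zero {f f' : ℝ → E} {K : ℝ} (h0 : f 0 = 0)
    (hd : ∀ t ∈ Ioo (-1 : ℝ) 1, HasDerivAt f (f' t) t) (hK : ∀ t ∈ Ioo (-1 : ℝ) 1, ‖f' t‖ ≤ K)
    {t : ℝ} (ht : t ∈ Ioo (-1 : ℝ) 1) : ‖f t‖ ≤ K := by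
  have := (convex_Ioo (-1 : ℝ) 1).norm_image_sub_le_of_norm_hasDerivWithin_le
    (fun s hs => (hd s hs).hasDerivWithinAt) hK (show (0 : ℝ) ∈ Ioo (-1 : ℝ) 1 by norm_num) ht
  rw [h0, sub_zero, sub_zero] at this
  have hK0 : 0 ≤ K := (norm_nonneg _).trans (hK t ht)
  have h1 : ‖t‖ ≤ 1 := abs_le.2 ⟨ht.1.le, ht.2.le⟩
  nlinarith

variable {𝒦 : E → E →L[ℝ] E →L[ℝ] E} {ℬ : E → E →L[ℝ] E}

/-- Trajectories whose velocity stays within `e` of a solution of the drift equation. -/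
structure NearDriftSolution (𝒦 : E → E →L[ℝ] E →L[ℝ] E) (ℬ : E → E →L[ℝ] E)
    (α M μ ν C e : ℝ) (Y Y' V : ℝ → E → E) : Prop where
  e_nonneg : 0 ≤ e
  e_le : e ≤ C * M
  motion : LabelledMotion 0 α M μ ν C Y Y'
  label : ∀ b, Y 0 b = b
  hasDeriv : ∀ t ∈ Ioo (-1 : ℝ) 1, ∀ b, HasDerivAt (fun s => V s b) (drift 𝒦 ν ℬ (Y t) (Y' t) b) t
  close : ∀ t ∈ Ioo (-1 : ℝ) 1, ∀ b, ‖Y' t b - V t b‖ ≤ e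
  cont : Continuous (V 0)

/-- The velocity obtained from one Picard step. -/
noncomputable def picardVelocity (𝒦 : E → E →L[ℝ] E →L[ℝ] E) (ν : ℝ) (ℬ : E → E →L[ℝ] E)
    (V₀ : E → E) (Z W : ℝ → E → E) (t : ℝ) (b : E) : E :=
  V₀ b + ∫ s in (0 : ℝ)..t, drift 𝒦 ν ℬ (Z s) (W s) b

/-- The positions obtained by integrating velocities `W`. -/
noncomputable def picardPosition (W : ℝ → E → E) (t : ℝ) (b : E) : E :=
  b + ∫ s in (0 : ℝ)..t, W s b

lemma LabelledMotion.hasDerivAt_picardVelocity {j : ℕ} {α M μ ν C : ℝ} {Z W : ℝ → E → E}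
    (h : LabelledMotion j α M μ ν C Z W)
    (h𝒦 : KernelDecay ((Module.finrank ℝ E : ℝ) + 1) 𝒦)
    (hℬ : KernelDecay ((Module.finrank ℝ E : ℝ) + 1) ℬ) (V₀ : E → E) :
    ∀ t ∈ Ioo (-1 : ℝ) 1, ∀ b, HasDerivAt (fun s => picardVelocity 𝒦 ν ℬ V₀ Z W s b)
      (drift 𝒦 ν ℬ (Z t) (W t) b) t := by
  obtain ⟨⟨D, hD, hb⟩, -, -⟩ := h.exists_geomBound_drift h𝒦 hℬ
  intro t ht b
  exact (hasDerivAt_intervalIntegral_of_continuousOn_Ioo (hb b).cont ht).const_add _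

lemma LabelledMotion.hasDerivAt_picardPosition {j : ℕ} {α M μ ν C : ℝ} {Z W : ℝ → E → E}
    (h : LabelledMotion j α M μ ν C Z W)
    (h𝒦 : KernelDecay ((Module.finrank ℝ E : ℝ) + 1) 𝒦)
    (hℬ : KernelDecay ((Module.finrank ℝ E : ℝ) + 1) ℬ) (V₀ : E → E) :
    ∀ t ∈ Ioo (-1 : ℝ) 1, ∀ b,
      HasDerivAt (fun s => picardPosition (picardVelocity 𝒦 ν ℬ V₀ Z W) s b)
      (picardVelocity 𝒦 ν ℬ V₀ Z W t b) t := by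
  intro t ht b
  exact (hasDerivAt_intervalIntegral_of_continuousOn_Ioo (fun s hs =>
    (h.hasDerivAt_picardVelocity h𝒦 hℬ V₀ s hs b).continuousAt.continuousWithinAt) ht).const_add _

lemma continuous_const_add_intervalIntegral {f : ℝ → E → E} {g : E → E} (hg : Continuous g)
    (hf : ∀ b, ContinuousOn (fun t => f t b) (Ioo (-1) 1)) {D : ℝ}
    (hD : ∀ t ∈ Ioo (-1 : ℝ) 1, ∀ b, ‖f t b‖ ≤ D)
    (hc : ∀ t ∈ Ioo (-1 : ℝ) 1, Continuous (f t)) {t : ℝ} (ht : t ∈ Ioo (-1 : ℝ) 1) :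
    Continuous (fun b => g b + ∫ s in (0 : ℝ)..t, f s b) := by
  have hsub : uIoc 0 t ⊆ Ioo (-1 : ℝ) 1 :=
    uIoc_subset_uIcc.trans (ordConnected_Ioo.uIcc_subset (by norm_num) ht)
  refine hg.add (intervalIntegral.continuous_of_dominated_interval (bound := fun _ => D)
    (fun b => ?_) (fun b => .of_forall fun s hs => hD s (hsub hs) b) (by simp)
    (.of_forall fun s hs => hc s (hsub hs)))
  exact ((hf b).mono hsub).aestronglyMeasurable measurableSet_uIoc

lemma exists_picard_close
    (h𝒦 : KernelDecay ((Module.finrank ℝ E : ℝ) + 1) 𝒦)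
    (hℬ : KernelDecay ((Module.finrank ℝ E : ℝ) + 1) ℬ) {α : ℝ} (hα : 0 < α) (hα1 : α < 1)
    {C C₁ : ℝ} (hC : 0 < C) (hCC : C ≤ C₁) : ∃ C' : ℝ, C₁ ≤ C' ∧
      ∀ {M μ ν e : ℝ} {Y Y' V Z W : ℝ → E → E} {j : ℕ},
      NearDriftSolution 𝒦 ℬ α M μ ν C e Y Y' V → LabelledMotion j α M μ ν C₁ Z W →
      (∀ t ∈ Ioo (-1 : ℝ) 1, ∀ b, ‖Z t b - Y t b‖ ≤ C₁ * e) →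
      (∀ t ∈ Ioo (-1 : ℝ) 1, ∀ b, ‖W t b - Y' t b‖ ≤ C₁ * e) →
      (∀ t ∈ Ioo (-1 : ℝ) 1, ∀ b, ‖picardVelocity 𝒦 ν ℬ (V 0) Z W t b - Y' t b‖ ≤ C' * e) ∧
      ∀ t ∈ Ioo (-1 : ℝ) 1, ∀ b,
        ‖picardPosition (picardVelocity 𝒦 ν ℬ (V 0) Z W) t b - Y t b‖ ≤ C' * e := by
  have hC₁ : 0 < C₁ := hC.trans_le hCC
  obtain ⟨C', hC0, hC'⟩ := exists_drift_sub_le h𝒦 hℬ hα hα1 hC₁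
  refine ⟨C' * C₁ + 1 + C₁, by nlinarith [mul_nonneg hC0 hC₁.le],
    fun {M μ ν e Y Y' V Z W j} hY h hZ hW => ?_⟩
  have he := hY.e_nonneg
  have h1 : ∀ t ∈ Ioo (-1 : ℝ) 1, ∀ b,
      ‖picardVelocity 𝒦 ν ℬ (V 0) Z W t b - Y' t b‖ ≤ (C' * C₁ + 1 + C₁) * e := by
    intro t ht b
    have h2 : ‖picardVelocity 𝒦 ν ℬ (V 0) Z W t b - V t b‖ ≤ C' * (C₁ * e) := by
      refine norm_le_of_hasDerivAt_of_zero (f := fun t => picardVelocity 𝒦 ν ℬ (V 0) Z W t b - V t b)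
        ?_ (fun t ht => (h.hasDerivAt_picardVelocity h𝒦 hℬ (V 0) t ht b).fun_sub
          (hY.hasDeriv t ht b)) ?_ ht
      · simp [picardVelocity]
      · intro t ht
        exact hC' (by positivity) (h.of_le (Nat.zero_le j)) (hY.motion.mono_C hCC) hZ hW t ht b
    have h3 := hY.close t ht b
    have e1 : picardVelocity 𝒦 ν ℬ (V 0) Z W t b - Y' t b
        = (picardVelocity 𝒦 ν ℬ (V 0) Z W t b - V t b) - (Y' t b - V t b) := by abel
    rw [e1]
    refine (norm_sub_le _ _).trans ?_
    nlinarith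
  refine ⟨h1, fun t ht b => ?_⟩
  refine norm_le_of_hasDerivAt_of_zero
    (f := fun t => picardPosition (picardVelocity 𝒦 ν ℬ (V 0) Z W) t b - Y t b) ?_
    (fun t ht => (h.hasDerivAt_picardPosition h𝒦 hℬ (V 0) t ht b).fun_sub
      (hY.motion.hasDeriv t ht b)) (fun t ht => h1 t ht b) ht
  simp [picardPosition, hY.label]

lemma exists_picard_step [Nontrivial E] {j : ℕ}
    (h𝒦 : KernelDecay ((Module.finrank ℝ E : ℝ) + 1) 𝒦)
    (hℬ : KernelDecay ((Module.finrank ℝ E : ℝ) + 1) ℬ) {α : ℝ} (hα : 0 < α) (hα1 : α < 1)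
    (hj : 0 < 1 - (j + 2) * (1 - α)) {C C₁ : ℝ} (hC : 0 < C) (hCC : C ≤ C₁) :
    ∃ C' : ℝ, C ≤ C' ∧ ∀ {M μ ν e : ℝ} {Y Y' V Z W : ℝ → E → E},
      NearDriftSolution 𝒦 ℬ α M μ ν C e Y Y' V → LabelledMotion j α M μ ν C₁ Z W →
      (∀ t ∈ Ioo (-1 : ℝ) 1, ∀ b, ‖Z t b - Y t b‖ ≤ C₁ * e) →
      (∀ t ∈ Ioo (-1 : ℝ) 1, ∀ b, ‖W t b - Y' t b‖ ≤ C₁ * e) →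
      ∃ Z' W' : ℝ → E → E, LabelledMotion (j + 1) α M μ ν C' Z' W' ∧
      (∀ t ∈ Ioo (-1 : ℝ) 1, ∀ b, ‖Z' t b - Y t b‖ ≤ C' * e) ∧
      ∀ t ∈ Ioo (-1 : ℝ) 1, ∀ b, ‖W' t b - Y' t b‖ ≤ C' * e := by
  have hC₁ : 0 < C₁ := hC.trans_le hCC
  obtain ⟨C₂, hC₂0, hC₂⟩ := exists_picard_close h𝒦 hℬ hα hα1 hC hCC
  obtain ⟨C₃, hC₃0, hC₃⟩ := exists_geomBound_drift_sub (E := E) h𝒦 hℬ hα hα1 hj hC₁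
  have hC₂' : 0 < C₂ := by linarith
  set K := C + C * (2 * C₂ * C) + C₂ + (2 * C₂ * C) + C₃ with hK
  have hp : 0 < C₂ * C := by positivity
  have hp2 : 0 < C * (2 * C₂ * C) := by positivity
  refine ⟨K, by linarith, fun {M μ ν e Y Y' V Z W} hY h hZ hW => ?_⟩
  obtain ⟨hcW, hcZ⟩ := hC₂ hY h hZ hW
  set W' := picardVelocity 𝒦 ν ℬ (V 0) Z W with hW'
  set Z' := picardPosition W' with hZ'
  have hM := h.M_pos
  have hμ := h.μ_pos
  have he := hY.e_nonneg
  have hM1 : M ≤ 1 := h.M_le.trans h.μ_le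
  have heC : e ≤ C := hY.e_le.trans (mul_le_of_le_one_right hC.le hM1)
  have hmono : C₂ * e ≤ K * e := by gcongr; linarith
  have hdW := h.hasDerivAt_picardVelocity h𝒦 hℬ (V 0)
  have hdZ := h.hasDerivAt_picardPosition h𝒦 hℬ (V 0)
  obtain ⟨⟨D, hD, hDb⟩, hdc, -⟩ := h.exists_geomBound_drift h𝒦 hℬ
  obtain ⟨D', hD', hDb'⟩ := hY.motion.bdd
  have hWb : ∀ t ∈ Ioo (-1 : ℝ) 1, ∀ b, ‖W' t b‖ ≤ D' + C₂ * e := by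
    intro t ht b
    have h1 := hcW t ht b
    have h2 := (hDb' b).bound t ht
    have := norm_add_le (W' t b - Y' t b) (Y' t b)
    rw [sub_add_cancel] at this
    linarith
  have hWc : ∀ t ∈ Ioo (-1 : ℝ) 1, Continuous (W' t) := fun t ht =>
    continuous_const_add_intervalIntegral hY.cont (fun b => (hDb b).cont)
      (fun t ht b => (hDb b).bound t ht) hdc ht
  have hdiff : ∀ {f g f' g' : E}, ‖f' - f‖ ≤ C₂ * e → ‖g' - g‖ ≤ C₂ * e →
      ‖f' - g'‖ ≤ ‖f - g‖ + 2 * C₂ * e ∧ ‖f - g‖ ≤ ‖f' - g'‖ + 2 * C₂ * e := by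
    intro f g f' g' h1 h2
    constructor
    · have e1 : f' - g' = (f - g) + (f' - f) - (g' - g) := by abel
      rw [e1]
      refine (norm_sub_le _ _).trans ?_
      have := norm_add_le (f - g) (f' - f)
      linarith
    · have e1 : f - g = (f' - g') - (f' - f) + (g' - g) := by abel
      rw [e1]
      refine (norm_add_le _ _).trans ?_
      have := norm_sub_le (f' - g') (f' - f)
      linarith
  have h2e : 2 * C₂ * e ≤ 2 * C₂ * C := by gcongr
  refine ⟨Z', W', ⟨h.M_pos, h.M_le, h.μ_le, h.ν_nonneg, h.ν_le, hdZ, ?_, hWc, ?_, ?_, ?_, ?_⟩,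
    fun t ht b => (hcZ t ht b).trans hmono, fun t ht b => (hcW t ht b).trans hmono⟩
  · intro t ht
    exact continuous_const_add_intervalIntegral continuous_id (fun b s hs =>
      (hdW s hs b).continuousAt.continuousWithinAt) hWb hWc ht
  · intro t ht b b'
    have h1 := hY.motion.far t ht b b'
    have h2 := (hdiff (hcZ t ht b) (hcZ t ht b')).2
    have h3 := norm_nonneg (Z' t b - Z' t b')
    calc 1 + ‖b - b'‖ ≤ C * (1 + ‖Y t b - Y t b'‖) := h1
      _ ≤ C * (1 + (‖Z' t b - Z' t b'‖ + 2 * C₂ * C)) := by gcongr; linarith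
      _ ≤ (C + C * (2 * C₂ * C)) * (1 + ‖Z' t b - Z' t b'‖) := by nlinarith
      _ ≤ _ := by gcongr; linarith
  · intro t ht b b'
    have h1 := hY.motion.lip t ht b b'
    have h2 := (hdiff (hcZ t ht b) (hcZ t ht b')).1
    have h3 := norm_nonneg (b - b')
    have h4 : 0 ≤ C * (2 * C₂ * C) + C₂ + C₃ := by linarith
    have h5 : K = (C + 2 * C₂ * C) + (C * (2 * C₂ * C) + C₂ + C₃) := by rw [hK]; ring
    have h6 : 0 ≤ (C * (2 * C₂ * C) + C₂ + C₃) * (1 + ‖b - b'‖) := by positivity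
    rw [h5, add_mul]
    nlinarith
  · refine ⟨D' + C₂ * e + D + 1, by positivity, fun b => GeomBound.succ_intro
      (fun t ht => (hWb t ht b).trans (by linarith)) (fun t ht => hdW t ht b) ?_⟩
    have h1 : 0 ≤ D' + C₂ * e := by positivity
    exact (hDb b).mono (by nlinarith) (by positivity) hD (by linarith)
  · intro b b'
    set R := 1 + ‖b - b'‖ with hR
    have hR1 : 1 ≤ R := by linarith [norm_nonneg (b - b')]
    have hR0 : 0 < R := by linarith
    have hRα : 1 ≤ R ^ α := Real.one_le_rpow hR1 hα.le
    refine GeomBound.succ_intro (fun t ht => ?_)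
      (fun t ht => (hdW t ht b).fun_sub (hdW t ht b')) ((hC₃ h b b').mono ?_ ?_ ?_ le_rfl)
    · have h1 : ‖Y' t b - Y' t b'‖ ≤ C * (M * R ^ α) := (hY.motion.pair b b').bound t ht
      have h2 := (hdiff (hcW t ht b) (hcW t ht b')).1
      have h3 : 2 * C₂ * e ≤ 2 * C₂ * C * (M * R ^ α) := by
        calc 2 * C₂ * e ≤ 2 * C₂ * (C * M) := by gcongr; exact hY.e_le
          _ ≤ 2 * C₂ * (C * M) * R ^ α := le_mul_of_one_le_right (by positivity) hRα
          _ = _ := by ring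
      have h4 : (C + 2 * C₂ * C) * (M * R ^ α) ≤ K * (M * R ^ α) := by gcongr; linarith
      nlinarith
    · have : R ^ (2 * α - 1) = R ^ α * R ^ (α - 1) := by
        rw [← Real.rpow_add hR0]; congr 1; ring
      rw [this]
      calc C₃ * (M * μ * (R ^ α * R ^ (α - 1))) ≤ K * (M * μ * (R ^ α * R ^ (α - 1))) := by
            gcongr; linarith
        _ = _ := by ring
    · have : 0 < K := by linarith
      positivity
    · positivity

lemma exists_picard_iterate [Nontrivial E]
    (h𝒦 : KernelDecay ((Module.finrank ℝ E : ℝ) + 1) 𝒦)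
    (hℬ : KernelDecay ((Module.finrank ℝ E : ℝ) + 1) ℬ) {α : ℝ} (hα : 0 < α) (hα1 : α < 1)
    (j : ℕ) (hj : 0 < 1 - (j + 1) * (1 - α)) {C : ℝ} (hC : 0 < C) :
    ∃ C₁ : ℝ, C ≤ C₁ ∧ ∀ {M μ ν e : ℝ} {Y Y' V : ℝ → E → E},
      NearDriftSolution 𝒦 ℬ α M μ ν C e Y Y' V →
      ∃ Z W : ℝ → E → E, LabelledMotion j α M μ ν C₁ Z W ∧
      (∀ t ∈ Ioo (-1 : ℝ) 1, ∀ b, ‖Z t b - Y t b‖ ≤ C₁ * e) ∧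
      ∀ t ∈ Ioo (-1 : ℝ) 1, ∀ b, ‖W t b - Y' t b‖ ≤ C₁ * e := by
  induction j with
  | zero =>
    refine ⟨C, le_rfl, fun {M μ ν e Y Y' V} h => ⟨Y, Y', h.motion, ?_, ?_⟩⟩ <;>
    · intro t ht b
      have := h.e_nonneg
      simp only [sub_self, norm_zero]
      positivity
  | succ j ih =>
    obtain ⟨C₁, hCC, h₁⟩ := ih (by push_cast at hj; nlinarith)
    obtain ⟨C', hC', h'⟩ := exists_picard_step (E := E) (j := j) h𝒦 hℬ hα hα1
      (by push_cast at hj; linarith) hC hCC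
    refine ⟨C', hC', fun {M μ ν e Y Y' V} h => ?_⟩
    obtain ⟨Z, W, h1, h2, h3⟩ := h₁ h
    exact h' h h1 h2 h3

/-- Trajectories near a solution of the drift equation have small differences of order `j + 2`
at the critical level `j`. -/
theorem exists_norm_fwdDiff_iter_le [Nontrivial E]
    (h𝒦 : KernelDecay ((Module.finrank ℝ E : ℝ) + 1) 𝒦)
    (hℬ : KernelDecay ((Module.finrank ℝ E : ℝ) + 1) ℬ) {α : ℝ} (hα : 0 < α) (hα1 : α < 1)
    (j : ℕ) (hj : 0 < 1 - (j + 1) * (1 - α)) (hj' : 1 - (j + 2) * (1 - α) < 0)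
    {C : ℝ} (hC : 0 < C) :
    ∃ C' : ℝ, 0 ≤ C' ∧ ∀ {M μ ν e : ℝ} {Y Y' V : ℝ → E → E},
      NearDriftSolution 𝒦 ℬ α M μ ν C e Y Y' V → ∀ {t h : ℝ}, 0 ≤ h → t ∈ Ioo (-1 : ℝ) 1 →
        t + (j + 2 : ℕ) * h ∈ Ioo (-1 : ℝ) 1 → ∀ b,
        ‖(fwdDiff h)^[j + 2] (fun t => Y t b) t‖ ≤ C' * (e + M * μ ^ (j + 1)) := by
  obtain ⟨C₁, hCC, h₁⟩ := exists_picard_iterate h𝒦 hℬ hα hα1 j hj hC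
  obtain ⟨C₂, hC₂0, hC₂⟩ := exists_picard_close h𝒦 hℬ hα hα1 hC hCC
  obtain ⟨C₃, hC₃0, hC₃⟩ := exists_norm_iterate_deriv_drift_le (E := E) h𝒦 hℬ hα hj'
    (show 0 < C₁ by linarith)
  have hC₂' : 0 < C₂ := by linarith
  refine ⟨2 ^ (j + 2) * (C₂ + C₃), by positivity,
    fun {M μ ν e Y Y' V} hY {t h} hh ht hth b => ?_⟩
  obtain ⟨Z, W, hm, hZ, hW⟩ := h₁ hY
  obtain ⟨hcW, hcZ⟩ := hC₂ hY hm hZ hW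
  obtain ⟨hdd, hdb⟩ := hC₃ hm b
  have hM := hm.M_pos
  have hμ := hm.μ_pos
  have he := hY.e_nonneg
  set fs : ℕ → ℝ → E := fun i => match i with
    | 0 => fun t => picardPosition (picardVelocity 𝒦 ν ℬ (V 0) Z W) t b
    | 1 => fun t => picardVelocity 𝒦 ν ℬ (V 0) Z W t b
    | i + 2 => deriv^[i] (fun t => drift 𝒦 ν ℬ (Z t) (W t) b) with hfs
  have h1 := norm_fwdDiff_iter_sub_pow_smul_le h (j + 2) (fs := fs) (c := 0)
    (ordConnected_Ioo (a := (-1 : ℝ)) (b := 1)) (K := C₃ * (M * μ ^ (j + 1))) (t := t) ?_ ?_ ht hth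
  · have h2 := norm_fwdDiff_iter_le (ordConnected_Ioo (a := (-1 : ℝ)) (b := 1))
      (f := fun t => Y t b - fs 0 t) (K := C₂ * e) (fun s hs => by
        rw [norm_sub_rev]; exact hcZ s hs b) hh (j + 2) ht hth
    have e1 : (fun t => Y t b) = fun t => fs 0 t + (Y t b - fs 0 t) := by ext1 t; abel
    rw [e1, fwdDiff_iter_add_fun]
    refine (norm_add_le _ _).trans ?_
    rw [smul_zero, sub_zero] at h1
    have h3 : |h| ^ (j + 2) ≤ 2 ^ (j + 2) := by
      rw [abs_of_nonneg hh]
      gcongr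
      have := ht.1
      have := hth.2
      push_cast at this
      nlinarith [show 0 ≤ (j : ℝ) * h by positivity]
    have h4 : |h| ^ (j + 2) * (C₃ * (M * μ ^ (j + 1))) ≤
        2 ^ (j + 2) * (C₃ * (M * μ ^ (j + 1))) := by gcongr
    have h5 : 0 ≤ (2 : ℝ) ^ (j + 2) * (C₂ * (M * μ ^ (j + 1))) := by positivity
    have h6 : 0 ≤ (2 : ℝ) ^ (j + 2) * (C₃ * e) := by positivity
    nlinarith
  · intro i hi s hs
    match i with
    | 0 => exact hm.hasDerivAt_picardPosition h𝒦 hℬ (V 0) s hs b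
    | 1 => exact hm.hasDerivAt_picardVelocity h𝒦 hℬ (V 0) s hs b
    | i + 2 => exact hdd i (by omega) s hs
  · intro s hs
    rw [sub_zero]
    exact hdb s hs

end Picard

section Comparability

variable {E : Type*} [NormedAddCommGroup E] [InnerProductSpace ℝ E] [FiniteDimensional ℝ E]
  [MeasurableSpace E] [BorelSpace E]

lemma one_add_norm_le_of_norm_deriv_le {f f' : ℝ → E}
    (hd : ∀ t ∈ Ioo (-1 : ℝ) 1, HasDerivAt f (f' t) t)
    (hb : ∀ t ∈ Ioo (-1 : ℝ) 1, ‖f' t‖ ≤ ‖f t‖ + 1) {s t : ℝ} (hs : s ∈ Ioo (-1 : ℝ) 1)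
    (ht : t ∈ Ioo (-1 : ℝ) 1) (hst : s ≤ t) (hst' : t - s ≤ 1) : 1 + ‖f t‖ ≤ 3 * (1 + ‖f s‖) := by
  have hsub : Icc s t ⊆ Ioo (-1 : ℝ) 1 := ordConnected_Ioo.out hs ht
  have h := norm_le_gronwallBound_of_norm_deriv_right_le (f := f) (f' := f') (δ := ‖f s‖) (K := 1)
    (ε := 1) (a := s) (b := t) (fun x hx => (hd x (hsub hx)).continuousAt.continuousWithinAt)
    (fun x hx => (hd x (hsub (Ico_subset_Icc_self hx))).hasDerivWithinAt) le_rfl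
    (fun x hx => by rw [one_mul]; exact hb x (hsub (Ico_subset_Icc_self hx))) t
    (right_mem_Icc.2 hst)
  rw [gronwallBound_of_K_ne_0 one_ne_zero] at h
  have h1 : Real.exp (1 * (t - s)) ≤ 3 := by
    have := Real.exp_one_lt_d9
    have := Real.exp_le_exp.2 (show 1 * (t - s) ≤ 1 by linarith)
    linarith
  have h2 := norm_nonneg (f s)
  nlinarith

lemma one_add_norm_comparable_zero {f f' : ℝ → E}
    (hd : ∀ t ∈ Ioo (-1 : ℝ) 1, HasDerivAt f (f' t) t)
    (hb : ∀ t ∈ Ioo (-1 : ℝ) 1, ‖f' t‖ ≤ ‖f t‖ + 1) {t : ℝ} (ht : t ∈ Ioo (-1 : ℝ) 1) :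
    1 + ‖f t‖ ≤ 3 * (1 + ‖f 0‖) ∧ 1 + ‖f 0‖ ≤ 3 * (1 + ‖f t‖) := by
  have h0 : (0 : ℝ) ∈ Ioo (-1 : ℝ) 1 := by norm_num
  have hneg : ∀ {s : ℝ}, s ∈ Ioo (-1 : ℝ) 1 → -s ∈ Ioo (-1 : ℝ) 1 := fun hs =>
    ⟨by linarith [hs.2], by linarith [hs.1]⟩
  have hd' : ∀ t ∈ Ioo (-1 : ℝ) 1, HasDerivAt (fun s => f (-s)) (-f' (-t)) t := fun t ht => by
    simpa [Function.comp_def] using (hd (-t) (hneg ht)).scomp t (hasDerivAt_neg t)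
  have hb' : ∀ t ∈ Ioo (-1 : ℝ) 1, ‖-f' (-t)‖ ≤ ‖f (-t)‖ + 1 := fun t ht => by
    rw [norm_neg]; exact hb _ (hneg ht)
  rcases le_total 0 t with h | h
  · refine ⟨one_add_norm_le_of_norm_deriv_le hd hb h0 ht h (by linarith [ht.2]), ?_⟩
    have := one_add_norm_le_of_norm_deriv_le hd' hb' (hneg ht) h0 (by linarith) (by linarith [ht.2])
    simpa using this
  · refine ⟨?_, one_add_norm_le_of_norm_deriv_le hd hb ht h0 h (by linarith [ht.1])⟩
    have := one_add_norm_le_of_norm_deriv_le hd' hb' h0 (hneg ht) (by linarith) (by linarith [ht.1])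
    simpa using this

lemma labelledMotion_of_holder {α M μ ν : ℝ} (hα : 0 < α) (hα1 : α < 1) {Y Y' : ℝ → E → E}
    (hM : 0 < M) (hMμ : M ≤ μ) (hμ : μ ≤ 1) (hν : 0 ≤ ν) (hνμ : ν ≤ μ)
    (hd : ∀ t ∈ Ioo (-1 : ℝ) 1, ∀ b, HasDerivAt (fun s => Y s b) (Y' t b) t)
    (hc : ∀ t ∈ Ioo (-1 : ℝ) 1, Continuous (Y t)) (hc' : ∀ t ∈ Ioo (-1 : ℝ) 1, Continuous (Y' t))
    (hct : ∀ b, ContinuousOn (fun t => Y' t b) (Ioo (-1) 1)) (h0 : ∀ b, Y 0 b = b)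
    (hh : ∀ t ∈ Ioo (-1 : ℝ) 1, ∀ b b', ‖Y' t b - Y' t b'‖ ≤ M * ‖Y t b - Y t b'‖ ^ α)
    {D : ℝ} (hD : ∀ t ∈ Ioo (-1 : ℝ) 1, ∀ b, ‖Y' t b‖ ≤ D) :
    LabelledMotion 0 α M μ ν 3 Y Y' := by
  have hcomp : ∀ t ∈ Ioo (-1 : ℝ) 1, ∀ b b', 1 + ‖Y t b - Y t b'‖ ≤ 3 * (1 + ‖b - b'‖) ∧
      1 + ‖b - b'‖ ≤ 3 * (1 + ‖Y t b - Y t b'‖) := by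
    intro t ht b b'
    have := one_add_norm_comparable_zero (f := fun t => Y t b - Y t b')
      (fun t ht => (hd t ht b).fun_sub (hd t ht b')) (fun t ht => ?_) ht
    · simpa only [h0] using this
    · refine (hh t ht b b').trans ?_
      have h1 : ‖Y t b - Y t b'‖ ^ α ≤ ‖Y t b - Y t b'‖ + 1 := by
        calc ‖Y t b - Y t b'‖ ^ α ≤ (‖Y t b - Y t b'‖ + 1) ^ α := by gcongr; linarith
          _ ≤ (‖Y t b - Y t b'‖ + 1) ^ (1 : ℝ) := Real.rpow_le_rpow_of_exponent_le
              (by linarith [norm_nonneg (Y t b - Y t b')]) hα1.le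
          _ = _ := Real.rpow_one _
      have : 0 ≤ ‖Y t b - Y t b'‖ ^ α := by positivity
      nlinarith
  have hD0 : 0 ≤ D := (norm_nonneg _).trans (hD 0 (by norm_num) 0)
  refine ⟨hM, hMμ, hμ, hν, hνμ, hd, hc, hc', fun t ht b b' => (hcomp t ht b b').2,
    fun t ht b b' => by linarith [(hcomp t ht b b').1],
    ⟨D, hD0, fun b => ⟨hct b, fun t ht => by simpa using hD t ht b⟩⟩, fun b b' =>
    ⟨(hct b).sub (hct b'), fun t ht => ?_⟩⟩
  simp only [pow_zero, mul_one]
  refine (hh t ht b b').trans ?_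
  have h3 : (3 : ℝ) ^ α ≤ 3 := by
    have := Real.rpow_le_rpow_of_exponent_le (x := 3) (by norm_num) hα1.le
    rwa [Real.rpow_one] at this
  calc M * ‖Y t b - Y t b'‖ ^ α ≤ M * (3 * (1 + ‖b - b'‖)) ^ α := by
        gcongr; linarith [(hcomp t ht b b').1]
    _ = M * (3 ^ α * (1 + ‖b - b'‖) ^ α) := by rw [Real.mul_rpow (by norm_num) (by positivity)]
    _ ≤ M * (3 * (1 + ‖b - b'‖) ^ α) := by gcongr
    _ = _ := by ring

end Comparability

section Moments

/-- The incomplete moment `∫_ε^1 s^q e^{-sz} ds`. -/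
noncomputable def expMoment (ε q z : ℝ) : ℝ := ∫ s in ε..1, s ^ q * Real.exp (-(s * z))

lemma continuous_rpow_mul_exp {q : ℝ} (hq : 0 ≤ q) (z : ℝ) :
    Continuous fun s : ℝ => s ^ q * Real.exp (-(s * z)) :=
  (Real.continuous_rpow_const hq).mul (by fun_prop)

lemma hasDerivAt_expMoment {ε q : ℝ} (hε : 0 ≤ ε) (hε1 : ε ≤ 1) (hq : 0 ≤ q) (z : ℝ) :
    HasDerivAt (expMoment ε q) (-expMoment ε (q + 1) z) z := by
  have h := (intervalIntegral.hasDerivAt_integral_of_dominated_loc_of_deriv_le (μ := volume)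
    (F := fun z s => s ^ q * Real.exp (-(s * z))) (F' := fun z s => -(s ^ (q + 1) * Real.exp (-(s * z))))
    (a := ε) (b := 1) (bound := fun _ => Real.exp (|z| + 1)) (Metric.ball_mem_nhds z one_pos)
    (Filter.Eventually.of_forall fun z => (continuous_rpow_mul_exp hq z).aestronglyMeasurable)
    ((continuous_rpow_mul_exp hq z).intervalIntegrable _ _)
    (continuous_rpow_mul_exp (by linarith) z).neg.aestronglyMeasurable
    (Filter.Eventually.of_forall fun s hs x hx => ?_) intervalIntegrable_const
    (Filter.Eventually.of_forall fun s hs x hx => ?_)).2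
  · rw [intervalIntegral.integral_neg] at h
    exact h
  · rw [uIoc_of_le hε1] at hs
    have hs0 : 0 < s := hε.trans_lt hs.1
    rw [norm_neg, Real.norm_of_nonneg (by positivity)]
    have h1 : s ^ (q + 1) ≤ 1 := Real.rpow_le_one hs0.le hs.2 (by linarith)
    have h2 : -(s * x) ≤ |z| + 1 := by
      rw [Metric.mem_ball, Real.dist_eq] at hx
      have h3 : |x| ≤ |z| + 1 := by
        have := abs_sub_abs_le_abs_sub x z
        linarith
      have h4 : |s * x| ≤ |x| := by
        rw [abs_mul, abs_of_pos hs0]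
        exact mul_le_of_le_one_left (abs_nonneg x) hs.2
      linarith [neg_abs_le (s * x)]
    calc s ^ (q + 1) * Real.exp (-(s * x)) ≤ 1 * Real.exp (|z| + 1) := by gcongr
      _ = _ := one_mul _
  · rw [uIoc_of_le hε1] at hs
    have hs0 : 0 < s := hε.trans_lt hs.1
    have h1 : HasDerivAt (fun x : ℝ => -(s * x)) (-s) x := by
      simpa using ((hasDerivAt_id' x).const_mul s).fun_neg
    refine (h1.exp.const_mul (s ^ q)).congr_deriv ?_
    rw [Real.rpow_add_one hs0.ne']
    ring

lemma expMoment_nonneg {ε q z : ℝ} (hε : 0 ≤ ε) (hε1 : ε ≤ 1) : 0 ≤ expMoment ε q z :=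
  intervalIntegral.integral_nonneg hε1 fun _ hs =>
    mul_nonneg (Real.rpow_nonneg (hε.trans hs.1) _) (Real.exp_pos _).le

lemma expMoment_le_zero {ε q z : ℝ} (hε : 0 ≤ ε) (hq : 0 ≤ q) :
    expMoment ε q z ≤ expMoment 0 q z := by
  have hc := continuous_rpow_mul_exp hq z
  have := intervalIntegral.integral_add_adjacent_intervals (μ := volume)
    (hc.intervalIntegrable 0 ε) (hc.intervalIntegrable ε 1)
  rw [expMoment, expMoment, ← this]
  have : 0 ≤ ∫ s in (0 : ℝ)..ε, s ^ q * Real.exp (-(s * z)) :=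
    intervalIntegral.integral_nonneg hε fun s hs =>
      mul_nonneg (Real.rpow_nonneg hs.1 _) (Real.exp_pos _).le
  linarith

lemma expMoment_le_exp {ε q z : ℝ} (hε : 0 ≤ ε) (hε1 : ε ≤ 1) (hq : 0 ≤ q) (hz : 0 ≤ z) :
    expMoment ε q z ≤ Real.exp (-(ε * z)) := by
  have hc := continuous_rpow_mul_exp hq z
  calc expMoment ε q z ≤ ∫ s in ε..1, Real.exp (-(ε * z)) := by
        refine intervalIntegral.integral_mono_on hε1 (hc.intervalIntegrable _ _)
          intervalIntegrable_const fun s hs => ?_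
        have h1 : s ^ q ≤ 1 := Real.rpow_le_one (hε.trans hs.1) hs.2 hq
        calc s ^ q * Real.exp (-(s * z)) ≤ 1 * Real.exp (-(ε * z)) := by
              gcongr
              exact hs.1
          _ = _ := one_mul _
    _ = (1 - ε) * Real.exp (-(ε * z)) := by simp
    _ ≤ 1 * Real.exp (-(ε * z)) := by gcongr; linarith
    _ = _ := one_mul _

lemma mul_expMoment_add_one {ε q : ℝ} (hq : 0 ≤ q) (z : ℝ) :
    z * expMoment ε (q + 1) z
      = (q + 1) * expMoment ε q z + ε ^ (q + 1) * Real.exp (-(ε * z)) - Real.exp (-z) := by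
  have h := intervalIntegral.integral_eq_sub_of_hasDerivAt (a := ε) (b := 1)
    (f := fun s => s ^ (q + 1) * Real.exp (-(s * z)))
    (f' := fun s => (q + 1) * (s ^ q * Real.exp (-(s * z))) - z * (s ^ (q + 1) * Real.exp (-(s * z))))
    (fun s hs => ?_) ?_
  · rw [intervalIntegral.integral_sub, intervalIntegral.integral_const_mul,
      intervalIntegral.integral_const_mul] at h
    · simp only [expMoment]
      simp only [Real.one_rpow, one_mul] at h
      linarith
    · exact ((continuous_rpow_mul_exp hq z).const_mul _).intervalIntegrable _ _
    · exact ((continuous_rpow_mul_exp (by linarith) z).const_mul _).intervalIntegrable _ _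
  · have h1 : HasDerivAt (fun s : ℝ => -(s * z)) (-z) s := by
      simpa using ((hasDerivAt_id' s).mul_const z).fun_neg
    refine ((Real.hasDerivAt_rpow_const (p := q + 1) (Or.inr (by linarith))).mul h1.exp).congr_deriv ?_
    simp only [add_sub_cancel_right]
    ring
  · exact (((continuous_rpow_mul_exp hq z).const_mul _).sub
      ((continuous_rpow_mul_exp (by linarith) z).const_mul _)).intervalIntegrable _ _

lemma exists_exp_neg_le (p : ℝ) : ∃ C : ℝ, 0 < C ∧ ∀ z : ℝ, 0 ≤ z →
    Real.exp (-z) ≤ C * (1 + z) ^ (-p) := by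
  obtain ⟨n, hn⟩ := exists_nat_ge p
  refine ⟨Real.exp 1 * n.factorial, by positivity, fun z hz => ?_⟩
  have h1 := Real.pow_div_factorial_le_exp (1 + z) (by linarith) n
  have h2 : (1 + z) ^ p ≤ (1 + z) ^ n := by
    rw [← Real.rpow_natCast]
    exact Real.rpow_le_rpow_of_exponent_le (by linarith) hn
  have h3 : 0 < (1 + z) ^ p := by positivity
  rw [Real.rpow_neg (by linarith), ← div_eq_mul_inv, le_div_iff₀ h3, Real.exp_neg,
    inv_mul_le_iff₀ (Real.exp_pos z)]
  rw [div_le_iff₀ (by positivity), Real.exp_add] at h1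
  linarith

lemma exists_expMoment_zero_le {q : ℝ} (hq : 0 ≤ q) : ∃ C : ℝ, 0 < C ∧ ∀ z : ℝ, 0 ≤ z →
    expMoment 0 q z ≤ C * (1 + z) ^ (-(q + 1)) := by
  have hΓ : 0 < Real.Gamma (q + 1) := Real.Gamma_pos_of_pos (by linarith)
  refine ⟨2 ^ (q + 1) * (1 + Real.Gamma (q + 1)), by positivity, fun z hz => ?_⟩
  have h2 : 0 < (2 : ℝ) ^ (q + 1) := by positivity
  rcases le_total z 1 with h | h
  · have h1 := expMoment_le_exp le_rfl zero_le_one hq hz (z := z)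
    simp only [zero_mul, neg_zero, Real.exp_zero] at h1
    have h3 : (1 + z) ^ (q + 1) ≤ 2 ^ (q + 1) := by gcongr; linarith
    rw [Real.rpow_neg (by linarith), ← div_eq_mul_inv, le_div_iff₀ (by positivity)]
    have := expMoment_nonneg le_rfl zero_le_one (q := q) (z := z)
    nlinarith [mul_pos h2 hΓ]
  · have hz0 : 0 < z := by linarith
    have e := Real.integral_rpow_mul_exp_neg_mul_Ioi (a := q + 1) (r := z) (by linarith) hz0
    have hI : IntegrableOn (fun t : ℝ => t ^ (q + 1 - 1) * Real.exp (-(z * t))) (Ioi 0) := by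
      by_contra hI
      rw [integral_undef hI] at e
      have : 0 < (1 / z) ^ (q + 1) * Real.Gamma (q + 1) := by positivity
      linarith
    have h1 : expMoment 0 q z ≤ (1 / z) ^ (q + 1) * Real.Gamma (q + 1) := by
      rw [← e, expMoment, intervalIntegral.integral_of_le zero_le_one]
      have e' : (fun s : ℝ => s ^ q * Real.exp (-(s * z)))
          = fun t : ℝ => t ^ (q + 1 - 1) * Real.exp (-(z * t)) := by
        ext s; rw [add_sub_cancel_right, mul_comm s z]
      rw [e']
      exact setIntegral_mono_set hI ((ae_restrict_mem measurableSet_Ioi).mono fun s hs =>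
        mul_nonneg (Real.rpow_nonneg (le_of_lt hs) _) (Real.exp_pos _).le)
        (LE.le.eventuallyLE fun s hs => hs.1)
    have h3 : (1 / z) ^ (q + 1) ≤ 2 ^ (q + 1) * (1 + z) ^ (-(q + 1)) := by
      rw [Real.rpow_neg (by linarith), ← Real.inv_rpow (by linarith), ← Real.mul_rpow (by norm_num)
        (by positivity)]
      gcongr
      rw [← div_eq_mul_inv, div_le_div_iff₀ hz0 (by linarith)]
      linarith
    have h4 : 0 < (1 + z) ^ (-(q + 1)) := by positivity
    calc _ ≤ (2 ^ (q + 1) * (1 + z) ^ (-(q + 1))) * Real.Gamma (q + 1) := h1.trans (by gcongr)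
      _ ≤ _ := by nlinarith [mul_pos h2 h4]

end Moments

section RadialKernels

variable {E : Type} [NormedAddCommGroup E] [InnerProductSpace ℝ E]

lemma KernelDecay.linear {F : Type} [NormedAddCommGroup F] [NormedSpace ℝ F] (T : E →L[ℝ] F) :
    KernelDecay (-1) (fun y => T y) := by
  refine ⟨T.contDiff, fun i => ?_⟩
  rcases i with _ | _ | i
  · refine ⟨‖T‖, norm_nonneg _, fun y => ?_⟩
    simp only [norm_iteratedFDeriv_zero, neg_neg, Nat.cast_zero, sub_zero, Real.rpow_one]
    exact (T.le_opNorm y).trans (by gcongr; linarith)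
  · refine ⟨‖T‖, norm_nonneg _, fun y => ?_⟩
    rw [← norm_iteratedFDeriv_fderiv, norm_iteratedFDeriv_zero, T.fderiv]
    simp
  · refine ⟨0, le_rfl, fun y => ?_⟩
    rw [← norm_iteratedFDeriv_fderiv]
    have : _root_.fderiv ℝ (fun y => T y) = fun _ => T := funext fun y => T.fderiv
    rw [this, iteratedFDeriv_const_of_ne (by omega)]
    simp

lemma KernelDecay.const {F : Type} [NormedAddCommGroup F] [NormedSpace ℝ F] (c : F) :
    KernelDecay 0 (fun _ : E => c) := by
  refine ⟨contDiff_const, fun i => ?_⟩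
  rcases i with _ | i
  · exact ⟨‖c‖, norm_nonneg _, fun y => by simp⟩
  · refine ⟨0, le_rfl, fun y => ?_⟩
    rw [iteratedFDeriv_const_of_ne (by omega)]
    simp

/-- A sequence of functions, each being up to a linear factor the derivative of the previous one
and decaying two powers faster, consists of smooth kernels. -/
lemma kernelDecay_of_hasFDerivAt_seq {a : ℝ} {f : ℕ → E → ℝ}
    (hf : ∀ n y, HasFDerivAt (f n) ((-(1 / 2) * f (n + 1) y) • innerSL ℝ y) y)
    (hb : ∀ n : ℕ, ∃ C : ℝ, 0 ≤ C ∧ ∀ y, ‖f n y‖ ≤ C * (1 + ‖y‖) ^ (-(a + 2 * n))) :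
    KernelDecay a (f 0) := by
  have hd : ∀ n, fderiv ℝ (f n) = fun y => (ContinuousLinearMap.lsmul ℝ ℝ (E := E →L[ℝ] ℝ))
      (f (n + 1) y) (((-(1 / 2 : ℝ)) • innerSL ℝ) y) := fun n => by
    ext1 y
    rw [(hf n y).fderiv]
    simp [smul_smul, mul_comm]
  have hsm : ∀ i : ℕ, ∀ n, ContDiff ℝ i (f n) := by
    intro i
    induction i with
    | zero =>
      intro n
      exact contDiff_zero.2 (continuous_iff_continuousAt.2 fun y => (hf n y).continuousAt)
    | succ i ih =>
      intro n
      push_cast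
      rw [contDiff_succ_iff_fderiv]
      refine ⟨fun y => (hf n y).differentiableAt, by simp, ?_⟩
      rw [hd]
      exact (ContinuousLinearMap.contDiff _ |>.comp (ih (n + 1))).clm_apply
        (ContinuousLinearMap.contDiff _)
  have hsm' : ∀ n, ContDiff ℝ (⊤ : ℕ∞) (f n) := fun n => contDiff_infty.2 fun i => hsm i n
  have main : ∀ i : ℕ, ∀ k ≤ i, ∀ n : ℕ, ∃ C : ℝ, 0 ≤ C ∧ ∀ y,
      ‖iteratedFDeriv ℝ k (f n) y‖ ≤ C * (1 + ‖y‖) ^ (-(a + 2 * n) - k) := by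
    intro i
    induction i with
    | zero =>
      intro k hk n
      obtain rfl : k = 0 := by omega
      simpa using hb n
    | succ i ih =>
      intro k hk n
      rcases k with _ | k
      · simpa using hb n
      obtain ⟨C', hC'0, hC'⟩ : ∃ C' : ℕ → ℝ, (∀ j, 0 ≤ C' j) ∧ ∀ j ≤ i, ∀ y,
          ‖iteratedFDeriv ℝ j (f (n + 1)) y‖ ≤ C' j * (1 + ‖y‖) ^ (-(a + 2 * (n + 1 : ℕ)) - j) := by
        choose C' h h' using fun j : ℕ => fun hj : j ≤ i => ih j hj (n + 1)
        refine ⟨fun j => if hj : j ≤ i then C' j hj else 0, fun j => ?_, fun j hj y => ?_⟩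
        · dsimp only
          split_ifs with hj
          exacts [h j hj, le_rfl]
        · simpa [hj] using h' j hj y
      set L : E →L[ℝ] E →L[ℝ] ℝ := (-(1 / 2 : ℝ)) • innerSL ℝ
      have hL := KernelDecay.linear L
      choose D hD0 hD using hL.2
      set B := ContinuousLinearMap.lsmul ℝ ℝ (E := E →L[ℝ] ℝ)
      refine ⟨‖B‖ * ∑ j ∈ Finset.range (k + 1), (k.choose j : ℝ) * C' j * D (k - j),
        mul_nonneg (norm_nonneg B) (Finset.sum_nonneg fun j _ =>
          mul_nonneg (mul_nonneg (by positivity) (hC'0 j)) (hD0 _)), fun y => ?_⟩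
      have hy : 0 < 1 + ‖y‖ := by positivity
      rw [← norm_iteratedFDeriv_fderiv, hd]
      refine (B.norm_iteratedFDeriv_le_of_bilinear (hsm' (n + 1)) L.contDiff y (n := k)
        (by exact_mod_cast le_top)).trans ?_
      rw [mul_assoc, Finset.sum_mul]
      refine mul_le_mul_of_nonneg_left (Finset.sum_le_sum fun j hj => ?_) (norm_nonneg B)
      have hj' : j ≤ k := by simpa [Nat.lt_succ_iff] using hj
      have e : (1 + ‖y‖) ^ (-(a + 2 * n) - (k + 1 : ℕ)) = (1 + ‖y‖) ^ (-(a + 2 * (n + 1 : ℕ)) - j) *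
          (1 + ‖y‖) ^ (-(-1 : ℝ) - ((k - j : ℕ) : ℝ)) := by
        rw [← Real.rpow_add hy, Nat.cast_sub hj']; push_cast; ring_nf
      rw [e]
      calc _ ≤ (k.choose j : ℝ) * (C' j * (1 + ‖y‖) ^ (-(a + 2 * (n + 1 : ℕ)) - j)) *
            (D (k - j) * (1 + ‖y‖) ^ (-(-1 : ℝ) - ((k - j : ℕ) : ℝ))) := by
            gcongr
            · exact mul_nonneg (by positivity) (mul_nonneg (hC'0 j) (by positivity))
            · exact hC' j (by omega) y
            · exact hD _ y
        _ = _ := by ring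
  refine ⟨hsm' 0, fun i => ?_⟩
  simpa using main i i le_rfl 0

lemma hasFDerivAt_comp_norm_sq_div_four {f : ℝ → ℝ} {f' : ℝ} {y : E}
    (h : HasDerivAt f (-f') (‖y‖ ^ 2 / 4)) :
    HasFDerivAt (fun y : E => f (‖y‖ ^ 2 / 4)) ((-(1 / 2) * f') • innerSL ℝ y) y := by
  have h1 : HasFDerivAt (fun y : E => ‖y‖ ^ 2 / 4) ((1 / 2 : ℝ) • innerSL ℝ y) y := by
    have := (hasStrictFDerivAt_norm_sq y).hasFDerivAt.const_mul (1 / 4 : ℝ)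
    refine (this.congr_of_eventuallyEq (Filter.Eventually.of_forall fun y => ?_)).congr_fderiv ?_
    · simp; ring
    · ext v; simp; ring
  refine (h.comp_hasFDerivAt y h1).congr_fderiv ?_
  rw [smul_smul]; ring_nf

lemma one_add_norm_sq_div_four_rpow_le {p : ℝ} (hp : 0 ≤ p) (y : E) :
    (1 + ‖y‖ ^ 2 / 4) ^ (-p) ≤ 8 ^ p * (1 + ‖y‖) ^ (-(2 * p)) := by
  have h1 : 0 < 1 + ‖y‖ := by positivity
  have h2 : (1 + ‖y‖) ^ 2 ≤ 8 * (1 + ‖y‖ ^ 2 / 4) := by nlinarith [sq_nonneg (‖y‖ - 1)]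
  rw [Real.rpow_neg (by positivity), Real.rpow_neg h1.le, ← div_eq_mul_inv, inv_eq_one_div,
    div_le_div_iff₀ (by positivity) (by positivity), one_mul, ← Real.mul_rpow (by norm_num)
    (by positivity), show (1 + ‖y‖) ^ (2 * p) = ((1 + ‖y‖) ^ 2) ^ p by
      rw [Real.rpow_mul h1.le]; norm_cast]
  gcongr

lemma kernelDecay_comp_norm_sq_div_four {p : ℝ} (hp : 0 ≤ p) {f : ℕ → ℝ → ℝ}
    (hf : ∀ n z, HasDerivAt (f n) (-f (n + 1) z) z)
    (hb : ∀ n : ℕ, ∃ C : ℝ, 0 < C ∧ ∀ z, 0 ≤ z → |f n z| ≤ C * (1 + z) ^ (-(p + n))) :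
    KernelDecay (2 * p) fun y : E => f 0 (‖y‖ ^ 2 / 4) := by
  refine kernelDecay_of_hasFDerivAt_seq (f := fun n y => f n (‖y‖ ^ 2 / 4))
    (fun n y => hasFDerivAt_comp_norm_sq_div_four (hf n _)) fun n => ?_
  obtain ⟨C, hC0, hC⟩ := hb n
  refine ⟨C * 8 ^ (p + n), by positivity, fun y => (hC _ (by positivity)).trans ?_⟩
  have := one_add_norm_sq_div_four_rpow_le (p := p + n) (by positivity) y
  rw [mul_add] at this
  rw [mul_assoc]
  gcongr

lemma kernelDecay_gaussian {p : ℝ} (hp : 0 ≤ p) :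
    KernelDecay (2 * p) fun y : E => Real.exp (-(‖y‖ ^ 2 / 4)) :=
  kernelDecay_comp_norm_sq_div_four hp (f := fun _ z => Real.exp (-z))
    (fun n z => by simpa using (hasDerivAt_id' z).fun_neg.exp) fun n => by
      obtain ⟨C, hC0, hC⟩ := exists_exp_neg_le (p + n)
      exact ⟨C, hC0, fun z hz => by rw [abs_of_pos (Real.exp_pos _)]; exact hC z hz⟩

lemma kernelDecay_expMoment_zero {q : ℝ} (hq : 0 ≤ q) :
    KernelDecay (2 * (q + 1)) fun y : E => expMoment 0 q (‖y‖ ^ 2 / 4) := by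
  have := kernelDecay_comp_norm_sq_div_four (E := E) (p := q + 1) (by linarith)
    (f := fun n => expMoment 0 (q + n))
    (fun n z => by
      have := hasDerivAt_expMoment le_rfl zero_le_one (q := q + n) (by positivity) z
      push_cast
      rwa [← add_assoc]) fun n => by
      obtain ⟨C, hC0, hC⟩ := exists_expMoment_zero_le (q := q + n) (by positivity)
      refine ⟨C, hC0, fun z hz => ?_⟩
      rw [abs_of_nonneg (expMoment_nonneg le_rfl zero_le_one), add_right_comm]
      exact hC z hz
  simpa using this

lemma kernelDecay_expMoment {ε q p : ℝ} (hε : 0 < ε) (hε1 : ε ≤ 1) (hq : 0 ≤ q) (hp : 0 ≤ p) :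
    KernelDecay (2 * p) fun y : E => expMoment ε q (‖y‖ ^ 2 / 4) := by
  have := kernelDecay_comp_norm_sq_div_four (E := E) (p := p) hp
    (f := fun n => expMoment ε (q + n))
    (fun n z => by
      have := hasDerivAt_expMoment hε.le hε1 (q := q + n) (by positivity) z
      push_cast
      rwa [← add_assoc]) fun n => by
      obtain ⟨C, hC0, hC⟩ := exists_exp_neg_le (p + n)
      refine ⟨C * ε ^ (-(p + n)), by positivity, fun z hz => ?_⟩
      rw [abs_of_nonneg (expMoment_nonneg hε.le hε1)]
      refine (expMoment_le_exp hε.le hε1 (by positivity) hz).trans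
        ((hC (ε * z) (by positivity)).trans ?_)
      rw [mul_assoc, ← Real.mul_rpow hε.le (by linarith)]
      have : ε * (1 + z) ≤ 1 + ε * z := by linarith
      gcongr C * ?_
      exact Real.rpow_le_rpow_of_nonpos (by positivity) this (by linarith [Nat.cast_nonneg (α := ℝ) n])
  simpa using this

end RadialKernels

section Divergence

variable {d : ℕ} {G H K : Type} [NormedAddCommGroup G] [NormedSpace ℝ G] [NormedAddCommGroup H]
  [NormedSpace ℝ H] [NormedAddCommGroup K] [NormedSpace ℝ K]

/-- Continuously differentiable functions which decay of order `-a` together with their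
derivative. -/
structure C1Decay (a : ℝ) (f : EuclideanSpace ℝ (Fin d) → G) : Prop where
  contDiff : ContDiff ℝ 1 f
  bound : ∃ C : ℝ, 0 ≤ C ∧ ∀ y, ‖f y‖ ≤ C * (1 + ‖y‖) ^ (-a) ∧
    ‖fderiv ℝ f y‖ ≤ C * (1 + ‖y‖) ^ (-a)

lemma KernelDecay.c1Decay {a : ℝ} {f : EuclideanSpace ℝ (Fin d) → G} (h : KernelDecay a f) :
    C1Decay a f := by
  refine ⟨h.1.of_le (by exact_mod_cast le_top), ?_⟩
  obtain ⟨C, hC0, hC⟩ := h.bound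
  obtain ⟨C', hC'0, hC'⟩ := (h.fderiv.mono (show a ≤ a + 1 by linarith)).bound
  refine ⟨C + C', by positivity, fun y => ⟨(hC y).trans ?_, (hC' y).trans ?_⟩⟩ <;>
  · gcongr
    linarith

namespace C1Decay

lemma differentiable {a : ℝ} {f : EuclideanSpace ℝ (Fin d) → G} (h : C1Decay a f) :
    Differentiable ℝ f := h.contDiff.differentiable (by simp)

lemma continuous_fderiv {a : ℝ} {f : EuclideanSpace ℝ (Fin d) → G} (h : C1Decay a f) :
    Continuous (fderiv ℝ f) := h.contDiff.continuous_fderiv (by simp)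

lemma bilin (B : G →L[ℝ] H →L[ℝ] K) {a b : ℝ} {f : EuclideanSpace ℝ (Fin d) → G}
    {g : EuclideanSpace ℝ (Fin d) → H} (hf : C1Decay a f) (hg : C1Decay b g) :
    C1Decay (a + b) (fun y => B (f y) (g y)) := by
  refine ⟨(B.contDiff.comp hf.contDiff).clm_apply hg.contDiff, ?_⟩
  obtain ⟨C, hC0, hC⟩ := hf.bound
  obtain ⟨C', hC'0, hC'⟩ := hg.bound
  refine ⟨‖B‖ * (2 * (C * C')), by positivity, fun y => ?_⟩
  have hy : 0 < 1 + ‖y‖ := by positivity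
  have e : (1 + ‖y‖) ^ (-(a + b)) = (1 + ‖y‖) ^ (-a) * (1 + ‖y‖) ^ (-b) := by
    rw [← Real.rpow_add hy]; ring_nf
  have hCy := hC y
  have hCy' := hC' y
  have h1 : ‖f y‖ * ‖g y‖ ≤ C * (1 + ‖y‖) ^ (-a) * (C' * (1 + ‖y‖) ^ (-b)) :=
    mul_le_mul hCy.1 hCy'.1 (norm_nonneg _) (by positivity)
  have h2 : ‖f y‖ * ‖fderiv ℝ g y‖ ≤ C * (1 + ‖y‖) ^ (-a) * (C' * (1 + ‖y‖) ^ (-b)) :=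
    mul_le_mul hCy.1 hCy'.2 (norm_nonneg _) (by positivity)
  have h3 : ‖fderiv ℝ f y‖ * ‖g y‖ ≤ C * (1 + ‖y‖) ^ (-a) * (C' * (1 + ‖y‖) ^ (-b)) :=
    mul_le_mul hCy.2 hCy'.1 (norm_nonneg _) (by positivity)
  have hP : 0 ≤ C * (1 + ‖y‖) ^ (-a) * (C' * (1 + ‖y‖) ^ (-b)) := by positivity
  constructor
  · calc _ ≤ ‖B‖ * ‖f y‖ * ‖g y‖ := B.le_opNorm₂ _ _
      _ = ‖B‖ * (‖f y‖ * ‖g y‖) := by ring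
      _ ≤ ‖B‖ * (2 * (C * (1 + ‖y‖) ^ (-a) * (C' * (1 + ‖y‖) ^ (-b)))) := by
          gcongr ‖B‖ * ?_; linarith
      _ = _ := by rw [e]; ring
  · have hd : HasFDerivAt (fun y => B (f y) (g y))
        (B.precompR (EuclideanSpace ℝ (Fin d)) (f y) (fderiv ℝ g y)
          + B.precompL (EuclideanSpace ℝ (Fin d)) (fderiv ℝ f y) (g y)) y :=
      B.hasFDerivAt_of_bilinear (hf.differentiable y).hasFDerivAt (hg.differentiable y).hasFDerivAt
    rw [hd.fderiv]
    calc _ ≤ ‖B‖ * ‖f y‖ * ‖fderiv ℝ g y‖ + ‖B‖ * ‖fderiv ℝ f y‖ * ‖g y‖ := by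
          refine (norm_add_le _ _).trans (add_le_add ?_ ?_)
          · refine ((B.precompR _).le_opNorm₂ _ _).trans ?_
            gcongr
            exact B.norm_precompR_le _
          · refine ((B.precompL _).le_opNorm₂ _ _).trans ?_
            gcongr
            exact B.norm_precompL_le _
      _ = ‖B‖ * (‖f y‖ * ‖fderiv ℝ g y‖ + ‖fderiv ℝ f y‖ * ‖g y‖) := by ring
      _ ≤ ‖B‖ * (2 * (C * (1 + ‖y‖) ^ (-a) * (C' * (1 + ‖y‖) ^ (-b)))) := by
          gcongr ‖B‖ * ?_; linarith
      _ = _ := by rw [e]; ring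

end C1Decay

lemma integrable_of_decay {a C : ℝ} (ha : (d : ℝ) < a) {f : EuclideanSpace ℝ (Fin d) → G}
    (hf : Continuous f) (h : ∀ y, ‖f y‖ ≤ C * (1 + ‖y‖) ^ (-a)) : Integrable f := by
  refine Integrable.mono' ((integrable_one_add_norm (E := EuclideanSpace ℝ (Fin d))
    (μ := volume) (r := a) (by simpa using ha)).const_mul C) hf.aestronglyMeasurable
    (Filter.Eventually.of_forall h)

/-- The divergence of a vector field. -/
noncomputable def divg (v : EuclideanSpace ℝ (Fin d) → EuclideanSpace ℝ (Fin d))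
    (y : EuclideanSpace ℝ (Fin d)) : ℝ :=
  ∑ i, fderiv ℝ v y (EuclideanSpace.single i 1) i

lemma integrable_mul_of_decay {a b C C' : ℝ} (hab : (d : ℝ) < a + b) (hC : 0 ≤ C)
    {f : EuclideanSpace ℝ (Fin d) → ℝ} {g : EuclideanSpace ℝ (Fin d) → G}
    (hf : Continuous f) (hg : Continuous g) (h : ∀ y, ‖f y‖ ≤ C * (1 + ‖y‖) ^ (-a))
    (h' : ∀ y, ‖g y‖ ≤ C' * (1 + ‖y‖) ^ (-b)) : Integrable fun y => f y • g y := by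
  refine integrable_of_decay (C := C * C') hab (hf.smul hg) fun y => ?_
  have hy : 0 < 1 + ‖y‖ := by positivity
  have e : (1 + ‖y‖) ^ (-(a + b)) = (1 + ‖y‖) ^ (-a) * (1 + ‖y‖) ^ (-b) := by
    rw [← Real.rpow_add hy]; ring_nf
  rw [norm_smul, e]
  calc _ ≤ (C * (1 + ‖y‖) ^ (-a)) * (C' * (1 + ‖y‖) ^ (-b)) :=
        mul_le_mul (h y) (h' y) (norm_nonneg _) (by positivity)
    _ = _ := by ring

lemma norm_apply_le_norm (v : EuclideanSpace ℝ (Fin d)) (i : Fin d) : ‖v i‖ ≤ ‖v‖ :=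
  PiLp.norm_apply_le v i

theorem integral_fderiv_apply_eq {a b : ℝ} (hab : (d : ℝ) < a + b)
    {f : EuclideanSpace ℝ (Fin d) → G} {v : EuclideanSpace ℝ (Fin d) → EuclideanSpace ℝ (Fin d)}
    (hf : C1Decay a f) (hv : C1Decay b v) :
    ∫ y, fderiv ℝ f y (v y) = - ∫ y, divg v y • f y := by
  obtain ⟨C, hC0, hC⟩ := hf.bound
  obtain ⟨C', hC'0, hC'⟩ := hv.bound
  have e1 : ∀ y, fderiv ℝ f y (v y)
      = ∑ i, (v y i) • fderiv ℝ f y (EuclideanSpace.single i 1) := fun y => by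
    conv_lhs => rw [← (EuclideanSpace.basisFun (Fin d) ℝ).sum_repr (v y)]
    simp
  have hvi : ∀ i y, fderiv ℝ (fun y => v y i) y = (EuclideanSpace.proj i).comp (fderiv ℝ v y) :=
    fun i y => ((EuclideanSpace.proj (𝕜 := ℝ) i).hasFDerivAt.comp y
      (hv.differentiable y).hasFDerivAt).fderiv
  have hcv : ∀ i, Continuous fun y => v y i := fun i =>
    (EuclideanSpace.proj (𝕜 := ℝ) i).continuous.comp hv.contDiff.continuous
  have hcdv : ∀ i, Continuous fun y => fderiv ℝ v y (EuclideanSpace.single i 1) i := fun i =>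
    (EuclideanSpace.proj (𝕜 := ℝ) i).continuous.comp
      (hv.continuous_fderiv.clm_apply continuous_const)
  have hbv : ∀ i y, ‖v y i‖ ≤ C' * (1 + ‖y‖) ^ (-b) := fun i y =>
    (norm_apply_le_norm _ i).trans (hC' y).1
  have hbdv : ∀ i y, ‖fderiv ℝ v y (EuclideanSpace.single i 1) i‖ ≤ C' * (1 + ‖y‖) ^ (-b) :=
    fun i y => (norm_apply_le_norm _ i).trans (((fderiv ℝ v y).le_opNorm _).trans
      (by simpa using (hC' y).2))
  have hi1 : ∀ i, Integrable fun y => (v y i) • fderiv ℝ f y (EuclideanSpace.single i 1) := fun i =>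
    integrable_mul_of_decay (by rwa [add_comm]) hC'0 (hcv i)
      (hf.continuous_fderiv.clm_apply continuous_const) (hbv i) (C' := C) fun y =>
      ((fderiv ℝ f y).le_opNorm _).trans (by simpa using (hC y).2)
  have hi2 : ∀ i, Integrable fun y => (fderiv ℝ v y (EuclideanSpace.single i 1) i) • f y := fun i =>
    integrable_mul_of_decay (by rwa [add_comm]) hC'0 (hcdv i) hf.contDiff.continuous
      (hbdv i) fun y => (hC y).1
  have hi3 : ∀ i, Integrable fun y => (v y i) • f y := fun i =>
    integrable_mul_of_decay (by rwa [add_comm]) hC'0 (hcv i) hf.contDiff.continuous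
      (hbv i) fun y => (hC y).1
  simp only [e1, divg, Finset.sum_smul]
  rw [integral_finsetSum _ fun i _ => hi1 i, integral_finsetSum _ fun i _ => hi2 i,
    ← Finset.sum_neg_distrib]
  refine Finset.sum_congr rfl fun i _ => ?_
  have := integral_smul_fderiv_eq_neg_fderiv_smul_of_integrable (μ := volume)
    (f := fun y => v y i) (g := f) (v := EuclideanSpace.single i 1)
    (by simp only [hvi]; exact hi2 i) (hi1 i) (hi3 i)
    (fun y _ => (EuclideanSpace.proj (𝕜 := ℝ) i).differentiableAt.comp y (hv.differentiable y))
    (fun y _ => hf.differentiable y)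
  rw [this]
  simp only [hvi]
  rfl

end Divergence

section RadialMatrix

variable {d : ℕ}

open scoped InnerProductSpace

/-- The matrix field `A(|y|²/4) I + B(|y|²/4) y ⊗ y`. -/
noncomputable def radialMat (A B : ℝ → ℝ) (y : EuclideanSpace ℝ (Fin d)) :
    EuclideanSpace ℝ (Fin d) →L[ℝ] EuclideanSpace ℝ (Fin d) :=
  A (‖y‖ ^ 2 / 4) • ContinuousLinearMap.id ℝ _ + B (‖y‖ ^ 2 / 4) • (innerSL ℝ y).smulRight y

lemma radialMat_apply (A B : ℝ → ℝ) (y v : EuclideanSpace ℝ (Fin d)) :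
    radialMat A B y v = A (‖y‖ ^ 2 / 4) • v + (B (‖y‖ ^ 2 / 4) * ⟪y, v⟫_ℝ) • y := by
  simp [radialMat, mul_smul]

lemma inner_radialMat (A B : ℝ → ℝ) (y v e : EuclideanSpace ℝ (Fin d)) :
    ⟪radialMat A B y v, e⟫_ℝ = ⟪v, radialMat A B y e⟫_ℝ := by
  simp only [radialMat_apply, inner_add_left, inner_add_right, inner_smul_left, inner_smul_right,
    RCLike.conj_to_real, real_inner_comm v y]
  ring

lemma kernelDecay_radialMat {a : ℝ} {A B : ℝ → ℝ}
    (hA : KernelDecay a fun y : EuclideanSpace ℝ (Fin d) => A (‖y‖ ^ 2 / 4))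
    (hB : KernelDecay (a + 2) fun y : EuclideanSpace ℝ (Fin d) => B (‖y‖ ^ 2 / 4)) :
    KernelDecay a (radialMat (d := d) A B) := by
  have h1 := hA.clm_comp (ContinuousLinearMap.toSpanSingleton ℝ
    (ContinuousLinearMap.id ℝ (EuclideanSpace ℝ (Fin d))))
  have h2 := ((KernelDecay.linear (innerSL ℝ (E := EuclideanSpace ℝ (Fin d)))).bilin
    (ContinuousLinearMap.smulRightL ℝ (EuclideanSpace ℝ (Fin d)) (EuclideanSpace ℝ (Fin d)))
    (KernelDecay.linear (ContinuousLinearMap.id ℝ (EuclideanSpace ℝ (Fin d)))))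
  have h3 := (hB.bilin (ContinuousLinearMap.lsmul ℝ ℝ) h2).mono (show a ≤ _ by linarith)
  convert! h1.add h3 using 2 with y

lemma fderiv_radialMat_apply {A B : ℝ → ℝ} {A' B' : ℝ} {y : EuclideanSpace ℝ (Fin d)}
    (hA : HasDerivAt A (-A') (‖y‖ ^ 2 / 4)) (hB : HasDerivAt B (-B') (‖y‖ ^ 2 / 4))
    (v w : EuclideanSpace ℝ (Fin d)) :
    fderiv ℝ (fun y => radialMat A B y v) y w
      = (-(1 / 2) * A' * ⟪y, w⟫_ℝ) • v + (-(1 / 2) * B' * ⟪y, w⟫_ℝ * ⟪y, v⟫_ℝ) • y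
        + B (‖y‖ ^ 2 / 4) • (⟪w, v⟫_ℝ • y + ⟪y, v⟫_ℝ • w) := by
  have h1 := (hasFDerivAt_comp_norm_sq_div_four hA).smul_const v
  have h2 : HasFDerivAt (fun y : EuclideanSpace ℝ (Fin d) => ⟪y, v⟫_ℝ) (innerSL ℝ v) y := by
    have := (innerSL ℝ v).hasFDerivAt (x := y)
    refine this.congr_of_eventuallyEq (Filter.Eventually.of_forall fun x => ?_)
    simp [real_inner_comm]
  have h3 := ((hasFDerivAt_comp_norm_sq_div_four hB).mul h2).smul (hasFDerivAt_id y)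
  have h4 : (fun y => radialMat A B y v) = fun y => A (‖y‖ ^ 2 / 4) • v
      + (B (‖y‖ ^ 2 / 4) * ⟪y, v⟫_ℝ) • y := funext fun y => radialMat_apply A B y v
  have h5 : HasFDerivAt (fun y => A (‖y‖ ^ 2 / 4) • v + (B (‖y‖ ^ 2 / 4) * ⟪y, v⟫_ℝ) • y) _ y :=
    h1.fun_add h3
  rw [h4, h5.fderiv]
  simp [real_inner_comm v w]
  module

lemma inner_eq_sum (x y : EuclideanSpace ℝ (Fin d)) : ⟪x, y⟫_ℝ = ∑ i, x i * y i := by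
  simp [PiLp.inner_apply, mul_comm]

lemma divg_radialMat {A B : ℝ → ℝ} {A' B' : ℝ} {y : EuclideanSpace ℝ (Fin d)}
    (hA : HasDerivAt A (-A') (‖y‖ ^ 2 / 4)) (hB : HasDerivAt B (-B') (‖y‖ ^ 2 / 4))
    (v : EuclideanSpace ℝ (Fin d)) :
    divg (fun y => radialMat A B y v) y
      = (-(1 / 2) * A' - 2 * B' * (‖y‖ ^ 2 / 4) + (d + 1) * B (‖y‖ ^ 2 / 4)) * ⟪y, v⟫_ℝ := by
  simp only [divg, fderiv_radialMat_apply hA hB v]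
  have e1 : ∀ (x : EuclideanSpace ℝ (Fin d)) (i : Fin d),
      ⟪x, EuclideanSpace.single i (1 : ℝ)⟫_ℝ = x i := fun x i => by
    simp [EuclideanSpace.inner_single_right]
  have e2 : ∀ (x : EuclideanSpace ℝ (Fin d)) (i : Fin d),
      ⟪EuclideanSpace.single i (1 : ℝ), x⟫_ℝ = x i := fun x i => by
    simp [EuclideanSpace.inner_single_left]
  have e3 : ‖y‖ ^ 2 = ∑ i, y i * y i := by rw [← real_inner_self_eq_norm_sq, inner_eq_sum]
  simp only [e1, e2, PiLp.add_apply, PiLp.smul_apply, smul_eq_mul, PiLp.single_apply,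
    if_true]
  rw [show ∀ a b c : ℝ, (a - b + c) * ⟪y, v⟫_ℝ = a * ⟪y, v⟫_ℝ - b * ⟪y, v⟫_ℝ + c * ⟪y, v⟫_ℝ
    from fun a b c => by ring]
  have s1 : ∑ i, -(1 / 2) * A' * y i * v i = -(1 / 2) * A' * ⟪y, v⟫_ℝ := by
    rw [inner_eq_sum, Finset.mul_sum]
    exact Finset.sum_congr rfl fun i _ => by ring
  have s2 : ∑ i, -(1 / 2) * B' * y i * ⟪y, v⟫_ℝ * y i = -(2 * B' * (‖y‖ ^ 2 / 4) * ⟪y, v⟫_ℝ) := by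
    rw [e3, show ∀ S : ℝ, -(2 * B' * (S / 4) * ⟪y, v⟫_ℝ) = (-(1 / 2) * B' * ⟪y, v⟫_ℝ) * S from
      fun S => by ring, Finset.mul_sum]
    exact Finset.sum_congr rfl fun i _ => by ring
  have s3 : ∑ i : Fin d, B (‖y‖ ^ 2 / 4) * (v i * y i + ⟪y, v⟫_ℝ * 1)
      = (d + 1) * B (‖y‖ ^ 2 / 4) * ⟪y, v⟫_ℝ := by
    rw [← Finset.mul_sum, Finset.sum_add_distrib, Finset.sum_const, Finset.card_univ,
      Fintype.card_fin, show ∑ i, v i * y i = ⟪y, v⟫_ℝ by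
        rw [inner_eq_sum]; exact Finset.sum_congr rfl fun i _ => by ring]
    simp
    ring
  rw [Finset.sum_add_distrib, Finset.sum_add_distrib, s1, s2, s3]
  ring

/-- Truncated Leray projection of the Gaussian (up to a factor). -/
noncomputable def testMat (d : ℕ) (ε : ℝ) :
    EuclideanSpace ℝ (Fin d) → EuclideanSpace ℝ (Fin d) →L[ℝ] EuclideanSpace ℝ (Fin d) :=
  radialMat (fun z => Real.exp (-z) - 1 / 2 * expMoment ε (d / 2 - 1) z)
    (fun z => 1 / 4 * expMoment ε (d / 2) z)

/-- The gradient part of `testMat` is the derivative of this field. -/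
noncomputable def potentialField (d : ℕ) (ε : ℝ) (y : EuclideanSpace ℝ (Fin d)) :
    EuclideanSpace ℝ (Fin d) :=
  (-(1 / 2) * expMoment ε (d / 2 - 1) (‖y‖ ^ 2 / 4)) • y

lemma half_sub_one_nonneg (hd : 2 ≤ d) : (0 : ℝ) ≤ d / 2 - 1 := by
  have : (2 : ℝ) ≤ d := by exact_mod_cast hd
  linarith

lemma hasDerivAt_testMat_fst (hd : 2 ≤ d) {ε : ℝ} (hε : 0 ≤ ε) (hε1 : ε ≤ 1) (z : ℝ) :
    HasDerivAt (fun z => Real.exp (-z) - 1 / 2 * expMoment ε (d / 2 - 1) z)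
      (-(Real.exp (-z) - 1 / 2 * expMoment ε (d / 2) z)) z := by
  have h1 := hasDerivAt_expMoment hε hε1 (half_sub_one_nonneg hd) z
  rw [sub_add_cancel] at h1
  have h2 : HasDerivAt (fun z : ℝ => Real.exp (-z)) (-Real.exp (-z)) z := by
    simpa using (hasDerivAt_id' z).fun_neg.exp
  exact (h2.fun_sub (h1.const_mul (1 / 2))).congr_deriv (by ring)

lemma hasDerivAt_testMat_snd {ε : ℝ} (hε : 0 ≤ ε) (hε1 : ε ≤ 1) (z : ℝ) :
    HasDerivAt (fun z => 1 / 4 * expMoment ε (d / 2) z)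
      (-(1 / 4 * expMoment ε (d / 2 + 1) z)) z :=
  ((hasDerivAt_expMoment hε hε1 (by positivity) z).const_mul (1 / 4)).congr_deriv (by ring)

lemma kernelDecay_const_mul {a : ℝ} {f : EuclideanSpace ℝ (Fin d) → ℝ} (c : ℝ)
    (h : KernelDecay a f) : KernelDecay a fun y => c * f y :=
  h.clm_comp (c • ContinuousLinearMap.id ℝ ℝ)

lemma kernelDecay_testMat_zero (hd : 2 ≤ d) : KernelDecay (d : ℝ) (testMat d 0) := by
  refine kernelDecay_radialMat ?_ ?_
  · have h1 := kernelDecay_gaussian (E := EuclideanSpace ℝ (Fin d)) (p := d / 2) (by positivity)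
    have h2 := kernelDecay_expMoment_zero (E := EuclideanSpace ℝ (Fin d)) (half_sub_one_nonneg hd)
    rw [sub_add_cancel] at h2
    rw [mul_div_cancel₀ _ two_ne_zero] at h1 h2
    simpa [sub_eq_add_neg] using h1.add (kernelDecay_const_mul (-(1 / 2)) h2)
  · have h2 := kernelDecay_expMoment_zero (E := EuclideanSpace ℝ (Fin d)) (q := d / 2) (by positivity)
    rw [mul_add, mul_div_cancel₀ _ two_ne_zero, mul_one] at h2
    exact kernelDecay_const_mul _ h2

lemma kernelDecay_testMat (hd : 2 ≤ d) {ε : ℝ} (hε : 0 < ε) (hε1 : ε ≤ 1) {p : ℝ} (hp : 0 ≤ p) :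
    KernelDecay (2 * p) (testMat d ε) := by
  refine kernelDecay_radialMat ?_ ?_
  · have h1 := kernelDecay_gaussian (E := EuclideanSpace ℝ (Fin d)) hp
    have h2 := kernelDecay_expMoment (E := EuclideanSpace ℝ (Fin d)) hε hε1
      (half_sub_one_nonneg hd) hp
    simpa [sub_eq_add_neg] using h1.add (kernelDecay_const_mul (-(1 / 2)) h2)
  · have h2 := kernelDecay_expMoment (E := EuclideanSpace ℝ (Fin d)) hε hε1 (q := d / 2)
      (by positivity) (p := p + 1) (by positivity)
    rw [mul_add, mul_one] at h2
    exact kernelDecay_const_mul _ h2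

lemma kernelDecay_potentialField (hd : 2 ≤ d) {ε : ℝ} (hε : 0 < ε) (hε1 : ε ≤ 1) {p : ℝ}
    (hp : 0 ≤ p) : KernelDecay (2 * p) (potentialField d ε) := by
  have h2 := kernelDecay_expMoment (E := EuclideanSpace ℝ (Fin d)) hε hε1
      (half_sub_one_nonneg hd) (p := p + 1) (by positivity)
  exact ((kernelDecay_const_mul (-(1 / 2)) h2).bilin (ContinuousLinearMap.lsmul ℝ ℝ)
    (KernelDecay.linear (ContinuousLinearMap.id ℝ _))).mono (by linarith)

lemma fderiv_potentialField (hd : 2 ≤ d) {ε : ℝ} (hε : 0 ≤ ε) (hε1 : ε ≤ 1)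
    (y v : EuclideanSpace ℝ (Fin d)) :
    fderiv ℝ (potentialField d ε) y v = testMat d ε y v - Real.exp (-(‖y‖ ^ 2 / 4)) • v := by
  have h1 := hasDerivAt_expMoment hε hε1 (half_sub_one_nonneg hd) (‖y‖ ^ 2 / 4)
  rw [sub_add_cancel] at h1
  have h2 := ((hasFDerivAt_comp_norm_sq_div_four h1).const_mul (-(1 / 2))).smul (hasFDerivAt_id y)
  have h3 : HasFDerivAt (potentialField d ε) _ y := h2
  rw [h3.fderiv, testMat, radialMat_apply]
  simp
  module

lemma divg_testMat (hd : 2 ≤ d) {ε : ℝ} (hε : 0 ≤ ε) (hε1 : ε ≤ 1)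
    (y v : EuclideanSpace ℝ (Fin d)) :
    divg (fun y => testMat d ε y v) y
      = -(1 / 2) * (ε ^ ((d : ℝ) / 2 + 1) * Real.exp (-(ε * (‖y‖ ^ 2 / 4)))) * ⟪y, v⟫_ℝ := by
  rw [testMat, divg_radialMat (hasDerivAt_testMat_fst hd hε hε1 _) (hasDerivAt_testMat_snd hε hε1 _)]
  have := mul_expMoment_add_one (ε := ε) (q := (d : ℝ) / 2) (by positivity) (‖y‖ ^ 2 / 4)
  congr 1
  linear_combination -(1 / 2) * this

end RadialMatrix

section StaticIdentity

variable {d : ℕ}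

open scoped InnerProductSpace

lemma integrable_clm_apply_of_decay {G H : Type} [NormedAddCommGroup G] [NormedSpace ℝ G]
    [NormedAddCommGroup H] [NormedSpace ℝ H] {a C C' : ℝ} (ha : (d : ℝ) < a)
    {A : EuclideanSpace ℝ (Fin d) → G →L[ℝ] H} {g : EuclideanSpace ℝ (Fin d) → G}
    (hA : Continuous A) (hg : Continuous g) (h : ∀ y, ‖A y‖ ≤ C * (1 + ‖y‖) ^ (-a))
    (h' : ∀ y, ‖g y‖ ≤ C') : Integrable fun y => A y (g y) := by
  refine integrable_of_decay (C := C * C') ha (hA.clm_apply hg) fun y => ?_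
  calc _ ≤ ‖A y‖ * ‖g y‖ := (A y).le_opNorm _
    _ ≤ (C * (1 + ‖y‖) ^ (-a)) * C' :=
        mul_le_mul (h y) (h' y) (norm_nonneg _) ((norm_nonneg _).trans (h y))
    _ = _ := by ring

lemma C1Decay.exists_bound {G : Type} [NormedAddCommGroup G] [NormedSpace ℝ G]
    {f : EuclideanSpace ℝ (Fin d) → G} (h : C1Decay 0 f) :
    ∃ C : ℝ, 0 ≤ C ∧ ∀ y, ‖f y‖ ≤ C ∧ ‖fderiv ℝ f y‖ ≤ C := by
  simpa using h.bound

lemma kernelDecay_testMat_add_one (hd : 2 ≤ d) {ε : ℝ} (hε : 0 < ε) (hε1 : ε ≤ 1) :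
    KernelDecay ((d : ℝ) + 1) (testMat d ε) := by
  have := kernelDecay_testMat hd hε hε1 (p := (d + 1) / 2) (by positivity)
  rwa [mul_div_cancel₀ _ two_ne_zero] at this

lemma integral_testMat_eq (hd : 2 ≤ d) {ε : ℝ} (hε : 0 < ε) (hε1 : ε ≤ 1)
    {b : EuclideanSpace ℝ (Fin d) → EuclideanSpace ℝ (Fin d)} (hb : C1Decay 0 b)
    (hdb : ∀ y, divg b y = 0) :
    ∫ y, testMat d ε y (b y) = ∫ y, Real.exp (-(‖y‖ ^ 2 / 4)) • b y := by
  have hθ := (kernelDecay_potentialField hd hε hε1 (p := (d + 1) / 2) (by positivity)).c1Decay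
  rw [mul_div_cancel₀ _ two_ne_zero] at hθ
  have h := integral_fderiv_apply_eq (by linarith) hθ hb
  obtain ⟨C, hC0, hC⟩ := hb.exists_bound
  obtain ⟨K, hK0, hK⟩ := (kernelDecay_testMat_add_one hd hε hε1).bound
  have hg := (kernelDecay_gaussian (E := EuclideanSpace ℝ (Fin d)) (p := (d + 1) / 2)
    (by positivity))
  rw [mul_div_cancel₀ _ two_ne_zero] at hg
  obtain ⟨K', hK'0, hK'⟩ := hg.bound
  simp only [hdb, zero_smul, integral_zero, neg_zero, fderiv_potentialField hd hε.le hε1] at h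
  rw [integral_sub] at h
  · exact sub_eq_zero.1 h
  · exact integrable_clm_apply_of_decay (by linarith)
      (kernelDecay_testMat_add_one hd hε hε1).1.continuous hb.contDiff.continuous hK
      fun y => (hC y).1
  · exact integrable_mul_of_decay (a := d + 1) (b := 0) (by linarith) hK'0 hg.1.continuous
      hb.contDiff.continuous hK' (C' := C) (by simpa using fun y => (hC y).1)

lemma integral_fderiv_testMat_eq (hd : 2 ≤ d) {ε : ℝ} (hε : 0 < ε) (hε1 : ε ≤ 1)
    {w : EuclideanSpace ℝ (Fin d) → EuclideanSpace ℝ (Fin d)} (hw : C1Decay 0 w)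
    (hdw : ∀ y, divg w y = 0) :
    ∫ y, testMat d ε y (fderiv ℝ w y (w y)) = -∫ y, fderiv ℝ (testMat d ε) y (w y) (w y) := by
  have hK := kernelDecay_testMat_add_one hd hε hε1
  have hf := hK.c1Decay.bilin (ContinuousLinearMap.id ℝ
    (EuclideanSpace ℝ (Fin d) →L[ℝ] EuclideanSpace ℝ (Fin d))) hw
  rw [add_zero] at hf
  have h := integral_fderiv_apply_eq (by linarith) hf hw
  have e : ∀ y, fderiv ℝ (fun y => ContinuousLinearMap.id ℝ
      (EuclideanSpace ℝ (Fin d) →L[ℝ] EuclideanSpace ℝ (Fin d)) (testMat d ε y) (w y)) y (w y)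
      = testMat d ε y (fderiv ℝ w y (w y)) + fderiv ℝ (testMat d ε) y (w y) (w y) := fun y => by
    have := (hK.differentiable y).hasFDerivAt.clm_apply (hw.differentiable y).hasFDerivAt
    simp only [ContinuousLinearMap.id_apply]
    rw [this.fderiv]
    simp
  obtain ⟨C, hC0, hC⟩ := hw.exists_bound
  obtain ⟨K, hK0, hKb⟩ := hK.bound
  obtain ⟨K', hK'0, hK'⟩ := hK.fderiv.bound
  simp only [e, hdw, zero_smul, integral_zero, neg_zero] at h
  rw [integral_add] at h
  · exact eq_neg_of_add_eq_zero_left h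
  · refine integrable_clm_apply_of_decay (C' := C * C) (by linarith) hK.1.continuous
      (hw.continuous_fderiv.clm_apply hw.contDiff.continuous) hKb fun y => ?_
    exact ((fderiv ℝ w y).le_opNorm _).trans (mul_le_mul (hC y).2 (hC y).1 (norm_nonneg _) hC0)
  · refine integrable_of_decay (a := d + 1 + 1) (C := K' * C * C) (by linarith)
      ((hK.fderiv.1.continuous.clm_apply hw.contDiff.continuous).clm_apply
      hw.contDiff.continuous) fun y => ?_
    refine (ContinuousLinearMap.le_opNorm₂ _ _ _).trans ?_
    calc _ ≤ (K' * (1 + ‖y‖) ^ (-((d : ℝ) + 1 + 1))) * C * C := by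
          gcongr
          exacts [hK' y, (hC y).1, (hC y).1]
      _ = _ := by ring

lemma integral_gaussian_inner_eq (hd : 2 ≤ d) {ε : ℝ} (hε : 0 < ε) (hε1 : ε ≤ 1)
    {w b : EuclideanSpace ℝ (Fin d) → EuclideanSpace ℝ (Fin d)}
    {P : EuclideanSpace ℝ (Fin d) → ℝ} (hw : C1Decay 0 w) (hb : C1Decay 0 b) (hP : C1Decay 0 P)
    (hdw : ∀ y, divg w y = 0) (hdb : ∀ y, divg b y = 0)
    (h : ∀ y e, ⟪b y, e⟫_ℝ = -⟪fderiv ℝ w y (w y), e⟫_ℝ - fderiv ℝ P y e)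
    (e : EuclideanSpace ℝ (Fin d)) :
    ⟪∫ y, Real.exp (-(‖y‖ ^ 2 / 4)) • b y, e⟫_ℝ
      = ∫ y, (⟪fderiv ℝ (testMat d ε) y (w y) (w y), e⟫_ℝ
        - 1 / 2 * (ε ^ ((d : ℝ) / 2 + 1) * Real.exp (-(ε * (‖y‖ ^ 2 / 4)))) * ⟪y, e⟫_ℝ * P y) := by
  have hK := kernelDecay_testMat_add_one hd hε hε1
  obtain ⟨C, hC0, hC⟩ := hw.exists_bound
  obtain ⟨C₁, hC₁0, hC₁⟩ := hb.exists_bound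
  obtain ⟨C₂, hC₂0, hC₂⟩ := hP.exists_bound
  obtain ⟨K, hK0, hKb⟩ := hK.bound
  obtain ⟨K', hK'0, hK'⟩ := hK.fderiv.bound
  have hv : C1Decay ((d : ℝ) + 1) fun y => testMat d ε y e :=
    (hK.clm_comp ((ContinuousLinearMap.apply ℝ (EuclideanSpace ℝ (Fin d))) e)).c1Decay
  have h3 := integral_fderiv_apply_eq (by linarith) hP hv
  simp only [divg_testMat hd hε.le hε1] at h3
  have i1 : Integrable fun y => testMat d ε y (b y) :=
    integrable_clm_apply_of_decay (by linarith) hK.1.continuous hb.contDiff.continuous hKb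
      fun y => (hC₁ y).1
  have i2 : Integrable fun y => testMat d ε y (fderiv ℝ w y (w y)) := by
    refine integrable_clm_apply_of_decay (C' := C * C) (by linarith) hK.1.continuous
      (hw.continuous_fderiv.clm_apply hw.contDiff.continuous) hKb fun y => ?_
    exact ((fderiv ℝ w y).le_opNorm _).trans (mul_le_mul (hC y).2 (hC y).1 (norm_nonneg _) hC0)
  have i3 : Integrable fun y => fderiv ℝ P y (testMat d ε y e) := by
    refine integrable_of_decay (a := d + 1) (C := C₂ * (K * ‖e‖)) (by linarith)
      (hP.continuous_fderiv.clm_apply hv.contDiff.continuous) fun y => ?_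
    refine ((fderiv ℝ P y).le_opNorm _).trans ?_
    calc _ ≤ C₂ * ((K * (1 + ‖y‖) ^ (-((d : ℝ) + 1))) * ‖e‖) := by
          gcongr
          · exact (hC₂ y).2
          · exact ((testMat d ε y).le_opNorm _).trans (by gcongr; exact hKb y)
      _ = _ := by ring
  have i4 : Integrable fun y => fderiv ℝ (testMat d ε) y (w y) (w y) := by
    refine integrable_of_decay (a := d + 1 + 1) (C := K' * C * C) (by linarith)
      ((hK.fderiv.1.continuous.clm_apply hw.contDiff.continuous).clm_apply
      hw.contDiff.continuous) fun y => ?_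
    refine (ContinuousLinearMap.le_opNorm₂ _ _ _).trans ?_
    calc _ ≤ (K' * (1 + ‖y‖) ^ (-((d : ℝ) + 1 + 1))) * C * C := by
          gcongr
          exacts [hK' y, (hC y).1, (hC y).1]
      _ = _ := by ring
  have i5 : Integrable fun y => (1 / 2 * (ε ^ ((d : ℝ) / 2 + 1) *
      Real.exp (-(ε * (‖y‖ ^ 2 / 4)))) * ⟪y, e⟫_ℝ * P y) := by
    have hdv : ∀ y, ‖divg (fun y => testMat d ε y e) y‖ ≤ (∑ _i : Fin d, hv.bound.choose) *
        (1 + ‖y‖) ^ (-((d : ℝ) + 1)) := fun y => by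
      rw [divg, Finset.sum_mul]
      refine (norm_sum_le _ _).trans (Finset.sum_le_sum fun i _ => ?_)
      refine (norm_apply_le_norm _ i).trans ((ContinuousLinearMap.le_opNorm _ _).trans ?_)
      simpa using (hv.bound.choose_spec.2 y).2
    simp only [divg_testMat hd hε.le hε1] at hdv
    refine integrable_of_decay (a := d + 1) (C := (∑ _i : Fin d, hv.bound.choose) * C₂)
      (by linarith) (by have := hP.contDiff.continuous; fun_prop) fun y => ?_
    have := hdv y
    rw [norm_mul]
    calc _ = ‖-(1 / 2) * (ε ^ ((d : ℝ) / 2 + 1) * Real.exp (-(ε * (‖y‖ ^ 2 / 4)))) * ⟪y, e⟫_ℝ‖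
          * ‖P y‖ := by
            congr 1
            rw [← norm_neg]; congr 1; ring
      _ ≤ ((∑ _i : Fin d, hv.bound.choose) * (1 + ‖y‖) ^ (-((d : ℝ) + 1))) * C₂ :=
          mul_le_mul this (hC₂ y).1 (norm_nonneg _) ((norm_nonneg _).trans this)
      _ = _ := by ring
  have e1 : ⟪∫ y, testMat d ε y (b y), e⟫_ℝ = ∫ y, ⟪testMat d ε y (b y), e⟫_ℝ := by
    rw [real_inner_comm, ← integral_inner i1]
    simp only [real_inner_comm]
  have e2 : ∀ y, ⟪testMat d ε y (b y), e⟫_ℝ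
      = -⟪testMat d ε y (fderiv ℝ w y (w y)), e⟫_ℝ - fderiv ℝ P y (testMat d ε y e) := fun y => by
    rw [testMat, inner_radialMat, h, ← inner_radialMat]
  have i2' : Integrable fun y => ⟪testMat d ε y (fderiv ℝ w y (w y)), e⟫_ℝ := i2.inner_const e
  have i4' : Integrable fun y => ⟪fderiv ℝ (testMat d ε) y (w y) (w y), e⟫_ℝ := i4.inner_const e
  have e3 : ∫ y, ⟪testMat d ε y (fderiv ℝ w y (w y)), e⟫_ℝ
      = -∫ y, ⟪fderiv ℝ (testMat d ε) y (w y) (w y), e⟫_ℝ := by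
    have := congrArg (fun v => ⟪e, v⟫_ℝ) (integral_fderiv_testMat_eq hd hε hε1 hw hdw)
    simp only [inner_neg_right] at this
    rw [← integral_inner i2, ← integral_inner i4] at this
    simpa only [real_inner_comm] using this
  rw [← integral_testMat_eq hd hε hε1 hb hdb, e1]
  simp only [e2]
  rw [integral_sub i2'.fun_neg i3, integral_neg, e3, h3, neg_neg, sub_neg_eq_add,
    integral_sub i4' i5, sub_eq_add_neg, ← integral_neg]
  congr 2
  ext y
  simp only [smul_eq_mul]
  ring

end StaticIdentity

section StaticLimit

variable {d : ℕ}

open scoped InnerProductSpace Topology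

lemma fderiv_testMat_apply (hd : 2 ≤ d) {ε : ℝ} (hε : 0 ≤ ε) (hε1 : ε ≤ 1)
    (hK : Differentiable ℝ (testMat d ε)) (y v w : EuclideanSpace ℝ (Fin d)) :
    fderiv ℝ (testMat d ε) y w v
      = (-(1 / 2) * (Real.exp (-(‖y‖ ^ 2 / 4)) - 1 / 2 * expMoment ε (d / 2) (‖y‖ ^ 2 / 4))
          * ⟪y, w⟫_ℝ) • v
        + (-(1 / 2) * (1 / 4 * expMoment ε (d / 2 + 1) (‖y‖ ^ 2 / 4)) * ⟪y, w⟫_ℝ * ⟪y, v⟫_ℝ) • y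
        + (1 / 4 * expMoment ε (d / 2) (‖y‖ ^ 2 / 4)) • (⟪w, v⟫_ℝ • y + ⟪y, v⟫_ℝ • w) := by
  rw [← fderiv_radialMat_apply (hasDerivAt_testMat_fst hd hε hε1 _)
    (hasDerivAt_testMat_snd hε hε1 _)]
  have : HasFDerivAt (fun y => testMat d ε y v) _ y :=
    (hK y).hasFDerivAt.clm_apply (hasFDerivAt_const v y)
  change _ = fderiv ℝ (fun y => testMat d ε y v) y w
  rw [this.fderiv]
  simp

lemma tendsto_expMoment {q : ℝ} (hq : 0 ≤ q) (z : ℝ) :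
    Filter.Tendsto (fun ε => expMoment ε q z) (𝓝[>] 0) (𝓝 (expMoment 0 q z)) := by
  have hc := continuous_rpow_mul_exp hq z
  have h1 : Continuous fun ε : ℝ => ∫ s in (1 : ℝ)..ε, s ^ q * Real.exp (-(s * z)) :=
    intervalIntegral.continuous_primitive (fun a b => hc.intervalIntegrable a b) 1
  have h2 : Continuous fun ε : ℝ => expMoment ε q z := by
    simp only [expMoment]
    simp_rw [fun ε => intervalIntegral.integral_symm (μ := volume)
      (f := fun s : ℝ => s ^ q * Real.exp (-(s * z))) 1 ε]
    exact h1.neg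
  exact (h2.tendsto 0).mono_left nhdsWithin_le_nhds

lemma exists_fderiv_testMat_le (hd : 2 ≤ d) : ∃ C : ℝ, 0 ≤ C ∧ ∀ ε : ℝ, 0 < ε → ε ≤ 1 →
    ∀ y w : EuclideanSpace ℝ (Fin d),
    ‖fderiv ℝ (testMat d ε) y w w‖ ≤ C * (1 + ‖y‖) ^ (-((d : ℝ) + 1)) * ‖w‖ ^ 2 := by
  have g0 := kernelDecay_gaussian (E := EuclideanSpace ℝ (Fin d)) (p := d / 2 + 1) (by positivity)
  have g1 := kernelDecay_expMoment_zero (E := EuclideanSpace ℝ (Fin d)) (q := d / 2)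
    (by positivity)
  have g2 := kernelDecay_expMoment_zero (E := EuclideanSpace ℝ (Fin d)) (q := d / 2 + 1)
    (by positivity)
  obtain ⟨C₀, hC₀0, hC₀⟩ := g0.bound
  obtain ⟨C₁, hC₁0, hC₁⟩ := g1.bound
  obtain ⟨C₂, hC₂0, hC₂⟩ := g2.bound
  refine ⟨C₀ + C₁ + C₂, by positivity, fun ε hε hε1 y w => ?_⟩
  rw [fderiv_testMat_apply hd hε.le hε1 (kernelDecay_testMat_add_one hd hε hε1).differentiable]
  set r : ℝ := 1 + ‖y‖ with hr
  have hr0 : 0 < r := by positivity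
  have hyr : ‖y‖ ≤ r := by linarith
  have e1 : r ^ (-(2 * ((d : ℝ) / 2 + 1))) * r = r ^ (-((d : ℝ) + 1)) := by
    rw [← Real.rpow_add_one hr0.ne']; ring_nf
  have e2 : r ^ (-(2 * ((d : ℝ) / 2 + 1 + 1))) * r ^ 3 = r ^ (-((d : ℝ) + 1)) := by
    rw [← Real.rpow_natCast, ← Real.rpow_add hr0]; push_cast; ring_nf
  have b0 := hC₀ y
  have b1 := hC₁ y
  have b2 := hC₂ y
  simp only [Real.norm_eq_abs, Real.abs_exp] at b0
  rw [Real.norm_of_nonneg (expMoment_nonneg le_rfl zero_le_one)] at b1 b2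
  set z := ‖y‖ ^ 2 / 4 with hz
  have m1 : expMoment ε (d / 2) z ≤ C₁ * r ^ (-(2 * ((d : ℝ) / 2 + 1))) :=
    (expMoment_le_zero hε.le (by positivity)).trans b1
  have m2 : expMoment ε (d / 2 + 1) z ≤ C₂ * r ^ (-(2 * ((d : ℝ) / 2 + 1 + 1))) :=
    (expMoment_le_zero hε.le (by positivity)).trans b2
  have n1 := expMoment_nonneg (q := d / 2) (z := z) hε.le hε1
  have n2 := expMoment_nonneg (q := d / 2 + 1) (z := z) hε.le hε1
  have i1 : |⟪y, w⟫_ℝ| ≤ r * ‖w‖ := (abs_real_inner_le_norm y w).trans (by gcongr)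
  have i2 : |⟪w, w⟫_ℝ| ≤ ‖w‖ * ‖w‖ := abs_real_inner_le_norm w w
  set g := Real.exp (-z)
  have hg : 0 ≤ g := (Real.exp_pos _).le
  set a := expMoment ε (d / 2) z
  set b := expMoment ε (d / 2 + 1) z
  have habs : |g - 1 / 2 * a| ≤ g + 1 / 2 * a := by
    rw [abs_le]; constructor <;> nlinarith
  calc _ ≤ ‖(-(1 / 2) * (g - 1 / 2 * a) * ⟪y, w⟫_ℝ) • w‖
        + ‖(-(1 / 2) * (1 / 4 * b) * ⟪y, w⟫_ℝ * ⟪y, w⟫_ℝ) • y‖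
        + ‖(1 / 4 * a) • (⟪w, w⟫_ℝ • y + ⟪y, w⟫_ℝ • w)‖ := norm_add₃_le
    _ ≤ (1 / 2 * (g + 1 / 2 * a) * (r * ‖w‖)) * ‖w‖
        + (1 / 2 * (1 / 4 * b) * (r * ‖w‖) * (r * ‖w‖)) * r
        + (1 / 4 * a) * (‖w‖ * ‖w‖ * r + r * ‖w‖ * ‖w‖) := by
        gcongr
        · rw [norm_smul, norm_mul, norm_mul, norm_neg, Real.norm_eq_abs, Real.norm_eq_abs,
            Real.norm_eq_abs, abs_of_pos (by norm_num : (0 : ℝ) < 1 / 2)]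
          gcongr
        · rw [norm_smul, norm_mul, norm_mul, norm_mul, norm_neg, Real.norm_eq_abs,
            Real.norm_eq_abs, Real.norm_eq_abs, abs_of_pos (by norm_num : (0 : ℝ) < 1 / 2),
            abs_of_nonneg (by positivity : 0 ≤ 1 / 4 * b)]
          gcongr
        · rw [norm_smul, Real.norm_of_nonneg (by positivity : 0 ≤ 1 / 4 * a)]
          gcongr
          refine (norm_add_le _ _).trans ?_
          rw [norm_smul, norm_smul, Real.norm_eq_abs, Real.norm_eq_abs]
          gcongr
    _ = (1 / 2 * g + 3 / 4 * a) * r * ‖w‖ ^ 2 + 1 / 8 * b * r ^ 3 * ‖w‖ ^ 2 := by ring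
    _ ≤ (C₀ * r ^ (-(2 * ((d : ℝ) / 2 + 1))) + C₁ * r ^ (-(2 * ((d : ℝ) / 2 + 1)))) * r * ‖w‖ ^ 2
        + C₂ * r ^ (-(2 * ((d : ℝ) / 2 + 1 + 1))) * r ^ 3 * ‖w‖ ^ 2 := by
        have k1 : 1 / 2 * g + 3 / 4 * a ≤ C₀ * r ^ (-(2 * ((d : ℝ) / 2 + 1)))
            + C₁ * r ^ (-(2 * ((d : ℝ) / 2 + 1))) := by linarith
        have k2 : 1 / 8 * b ≤ C₂ * r ^ (-(2 * ((d : ℝ) / 2 + 1 + 1))) := by linarith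
        gcongr
    _ = _ := by
        rw [show ∀ x : ℝ, (C₀ * x + C₁ * x) * r = (C₀ + C₁) * (x * r) by intro x; ring, e1,
          mul_assoc C₂, e2]
        ring

lemma tendsto_fderiv_testMat (hd : 2 ≤ d) (y w : EuclideanSpace ℝ (Fin d)) :
    Filter.Tendsto (fun ε => fderiv ℝ (testMat d ε) y w w) (𝓝[>] 0)
      (𝓝 (fderiv ℝ (testMat d 0) y w w)) := by
  rw [fderiv_testMat_apply hd le_rfl zero_le_one (kernelDecay_testMat_zero hd).differentiable]
  have h1 := tendsto_expMoment (q := d / 2) (by positivity) (‖y‖ ^ 2 / 4)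
  have h2 := tendsto_expMoment (q := d / 2 + 1) (by positivity) (‖y‖ ^ 2 / 4)
  have key := ((((tendsto_const_nhds (x := Real.exp (-(‖y‖ ^ 2 / 4)))).sub
    (h1.const_mul (1 / 2))).const_mul (-(1 / 2))).mul_const ⟪y, w⟫_ℝ).smul_const w |>.add
    (((((h2.const_mul (1 / 4)).const_mul (-(1 / 2))).mul_const ⟪y, w⟫_ℝ).mul_const
      ⟪y, w⟫_ℝ).smul_const y) |>.add
    ((h1.const_mul (1 / 4)).smul_const (⟪w, w⟫_ℝ • y + ⟪y, w⟫_ℝ • w))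
  refine key.congr' ?_
  filter_upwards [Ioc_mem_nhdsGT (zero_lt_one' ℝ)] with ε hε
  rw [fderiv_testMat_apply hd hε.1.le hε.2
    (kernelDecay_testMat_add_one hd hε.1 hε.2).differentiable]

lemma exists_error_le (hd : 2 ≤ d) : ∃ C : ℝ, 0 ≤ C ∧ ∀ ε : ℝ, 0 < ε → ε ≤ 1 →
    ∀ y : EuclideanSpace ℝ (Fin d),
    ε ^ ((d : ℝ) / 2 + 1) * Real.exp (-(ε * (‖y‖ ^ 2 / 4))) * ‖y‖
      ≤ C * (1 + ‖y‖) ^ (-((d : ℝ) + 1)) := by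
  obtain ⟨C, hC0, hC⟩ := exists_exp_neg_le ((d : ℝ) / 2 + 1)
  refine ⟨C * 8 ^ ((d : ℝ) / 2 + 1), by positivity, fun ε hε hε1 y => ?_⟩
  have hp : (0 : ℝ) ≤ (d : ℝ) / 2 + 1 := by positivity
  have h1 : ε * (1 + ‖y‖ ^ 2 / 4) ≤ 1 + ε * (‖y‖ ^ 2 / 4) := by linarith
  have h2 := hC (ε * (‖y‖ ^ 2 / 4)) (by positivity)
  have h3 : (1 + ε * (‖y‖ ^ 2 / 4)) ^ (-((d : ℝ) / 2 + 1))
      ≤ (ε * (1 + ‖y‖ ^ 2 / 4)) ^ (-((d : ℝ) / 2 + 1)) :=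
    Real.rpow_le_rpow_of_nonpos (by positivity) h1 (by linarith)
  rw [Real.mul_rpow hε.le (by positivity)] at h3
  have h4 := one_add_norm_sq_div_four_rpow_le hp y
  have hr0 : 0 < 1 + ‖y‖ := by positivity
  have e1 : (1 + ‖y‖) ^ (-(2 * ((d : ℝ) / 2 + 1))) * (1 + ‖y‖) = (1 + ‖y‖) ^ (-((d : ℝ) + 1)) := by
    rw [← Real.rpow_add_one hr0.ne']; ring_nf
  calc _ ≤ ε ^ ((d : ℝ) / 2 + 1) * (C * (ε ^ (-((d : ℝ) / 2 + 1))
        * (8 ^ ((d : ℝ) / 2 + 1) * (1 + ‖y‖) ^ (-(2 * ((d : ℝ) / 2 + 1)))))) * (1 + ‖y‖) := by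
        gcongr
        · exact h2.trans (by gcongr; exact h3.trans (by gcongr))
        · linarith
    _ = (ε ^ ((d : ℝ) / 2 + 1) * ε ^ (-((d : ℝ) / 2 + 1))) * (C * 8 ^ ((d : ℝ) / 2 + 1) *
        ((1 + ‖y‖) ^ (-(2 * ((d : ℝ) / 2 + 1))) * (1 + ‖y‖))) := by ring
    _ = _ := by
        rw [← Real.rpow_add hε, add_neg_cancel, Real.rpow_zero, one_mul, e1]

theorem integral_gaussian_eq (hd : 2 ≤ d)
    {w b : EuclideanSpace ℝ (Fin d) → EuclideanSpace ℝ (Fin d)}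
    {P : EuclideanSpace ℝ (Fin d) → ℝ} (hw : C1Decay 0 w) (hb : C1Decay 0 b) (hP : C1Decay 0 P)
    (hdw : ∀ y, divg w y = 0) (hdb : ∀ y, divg b y = 0)
    (h : ∀ y e, ⟪b y, e⟫_ℝ = -⟪fderiv ℝ w y (w y), e⟫_ℝ - fderiv ℝ P y e) :
    ∫ y, Real.exp (-(‖y‖ ^ 2 / 4)) • b y = ∫ y, fderiv ℝ (testMat d 0) y (w y) (w y) := by
  obtain ⟨C, hC0, hC⟩ := hw.exists_bound
  obtain ⟨C₂, hC₂0, hC₂⟩ := hP.exists_bound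
  obtain ⟨C₃, hC₃0, hC₃⟩ := exists_fderiv_testMat_le hd
  obtain ⟨C₄, hC₄0, hC₄⟩ := exists_error_le hd
  obtain ⟨K', hK'0, hK'⟩ := (kernelDecay_testMat_zero hd).fderiv.bound
  have i0 : Integrable fun y => fderiv ℝ (testMat d 0) y (w y) (w y) := by
    refine integrable_of_decay (a := d + 1) (C := K' * C * C) (by linarith)
      (((kernelDecay_testMat_zero hd).fderiv.1.continuous.clm_apply
        hw.contDiff.continuous).clm_apply hw.contDiff.continuous) fun y => ?_
    refine (ContinuousLinearMap.le_opNorm₂ _ _ _).trans ?_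
    calc _ ≤ (K' * (1 + ‖y‖) ^ (-((d : ℝ) + 1))) * C * C := by
          gcongr
          exacts [hK' y, (hC y).1, (hC y).1]
      _ = _ := by ring
  refine ext_inner_right ℝ fun e => ?_
  have e1 : ⟪∫ y, fderiv ℝ (testMat d 0) y (w y) (w y), e⟫_ℝ
      = ∫ y, ⟪fderiv ℝ (testMat d 0) y (w y) (w y), e⟫_ℝ := by
    rw [real_inner_comm, ← integral_inner i0]
    simp only [real_inner_comm]
  rw [e1]
  set F : ℝ → EuclideanSpace ℝ (Fin d) → ℝ := fun ε y =>
    ⟪fderiv ℝ (testMat d ε) y (w y) (w y), e⟫_ℝ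
        - 1 / 2 * (ε ^ ((d : ℝ) / 2 + 1) * Real.exp (-(ε * (‖y‖ ^ 2 / 4)))) * ⟪y, e⟫_ℝ * P y with hF
  have hlim : Filter.Tendsto (fun ε => ∫ y, F ε y) (𝓝[>] 0)
      (𝓝 (∫ y, ⟪fderiv ℝ (testMat d 0) y (w y) (w y), e⟫_ℝ)) := by
    refine tendsto_integral_filter_of_dominated_convergence
      (fun y => (C₃ * C ^ 2 * ‖e‖ + 1 / 2 * C₄ * ‖e‖ * C₂) * (1 + ‖y‖) ^ (-((d : ℝ) + 1)))
      ?_ ?_ ?_ ?_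
    · filter_upwards [Ioc_mem_nhdsGT (zero_lt_one' ℝ)] with ε hε
      have c1 := (kernelDecay_testMat_add_one hd hε.1 hε.2).fderiv.1.continuous
      have c2 := hw.contDiff.continuous
      have c3 := hP.contDiff.continuous
      exact Continuous.aestronglyMeasurable (by fun_prop)
    · filter_upwards [Ioc_mem_nhdsGT (zero_lt_one' ℝ)] with ε hε
      refine Filter.Eventually.of_forall fun y => ?_
      have j1 := hC₃ ε hε.1 hε.2 y (w y)
      have j2 := hC₄ ε hε.1 hε.2 y
      have hE : 0 ≤ ε ^ ((d : ℝ) / 2 + 1) * Real.exp (-(ε * (‖y‖ ^ 2 / 4))) :=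
        mul_nonneg (Real.rpow_nonneg hε.1.le _) (Real.exp_pos _).le
      calc ‖F ε y‖ ≤ ‖⟪fderiv ℝ (testMat d ε) y (w y) (w y), e⟫_ℝ‖
            + ‖1 / 2 * (ε ^ ((d : ℝ) / 2 + 1) * Real.exp (-(ε * (‖y‖ ^ 2 / 4)))) * ⟪y, e⟫_ℝ
              * P y‖ := norm_sub_le _ _
        _ ≤ (C₃ * (1 + ‖y‖) ^ (-((d : ℝ) + 1)) * C ^ 2) * ‖e‖
            + 1 / 2 * (C₄ * (1 + ‖y‖) ^ (-((d : ℝ) + 1))) * ‖e‖ * C₂ := by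
            gcongr
            · refine (norm_inner_le_norm _ _).trans ?_
              gcongr
              refine j1.trans ?_
              gcongr
              exact (hC y).1
            · rw [norm_mul, norm_mul, norm_mul, Real.norm_of_nonneg hE,
                Real.norm_of_nonneg (by norm_num : (0 : ℝ) ≤ 1 / 2)]
              calc _ ≤ 1 / 2 * (ε ^ ((d : ℝ) / 2 + 1) * Real.exp (-(ε * (‖y‖ ^ 2 / 4))))
                    * (‖y‖ * ‖e‖) * C₂ := by
                    gcongr
                    · exact norm_inner_le_norm _ _
                    · exact (hC₂ y).1
                _ = 1 / 2 * (ε ^ ((d : ℝ) / 2 + 1) * Real.exp (-(ε * (‖y‖ ^ 2 / 4))) * ‖y‖)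
                    * ‖e‖ * C₂ := by ring
                _ ≤ _ := by gcongr
        _ = _ := by ring
    · refine Integrable.const_mul ?_ _
      refine integrable_of_decay (a := d + 1) (C := 1) (by linarith) ?_ fun y => ?_
      · exact Continuous.rpow_const (by fun_prop) fun y => Or.inl (by positivity)
      · rw [Real.norm_of_nonneg (by positivity), one_mul]
    · refine Filter.Eventually.of_forall fun y => ?_
      have l1 := (tendsto_fderiv_testMat hd y (w y)).inner (tendsto_const_nhds (x := e)) (𝕜 := ℝ)
      have l2 : Filter.Tendsto (fun ε : ℝ => 1 / 2 * (ε ^ ((d : ℝ) / 2 + 1) *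
          Real.exp (-(ε * (‖y‖ ^ 2 / 4)))) * ⟪y, e⟫_ℝ * P y) (𝓝[>] 0) (𝓝 0) := by
        have hc : Continuous fun ε : ℝ => 1 / 2 * (ε ^ ((d : ℝ) / 2 + 1) *
          Real.exp (-(ε * (‖y‖ ^ 2 / 4)))) * ⟪y, e⟫_ℝ * P y := by
          have := Real.continuous_rpow_const (q := (d : ℝ) / 2 + 1) (by positivity)
          fun_prop
        have := (hc.tendsto 0).mono_left (nhdsWithin_le_nhds (s := Ioi 0))
        rwa [Real.zero_rpow (by positivity), zero_mul, mul_zero, zero_mul, zero_mul] at this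
      have l3 := l1.sub l2
      rwa [sub_zero] at l3
  refine tendsto_nhds_unique (tendsto_const_nhds.congr' ?_) hlim
  filter_upwards [Ioc_mem_nhdsGT (zero_lt_one' ℝ)] with ε hε
  exact integral_gaussian_inner_eq hd hε.1 hε.2 hw hb hP hdw hdb h e

end StaticLimit

section PeriodicSmooth

variable {d : ℕ} {H H' : Type} [NormedAddCommGroup H] [NormedSpace ℝ H] [NormedAddCommGroup H']
  [NormedSpace ℝ H']

open scoped InnerProductSpace Topology

/-- The lattice vector with coordinates `n`. -/
noncomputable def latticeVec (n : Fin d → ℤ) : EuclideanSpace ℝ (Fin d) :=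
  (EuclideanSpace.equiv (Fin d) ℝ).symm fun i => (n i : ℝ)

/-- Functions on space-time, smooth on `(0,T) × ℝ^d` and periodic in space. -/
structure PeriodicSmooth (T : ℝ) (F : ℝ × EuclideanSpace ℝ (Fin d) → H) : Prop where
  smooth : ContDiffOn ℝ (⊤ : ℕ∞) F (Ioo 0 T ×ˢ univ)
  periodic : ∀ q n, F (q + (0, latticeVec n)) = F q

lemma isOpen_slab (T : ℝ) :
    IsOpen (Ioo 0 T ×ˢ (univ : Set (EuclideanSpace ℝ (Fin d)))) := isOpen_Ioo.prod isOpen_univ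

namespace PeriodicSmooth

variable {T : ℝ} {F : ℝ × EuclideanSpace ℝ (Fin d) → H}

lemma contDiffAt (hF : PeriodicSmooth T F) {q : ℝ × EuclideanSpace ℝ (Fin d)}
    (hq : q.1 ∈ Ioo 0 T) : ContDiffAt ℝ (⊤ : ℕ∞) F q :=
  hF.smooth.contDiffAt ((isOpen_slab T).mem_nhds ⟨hq, trivial⟩)

lemma hasFDerivAt (hF : PeriodicSmooth T F) {q : ℝ × EuclideanSpace ℝ (Fin d)}
    (hq : q.1 ∈ Ioo 0 T) : HasFDerivAt F (fderiv ℝ F q) q :=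
  ((hF.contDiffAt hq).differentiableAt (by simp)).hasFDerivAt

lemma fderiv (hF : PeriodicSmooth T F) : PeriodicSmooth T (fderiv ℝ F) := by
  refine ⟨hF.smooth.fderiv_of_isOpen (isOpen_slab T) (by simp), fun q n => ?_⟩
  rw [← fderiv_comp_add_right]
  congr 1
  exact funext fun q => hF.periodic q n

lemma clm_comp (hF : PeriodicSmooth T F) (L : H →L[ℝ] H') :
    PeriodicSmooth T fun q => L (F q) :=
  ⟨L.contDiff.comp_contDiffOn hF.smooth, fun q n => by rw [hF.periodic]⟩

lemma dir (hF : PeriodicSmooth T F) (e : ℝ × EuclideanSpace ℝ (Fin d)) :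
    PeriodicSmooth T fun q => _root_.fderiv ℝ F q e :=
  hF.fderiv.clm_comp (ContinuousLinearMap.apply ℝ H e)

lemma add {F' : ℝ × EuclideanSpace ℝ (Fin d) → H} (hF : PeriodicSmooth T F)
    (hF' : PeriodicSmooth T F') : PeriodicSmooth T fun q => F q + F' q :=
  ⟨hF.smooth.add hF'.smooth, fun q n => by rw [hF.periodic, hF'.periodic]⟩

lemma exists_bound (hF : PeriodicSmooth T F) {A B : ℝ} (hA : 0 < A) (hB : B < T) :
    ∃ D : ℝ, 0 ≤ D ∧ ∀ t ∈ Icc A B, ∀ x, ‖F (t, x)‖ ≤ D := by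
  have hK : IsCompact (Icc A B ×ˢ ((EuclideanSpace.equiv (Fin d) ℝ).symm '' Icc 0 1)) :=
    isCompact_Icc.prod (isCompact_Icc.image (EuclideanSpace.equiv (Fin d) ℝ).symm.continuous)
  have hc : ContinuousOn F (Icc A B ×ˢ ((EuclideanSpace.equiv (Fin d) ℝ).symm '' Icc 0 1)) :=
    hF.smooth.continuousOn.mono fun q hq =>
      ⟨⟨hA.trans_le hq.1.1, hq.1.2.trans_lt hB⟩, trivial⟩
  obtain ⟨D, hD⟩ := hK.exists_bound_of_continuousOn hc
  refine ⟨max D 0, le_max_right _ _, fun t ht x => ?_⟩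
  rw [← hF.periodic (t, x) (fun i => -⌊x i⌋)]
  refine (hD _ ⟨by simpa using ht, ?_⟩).trans (le_max_left _ _)
  refine ⟨fun i => Int.fract (x i), ⟨fun i => Int.fract_nonneg _, fun i => (Int.fract_lt_one _).le⟩, ?_⟩
  ext i
  simp [latticeVec, Int.fract, sub_eq_add_neg]

lemma hasFDerivAt_slice (hF : PeriodicSmooth T F) {t : ℝ} (ht : t ∈ Ioo 0 T)
    (X : EuclideanSpace ℝ (Fin d)) (σ : ℝ) (y : EuclideanSpace ℝ (Fin d)) :
    HasFDerivAt (fun y => F (t, X + σ • y)) ((_root_.fderiv ℝ F (t, X + σ • y)).comp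
      (σ • ContinuousLinearMap.inr ℝ ℝ (EuclideanSpace ℝ (Fin d)))) y := by
  have h1 : HasFDerivAt (fun y : EuclideanSpace ℝ (Fin d) => (t, X + σ • y))
      (σ • ContinuousLinearMap.inr ℝ ℝ (EuclideanSpace ℝ (Fin d))) y := by
    have := (hasFDerivAt_const (𝕜 := ℝ) t y).prodMk (((hasFDerivAt_id (𝕜 := ℝ) y).const_smul σ).const_add X)
    refine this.congr_fderiv ?_
    ext <;> simp
  exact (hF.hasFDerivAt (q := (t, X + σ • y)) ht).comp y h1

lemma fderiv_slice (hF : PeriodicSmooth T F) {t : ℝ} (ht : t ∈ Ioo 0 T)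
    (X : EuclideanSpace ℝ (Fin d)) (σ : ℝ) (y v : EuclideanSpace ℝ (Fin d)) :
    _root_.fderiv ℝ (fun y => F (t, X + σ • y)) y v
      = σ • _root_.fderiv ℝ F (t, X + σ • y) (0, v) := by
  rw [(hF.hasFDerivAt_slice ht X σ y).fderiv]
  simp

lemma contDiff_slice (hF : PeriodicSmooth T F) {t : ℝ} (ht : t ∈ Ioo 0 T)
    (X : EuclideanSpace ℝ (Fin d)) (σ : ℝ) :
    ContDiff ℝ (⊤ : ℕ∞) fun y => F (t, X + σ • y) := by
  have : ContDiff ℝ (⊤ : ℕ∞) fun y : EuclideanSpace ℝ (Fin d) => (t, X + σ • y) := by fun_prop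
  exact hF.smooth.comp_contDiff this fun y => ⟨ht, trivial⟩

lemma c1Decay_slice (hF : PeriodicSmooth T F) {t : ℝ} (ht : t ∈ Ioo 0 T)
    (X : EuclideanSpace ℝ (Fin d)) (σ : ℝ) : C1Decay 0 fun y => F (t, X + σ • y) := by
  refine ⟨(hF.contDiff_slice ht X σ).of_le (by exact_mod_cast le_top), ?_⟩
  obtain ⟨D, hD0, hD⟩ := hF.exists_bound ht.1 ht.2
  obtain ⟨D', hD'0, hD'⟩ := hF.fderiv.exists_bound ht.1 ht.2
  have ht' : t ∈ Icc t t := ⟨le_rfl, le_rfl⟩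
  refine ⟨D + |σ| * D', by positivity, fun y => ?_⟩
  simp only [neg_zero, Real.rpow_zero, mul_one]
  constructor
  · have := hD t ht' (X + σ • y)
    have h0 : 0 ≤ |σ| * D' := by positivity
    linarith
  · refine (ContinuousLinearMap.opNorm_le_bound _ (by positivity : 0 ≤ |σ| * D') fun v => ?_).trans
      (by linarith)
    rw [hF.fderiv_slice ht, norm_smul, Real.norm_eq_abs, mul_assoc]
    gcongr
    refine (ContinuousLinearMap.le_opNorm _ _).trans ?_
    have : ‖((0 : ℝ), v)‖ = ‖v‖ := by simp [Prod.norm_def]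
    rw [this]
    gcongr
    exact hD' t ht' _

lemma fderiv_dir_comm (hF : PeriodicSmooth T F) {q : ℝ × EuclideanSpace ℝ (Fin d)}
    (hq : q.1 ∈ Ioo 0 T) (e e' : ℝ × EuclideanSpace ℝ (Fin d)) :
    _root_.fderiv ℝ (fun q => _root_.fderiv ℝ F q e) q e'
      = _root_.fderiv ℝ (fun q => _root_.fderiv ℝ F q e') q e := by
  have h := (hF.contDiffAt hq).isSymmSndFDerivAt (by
    rw [minSmoothness_of_isRCLikeNormedField]; exact WithTop.coe_le_coe.2 (le_top : (2 : ℕ∞) ≤ ⊤))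
  have h1 : ∀ e, HasFDerivAt (fun q => _root_.fderiv ℝ F q e)
      ((ContinuousLinearMap.apply ℝ H e).comp (_root_.fderiv ℝ (_root_.fderiv ℝ F) q)) q :=
    fun e => (ContinuousLinearMap.apply ℝ H e).hasFDerivAt.comp q (hF.fderiv.hasFDerivAt hq)
  rw [(h1 e).fderiv, (h1 e').fderiv]
  simpa using h e' e

end PeriodicSmooth

/-- Spatial divergence of a space-time vector field. -/
noncomputable def spaceDiv (U : ℝ × EuclideanSpace ℝ (Fin d) → EuclideanSpace ℝ (Fin d))
    (q : ℝ × EuclideanSpace ℝ (Fin d)) : ℝ :=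
  ∑ i, fderiv ℝ U q (0, EuclideanSpace.single i 1) i

/-- Spatial Laplacian. -/
noncomputable def spaceLap (U : ℝ × EuclideanSpace ℝ (Fin d) → H)
    (q : ℝ × EuclideanSpace ℝ (Fin d)) : H :=
  ∑ i : Fin d, fderiv ℝ (fun q => fderiv ℝ U q (0, EuclideanSpace.single i 1)) q
    (0, EuclideanSpace.single i 1)

lemma spaceDiv_dir_eq_zero {T : ℝ} {U : ℝ × EuclideanSpace ℝ (Fin d) → EuclideanSpace ℝ (Fin d)}
    (hU : PeriodicSmooth T U) (hdiv : ∀ q, q.1 ∈ Ioo 0 T → spaceDiv U q = 0)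
    (e : ℝ × EuclideanSpace ℝ (Fin d)) :
    ∀ q, q.1 ∈ Ioo 0 T → spaceDiv (fun q => fderiv ℝ U q e) q = 0 := fun q hq => by
  have h1 : ∀ i : Fin d, HasFDerivAt (fun q => fderiv ℝ U q (0, EuclideanSpace.single i 1) i)
      ((EuclideanSpace.proj i).comp (fderiv ℝ (fun q => fderiv ℝ U q
        (0, EuclideanSpace.single i 1)) q)) q := fun i =>
    (EuclideanSpace.proj (𝕜 := ℝ) i).hasFDerivAt.comp q
      ((hU.dir (0, EuclideanSpace.single i 1)).hasFDerivAt hq)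
  have h2 := HasFDerivAt.fun_sum (u := Finset.univ) fun i _ => h1 i
  have h3 : HasFDerivAt (spaceDiv U) (0 : ℝ × EuclideanSpace ℝ (Fin d) →L[ℝ] ℝ) q := by
    refine (hasFDerivAt_const 0 q).congr_of_eventuallyEq ?_
    filter_upwards [(isOpen_slab T).mem_nhds (x := q) ⟨hq, trivial⟩] with q' hq'
    exact hdiv q' hq'.1
  have h4 := congrArg (fun L => L e) (h2.unique h3)
  simp only [sum_apply, ContinuousLinearMap.comp_apply, zero_apply] at h4
  refine Eq.trans ?_ h4
  refine Finset.sum_congr rfl fun i _ => ?_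
  rw [hU.fderiv_dir_comm hq]
  rfl

end PeriodicSmooth

section TimeDerivative

variable {d : ℕ}

open scoped InnerProductSpace Topology

lemma norm_smul_comp_le {G G' : Type} [NormedAddCommGroup G] [NormedSpace ℝ G]
    [NormedAddCommGroup G'] [NormedSpace ℝ G'] {a C D : ℝ}
    {g : EuclideanSpace ℝ (Fin d) → ℝ} (hgb : ∀ y, ‖g y‖ ≤ C * (1 + ‖y‖) ^ (-a))
    {A : G →L[ℝ] G'} {L : ℝ × EuclideanSpace ℝ (Fin d) × ℝ →L[ℝ] G} {y : EuclideanSpace ℝ (Fin d)}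
    (hA : ‖A‖ ≤ D) (hL : ‖L‖ ≤ 2 * (1 + ‖y‖)) :
    ‖g y • A.comp L‖ ≤ C * D * 2 * (1 + ‖y‖) ^ (-(a - 1)) := by
  have hy : 0 < 1 + ‖y‖ := by positivity
  rw [norm_smul, neg_sub, sub_eq_neg_add, Real.rpow_add_one hy.ne']
  calc _ ≤ (C * (1 + ‖y‖) ^ (-a)) * (D * (2 * (1 + ‖y‖))) := by
        refine mul_le_mul (hgb y) ((A.opNorm_comp_le L).trans ?_) (norm_nonneg _)
          ((norm_nonneg _).trans (hgb y))
        exact mul_le_mul hA hL (norm_nonneg _) ((norm_nonneg _).trans hA)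
    _ = _ := by ring

lemma exists_affineParam : ∃ L : EuclideanSpace ℝ (Fin d) →
      (ℝ × EuclideanSpace ℝ (Fin d) × ℝ) →L[ℝ] (ℝ × EuclideanSpace ℝ (Fin d)),
    (∀ y q, L y q = (q.1, q.2.1 + q.2.2 • y)) ∧ Continuous L := by
  refine ⟨fun y => (ContinuousLinearMap.fst ℝ ℝ (EuclideanSpace ℝ (Fin d) × ℝ)).prod
      ((ContinuousLinearMap.fst ℝ (EuclideanSpace ℝ (Fin d)) ℝ).comp
        (ContinuousLinearMap.snd ℝ ℝ (EuclideanSpace ℝ (Fin d) × ℝ)))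
      + ContinuousLinearMap.smulRightL ℝ (ℝ × EuclideanSpace ℝ (Fin d) × ℝ)
        (ℝ × EuclideanSpace ℝ (Fin d)) ((ContinuousLinearMap.snd ℝ (EuclideanSpace ℝ (Fin d)) ℝ).comp
        (ContinuousLinearMap.snd ℝ ℝ (EuclideanSpace ℝ (Fin d) × ℝ)))
        (ContinuousLinearMap.inr ℝ ℝ (EuclideanSpace ℝ (Fin d)) y), fun y q => ?_, by fun_prop⟩
  ext <;> simp

lemma hasDerivAt_integral_mollified {a C T : ℝ} (ha : (d : ℝ) + 1 < a)
    {g : EuclideanSpace ℝ (Fin d) → ℝ} (hg : Continuous g)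
    (hgb : ∀ y, ‖g y‖ ≤ C * (1 + ‖y‖) ^ (-a))
    {F : ℝ × EuclideanSpace ℝ (Fin d) → EuclideanSpace ℝ (Fin d)} (hF : PeriodicSmooth T F)
    {X : ℝ → EuclideanSpace ℝ (Fin d)} {σ : ℝ → ℝ} {X' : EuclideanSpace ℝ (Fin d)} {σ' t : ℝ}
    (ht : t ∈ Ioo 0 T) (hX : HasDerivAt X X' t) (hσ : HasDerivAt σ σ' t) :
    HasDerivAt (fun s => ∫ y, g y • F (s, X s + σ s • y))
      (∫ y, g y • fderiv ℝ F (t, X t + σ t • y) (1, X' + σ' • y)) t := by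
  have hC : 0 ≤ C := by
    have := (norm_nonneg _).trans (hgb 0)
    simpa using this
  set A := t / 2
  set B := (t + T) / 2
  have hA : 0 < A := half_pos ht.1
  have hB : B < T := by simp only [B]; linarith [ht.2]
  have htAB : t ∈ Ioo A B := ⟨by simp only [A]; linarith [ht.1], by simp only [B]; linarith [ht.2]⟩
  obtain ⟨D, hD0, hD⟩ := hF.exists_bound hA hB
  obtain ⟨D', hD'0, hD'⟩ := hF.fderiv.exists_bound hA hB
  obtain ⟨L, hL, hLc⟩ := exists_affineParam (d := d)
  have hLn : ∀ y, ‖L y‖ ≤ 2 * (1 + ‖y‖) := fun y => by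
    refine ContinuousLinearMap.opNorm_le_bound _ (by positivity) fun q => ?_
    have h1 : ‖q.1‖ ≤ ‖q‖ := norm_fst_le q
    have h2 : ‖q.2.1‖ ≤ ‖q‖ := (norm_fst_le q.2).trans (norm_snd_le q)
    have h3 : ‖q.2.2‖ ≤ ‖q‖ := (norm_snd_le q.2).trans (norm_snd_le q)
    have h0 := norm_nonneg q
    have hy := norm_nonneg y
    rw [hL, Prod.norm_def]
    refine max_le (h1.trans (by nlinarith)) ((norm_add_le _ _).trans ?_)
    rw [norm_smul]
    have : ‖q.2.2‖ * ‖y‖ ≤ ‖q‖ * ‖y‖ := by gcongr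
    nlinarith
  set q₀ : ℝ × EuclideanSpace ℝ (Fin d) × ℝ := (t, X t, σ t)
  have hs : {q : ℝ × EuclideanSpace ℝ (Fin d) × ℝ | q.1 ∈ Ioo A B} ∈ 𝓝 q₀ :=
    (isOpen_Ioo.preimage continuous_fst).mem_nhds htAB
  have hsub : ∀ {s}, s ∈ Ioo A B → s ∈ Ioo 0 T := fun hs => ⟨hA.trans hs.1, hs.2.trans hB⟩
  have hcont : ∀ {q : ℝ × EuclideanSpace ℝ (Fin d) × ℝ}, q.1 ∈ Ioo A B →
      Continuous fun y => F (L y q) := fun {q} hq => by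
    refine hF.smooth.continuousOn.comp_continuous (by fun_prop) fun y => ?_
    rw [hL]
    exact ⟨hsub hq, trivial⟩
  have hcont' : ∀ {q : ℝ × EuclideanSpace ℝ (Fin d) × ℝ}, q.1 ∈ Ioo A B →
      Continuous fun y => fderiv ℝ F (L y q) := fun {q} hq => by
    refine hF.fderiv.smooth.continuousOn.comp_continuous (by fun_prop) fun y => ?_
    rw [hL]
    exact ⟨hsub hq, trivial⟩
  have key := hasFDerivAt_integral_of_dominated_of_fderiv_le (𝕜 := ℝ) (μ := volume)
    (F := fun (q : ℝ × EuclideanSpace ℝ (Fin d) × ℝ) y => g y • F (L y q))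
    (F' := fun q y => g y • (fderiv ℝ F (L y q)).comp (L y)) (x₀ := q₀)
    (bound := fun y => C * D' * 2 * (1 + ‖y‖) ^ (-(a - 1))) hs ?_ ?_ ?_ ?_ ?_ ?_
  · have hcurve : HasDerivAt (fun s => (s, X s, σ s)) (1, X', σ') t :=
      (hasDerivAt_id t).prodMk (hX.prodMk hσ)
    have h := HasFDerivAt.comp_hasDerivAt t (f := fun s => (s, X s, σ s)) key hcurve
    have hInt : Integrable fun y => g y • (fderiv ℝ F (L y q₀)).comp (L y) := by
      refine integrable_of_decay (a := a - 1) (C := C * D' * 2) (by linarith)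
        (hg.smul ((hcont' htAB).clm_comp hLc)) fun y => ?_
      rw [hL]
      exact norm_smul_comp_le hgb (hD' _ (Ioo_subset_Icc_self htAB) _) (hLn y)
    rw [ContinuousLinearMap.integral_apply hInt] at h
    simpa only [hL, Function.comp_def, smul_apply, ContinuousLinearMap.comp_apply, q₀] using h
  · filter_upwards [hs] with q hq
    exact (hg.smul (hcont hq)).aestronglyMeasurable
  · refine integrable_of_decay (a := a) (C := C * D) (by linarith) (hg.smul (hcont htAB)) fun y => ?_
    rw [norm_smul, hL]
    calc _ ≤ (C * (1 + ‖y‖) ^ (-a)) * D := by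
          gcongr
          exacts [hgb y, hD _ (Ioo_subset_Icc_self htAB) _]
      _ = _ := by ring
  · exact (hg.smul ((hcont' htAB).clm_comp hLc)).aestronglyMeasurable
  · refine Filter.Eventually.of_forall fun y q hq => ?_
    rw [hL]
    exact norm_smul_comp_le hgb (hD' _ (Ioo_subset_Icc_self hq) _) (hLn y)
  · refine Integrable.const_mul ?_ _
    refine integrable_of_decay (a := a - 1) (C := 1) (by linarith) ?_ fun y => ?_
    · exact Continuous.rpow_const (by fun_prop) fun y => Or.inl (by positivity)
    · rw [Real.norm_of_nonneg (by positivity), one_mul]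
  · refine Filter.Eventually.of_forall fun y q hq => ?_
    have hq' : (L y q).1 ∈ Ioo 0 T := by rw [hL]; exact hsub hq
    exact ((hF.hasFDerivAt hq').comp q (L y).hasFDerivAt).const_smul (g y)

end TimeDerivative

section NavierStokesIdentity

variable {d : ℕ}

open scoped InnerProductSpace Topology

/-- Divergence-free smooth periodic fields. -/
structure Solenoidal (T : ℝ) (F : ℝ × EuclideanSpace ℝ (Fin d) → EuclideanSpace ℝ (Fin d)) :
    Prop where
  smooth : PeriodicSmooth T F
  div_eq_zero : ∀ q, q.1 ∈ Ioo 0 T → spaceDiv F q = 0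

namespace Solenoidal

variable {T : ℝ} {F F' : ℝ × EuclideanSpace ℝ (Fin d) → EuclideanSpace ℝ (Fin d)}

lemma dir (hF : Solenoidal T F) (e : ℝ × EuclideanSpace ℝ (Fin d)) :
    Solenoidal T fun q => fderiv ℝ F q e :=
  ⟨hF.smooth.dir e, spaceDiv_dir_eq_zero hF.smooth hF.div_eq_zero e⟩

lemma add (hF : Solenoidal T F) (hF' : Solenoidal T F') : Solenoidal T fun q => F q + F' q := by
  refine ⟨hF.smooth.add hF'.smooth, fun q hq => ?_⟩
  have h : HasFDerivAt (fun q => F q + F' q) _ q :=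
    (hF.smooth.hasFDerivAt hq).fun_add (hF'.smooth.hasFDerivAt hq)
  have h1 := hF.div_eq_zero q hq
  have h2 := hF'.div_eq_zero q hq
  rw [spaceDiv] at h1 h2 ⊢
  rw [h.fderiv]
  simp [Finset.sum_add_distrib, h1, h2]

lemma smul (hF : Solenoidal T F) (c : ℝ) : Solenoidal T fun q => c • F q := by
  refine ⟨hF.smooth.clm_comp (c • ContinuousLinearMap.id ℝ _), fun q hq => ?_⟩
  have h : HasFDerivAt (fun q => c • F q) _ q := (hF.smooth.hasFDerivAt hq).fun_const_smul c
  have h1 := hF.div_eq_zero q hq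
  rw [spaceDiv] at h1 ⊢
  rw [h.fderiv]
  simp [← Finset.mul_sum, h1]

lemma zero : Solenoidal T fun _ : ℝ × EuclideanSpace ℝ (Fin d) => (0 : EuclideanSpace ℝ (Fin d)) :=
  ⟨⟨contDiffOn_const, fun _ _ => rfl⟩, fun q _ => by simp [spaceDiv]⟩

lemma sum {ι : Type*} (s : Finset ι)
    {f : ι → ℝ × EuclideanSpace ℝ (Fin d) → EuclideanSpace ℝ (Fin d)}
    (hf : ∀ i, Solenoidal T (f i)) : Solenoidal T fun q => ∑ i ∈ s, f i q := by
  classical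
  induction s using Finset.induction_on with
  | empty => simpa using zero
  | insert i s hi ih => simpa [Finset.sum_insert hi] using (hf i).add ih

lemma spaceLap (hF : Solenoidal T F) : Solenoidal T (spaceLap F) :=
  Solenoidal.sum _ fun i => (hF.dir (0, EuclideanSpace.single i 1)).dir
    (0, EuclideanSpace.single i 1)

lemma divg_slice (hF : Solenoidal T F) {t : ℝ} (ht : t ∈ Ioo 0 T)
    (X : EuclideanSpace ℝ (Fin d)) (σ : ℝ) (y : EuclideanSpace ℝ (Fin d)) :
    divg (fun y => F (t, X + σ • y)) y = 0 := by
  have h := hF.div_eq_zero (t, X + σ • y) ht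
  rw [spaceDiv] at h
  simp only [divg, hF.smooth.fderiv_slice ht, PiLp.smul_apply, smul_eq_mul]
  rw [← Finset.mul_sum, h, mul_zero]

end Solenoidal

/-- Smooth periodic solutions of the Navier--Stokes equations on `(0,T) × ℝ^d`. -/
structure NavierStokes (T ν : ℝ)
    (U : ℝ × EuclideanSpace ℝ (Fin d) → EuclideanSpace ℝ (Fin d))
    (P : ℝ × EuclideanSpace ℝ (Fin d) → ℝ) : Prop where
  velocity : Solenoidal T U
  pressure : PeriodicSmooth T P
  momentum : ∀ q, q.1 ∈ Ioo 0 T → ∀ e,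
    ⟪fderiv ℝ U q (1, U q) + (-ν) • spaceLap U q, e⟫_ℝ = -fderiv ℝ P q (0, e)

/-- The Laplacian of `exp (-‖y‖ ^ 2 / 4)`. -/
noncomputable def gaussLap (d : ℕ) (y : EuclideanSpace ℝ (Fin d)) : ℝ :=
  (‖y‖ ^ 2 / 4 - d / 2) * Real.exp (-(‖y‖ ^ 2 / 4))

lemma hasFDerivAt_gaussian (y : EuclideanSpace ℝ (Fin d)) :
    HasFDerivAt (fun y : EuclideanSpace ℝ (Fin d) => Real.exp (-(‖y‖ ^ 2 / 4)))
      ((-(1 / 2) * Real.exp (-(‖y‖ ^ 2 / 4))) • innerSL ℝ y) y := by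
  refine hasFDerivAt_comp_norm_sq_div_four (f := fun z => Real.exp (-z)) ?_
  simpa using (hasDerivAt_id' (‖y‖ ^ 2 / 4)).fun_neg.exp

lemma kernelDecay_gaussian' (a : ℝ) (ha : 0 ≤ a) :
    KernelDecay a fun y : EuclideanSpace ℝ (Fin d) => Real.exp (-(‖y‖ ^ 2 / 4)) := by
  have := kernelDecay_gaussian (E := EuclideanSpace ℝ (Fin d)) (p := a / 2) (by positivity)
  rwa [mul_div_cancel₀ _ two_ne_zero] at this

lemma integral_gaussian_fderiv_apply_self
    {w : EuclideanSpace ℝ (Fin d) → EuclideanSpace ℝ (Fin d)} (hw : C1Decay 0 w) :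
    ∫ y, Real.exp (-(‖y‖ ^ 2 / 4)) • fderiv ℝ w y y = (2 : ℝ) • ∫ y, gaussLap d y • w y := by
  have hv := ((kernelDecay_gaussian' (d := d) (d + 2) (by positivity)).bilin
    (ContinuousLinearMap.lsmul ℝ ℝ) (KernelDecay.linear
      (ContinuousLinearMap.id ℝ (EuclideanSpace ℝ (Fin d))))).c1Decay
  have h := integral_fderiv_apply_eq (by linarith) hw hv
  have e : ∀ y, divg (fun y : EuclideanSpace ℝ (Fin d) => (ContinuousLinearMap.lsmul ℝ ℝ)
      (Real.exp (-(‖y‖ ^ 2 / 4))) ((ContinuousLinearMap.id ℝ (EuclideanSpace ℝ (Fin d))) y)) y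
      = -(2 * gaussLap d y) := fun y => by
    have h1 : HasFDerivAt (fun y : EuclideanSpace ℝ (Fin d) => (ContinuousLinearMap.lsmul ℝ ℝ)
      (Real.exp (-(‖y‖ ^ 2 / 4))) ((ContinuousLinearMap.id ℝ (EuclideanSpace ℝ (Fin d))) y)) _ y :=
      (hasFDerivAt_gaussian y).smul (hasFDerivAt_id (𝕜 := ℝ) y)
    have h2 : ‖y‖ ^ 2 = ∑ i, y i * y i := by rw [← real_inner_self_eq_norm_sq, inner_eq_sum]
    have h3 : ∀ i : Fin d, ⟪y, EuclideanSpace.single i (1 : ℝ)⟫_ℝ = y i := fun i => by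
      simp [EuclideanSpace.inner_single_right]
    rw [divg, h1.fderiv]
    simp only [add_apply, smul_apply, ContinuousLinearMap.smulRight_apply, innerSL_apply_apply, h3,
      ContinuousLinearMap.id_apply, PiLp.add_apply, PiLp.smul_apply, PiLp.single_apply, if_true,
      smul_eq_mul, mul_one, Finset.sum_add_distrib, Finset.sum_const, Finset.card_univ,
      Fintype.card_fin, nsmul_eq_mul]
    have h4 : ∀ g : ℝ, ∑ i, -(1 / 2) * g * y i * y i = -(1 / 2) * g * ‖y‖ ^ 2 := fun g => by
      rw [h2, Finset.mul_sum]; exact Finset.sum_congr rfl fun i _ => by ring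
    rw [h4, gaussLap]
    ring
  simp only [e] at h
  simp only [ContinuousLinearMap.lsmul_apply, ContinuousLinearMap.id_apply, map_smul, neg_smul,
    integral_neg, neg_neg, mul_smul, integral_smul] at h
  exact h

lemma integral_gaussian_smul_fderiv
    {w : EuclideanSpace ℝ (Fin d) → EuclideanSpace ℝ (Fin d)} (hw : C1Decay 0 w) (i : Fin d) :
    ∫ y, Real.exp (-(‖y‖ ^ 2 / 4)) • fderiv ℝ w y (EuclideanSpace.single i 1)
      = ∫ y, (1 / 2 : ℝ) • Real.exp (-(‖y‖ ^ 2 / 4)) • y i • w y := by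
  have hv := ((kernelDecay_gaussian' (d := d) (d + 2) (by positivity)).bilin
    (ContinuousLinearMap.lsmul ℝ ℝ) (KernelDecay.const
      (EuclideanSpace.single i (1 : ℝ)))).c1Decay
  have h := integral_fderiv_apply_eq (by linarith) hw hv
  have e : ∀ y, divg (fun y : EuclideanSpace ℝ (Fin d) => (ContinuousLinearMap.lsmul ℝ ℝ)
      (Real.exp (-(‖y‖ ^ 2 / 4))) (EuclideanSpace.single i (1 : ℝ))) y
      = -(1 / 2 * (Real.exp (-(‖y‖ ^ 2 / 4)) * y i)) := fun y => by
    have h1 : HasFDerivAt (fun y : EuclideanSpace ℝ (Fin d) => (ContinuousLinearMap.lsmul ℝ ℝ)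
      (Real.exp (-(‖y‖ ^ 2 / 4))) (EuclideanSpace.single i (1 : ℝ))) _ y :=
      (hasFDerivAt_gaussian y).smul_const _
    have h3 : ∀ i : Fin d, ⟪y, EuclideanSpace.single i (1 : ℝ)⟫_ℝ = y i := fun i => by
      simp [EuclideanSpace.inner_single_right]
    rw [divg, h1.fderiv]
    simp only [ContinuousLinearMap.smulRight_apply, smul_apply, innerSL_apply_apply, h3,
      PiLp.smul_apply, PiLp.single_apply, smul_eq_mul, mul_ite, mul_one, mul_zero,
      Finset.mem_univ, if_true, Finset.sum_ite_eq']
    ring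
  simp only [e] at h
  simp only [ContinuousLinearMap.lsmul_apply, map_smul, neg_smul, integral_neg, neg_neg,
    mul_smul] at h
  exact h

lemma integrable_gaussian_smul {w : EuclideanSpace ℝ (Fin d) → EuclideanSpace ℝ (Fin d)}
    (hw : Continuous w) {C : ℝ} (hC : ∀ y, ‖w y‖ ≤ C * (1 + ‖y‖)) :
    Integrable fun y => Real.exp (-(‖y‖ ^ 2 / 4)) • w y := by
  have hg := kernelDecay_gaussian' (d := d) (d + 2) (by positivity)
  obtain ⟨K, hK0, hK⟩ := hg.bound
  exact integrable_mul_of_decay (a := d + 2) (b := -1) (by linarith) hK0 hg.1.continuous hw hK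
    (by simpa using hC)

lemma continuous_gaussLap : Continuous (gaussLap d) := by
  unfold gaussLap
  fun_prop

lemma exists_gaussLap_le (a : ℝ) (ha : 0 ≤ a) :
    ∃ C : ℝ, 0 ≤ C ∧ ∀ y, ‖gaussLap d y‖ ≤ C * (1 + ‖y‖) ^ (-a) := by
  obtain ⟨K, hK0, hK⟩ := (kernelDecay_gaussian' (d := d) (a + 2) (by positivity)).bound
  refine ⟨K * (1 + d), by positivity, fun y => ?_⟩
  have hy : 0 < 1 + ‖y‖ := by positivity
  have hn := norm_nonneg y
  have h1 : ‖‖y‖ ^ 2 / 4 - d / 2‖ ≤ (1 + d) * (1 + ‖y‖) ^ 2 := by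
    have hd : (0 : ℝ) ≤ d := by positivity
    rw [Real.norm_eq_abs, abs_le]
    constructor <;> nlinarith [mul_nonneg hd hn, mul_nonneg hd (sq_nonneg ‖y‖)]
  rw [gaussLap, norm_mul]
  calc _ ≤ ((1 + d) * (1 + ‖y‖) ^ 2) * (K * (1 + ‖y‖) ^ (-(a + 2))) := by
        gcongr
        exact hK y
    _ = K * (1 + d) * ((1 + ‖y‖) ^ (2 : ℕ) * (1 + ‖y‖) ^ (-(a + 2))) := by ring
    _ = _ := by
        rw [← Real.rpow_natCast, ← Real.rpow_add hy]
        congr 2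
        push_cast
        ring

lemma integral_gaussian_spaceLap {T : ℝ}
    {F : ℝ × EuclideanSpace ℝ (Fin d) → EuclideanSpace ℝ (Fin d)} (hF : PeriodicSmooth T F) {t : ℝ}
    (ht : t ∈ Ioo 0 T) (X : EuclideanSpace ℝ (Fin d)) {σ : ℝ} (hσ : σ ≠ 0) :
    ∫ y, Real.exp (-(‖y‖ ^ 2 / 4)) • spaceLap F (t, X + σ • y)
      = (σ⁻¹ ^ 2) • ∫ y, gaussLap d y • F (t, X + σ • y) := by
  set e : Fin d → ℝ × EuclideanSpace ℝ (Fin d) := fun i => (0, EuclideanSpace.single i 1) with he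
  have h1 : ∀ i, ∫ y, Real.exp (-(‖y‖ ^ 2 / 4)) • fderiv ℝ (fun q => fderiv ℝ F q (e i))
      (t, X + σ • y) (e i) = ∫ y, σ⁻¹ • (1 / 2 : ℝ) • Real.exp (-(‖y‖ ^ 2 / 4)) • y i •
        fderiv ℝ F (t, X + σ • y) (e i) := fun i => by
    rw [integral_smul, ← integral_gaussian_smul_fderiv ((hF.dir (e i)).c1Decay_slice ht X σ) i,
      ← integral_smul]
    refine integral_congr_ae (Filter.Eventually.of_forall fun y => ?_)
    simp only
    rw [(hF.dir (e i)).fderiv_slice ht, smul_comm σ⁻¹, inv_smul_smul₀ hσ]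
  have b1 : ∀ i, ∃ C, ∀ y, ‖fderiv ℝ (fun q => fderiv ℝ F q (e i)) (t, X + σ • y) (e i)‖ ≤ C :=
    fun i => by
      obtain ⟨D, -, hD⟩ := ((hF.dir (e i)).dir (e i)).exists_bound ht.1 ht.2
      exact ⟨D, fun y => hD t ⟨le_rfl, le_rfl⟩ _⟩
  have b2 : ∀ i, ∃ C, 0 ≤ C ∧ ∀ y, ‖fderiv ℝ F (t, X + σ • y) (e i)‖ ≤ C := fun i => by
      obtain ⟨D, hD0, hD⟩ := (hF.dir (e i)).exists_bound ht.1 ht.2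
      exact ⟨D, hD0, fun y => hD t ⟨le_rfl, le_rfl⟩ _⟩
  simp only [spaceLap, Finset.smul_sum]
  rw [integral_finsetSum]
  swap
  · intro i _
    obtain ⟨C, hC⟩ := b1 i
    refine integrable_gaussian_smul (C := C)
      (((hF.dir (e i)).dir (e i)).contDiff_slice ht X σ).continuous fun y => (hC y).trans ?_
    have := (norm_nonneg _).trans (hC y)
    nlinarith [norm_nonneg y]
  rw [Finset.sum_congr rfl fun i _ => h1 i, ← integral_finsetSum]
  swap
  · intro i _
    obtain ⟨C, hC0, hC⟩ := b2 i
    have hInt : Integrable fun y => Real.exp (-(‖y‖ ^ 2 / 4)) • y i •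
        fderiv ℝ F (t, X + σ • y) (e i) := by
      refine integrable_gaussian_smul (C := C) ?_ fun y => ?_
      swap
      · rw [norm_smul, mul_comm]
        exact mul_le_mul (hC y) ((norm_apply_le_norm y i).trans (by linarith)) (norm_nonneg _) hC0
      have := ((hF.dir (e i)).contDiff_slice ht X σ).continuous
      fun_prop
    exact (hInt.smul (1 / 2 : ℝ)).smul σ⁻¹
  have h2 : ∀ y : EuclideanSpace ℝ (Fin d), ∑ i, σ⁻¹ • (1 / 2 : ℝ) • Real.exp (-(‖y‖ ^ 2 / 4)) •
      y i • fderiv ℝ F (t, X + σ • y) (e i) = (σ⁻¹ ^ 2 * (1 / 2)) • Real.exp (-(‖y‖ ^ 2 / 4)) •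
        fderiv ℝ (fun y => F (t, X + σ • y)) y y := fun y => by
    have e3 : ((0 : ℝ), y) = ∑ i, y i • e i := by
      have : y = ∑ i, y i • EuclideanSpace.single i (1 : ℝ) := by
        ext j; simp [Finset.sum_apply, Pi.single_apply]
      simp only [he, Prod.smul_mk, smul_zero]
      rw [Prod.ext_iff]
      simpa [Prod.fst_sum, Prod.snd_sum] using this
    rw [hF.fderiv_slice ht, e3, map_sum, Finset.smul_sum, Finset.smul_sum, Finset.smul_sum]
    refine Finset.sum_congr rfl fun i _ => ?_
    rw [map_smul]
    simp only [smul_smul]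
    congr 1
    field_simp
  simp only [h2]
  rw [integral_smul, integral_gaussian_fderiv_apply_self (hF.c1Decay_slice ht X σ), smul_smul]
  congr 1
  ring

lemma integral_gaussLap_smul_const (c : EuclideanSpace ℝ (Fin d)) :
    ∫ y, gaussLap d y • c = 0 := by
  have h := integral_gaussian_fderiv_apply_self (KernelDecay.const (E := EuclideanSpace ℝ (Fin d))
    c).c1Decay
  simpa using h.symm

/-- The equation of motion of a Gaussian average of the velocity with moving centre and width. -/
lemma NavierStokes.hasDerivAt_gaussian_average (hd : 2 ≤ d) {T ν : ℝ}
    {U : ℝ × EuclideanSpace ℝ (Fin d) → EuclideanSpace ℝ (Fin d)}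
    {P : ℝ × EuclideanSpace ℝ (Fin d) → ℝ} (hU : NavierStokes T ν U P) {t : ℝ} (ht : t ∈ Ioo 0 T)
    {X : ℝ → EuclideanSpace ℝ (Fin d)} {X' : EuclideanSpace ℝ (Fin d)} (hX : HasDerivAt X X' t)
    {σ : ℝ → ℝ} {σ' : ℝ} (hσ : HasDerivAt σ σ' t) (hσ0 : σ t ≠ 0) :
    HasDerivAt (fun s => ∫ y, Real.exp (-(‖y‖ ^ 2 / 4)) • U (s, X s + σ s • y))
      ((σ t)⁻¹ • (∫ y, fderiv ℝ (testMat d 0) y (U (t, X t + σ t • y) - X')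
        (U (t, X t + σ t • y) - X'))
        + (ν * (σ t)⁻¹ ^ 2 + 2 * σ' * (σ t)⁻¹) • ∫ y, gaussLap d y • (U (t, X t + σ t • y) - X')) t := by
  have hs := hU.velocity.smooth
  obtain ⟨K, hK0, hK⟩ := (kernelDecay_gaussian' (d := d) (d + 2) (by positivity)).bound
  have hgc := (kernelDecay_gaussian' (d := d) (d + 2) (by positivity)).1.continuous
  have h0 := hasDerivAt_integral_mollified (a := d + 2) (by linarith) hgc hK hs ht hX hσ
  convert h0 using 1
  set w : EuclideanSpace ℝ (Fin d) → EuclideanSpace ℝ (Fin d) :=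
    fun y => U (t, X t + σ t • y) - X' with hw
  set B : ℝ × EuclideanSpace ℝ (Fin d) → EuclideanSpace ℝ (Fin d) :=
    fun q => σ t • (fderiv ℝ U q (1, X') + (-ν) • spaceLap U q) with hB
  have hBS : Solenoidal T B := ((hU.velocity.dir (1, X')).add (hU.velocity.spaceLap.smul (-ν))).smul (σ t)
  have hUc := hs.c1Decay_slice ht (X t) (σ t)
  have hwc : C1Decay 0 w := by
    have := (hs.add (F' := fun _ => -X') ⟨contDiffOn_const, fun _ _ => rfl⟩).c1Decay_slice ht
      (X t) (σ t)
    simpa only [← sub_eq_add_neg] using this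
  have hwd : ∀ y v, fderiv ℝ w y v = σ t • fderiv ℝ U (t, X t + σ t • y) (0, v) := fun y v => by
    rw [← hs.fderiv_slice ht, hw, fderiv_sub_const]
  have key := integral_gaussian_eq hd (w := w) (b := fun y => B (t, X t + σ t • y))
    (P := fun y => P (t, X t + σ t • y))
    hwc (hBS.smooth.c1Decay_slice ht (X t) (σ t)) (hU.pressure.c1Decay_slice ht (X t) (σ t))
    (fun y => by
      rw [← hU.velocity.divg_slice ht (X t) (σ t) y]
      simp only [divg, hw, fderiv_sub_const])
    (fun y => hBS.divg_slice ht (X t) (σ t) y) (fun y e => by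
      have h := hU.momentum (t, X t + σ t • y) ht e
      have e1 : ((1 : ℝ), U (t, X t + σ t • y)) = (1, X') + (0, w y) := by
        simp [hw]
      rw [e1, map_add] at h
      rw [hwd, hU.pressure.fderiv_slice ht, hB]
      simp only [inner_add_left, real_inner_smul_left, smul_eq_mul] at h ⊢
      linear_combination (σ t) * h)
  have i1 : ∀ {f : EuclideanSpace ℝ (Fin d) → EuclideanSpace ℝ (Fin d)}, C1Decay 0 f →
      Integrable fun y => gaussLap d y • f y := fun {f} hf => by
    obtain ⟨C, hC0, hC⟩ := hf.exists_bound
    obtain ⟨C', hC'0, hC'⟩ := exists_gaussLap_le (d := d) (d + 2) (by positivity)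
    exact integrable_mul_of_decay (a := d + 2) (b := 0) (by linarith) hC'0 continuous_gaussLap
      hf.contDiff.continuous hC' (by simpa using fun y => (hC y).1)
  have i2 : ∀ {f : EuclideanSpace ℝ (Fin d) → EuclideanSpace ℝ (Fin d)}, C1Decay 0 f →
      Integrable fun y => Real.exp (-(‖y‖ ^ 2 / 4)) • f y := fun {f} hf => by
    obtain ⟨C, hC0, hC⟩ := hf.exists_bound
    exact integrable_gaussian_smul hf.contDiff.continuous (C := C) fun y =>
      (hC y).1.trans (by nlinarith [norm_nonneg y])
  have i3 : Integrable fun y => Real.exp (-(‖y‖ ^ 2 / 4)) • fderiv ℝ w y y := by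
    obtain ⟨C, hC0, hC⟩ := hwc.exists_bound
    refine integrable_gaussian_smul (C := C) (hwc.continuous_fderiv.clm_apply continuous_id)
      fun y => (ContinuousLinearMap.le_opNorm _ _).trans ?_
    exact mul_le_mul (hC y).2 (by linarith) (norm_nonneg _) hC0
  have hlap := integral_gaussian_spaceLap hs ht (X t) hσ0
  have hw0 : ∫ y, gaussLap d y • U (t, X t + σ t • y) = ∫ y, gaussLap d y • w y := by
    have e1 : ∀ y, gaussLap d y • U (t, X t + σ t • y) = gaussLap d y • w y + gaussLap d y • X' :=
      fun y => by rw [hw, ← smul_add, sub_add_cancel]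
    simp only [e1]
    rw [integral_add (i1 hwc) (i1 (KernelDecay.const X').c1Decay), integral_gaussLap_smul_const,
      add_zero]
  have e2 : ∀ y, Real.exp (-(‖y‖ ^ 2 / 4)) • fderiv ℝ U (t, X t + σ t • y) (1, X' + σ' • y)
      = (σ t)⁻¹ • (Real.exp (-(‖y‖ ^ 2 / 4)) • B (t, X t + σ t • y))
        + ν • (Real.exp (-(‖y‖ ^ 2 / 4)) • spaceLap U (t, X t + σ t • y))
        + (σ' * (σ t)⁻¹) • (Real.exp (-(‖y‖ ^ 2 / 4)) • fderiv ℝ w y y) := fun y => by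
    have e3 : ((1 : ℝ), X' + σ' • y) = (1, X') + σ' • (0, y) := by simp
    rw [e3, map_add, map_smul, hwd, hB]
    simp only [smul_smul, smul_add, neg_smul, smul_neg]
    have : (σ t)⁻¹ * σ t = 1 := inv_mul_cancel₀ hσ0
    match_scalars <;> field_simp
    ring
  simp only [e2]
  have j1 := (i2 (hBS.smooth.c1Decay_slice ht (X t) (σ t))).fun_smul (σ t)⁻¹
  have j2 := (i2 (hU.velocity.spaceLap.smooth.c1Decay_slice ht (X t) (σ t))).fun_smul ν
  have j3 := i3.fun_smul (σ' * (σ t)⁻¹)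
  rw [integral_add (j1.fun_add j2) j3, integral_add j1 j2]
  rw [integral_smul, integral_smul, integral_smul, key, hlap, hw0,
    integral_gaussian_fderiv_apply_self hwc]
  module

end NavierStokesIdentity

section Normalisation

variable {d : ℕ}

open scoped InnerProductSpace Topology

lemma kernelDecay_gaussLap (a : ℝ) (ha : 0 ≤ a) : KernelDecay a (gaussLap d) := by
  have h0 := kernelDecay_gaussian' (d := d) a ha
  have h1 := kernelDecay_gaussian' (d := d) (a + 2) (by linarith)
  have hl := KernelDecay.linear (ContinuousLinearMap.id ℝ (EuclideanSpace ℝ (Fin d)))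
  have h2 := (hl.bilin (innerSL ℝ) hl).clm_comp ((1 / 4 : ℝ) • ContinuousLinearMap.id ℝ ℝ)
  have h3 := (h2.bilin (ContinuousLinearMap.lsmul ℝ ℝ) h1).mono (a := a) (by linarith)
  have h4 := h3.add (h0.clm_comp (((-(d : ℝ) / 2)) • ContinuousLinearMap.id ℝ ℝ))
  refine (congrArg (KernelDecay a) (funext fun y => ?_)).mp h4
  have : (innerSL ℝ y) y = ‖y‖ ^ 2 := by rw [innerSL_apply_apply, real_inner_self_eq_norm_sq]
  simp only [ContinuousLinearMap.id_apply, smul_apply, ContinuousLinearMap.lsmul_apply, this,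
    smul_eq_mul, gaussLap]
  ring

/-- The normalising constant of the Gaussian `exp (-‖y‖ ^ 2 / 4)`. -/
noncomputable def gaussConst (d : ℕ) : ℝ :=
  (∫ y : EuclideanSpace ℝ (Fin d), Real.exp (-(‖y‖ ^ 2 / 4)))⁻¹

/-- The heat kernel at time one. -/
noncomputable def gauss (d : ℕ) (y : EuclideanSpace ℝ (Fin d)) : ℝ :=
  gaussConst d * Real.exp (-(‖y‖ ^ 2 / 4))

/-- The Laplacian of `gauss`. -/
noncomputable def lapKernel (d : ℕ) (y : EuclideanSpace ℝ (Fin d)) : ℝ :=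
  gaussConst d * gaussLap d y

/-- The kernel expressing the mollified acceleration in terms of velocity differences. -/
noncomputable def stressKernel (d : ℕ) (y : EuclideanSpace ℝ (Fin d)) :
    EuclideanSpace ℝ (Fin d) →L[ℝ] EuclideanSpace ℝ (Fin d) →L[ℝ] EuclideanSpace ℝ (Fin d) :=
  gaussConst d • fderiv ℝ (testMat d 0) y

lemma kernelDecay_gauss (a : ℝ) (ha : 0 ≤ a) : KernelDecay a (gauss d) :=
  (kernelDecay_gaussian' a ha).clm_comp (gaussConst d • ContinuousLinearMap.id ℝ ℝ)

lemma kernelDecay_lapKernel (a : ℝ) (ha : 0 ≤ a) : KernelDecay a (lapKernel d) :=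
  (kernelDecay_gaussLap a ha).clm_comp (gaussConst d • ContinuousLinearMap.id ℝ ℝ)

lemma kernelDecay_stressKernel (hd : 2 ≤ d) : KernelDecay ((d : ℝ) + 1) (stressKernel d) :=
  (kernelDecay_testMat_zero hd).fderiv.clm_comp (gaussConst d • ContinuousLinearMap.id ℝ _)

lemma integrable_gaussian :
    Integrable fun y : EuclideanSpace ℝ (Fin d) => Real.exp (-(‖y‖ ^ 2 / 4)) := by
  have h := kernelDecay_gaussian' (d := d) (d + 1) (by positivity)
  obtain ⟨C, -, hC⟩ := h.bound
  exact integrable_of_decay (by linarith) h.1.continuous hC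

lemma gaussConst_pos : 0 < gaussConst d :=
  inv_pos.2 (integral_exp_pos integrable_gaussian)

lemma gauss_nonneg (y : EuclideanSpace ℝ (Fin d)) : 0 ≤ gauss d y :=
  mul_nonneg gaussConst_pos.le (Real.exp_pos _).le

lemma integral_gauss : ∫ y, gauss d y = 1 := by
  simp only [gauss]
  rw [integral_const_mul]
  exact inv_mul_cancel₀ (ne_of_gt (integral_exp_pos integrable_gaussian))

/-- The equation of motion of a normalised Gaussian average of the velocity. -/
lemma NavierStokes.hasDerivAt_average (hd : 2 ≤ d) {T ν : ℝ}
    {U : ℝ × EuclideanSpace ℝ (Fin d) → EuclideanSpace ℝ (Fin d)}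
    {P : ℝ × EuclideanSpace ℝ (Fin d) → ℝ} (hU : NavierStokes T ν U P) {t : ℝ} (ht : t ∈ Ioo 0 T)
    {X : ℝ → EuclideanSpace ℝ (Fin d)} {X' : EuclideanSpace ℝ (Fin d)} (hX : HasDerivAt X X' t)
    {σ : ℝ → ℝ} {σ' : ℝ} (hσ : HasDerivAt σ σ' t) (hσ0 : σ t ≠ 0) :
    HasDerivAt (fun s => ∫ y, gauss d y • U (s, X s + σ s • y))
      ((σ t)⁻¹ • (∫ y, stressKernel d y (U (t, X t + σ t • y) - X')
        (U (t, X t + σ t • y) - X'))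
        + (ν * (σ t)⁻¹ ^ 2 + 2 * σ' * (σ t)⁻¹) •
          ∫ y, lapKernel d y • (U (t, X t + σ t • y) - X')) t := by
  have h := (hU.hasDerivAt_gaussian_average hd ht hX hσ hσ0).fun_const_smul (gaussConst d)
  have e : (fun s => ∫ y, gauss d y • U (s, X s + σ s • y))
      = fun s => gaussConst d • ∫ y, Real.exp (-(‖y‖ ^ 2 / 4)) • U (s, X s + σ s • y) := by
    simp only [gauss, mul_smul, integral_smul]
  rw [e]
  refine h.congr_deriv ?_
  simp only [stressKernel, lapKernel, smul_apply, mul_smul, integral_smul]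
  module

/-- Componentwise form of the Navier--Stokes equations. -/
lemma navierStokes_of_components {T ν : ℝ}
    {u : ℝ → EuclideanSpace ℝ (Fin d) → EuclideanSpace ℝ (Fin d)}
    {p : ℝ → EuclideanSpace ℝ (Fin d) → ℝ}
    (hu : ContDiffOn ℝ (⊤ : ℕ∞) (fun q : ℝ × EuclideanSpace ℝ (Fin d) => u q.1 q.2)
      (Ioo 0 T ×ˢ univ))
    (hp : ContDiffOn ℝ (⊤ : ℕ∞) (fun q : ℝ × EuclideanSpace ℝ (Fin d) => p q.1 q.2)
      (Ioo 0 T ×ˢ univ))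
    (hup : ∀ t x (n : Fin d → ℤ), u t (x + latticeVec n) = u t x)
    (hpp : ∀ t x (n : Fin d → ℤ), p t (x + latticeVec n) = p t x)
    (hns : ∀ t ∈ Ioo (0 : ℝ) T, ∀ (x : EuclideanSpace ℝ (Fin d)) (i : Fin d),
      deriv (fun s => u s x i) t
          + ∑ j, u t x j * fderiv ℝ (fun y => u t y i) x (EuclideanSpace.single j 1)
          + fderiv ℝ (fun y => p t y) x (EuclideanSpace.single i 1)
        = ν * ∑ j, fderiv ℝ (fun y => fderiv ℝ (fun z => u t z i) y
            (EuclideanSpace.single j 1)) x (EuclideanSpace.single j 1))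
    (hdiv : ∀ t ∈ Ioo (0 : ℝ) T, ∀ x : EuclideanSpace ℝ (Fin d),
      ∑ i, fderiv ℝ (fun y => u t y i) x (EuclideanSpace.single i 1) = 0) :
    NavierStokes T ν (fun q => u q.1 q.2) (fun q => p q.1 q.2) := by
  set U : ℝ × EuclideanSpace ℝ (Fin d) → EuclideanSpace ℝ (Fin d) := fun q => u q.1 q.2 with hU
  set P : ℝ × EuclideanSpace ℝ (Fin d) → ℝ := fun q => p q.1 q.2 with hP
  have hUs : PeriodicSmooth T U := ⟨hu, fun q n => by simp [hU, hup]⟩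
  have hPs : PeriodicSmooth T P := ⟨hp, fun q n => by simp [hP, hpp]⟩
  have hx : ∀ {F : ℝ × EuclideanSpace ℝ (Fin d) → EuclideanSpace ℝ (Fin d)},
      PeriodicSmooth T F → ∀ t ∈ Ioo 0 T, ∀ x i v,
      fderiv ℝ (fun y => F (t, y) i) x v = (fderiv ℝ F (t, x) (0, v)) i := fun {F} hF t ht x i v => by
    have h1 := hF.hasFDerivAt_slice ht 0 1 x
    simp only [zero_add, one_smul] at h1
    have h2 : HasFDerivAt (fun y => F (t, y) i) _ x :=
      (EuclideanSpace.proj (𝕜 := ℝ) i).hasFDerivAt.comp x h1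
    rw [h2.fderiv]
    simp
  have hxs : ∀ t ∈ Ioo 0 T, ∀ x v, fderiv ℝ (fun y => p t y) x v = fderiv ℝ P (t, x) (0, v) :=
    fun t ht x v => by
    have h1 := hPs.hasFDerivAt_slice ht 0 1 x
    simp only [zero_add, one_smul] at h1
    have h2 : HasFDerivAt (fun y => p t y) _ x := h1
    rw [h2.fderiv]
    simp
  have ht' : ∀ t ∈ Ioo 0 T, ∀ x i, deriv (fun s => u s x i) t = (fderiv ℝ U (t, x) (1, 0)) i :=
    fun t ht x i => by
    have h1 := (hUs.hasFDerivAt (q := (t, x)) ht).comp_hasDerivAt t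
      ((hasDerivAt_id t).prodMk (hasDerivAt_const t x))
    have h2 := (EuclideanSpace.proj (𝕜 := ℝ) i).hasFDerivAt.comp_hasDerivAt t h1
    exact h2.deriv
  refine ⟨⟨hUs, fun q hq => ?_⟩, hPs, fun q hq e => ?_⟩
  · rw [← hdiv q.1 hq q.2, spaceDiv]
    exact Finset.sum_congr rfl fun i _ => (hx hUs q.1 hq q.2 i _).symm
  · obtain ⟨t, x⟩ := q
    have hsum : ∀ v : EuclideanSpace ℝ (Fin d), v = ∑ i, v i • EuclideanSpace.single i (1 : ℝ) :=
      fun v => by ext j; simp [Finset.sum_apply, Pi.single_apply]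
    have e0 : ∀ v : EuclideanSpace ℝ (Fin d), ((0 : ℝ), v)
        = ∑ i, v i • ((0 : ℝ), EuclideanSpace.single i (1 : ℝ)) := fun v => by
      rw [Prod.ext_iff]
      simpa [Prod.fst_sum, Prod.snd_sum] using hsum v
    have e1 : ((1 : ℝ), U (t, x)) = (1, 0) + (0, U (t, x)) := by simp
    rw [inner_eq_sum, e0 e, map_sum, ← Finset.sum_neg_distrib]
    refine Finset.sum_congr rfl fun i _ => ?_
    have h := hns t hq x i
    rw [ht' t hq, hxs t hq] at h
    have h2 : ∀ j, fderiv ℝ (fun y => fderiv ℝ (fun z => u t z i) y (EuclideanSpace.single j 1)) x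
        (EuclideanSpace.single j 1) = (fderiv ℝ (fun q => fderiv ℝ U q
          (0, EuclideanSpace.single j 1)) (t, x) (0, EuclideanSpace.single j 1)) i := fun j => by
      rw [← hx (hUs.dir (0, EuclideanSpace.single j 1)) t hq]
      congr 2
      exact funext fun y => hx hUs t hq y i _
    have h3 : ∀ j, fderiv ℝ (fun y => u t y i) x (EuclideanSpace.single j 1)
        = (fderiv ℝ U (t, x) (0, EuclideanSpace.single j 1)) i := fun j => hx hUs t hq x i _
    simp only [h2, h3] at h
    rw [e1, map_add, e0 (U (t, x)), map_sum, map_smul]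
    simp only [spaceLap, PiLp.add_apply, PiLp.smul_apply, smul_eq_mul, map_smul,
      WithLp.ofLp_sum, Finset.sum_apply]
    linear_combination (e i) * h

end Normalisation

section Liouville

variable {d : ℕ}

open scoped InnerProductSpace Topology NNReal

lemma exists_abs_det_sub_one_le {η : ℝ} (hη : 0 < η) :
    ∃ δ : ℝ, 0 < δ ∧ ∀ A : EuclideanSpace ℝ (Fin d) →L[ℝ] EuclideanSpace ℝ (Fin d), ‖A‖ ≤ δ →
      ∑ i, A (EuclideanSpace.single i 1) i = 0 →
      |(ContinuousLinearMap.id ℝ _ + A).det - 1| ≤ η * ‖A‖ := by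
  set b := (EuclideanSpace.basisFun (Fin d) ℝ).toBasis with hb
  set m : (EuclideanSpace ℝ (Fin d) →L[ℝ] EuclideanSpace ℝ (Fin d)) → Matrix (Fin d) (Fin d) ℝ :=
    fun A => LinearMap.toMatrix b b (A : EuclideanSpace ℝ (Fin d) →ₗ[ℝ] EuclideanSpace ℝ (Fin d))
    with hm
  have hdet : ∀ A, A.det = (m A).det := fun A => (LinearMap.det_toMatrix b _).symm
  have hentry : ∀ A i j, m A i j = A (EuclideanSpace.single j 1) i := fun A i j => by
    simp [hm, hb, LinearMap.toMatrix_apply]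
  have hcd : Differentiable ℝ fun A : EuclideanSpace ℝ (Fin d) →L[ℝ] EuclideanSpace ℝ (Fin d) =>
      (ContinuousLinearMap.id ℝ _ + A).det := by
    simp only [hdet, Matrix.det_apply, hentry]
    refine Differentiable.fun_sum fun σ _ => ?_
    refine Differentiable.fun_const_smul ?_ _
    have : ∀ i : Fin d, ContDiff ℝ 1
        fun A : EuclideanSpace ℝ (Fin d) →L[ℝ] EuclideanSpace ℝ (Fin d) =>
        (ContinuousLinearMap.id ℝ (EuclideanSpace ℝ (Fin d)) + A) (EuclideanSpace.single i 1)
          (σ i) := fun i => by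
      simp only [add_apply, PiLp.add_apply]
      refine contDiff_const.add ?_
      exact ((EuclideanSpace.proj (𝕜 := ℝ) (σ i)).comp
        (ContinuousLinearMap.apply ℝ _ (EuclideanSpace.single i (1 : ℝ)))).contDiff
    exact (contDiff_prod fun i _ => this i).differentiable one_ne_zero
  set L := fderiv ℝ (fun A : EuclideanSpace ℝ (Fin d) →L[ℝ] EuclideanSpace ℝ (Fin d) =>
      (ContinuousLinearMap.id ℝ _ + A).det) 0 with hL
  have hLt : ∀ A, L A = ∑ i, A (EuclideanSpace.single i 1) i := fun A => by
    have h1 := (hcd 0).hasFDerivAt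
    have h2 : HasDerivAt (fun r : ℝ => r • A) A 0 := by
      simpa using (hasDerivAt_id (0 : ℝ)).smul_const A
    have h1' : HasFDerivAt (fun A : EuclideanSpace ℝ (Fin d) →L[ℝ] EuclideanSpace ℝ (Fin d) =>
      (ContinuousLinearMap.id ℝ _ + A).det) L ((fun r : ℝ => r • A) 0) := by
      have hz : (fun r : ℝ => r • A) 0 = 0 := zero_smul ℝ A
      rw [hz]
      exact h1
    have h3 := h1'.comp_hasDerivAt (0 : ℝ) h2
    have h4 : HasDerivAt (fun r : ℝ => (ContinuousLinearMap.id ℝ _ + r • A).det)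
        (∑ i, A (EuclideanSpace.single i 1) i) 0 := by
      have h5 : ∀ r : ℝ, (ContinuousLinearMap.id ℝ _ + r • A).det = 1 + (m A).trace * r +
          (Matrix.det (1 + (Polynomial.X : Polynomial ℝ) • (m A).map Polynomial.C)).divX.divX.eval r
            * r ^ 2 := fun r => by
        rw [← Matrix.det_one_add_smul, hdet]
        congr 1
        simp [hm]
      have h6 : (m A).trace = ∑ i, A (EuclideanSpace.single i 1) i := by
        simp [Matrix.trace, hentry]
      simp only [h5, h6]
      have h7 : HasDerivAt (fun r : ℝ => (Matrix.det (1 + (Polynomial.X : Polynomial ℝ) •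
        (m A).map Polynomial.C)).divX.divX.eval r * r ^ 2) 0 0 := by
        simpa using (((Polynomial.hasDerivAt (Matrix.det (1 + (Polynomial.X : Polynomial ℝ) •
        (m A).map Polynomial.C)).divX.divX (0 : ℝ)).fun_mul ((hasDerivAt_id' (0 : ℝ)).fun_pow 2)))
      have h8 := (((hasDerivAt_id' (0 : ℝ)).const_mul
        (∑ i, A (EuclideanSpace.single i 1) i)).const_add 1).fun_add h7
      simpa using h8
    exact h3.unique h4
  have h0 := (hcd 0).hasFDerivAt.isLittleO
  rw [Asymptotics.isLittleO_iff] at h0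
  obtain ⟨δ, hδ, h⟩ := Metric.eventually_nhds_iff.1 (h0 hη)
  refine ⟨δ / 2, by positivity, fun A hA hA0 => ?_⟩
  have := h (y := A) (by rw [dist_zero_right]; linarith)
  rw [← hL, sub_zero, hLt, hA0] at this
  simpa [ContinuousLinearMap.det] using this

lemma integrable_of_eq_zero_of_lt_norm {F : EuclideanSpace ℝ (Fin d) → ℝ} (hF : Continuous F)
    {R : ℝ} (hR : ∀ x, R < ‖x‖ → F x = 0) : Integrable F :=
  hF.integrable_of_hasCompactSupport (HasCompactSupport.intro (isCompact_closedBall 0 R)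
    fun x hx => hR x (by simpa using hx))

lemma norm_integral_le_of_eq_zero_of_lt_norm {F : EuclideanSpace ℝ (Fin d) → ℝ} {R S : ℝ}
    (hR : ∀ x, R < ‖x‖ → F x = 0) (hS : ∀ x, ‖F x‖ ≤ S) :
    ‖∫ x, F x‖ ≤ S * volume.real (Metric.closedBall (0 : EuclideanSpace ℝ (Fin d)) R) := by
  have h : ∀ x, ‖F x‖ ≤ (Metric.closedBall (0 : EuclideanSpace ℝ (Fin d)) R).indicator
      (fun _ => S) x := fun x => by
    by_cases hx : x ∈ Metric.closedBall (0 : EuclideanSpace ℝ (Fin d)) R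
    · rw [indicator_of_mem hx]; exact hS x
    · rw [indicator_of_notMem hx, hR x (by simpa using hx), norm_zero]
  have hb : IsFiniteMeasure (volume.restrict (Metric.closedBall (0 : EuclideanSpace ℝ (Fin d)) R)) :=
    isFiniteMeasure_restrict.2 (isCompact_closedBall _ _).measure_lt_top.ne
  refine (norm_integral_le_of_norm_le ?_ (Filter.Eventually.of_forall h)).trans_eq ?_
  · exact (integrable_indicator_iff measurableSet_closedBall).2 (integrable_const S)
  · rw [integral_indicator_const _ measurableSet_closedBall, smul_eq_mul, mul_comm]

/-- A small displacement along a divergence-free field preserves integrals to first order. -/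
lemma eventually_integral_comp_add_smul_sub_le
    {w : EuclideanSpace ℝ (Fin d) → EuclideanSpace ℝ (Fin d)} {K : ℝ≥0} {D : ℝ}
    (hw : Differentiable ℝ w) (hK : LipschitzWith K w) (hD : ∀ x, ‖w x‖ ≤ D)
    (hdiv : ∀ x, divg w x = 0) {F : EuclideanSpace ℝ (Fin d) → ℝ} (hF : Continuous F) {R : ℝ}
    (hR : ∀ x, R < ‖x‖ → F x = 0) {η : ℝ} (hη : 0 < η) :
    ∀ᶠ ε in 𝓝 (0 : ℝ), |(∫ b, F (b + ε • w b)) - ∫ b, F b| ≤ η * |ε| := by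
  have hsupp : HasCompactSupport F := HasCompactSupport.intro (isCompact_closedBall 0 R)
    fun x hx => hR x (by simpa using hx)
  obtain ⟨S, hS⟩ := hsupp.exists_bound_of_continuous hF
  have hS0 : 0 ≤ S := (norm_nonneg _).trans (hS 0)
  have hD0 : 0 ≤ D := (norm_nonneg _).trans (hD 0)
  set V := volume.real (Metric.closedBall (0 : EuclideanSpace ℝ (Fin d)) (R + D))
  have hV0 : 0 ≤ V := measureReal_nonneg
  obtain ⟨δ, hδ, hdet⟩ := exists_abs_det_sub_one_le (d := d)
    (η := η / (K * S * V + 1)) (by positivity)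
  have h1 : ∀ᶠ ε in 𝓝 (0 : ℝ), |ε| * (K + 1) < min δ 1 := by
    have h0 : Filter.Tendsto (fun ε : ℝ => |ε| * ((K : ℝ) + 1)) (𝓝 0) (𝓝 (|0| * ((K : ℝ) + 1))) :=
      Continuous.tendsto (by fun_prop) 0
    exact h0.eventually_lt_const (by simp [hδ])
  filter_upwards [h1] with ε hε
  have hεδ : |ε| * K ≤ δ := by
    have := hε.trans_le (min_le_left _ _)
    nlinarith [abs_nonneg ε]
  have hε1 : |ε| * K < 1 := by
    have := hε.trans_le (min_le_right _ _)
    nlinarith [abs_nonneg ε]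
  have hε2 : |ε| ≤ 1 := by
    have := hε.trans_le (min_le_right _ _)
    nlinarith [abs_nonneg ε, mul_nonneg (abs_nonneg ε) K.2]
  set g : EuclideanSpace ℝ (Fin d) → EuclideanSpace ℝ (Fin d) := fun b => b + ε • w b with hg
  have hgc : Continuous g := continuous_id.add (hw.continuous.const_smul ε)
  have hg' : ∀ b, HasFDerivAt g (ContinuousLinearMap.id ℝ _ + ε • fderiv ℝ w b) b := fun b =>
    (hasFDerivAt_id b).add ((hw b).hasFDerivAt.const_smul ε)
  have happ : ApproximatesLinearOn g
      ((ContinuousLinearEquiv.refl ℝ (EuclideanSpace ℝ (Fin d)) :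
        EuclideanSpace ℝ (Fin d) ≃L[ℝ] EuclideanSpace ℝ (Fin d)) :
        EuclideanSpace ℝ (Fin d) →L[ℝ] EuclideanSpace ℝ (Fin d)) univ (‖ε‖₊ * K) := by
    intro x _ y _
    have e : g x - g y - (x - y) = ε • (w x - w y) := by simp only [hg]; module
    simp only [ContinuousLinearEquiv.coe_refl, ContinuousLinearMap.id_apply]
    rw [e, norm_smul, NNReal.coe_mul, coe_nnnorm, mul_assoc]
    gcongr
    simpa [dist_eq_norm] using hK.dist_le_mul x y
  have hc : Subsingleton (EuclideanSpace ℝ (Fin d)) ∨ ‖ε‖₊ * K <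
      ‖((ContinuousLinearEquiv.refl ℝ (EuclideanSpace ℝ (Fin d))).symm :
        EuclideanSpace ℝ (Fin d) →L[ℝ] EuclideanSpace ℝ (Fin d))‖₊⁻¹ := by
    rcases subsingleton_or_nontrivial (EuclideanSpace ℝ (Fin d)) with h | h
    · exact Or.inl h
    · right
      have : ‖((ContinuousLinearEquiv.refl ℝ (EuclideanSpace ℝ (Fin d))).symm :
        EuclideanSpace ℝ (Fin d) →L[ℝ] EuclideanSpace ℝ (Fin d))‖₊ = 1 := by
        rw [ContinuousLinearEquiv.refl_symm, ContinuousLinearEquiv.coe_refl]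
        exact NNReal.eq (by simp)
      rw [this, inv_one, ← NNReal.coe_lt_coe]
      simpa using hε1
  have hsurj := happ.surjective hc
  have hinj : InjOn g univ := happ.injOn hc
  have hcv := integral_image_eq_integral_abs_det_fderiv_smul volume MeasurableSet.univ
    (fun x _ => (hg' x).hasFDerivWithinAt) hinj F
  have hInt := integrableOn_image_iff_integrableOn_abs_det_fderiv_smul volume MeasurableSet.univ
    (fun x _ => (hg' x).hasFDerivWithinAt) hinj F
  rw [image_univ, hsurj.range_eq] at hcv hInt
  simp only [setIntegral_univ, integrableOn_univ] at hcv hInt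
  have hi := hInt.1 (integrable_of_eq_zero_of_lt_norm hF hR)
  have hz : ∀ b, R + D < ‖b‖ → F (g b) = 0 := fun b hb => by
    refine hR _ ?_
    have h2 : ‖b‖ ≤ ‖g b‖ + ‖ε • w b‖ := by
      have : b = g b - ε • w b := by simp [hg]
      calc ‖b‖ = ‖g b - ε • w b‖ := by rw [← this]
        _ ≤ _ := norm_sub_le _ _
    have h3 : ‖ε • w b‖ ≤ D := by
      rw [norm_smul, Real.norm_eq_abs]
      nlinarith [hD b, norm_nonneg (w b), abs_nonneg ε]
    linarith
  have hi' := integrable_of_eq_zero_of_lt_norm (F := fun b => F (g b)) (hF.comp hgc) hz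
  rw [hcv, ← integral_sub hi' hi, ← Real.norm_eq_abs]
  have hKn : ∀ b, ‖fderiv ℝ w b‖ ≤ K := fun b => norm_fderiv_le_of_lipschitz ℝ hK
  refine (norm_integral_le_of_eq_zero_of_lt_norm (R := R + D)
    (S := η / (K * S * V + 1) * (|ε| * K) * S) (fun b hb => by simp [hz b hb])
    fun b => ?_).trans ?_
  · have hA : ‖ε • fderiv ℝ w b‖ ≤ |ε| * K := by
      rw [norm_smul, Real.norm_eq_abs]
      gcongr
      exact hKn b
    have h4 := hdet (ε • fderiv ℝ w b) (hA.trans hεδ) (by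
      have := hdiv b
      rw [divg] at this
      simp [← Finset.mul_sum, this])
    have h5 : F (g b) - |(ContinuousLinearMap.id ℝ _ + ε • fderiv ℝ w b).det| • F (g b)
        = (|1| - |(ContinuousLinearMap.id ℝ _ + ε • fderiv ℝ w b).det|) * F (g b) := by
      rw [smul_eq_mul, abs_one]; ring
    rw [h5, norm_mul, Real.norm_eq_abs]
    refine mul_le_mul ?_ (hS _) (norm_nonneg _) (by positivity)
    refine (abs_abs_sub_abs_le_abs_sub _ _).trans ?_
    rw [abs_sub_comm]
    refine h4.trans ?_
    gcongr
  · have h6 : η / (K * S * V + 1) * (K * S * V) ≤ η := by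
      rw [div_mul_eq_mul_div, div_le_iff₀ (by positivity)]
      nlinarith
    nlinarith [abs_nonneg ε]

end Liouville

section Flow

open scoped NNReal Topology

variable {E : Type*} [NormedAddCommGroup E] [NormedSpace ℝ E]

/-- A bounded vector field that is Lipschitz in time and space. -/
structure LipschitzField (K D : ℝ≥0) (v : ℝ → E → E) : Prop where
  lipschitz : ∀ s s' x x', ‖v s x - v s' x'‖ ≤ K * (|s - s'| + ‖x - x'‖)
  bound : ∀ s x, ‖v s x‖ ≤ D

/-- `φ s t b` is the position at time `t` of the trajectory of `v` through `b` at time `s`. -/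
structure IsFlow (J : Set ℝ) (v : ℝ → E → E) (φ : ℝ → ℝ → E → E) : Prop where
  start : ∀ s ∈ J, ∀ b, φ s s b = b
  hasDerivAt : ∀ s ∈ J, ∀ t ∈ J, ∀ b, HasDerivAt (fun t => φ s t b) (v t (φ s t b)) t

variable {K D : ℝ≥0} {v : ℝ → E → E} {φ : ℝ → ℝ → E → E} {J : Set ℝ}

lemma LipschitzField.continuous (hv : LipschitzField K D v) :
    Continuous fun q : ℝ × E => v q.1 q.2 := by
  refine LipschitzWith.continuous (K := K * 2) (LipschitzWith.of_dist_le_mul fun q q' => ?_)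
  rw [dist_eq_norm, NNReal.coe_mul, mul_assoc]
  refine (hv.lipschitz _ _ _ _).trans ?_
  gcongr
  have h1 : |q.1 - q'.1| ≤ dist q q' := by
    rw [← Real.dist_eq]; exact le_max_left _ _
  have h2 : ‖q.2 - q'.2‖ ≤ dist q q' := by
    rw [← dist_eq_norm]; exact le_max_right _ _
  simp only [NNReal.coe_ofNat]
  linarith

lemma LipschitzField.lipschitzWith (hv : LipschitzField K D v) (s : ℝ) :
    LipschitzWith K (v s) :=
  LipschitzWith.of_dist_le_mul fun x y => by
    simpa [dist_eq_norm] using hv.lipschitz s s x y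

lemma LipschitzField.exists_isFlow [CompleteSpace E] (hv : LipschitzField K D v) (A B : ℝ) :
    ∃ φ, IsFlow (Ioo A B) v φ := by
  have h : ∀ s ∈ Ioo A B, ∀ b, ∃ γ : ℝ → E, γ s = b ∧
      ∀ t ∈ Ioo A B, HasDerivAt γ (v t (γ t)) t := by
    intro s hs b
    have hAB : 0 ≤ B - A := by linarith [hs.1, hs.2]
    have hp : IsPicardLindelof v (⟨s, Ioo_subset_Icc_self hs⟩ : Icc A B) b
        (D * ⟨B - A, hAB⟩) 0 D K :=
      { lipschitzOnWith := fun t _ => (hv.lipschitzWith t).lipschitzOnWith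
        continuousOn := fun x _ =>
          (hv.continuous.comp (continuous_id.prodMk continuous_const)).continuousOn
        norm_le := fun t _ x _ => hv.bound t x
        mul_max_le := by
          have : ((D * ⟨B - A, hAB⟩ : ℝ≥0) : ℝ) = D * (B - A) := rfl
          rw [this, NNReal.coe_zero, sub_zero]
          exact mul_le_mul_of_nonneg_left
            (max_le (by linarith [hs.1]) (by linarith [hs.2])) D.2 }
    obtain ⟨γ, h1, h2⟩ := hp.exists_eq_forall_mem_Icc_hasDerivWithinAt₀
    exact ⟨γ, h1, fun t ht => (h2 t (Ioo_subset_Icc_self ht)).hasDerivAt (Icc_mem_nhds ht.1 ht.2)⟩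
  choose γ h1 h2 using h
  classical
  refine ⟨fun s t b => if hs : s ∈ Ioo A B then γ s hs b t else 0, fun s hs b => ?_,
    fun s hs t ht b => ?_⟩
  · simp only [hs, dite_true, h1]
  · simp only [hs, dite_true]
    exact h2 s hs b t ht

lemma norm_sub_le_exp_mul_of_hasDerivAt (hv : LipschitzField K D v) (hJ : J.OrdConnected)
    {γ₁ γ₂ : ℝ → E} (h₁ : ∀ t ∈ J, HasDerivAt γ₁ (v t (γ₁ t)) t)
    (h₂ : ∀ t ∈ J, HasDerivAt γ₂ (v t (γ₂ t)) t) {s t : ℝ} (hs : s ∈ J) (ht : t ∈ J) :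
    ‖γ₁ t - γ₂ t‖ ≤ Real.exp (K * |t - s|) * ‖γ₁ s - γ₂ s‖ := by
  have hm : ∀ r ∈ Icc (0 : ℝ) 1, s + r * (t - s) ∈ J := fun r hr => by
    have := hJ.uIcc_subset hs ht
    refine this ?_
    rw [← segment_eq_uIcc]
    exact ⟨1 - r, r, by linarith [hr.2], hr.1, by ring, by simp only [smul_eq_mul]; ring⟩
  have hd : ∀ {γ : ℝ → E}, (∀ t ∈ J, HasDerivAt γ (v t (γ t)) t) → ∀ r ∈ Icc (0 : ℝ) 1,
      HasDerivAt (fun r => γ (s + r * (t - s)))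
        ((t - s) • v (s + r * (t - s)) (γ (s + r * (t - s)))) r := fun {γ} h r hr => by
    have h0 : HasDerivAt (fun r : ℝ => s + r * (t - s)) (t - s) r := by
      simpa using ((hasDerivAt_id' r).mul_const (t - s)).const_add s
    exact (h _ (hm r hr)).scomp r h0
  have hd' := fun r hr => (hd h₁ r hr).fun_sub (hd h₂ r hr)
  have := norm_le_gronwallBound_of_norm_deriv_right_le (K := K * |t - s|) (ε := 0)
    (f := fun r => γ₁ (s + r * (t - s)) - γ₂ (s + r * (t - s))) (δ := ‖γ₁ s - γ₂ s‖)
    (fun r hr => (hd' r hr).continuousAt.continuousWithinAt)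
    (fun r hr => (hd' r (Ico_subset_Icc_self hr)).hasDerivWithinAt) (by simp)
    (fun r hr => by
      rw [← smul_sub, norm_smul, Real.norm_eq_abs, add_zero, mul_comm (K : ℝ), mul_assoc]
      gcongr
      simpa using hv.lipschitz (s + r * (t - s)) (s + r * (t - s))
        (γ₁ (s + r * (t - s))) (γ₂ (s + r * (t - s)))) 1 ⟨zero_le_one, le_rfl⟩
  simpa [gronwallBound_ε0, mul_comm] using this

namespace IsFlow

lemma norm_sub_le (hφ : IsFlow J v φ) (hv : LipschitzField K D v) (hJ : J.OrdConnected) {s t : ℝ}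
    (hs : s ∈ J) (ht : t ∈ J) (b b' : E) :
    ‖φ s t b - φ s t b'‖ ≤ Real.exp (K * |t - s|) * ‖b - b'‖ := by
  simpa [hφ.start s hs] using norm_sub_le_exp_mul_of_hasDerivAt hv hJ
    (fun t ht => hφ.hasDerivAt s hs t ht b) (fun t ht => hφ.hasDerivAt s hs t ht b') hs ht

lemma continuous (hφ : IsFlow J v φ) (hv : LipschitzField K D v) (hJ : J.OrdConnected) {s t : ℝ}
    (hs : s ∈ J) (ht : t ∈ J) : Continuous (φ s t) := by
  refine LipschitzWith.continuous (K := ⟨Real.exp (K * |t - s|), (Real.exp_pos _).le⟩)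
    (LipschitzWith.of_dist_le_mul fun b b' => ?_)
  rw [dist_eq_norm, dist_eq_norm]
  exact hφ.norm_sub_le hv hJ hs ht b b'

lemma eq_of_hasDerivAt (hφ : IsFlow J v φ) (hv : LipschitzField K D v) (hJ : J.OrdConnected)
    {γ : ℝ → E} (h : ∀ t ∈ J, HasDerivAt γ (v t (γ t)) t) {s t : ℝ} (hs : s ∈ J) (ht : t ∈ J) :
    γ t = φ s t (γ s) := by
  have := norm_sub_le_exp_mul_of_hasDerivAt hv hJ h
    (fun t ht => hφ.hasDerivAt s hs t ht (γ s)) hs ht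
  rw [hφ.start s hs, sub_self, norm_zero, mul_zero] at this
  exact sub_eq_zero.1 (norm_le_zero_iff.1 this)

lemma comp (hφ : IsFlow J v φ) (hv : LipschitzField K D v) (hJ : J.OrdConnected) {r s t : ℝ}
    (hr : r ∈ J) (hs : s ∈ J) (ht : t ∈ J) (b : E) : φ s t (φ r s b) = φ r t b :=
  (hφ.eq_of_hasDerivAt hv hJ (fun t ht => hφ.hasDerivAt r hr t ht b) hs ht).symm

lemma norm_sub_self_le (hφ : IsFlow J v φ) (hv : LipschitzField K D v) (hJ : J.OrdConnected)
    {s t : ℝ} (hs : s ∈ J) (ht : t ∈ J) (b : E) : ‖φ s t b - b‖ ≤ D * |t - s| := by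
  have := hJ.convex.norm_image_sub_le_of_norm_hasDerivWithin_le (C := D)
    (fun r hr => (hφ.hasDerivAt s hs r hr b).hasDerivWithinAt) (fun r hr => hv.bound _ _) hs ht
  simpa [hφ.start s hs] using this

lemma norm_sub_linear_le (hφ : IsFlow J v φ) (hv : LipschitzField K D v) (hJ : J.OrdConnected)
    {s t : ℝ} (hs : s ∈ J) (ht : t ∈ J) (b : E) :
    ‖φ s t b - (b + (t - s) • v t b)‖ ≤ 2 * K * (1 + D) * |t - s| ^ 2 := by
  have hJ' := hJ.uIcc_subset hs ht
  have := (convex_uIcc s t).norm_image_sub_le_of_norm_hasDerivWithin_le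
    (f := fun r => φ s r b - r • v t b) (C := 2 * K * (1 + D) * |t - s|)
    (fun r hr => ((hφ.hasDerivAt s hs r (hJ' hr) b).fun_sub
      ((hasDerivAt_id' r).smul_const (v t b))).hasDerivWithinAt) (fun r hr => ?_)
      left_mem_uIcc right_mem_uIcc
  · rw [hφ.start s hs, Real.norm_eq_abs] at this
    refine (le_of_eq ?_).trans (this.trans_eq (by ring))
    congr 1
    module
  · have h1 : |r - s| ≤ |t - s| := abs_sub_left_of_mem_uIcc hr
    have h2 : |r - t| ≤ |t - s| := by
      rw [abs_sub_comm]
      exact abs_sub_right_of_mem_uIcc hr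
    rw [one_smul]
    refine (hv.lipschitz _ _ _ _).trans ?_
    have h3 := hφ.norm_sub_self_le hv hJ hs (hJ' hr) b
    have h4 : (D : ℝ) * |r - s| ≤ D * |t - s| := by gcongr
    have h5 : 0 ≤ (K : ℝ) * (|t - s| + D * |t - s|) := by positivity
    calc (K : ℝ) * (|r - t| + ‖φ s r b - b‖) ≤ K * (|t - s| + D * |t - s|) := by
          gcongr; exact h3.trans h4
      _ ≤ _ := by nlinarith

end IsFlow

end Flow

section Liouville

open scoped NNReal Topology

variable {d : ℕ} {K D : ℝ≥0} {v : ℝ → EuclideanSpace ℝ (Fin d) → EuclideanSpace ℝ (Fin d)}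
  {φ : ℝ → ℝ → EuclideanSpace ℝ (Fin d) → EuclideanSpace ℝ (Fin d)} {J : Set ℝ}

lemma eq_of_tendsto_integral_thickenedIndicator
    {μ μ' : Measure (EuclideanSpace ℝ (Fin d))} [IsFiniteMeasureOnCompacts μ]
    [IsFiniteMeasureOnCompacts μ']
    (h : ∀ k, IsCompact k → ∀ δ, ∀ hδ : 0 < δ, ∫ x, (thickenedIndicator hδ k x : ℝ) ∂μ =
      ∫ x, (thickenedIndicator hδ k x : ℝ) ∂μ') : μ = μ' := by
  have key : ∀ k : Set (EuclideanSpace ℝ (Fin d)), IsCompact k →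
      ∀ (ρ : Measure (EuclideanSpace ℝ (Fin d))) [IsFiniteMeasureOnCompacts ρ],
      Filter.Tendsto (fun n : ℕ => ∫ x, (thickenedIndicator
        (δ := 1 / ((n : ℝ) + 1)) Nat.one_div_pos_of_nat k x : ℝ) ∂ρ) Filter.atTop
        (𝓝 (ρ.real k)) := by
    intro k hk ρ _
    have hind : ρ.real k = ∫ x, k.indicator (fun _ => (1 : ℝ)) x ∂ρ := by
      rw [integral_indicator_const _ hk.measurableSet, smul_eq_mul, mul_one]
    rw [hind]
    have hb : Integrable (fun x => (thickenedIndicator (zero_lt_one' ℝ) k x : ℝ)) ρ := by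
      refine Continuous.integrable_of_hasCompactSupport (by fun_prop)
        (HasCompactSupport.intro (hk.cthickening (r := 1)) fun x hx => ?_)
      rw [thickenedIndicator_zero, NNReal.coe_zero]
      exact fun h => hx (Metric.thickening_subset_cthickening _ _ h)
    refine tendsto_integral_of_dominated_convergence
      (fun x => (thickenedIndicator (zero_lt_one' ℝ) k x : ℝ)) (fun n => ?_) hb
      (fun n => Filter.Eventually.of_forall fun x => ?_)
      (Filter.Eventually.of_forall fun x => ?_)
    · exact Continuous.aestronglyMeasurable (by fun_prop)
    · rw [Real.norm_of_nonneg NNReal.zero_le_coe, NNReal.coe_le_coe]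
      refine thickenedIndicator_mono _ _ ?_ k x
      rw [div_le_one (by positivity)]
      linarith [(n.cast_nonneg : (0 : ℝ) ≤ n)]
    · have := tendsto_pi_nhds.1 (thickenedIndicator_tendsto_indicator_closure
        (fun n : ℕ => (Nat.one_div_pos_of_nat : (0 : ℝ) < 1 / ((n : ℝ) + 1)))
        tendsto_one_div_add_atTop_nhds_zero_nat k) x
      rw [hk.isClosed.closure_eq] at this
      have h2 := (NNReal.continuous_coe.tendsto _).comp this
      have h3 : ((k.indicator (fun _ => (1 : ℝ≥0)) x : ℝ≥0) : ℝ) =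
          k.indicator (fun _ => (1 : ℝ)) x := by
        by_cases hx : x ∈ k
        · rw [indicator_of_mem hx, indicator_of_mem hx, NNReal.coe_one]
        · rw [indicator_of_notMem hx, indicator_of_notMem hx, NNReal.coe_zero]
      rw [h3] at h2
      exact h2
  apply Measure.OuterRegular.ext_isOpen
  apply Measure.InnerRegularWRT.eq_of_innerRegularWRT_of_forall_eq Measure.Regular.innerRegular
    Measure.Regular.innerRegular
  intro k hk
  have h1 : μ.real k = μ'.real k :=
    tendsto_nhds_unique (key k hk μ) (by simpa only [h k hk] using key k hk μ')
  rwa [measureReal_def, measureReal_def, ENNReal.toReal_eq_toReal_iff' hk.measure_lt_top.ne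
    hk.measure_lt_top.ne] at h1

namespace IsFlow

lemma hasDerivAt_integral_comp (hφ : IsFlow J v φ) (hv : LipschitzField K D v)
    (hJ : J.OrdConnected) (hJo : IsOpen J) (hvd : ∀ s, Differentiable ℝ (v s))
    (hdiv : ∀ s x, divg (v s) x = 0) {f : EuclideanSpace ℝ (Fin d) → ℝ} {L : ℝ≥0}
    (hf : LipschitzWith L f) {R : ℝ} (hR : ∀ x, R < ‖x‖ → f x = 0) {s t : ℝ} (hs : s ∈ J)
    (ht : t ∈ J) : HasDerivAt (fun s => ∫ b, f (φ s t b)) 0 s := by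
  set F : EuclideanSpace ℝ (Fin d) → ℝ := fun b => f (φ s t b) with hF
  set Λ : ℝ := L * Real.exp (K * |t - s|) with hΛ
  have hFc : Continuous F := hf.continuous.comp (hφ.continuous hv hJ hs ht)
  have hFL : ∀ b b', ‖F b - F b'‖ ≤ Λ * ‖b - b'‖ := fun b b' => by
    rw [← dist_eq_norm]
    refine (hf.dist_le_mul _ _).trans ?_
    rw [dist_eq_norm, hΛ, mul_assoc]
    gcongr
    exact hφ.norm_sub_le hv hJ hs ht b b'
  set R' := R + D * |t - s| with hR'
  have hF0 : ∀ b, R' < ‖b‖ → F b = 0 := fun b hb => by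
    refine hR _ ?_
    have := hφ.norm_sub_self_le hv hJ hs ht b
    have h2 := norm_sub_norm_le b (φ s t b)
    rw [norm_sub_rev] at h2
    linarith
  have hcomp : ∀ r ∈ J, ∀ b, f (φ r t b) = F (φ r s b) := fun r hr b => by
    simp only [hF, hφ.comp hv hJ hr hs ht]
  have hs0 : ∫ b, f (φ s t b) = ∫ b, F b := rfl
  set V := volume.real (Metric.closedBall (0 : EuclideanSpace ℝ (Fin d)) (R' + D)) with hV
  have hV0 : 0 ≤ V := measureReal_nonneg
  have hΛ0 : 0 ≤ Λ := by positivity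
  set Q : ℝ := Λ * (2 * K * (1 + D)) * V with hQ
  have hQ0 : 0 ≤ Q := by positivity
  rw [hasDerivAt_iff_isLittleO, Asymptotics.isLittleO_iff]
  intro η hη
  have e1 := eventually_integral_comp_add_smul_sub_le (hvd s) (hv.lipschitzWith s) (hv.bound s)
    (hdiv s) hFc hF0 (half_pos hη)
  have e2 : Filter.Tendsto (fun r => s - r) (𝓝 s) (𝓝 0) := by
    simpa using (continuous_sub_left s).tendsto s
  have e3 : ∀ᶠ r in 𝓝 s, |s - r| < min 1 (η / 2 / (Q + 1)) := by
    have := (continuous_abs.tendsto (0 : ℝ)).comp e2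
    exact this.eventually_lt_const (by rw [abs_zero]; positivity)
  filter_upwards [e2.eventually e1, e3, hJo.mem_nhds hs] with r hr1 hr2 hr
  have h1 : |s - r| ≤ 1 := (hr2.trans_le (min_le_left _ _)).le
  have h2 : |s - r| * Q ≤ η / 2 := by
    have := (hr2.trans_le (min_le_right _ _)).le
    rw [le_div_iff₀ (by positivity)] at this
    nlinarith [abs_nonneg (s - r)]
  have hz1 : ∀ b, R' + D < ‖b‖ → F (φ r s b) = 0 := fun b hb => by
    refine hF0 _ ?_
    have h3 := hφ.norm_sub_self_le hv hJ hr hs b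
    have h4 := norm_sub_norm_le b (φ r s b)
    rw [norm_sub_rev] at h4
    nlinarith [D.2]
  have hz2 : ∀ b, R' + D < ‖b‖ → F (b + (s - r) • v s b) = 0 := fun b hb => by
    refine hF0 _ ?_
    have h3 : ‖(s - r) • v s b‖ ≤ D := by
      rw [norm_smul, Real.norm_eq_abs]
      nlinarith [hv.bound s b, norm_nonneg (v s b), abs_nonneg (s - r)]
    have h4 := norm_sub_norm_le b (b + (s - r) • v s b)
    rw [sub_add_cancel_left, norm_neg] at h4
    linarith
  have hi1 := integrable_of_eq_zero_of_lt_norm (F := fun b => F (φ r s b))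
    (hFc.comp (hφ.continuous hv hJ hr hs)) hz1
  have hi2 := integrable_of_eq_zero_of_lt_norm (F := fun b => F (b + (s - r) • v s b))
    (hFc.comp (continuous_id.add ((hvd s).continuous.const_smul (s - r)))) hz2
  have h5 : ‖(∫ b, F (φ r s b)) - ∫ b, F (b + (s - r) • v s b)‖ ≤ Q * |s - r| ^ 2 := by
    rw [← integral_sub hi1 hi2]
    refine (norm_integral_le_of_eq_zero_of_lt_norm (R := R' + D)
      (S := Λ * (2 * K * (1 + D) * |s - r| ^ 2)) (fun b hb => by simp [hz1 b hb, hz2 b hb])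
      fun b => ?_).trans_eq (by rw [hQ]; ring)
    refine (hFL _ _).trans ?_
    gcongr
    exact hφ.norm_sub_linear_le hv hJ hr hs b
  have h6 : (∫ b, f (φ r t b)) - (∫ b, f (φ s t b)) - (r - s) • (0 : ℝ)
      = ((∫ b, F (φ r s b)) - ∫ b, F (b + (s - r) • v s b))
        + ((∫ b, F (b + (s - r) • v s b)) - ∫ b, F b) := by
    simp only [hcomp r hr, smul_zero]
    ring
  rw [h6]
  refine (norm_add_le _ _).trans ?_
  rw [Real.norm_eq_abs (r - s), abs_sub_comm r s]
  rw [← Real.norm_eq_abs] at hr1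
  nlinarith [abs_nonneg (s - r)]

lemma integral_comp_of_lipschitz (hφ : IsFlow J v φ) (hv : LipschitzField K D v)
    (hJ : J.OrdConnected) (hJo : IsOpen J) (hvd : ∀ s, Differentiable ℝ (v s))
    (hdiv : ∀ s x, divg (v s) x = 0) {f : EuclideanSpace ℝ (Fin d) → ℝ} {L : ℝ≥0}
    (hf : LipschitzWith L f) {R : ℝ} (hR : ∀ x, R < ‖x‖ → f x = 0) {s t : ℝ} (hs : s ∈ J)
    (ht : t ∈ J) : ∫ b, f (φ s t b) = ∫ b, f b := by
  have := hJ.convex.norm_image_sub_le_of_norm_hasDerivWithin_le (C := 0)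
    (fun r hr => (hφ.hasDerivAt_integral_comp hv hJ hJo hvd hdiv hf hR hr ht).hasDerivWithinAt)
    (fun r hr => by simp) ht hs
  rw [zero_mul] at this
  have := sub_eq_zero.1 (norm_le_zero_iff.1 this)
  rw [this]
  simp only [hφ.start t ht]

/-- The flow map between two times. -/
def homeomorph (hφ : IsFlow J v φ) (hv : LipschitzField K D v) (hJ : J.OrdConnected) {s t : ℝ}
    (hs : s ∈ J) (ht : t ∈ J) : EuclideanSpace ℝ (Fin d) ≃ₜ EuclideanSpace ℝ (Fin d) where
  toFun := φ s t
  invFun := φ t s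
  left_inv b := by rw [hφ.comp hv hJ hs ht hs, hφ.start s hs]
  right_inv b := by rw [hφ.comp hv hJ ht hs ht, hφ.start t ht]
  continuous_toFun := hφ.continuous hv hJ hs ht
  continuous_invFun := hφ.continuous hv hJ ht hs

/-- Liouville's theorem: the flow of a divergence-free field preserves volume. -/
theorem map_volume (hφ : IsFlow J v φ) (hv : LipschitzField K D v)
    (hJ : J.OrdConnected) (hJo : IsOpen J) (hvd : ∀ s, Differentiable ℝ (v s))
    (hdiv : ∀ s x, divg (v s) x = 0) {s t : ℝ} (hs : s ∈ J) (ht : t ∈ J) :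
    Measure.map (hφ.homeomorph hv hJ hs ht) volume = volume := by
  set g := hφ.homeomorph hv hJ hs ht with hg
  have hfin : IsFiniteMeasureOnCompacts (Measure.map g volume) :=
    ⟨fun k hk => by
      rw [g.measurableEmbedding.map_apply]
      exact (g.isCompact_preimage.2 hk).measure_lt_top⟩
  refine eq_of_tendsto_integral_thickenedIndicator fun k hk δ hδ => ?_
  obtain ⟨R, hR⟩ := hk.isBounded.subset_closedBall 0
  rw [g.measurableEmbedding.integral_map]
  refine hφ.integral_comp_of_lipschitz hv hJ hJo hvd hdiv
    (f := fun x => (thickenedIndicator hδ k x : ℝ)) (lipschitzWith_thickenedIndicator hδ k)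
    (R := R + δ) (fun x hx => ?_) hs ht
  rw [thickenedIndicator_zero hδ k, NNReal.coe_zero]
  intro hx'
  obtain ⟨z, hz, hzx⟩ := Metric.mem_thickening_iff.1 hx'
  have h1 : ‖z‖ ≤ R := by simpa using hR hz
  rw [dist_eq_norm] at hzx
  linarith [norm_sub_norm_le x z]

theorem integral_comp (hφ : IsFlow J v φ) (hv : LipschitzField K D v)
    (hJ : J.OrdConnected) (hJo : IsOpen J) (hvd : ∀ s, Differentiable ℝ (v s))
    (hdiv : ∀ s x, divg (v s) x = 0) {F : Type*} [NormedAddCommGroup F] [NormedSpace ℝ F]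
    (f : EuclideanSpace ℝ (Fin d) → F) {s t : ℝ} (hs : s ∈ J) (ht : t ∈ J) :
    ∫ b, f (φ s t b) = ∫ b, f b := by
  conv_rhs => rw [← hφ.map_volume hv hJ hJo hvd hdiv hs ht]
  rw [(hφ.homeomorph hv hJ hs ht).measurableEmbedding.integral_map]
  rfl

end IsFlow

end Liouville

section VolumeFlow

open scoped NNReal Topology

variable {d : ℕ}

/-- `φ s t` maps the positions at time `s` to the positions at time `t` under the flow of `U`
on the time interval `J`, and preserves volume. -/
structure VolumeFlow (J : Set ℝ) (U : ℝ × EuclideanSpace ℝ (Fin d) → EuclideanSpace ℝ (Fin d))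
    (φ : ℝ → ℝ → EuclideanSpace ℝ (Fin d) → EuclideanSpace ℝ (Fin d)) : Prop where
  start : ∀ s ∈ J, ∀ b, φ s s b = b
  hasDerivAt : ∀ s ∈ J, ∀ t ∈ J, ∀ b, HasDerivAt (fun t => φ s t b) (U (t, φ s t b)) t
  continuous : ∀ s ∈ J, ∀ t ∈ J, Continuous (φ s t)
  eq_of_hasDerivAt : ∀ γ : ℝ → EuclideanSpace ℝ (Fin d),
    (∀ t ∈ J, HasDerivAt γ (U (t, γ t)) t) → ∀ s ∈ J, ∀ t ∈ J, γ t = φ s t (γ s)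
  integral_comp : ∀ f : EuclideanSpace ℝ (Fin d) → EuclideanSpace ℝ (Fin d), ∀ s ∈ J, ∀ t ∈ J,
    ∫ b, f (φ s t b) = ∫ b, f b

lemma PeriodicSmooth.exists_lipschitzField {T : ℝ}
    {U : ℝ × EuclideanSpace ℝ (Fin d) → EuclideanSpace ℝ (Fin d)} (hU : PeriodicSmooth T U)
    {A B : ℝ} (hA : 0 < A) (hAB : A ≤ B) (hB : B < T) :
    ∃ K D, LipschitzField K D fun t x => U (projIcc A B hAB t, x) := by
  obtain ⟨D, hD0, hD⟩ := hU.exists_bound hA hB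
  obtain ⟨K, hK0, hK⟩ := hU.fderiv.exists_bound hA hB
  refine ⟨⟨K, hK0⟩, ⟨D, hD0⟩, fun s s' x x' => ?_, fun s x => hD _ (projIcc A B hAB s).2 x⟩
  have hc : Convex ℝ (Icc A B ×ˢ (univ : Set (EuclideanSpace ℝ (Fin d)))) :=
    (convex_Icc A B).prod convex_univ
  refine (hc.norm_image_sub_le_of_norm_hasFDerivWithin_le (C := K)
    (x := ((projIcc A B hAB s' : ℝ), x')) (y := ((projIcc A B hAB s : ℝ), x))
    (fun q hq => (hU.hasFDerivAt (q := q) ⟨hA.trans_le hq.1.1, hq.1.2.trans_lt hB⟩).hasFDerivWithinAt)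
    (fun q hq => hK q.1 hq.1 q.2) ⟨(projIcc A B hAB s').2, trivial⟩
    ⟨(projIcc A B hAB s).2, trivial⟩).trans ?_
  change K * _ ≤ K * _
  refine mul_le_mul_of_nonneg_left ?_ hK0
  rw [Prod.mk_sub_mk, Prod.norm_mk]
  refine max_le ?_ (by linarith [abs_nonneg (s - s')])
  have h1 : |(projIcc A B hAB s : ℝ) - projIcc A B hAB s'| ≤ |s - s'| := by
    simpa [Subtype.dist_eq, Real.dist_eq] using (LipschitzWith.projIcc hAB).dist_le_mul s s'
  exact h1.trans (by linarith [norm_nonneg (x - x')])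

theorem Solenoidal.exists_volumeFlow {T : ℝ}
    {U : ℝ × EuclideanSpace ℝ (Fin d) → EuclideanSpace ℝ (Fin d)} (hU : Solenoidal T U)
    {A B : ℝ} (hA : 0 < A) (hAB : A ≤ B) (hB : B < T) : ∃ φ, VolumeFlow (Ioo A B) U φ := by
  obtain ⟨K, D, hv⟩ := hU.smooth.exists_lipschitzField hA hAB hB
  obtain ⟨φ, hφ⟩ := hv.exists_isFlow A B
  have hmem : ∀ t, (projIcc A B hAB t : ℝ) ∈ Ioo 0 T := fun t =>
    ⟨hA.trans_le (projIcc A B hAB t).2.1, (projIcc A B hAB t).2.2.trans_lt hB⟩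
  have heq : ∀ t ∈ Ioo A B, ∀ x, U (projIcc A B hAB t, x) = U (t, x) := fun t ht x => by
    rw [projIcc_of_mem hAB (Ioo_subset_Icc_self ht)]
  have hvd : ∀ s, Differentiable ℝ fun x => U (projIcc A B hAB s, x) := fun s => by
    have := (hU.smooth.contDiff_slice (hmem s) 0 1).differentiable (by simp)
    simpa using this
  have hdiv : ∀ s x, divg (fun x => U (projIcc A B hAB s, x)) x = 0 := fun s x => by
    simpa using hU.divg_slice (hmem s) 0 1 x
  have hJ : (Ioo A B).OrdConnected := ordConnected_Ioo
  refine ⟨φ, hφ.start, fun s hs t ht b => ?_, fun s hs t ht => hφ.continuous hv hJ hs ht,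
    fun γ hγ s hs t ht => hφ.eq_of_hasDerivAt hv hJ (fun r hr => ?_) hs ht,
    fun f s hs t ht => hφ.integral_comp hv hJ isOpen_Ioo hvd hdiv f hs ht⟩
  · rw [← heq t ht]; exact hφ.hasDerivAt s hs t ht b
  · rw [heq r hr]; exact hγ r hr

end VolumeFlow

section Differences

variable {E G H V : Type*} [NormedAddCommGroup E] [NormedSpace ℝ E]
  [NormedAddCommGroup G] [NormedSpace ℝ G] [NormedAddCommGroup H] [NormedSpace ℝ H]
  [NormedAddCommGroup V] [NormedSpace ℝ V]

lemma fwdDiff_iter_translate (k a : E) (f : E → G) (n : ℕ) (z : E) :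
    (fwdDiff k)^[n] (fun x => f (x + a)) z = (fwdDiff k)^[n] f (z + a) := by
  induction n generalizing z with
  | zero => rfl
  | succ n ih =>
    rw [Function.iterate_succ_apply', Function.iterate_succ_apply', fwdDiff, fwdDiff, ih, ih,
      add_right_comm]

lemma norm_fwdDiff_iter_le_two_pow_mul {M : Type*} [AddCommMonoid M] (k : M) (n : ℕ) {f : M → G}
    {z : M} {S : ℝ} (h : ∀ p ≤ n, ‖f (z + p • k)‖ ≤ S) :
    ‖(fwdDiff k)^[n] f z‖ ≤ 2 ^ n * S := by
  induction n generalizing z with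
  | zero => simpa using h 0 le_rfl
  | succ n ih =>
    rw [Function.iterate_succ_apply', fwdDiff]
    have h1 := ih (z := z + k) fun p hp => by
      have := h (p + 1) (by omega)
      rwa [succ_nsmul', ← add_assoc] at this
    have h2 := ih (z := z) fun p hp => h p (by omega)
    refine (norm_sub_le _ _).trans ((add_le_add h1 h2).trans_eq ?_)
    ring

/-- A Leibniz-type bound for iterated differences of a bilinear expression. -/
lemma norm_fwdDiff_iter_bilin_le (B : G →L[ℝ] V →L[ℝ] H) (k : E) (n : ℕ) {f : E → G} {g : E → V}
    {z : E} {S : ℝ} (h : ∀ i j, i + j = n → ∀ p q, p + i ≤ n → q + j ≤ n →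
      ‖B ((fwdDiff k)^[i] f (z + p • k)) ((fwdDiff k)^[j] g (z + q • k))‖ ≤ S) :
    ‖(fwdDiff k)^[n] (fun x => B (f x) (g x)) z‖ ≤ 2 ^ n * S := by
  induction n generalizing f g with
  | zero => simpa using h 0 0 rfl 0 0 le_rfl le_rfl
  | succ n ih =>
    have e : fwdDiff k (fun x => B (f x) (g x))
        = (fun x => B (f (x + k)) (fwdDiff k g x)) + fun x => B (fwdDiff k f x) (g x) := by
      ext x
      simp only [fwdDiff, Pi.add_apply, map_sub, sub_apply]
      abel
    rw [Function.iterate_succ_apply, e, fwdDiff_iter_add]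
    have h1 := ih (f := fun x => f (x + k)) (g := fwdDiff k g) fun i j hij p q hp hq => by
      rw [fwdDiff_iter_translate, ← Function.iterate_succ_apply (fwdDiff k) j g, add_assoc,
        ← succ_nsmul]
      exact h i (j + 1) (by omega) (p + 1) q (by omega) (by omega)
    have h2 := ih (f := fwdDiff k f) (g := g) fun i j hij p q hp hq => by
      rw [← Function.iterate_succ_apply (fwdDiff k) i f]
      exact h (i + 1) j (by omega) p q (by omega) (by omega)
    refine (norm_add_le _ _).trans ((add_le_add h1 h2).trans_eq ?_)
    ring

/-- Summation by parts: one of the differences can be moved from the argument to the kernel. -/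
lemma fwdDiff_iter_integral_shift [MeasurableSpace E] [BorelSpace E] {μ : Measure E}
    [μ.IsAddRightInvariant] (K : E → V) (Q : E → V →L[ℝ] H) (k : E) (n : ℕ)
    (hInt : ∀ i : ℕ, Integrable (fun y => Q (y + i • k) (K y)) μ) :
    (fwdDiff 1)^[n + 1] (fun i : ℕ => ∫ y, Q (y + i • k) (K y) ∂μ) 0
      = ∫ z, (fwdDiff k)^[n] (fun x => Q x (K (z - k) - K z)) z ∂μ := by
  have hInt' : ∀ i : ℕ, Integrable (fun z => Q (z + i • k) (K (z - k))) μ := fun i => by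
    have := (hInt (i + 1)).comp_sub_right k
    refine this.congr (Filter.Eventually.of_forall fun z => ?_)
    simp only [succ_nsmul']
    rw [show z - k + (k + i • k) = z + i • k by abel]
  have h1 : fwdDiff 1 (fun i : ℕ => ∫ y, Q (y + i • k) (K y) ∂μ)
      = fun i : ℕ => ∫ z, Q (z + i • k) (K (z - k) - K z) ∂μ := by
    ext i
    simp only [fwdDiff, map_sub]
    rw [integral_sub (hInt' i) (hInt i)]
    congr 1
    rw [← integral_sub_right_eq_self _ k]
    refine integral_congr_ae (Filter.Eventually.of_forall fun z => ?_)
    simp only [succ_nsmul']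
    rw [show z - k + (k + i • k) = z + i • k by abel]
  rw [Function.iterate_succ_apply, h1, fwdDiff_iter_eq_sum_shift]
  simp only [fwdDiff_iter_eq_sum_shift, smul_eq_mul, mul_one, zero_add]
  have hi : ∀ i : ℕ, Integrable (fun z => Q (z + i • k) (K (z - k) - K z)) μ := fun i => by
    simp only [map_sub]
    exact (hInt' i).sub (hInt i)
  rw [integral_finsetSum _ fun i _ => by
    simp only [← Int.cast_smul_eq_zsmul ℝ]
    exact (hi i).smul _]
  refine Finset.sum_congr rfl fun i _ => ?_
  simp only [← Int.cast_smul_eq_zsmul ℝ]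
  rw [integral_smul]

end Differences

section KernelDifference

variable {d : ℕ} {V H : Type} [NormedAddCommGroup V] [NormedSpace ℝ V] [NormedAddCommGroup H]
  [NormedSpace ℝ H]

/-- Translates of a decaying kernel are Hölder continuous in a weighted `L¹` space. -/
lemma KernelDecay.exists_integral_sub_le {K : EuclideanSpace ℝ (Fin d) → V}
    (hK : KernelDecay ((d : ℝ) + 1) K) {α : ℝ} (hα : 0 < α) (hα1 : α < 1) :
    ∃ C : ℝ, 0 ≤ C ∧ ∀ (k : EuclideanSpace ℝ (Fin d)) {F : EuclideanSpace ℝ (Fin d) → H} {S : ℝ},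
      0 ≤ S → (∀ z, ‖F z‖ ≤ S * ‖K (z - k) - K z‖ * (1 + ‖z‖) ^ α) →
        ‖∫ z, F z‖ ≤ S * C * ‖k‖ ^ α := by
  have hd0 : (0 : ℝ) ≤ (d : ℝ) + 1 := by positivity
  obtain ⟨C₀, hC₀, h0⟩ := hK.bound
  obtain ⟨C₁, hC₁, h1⟩ := hK.exists_comp_sub_bound hd0 (C₁ := 2) two_pos
  set g : EuclideanSpace ℝ (Fin d) → ℝ := fun z => (1 + ‖z‖) ^ (-((d : ℝ) + (1 - α))) with hg
  have hgi : Integrable g := by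
    have := integrable_one_add_norm (E := EuclideanSpace ℝ (Fin d)) (μ := volume)
      (r := (d : ℝ) + (1 - α)) (by simp; linarith)
    exact this
  have hgg : ∀ z : EuclideanSpace ℝ (Fin d), (1 + ‖z‖) ^ (-((d : ℝ) + 1)) * (1 + ‖z‖) ^ α = g z :=
    fun z => by
      rw [hg, ← Real.rpow_add (by positivity)]
      congr 1; ring
  have hg0 : ∀ z, 0 ≤ g z := fun z => by positivity
  have hpt : ∀ k z : EuclideanSpace ℝ (Fin d), ‖K (z - k) - K z‖ * (1 + ‖z‖) ^ α
      ≤ (C₁ + 3 * C₀) * ‖k‖ ^ α * (g (z - k) + g z) := by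
    intro k z
    have hkα : 0 ≤ ‖k‖ ^ α := by positivity
    rcases le_total ‖k‖ 1 with hk | hk
    · have h2 := h1 (r := 1 + ‖z‖) (η := ‖k‖) (z := z - k) (w := z) (by positivity) (norm_nonneg _)
        (by have := norm_sub_norm_le z k
            have := norm_nonneg (z - k)
            linarith) (by linarith [norm_nonneg z])
        (by rw [sub_sub_cancel_left, norm_neg]; nlinarith [norm_nonneg z, norm_nonneg k])
      have h3 : ‖k‖ ≤ ‖k‖ ^ α := by
        simpa using Real.rpow_le_rpow_of_exponent_ge' (norm_nonneg k) hk hα.le hα1.le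
      calc ‖K (z - k) - K z‖ * (1 + ‖z‖) ^ α
          ≤ C₁ * (1 + ‖z‖) ^ (-((d : ℝ) + 1)) * ‖k‖ * (1 + ‖z‖) ^ α := by gcongr
        _ = C₁ * ‖k‖ * g z := by rw [← hgg]; ring
        _ ≤ (C₁ + 3 * C₀) * ‖k‖ ^ α * (g (z - k) + g z) := by
            gcongr
            · linarith
            · linarith [hg0 (z - k)]
    · have h3 : (1 + ‖z‖) ^ α ≤ 2 * ‖k‖ ^ α * (1 + ‖z - k‖) ^ α := by
        have h4 : 1 + ‖z‖ ≤ 2 * ‖k‖ * (1 + ‖z - k‖) := by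
          have := norm_add_le (z - k) k
          rw [sub_add_cancel] at this
          nlinarith [norm_nonneg (z - k)]
        refine (Real.rpow_le_rpow (by positivity) h4 hα.le).trans ?_
        rw [Real.mul_rpow (by positivity) (by positivity), Real.mul_rpow (by positivity)
          (by positivity)]
        gcongr
        simpa using Real.rpow_le_rpow_of_exponent_le one_le_two hα1.le
      have h5 : 1 ≤ ‖k‖ ^ α := Real.one_le_rpow hk hα.le
      calc ‖K (z - k) - K z‖ * (1 + ‖z‖) ^ α
          ≤ (C₀ * (1 + ‖z - k‖) ^ (-((d : ℝ) + 1)) + C₀ * (1 + ‖z‖) ^ (-((d : ℝ) + 1)))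
              * (1 + ‖z‖) ^ α := by
            gcongr
            exact (norm_sub_le _ _).trans (add_le_add (h0 _) (h0 _))
        _ ≤ C₀ * (1 + ‖z - k‖) ^ (-((d : ℝ) + 1)) * (2 * ‖k‖ ^ α * (1 + ‖z - k‖) ^ α)
              + C₀ * g z := by
            rw [add_mul, mul_assoc C₀ _ ((1 + ‖z‖) ^ α), mul_assoc C₀ _ ((1 + ‖z‖) ^ α), hgg,
              ← mul_assoc]
            gcongr
        _ = 2 * C₀ * ‖k‖ ^ α * g (z - k) + C₀ * 1 * g z := by rw [← hgg (z - k)]; ring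
        _ ≤ 2 * C₀ * ‖k‖ ^ α * g (z - k) + C₀ * ‖k‖ ^ α * g z := by
            have := hg0 z
            gcongr
        _ ≤ (C₁ + 3 * C₀) * ‖k‖ ^ α * (g (z - k) + g z) := by
            have e1 := mul_nonneg (mul_nonneg hC₁ hkα) (hg0 z)
            have e2 := mul_nonneg (mul_nonneg hC₁ hkα) (hg0 (z - k))
            have e3 := mul_nonneg (mul_nonneg hC₀ hkα) (hg0 z)
            have e4 := mul_nonneg (mul_nonneg hC₀ hkα) (hg0 (z - k))
            nlinarith
  have hI : ∀ k, Integrable fun z => g (z - k) + g z := fun k => (hgi.comp_sub_right k).add hgi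
  refine ⟨(C₁ + 3 * C₀) * (2 * ∫ z, g z), mul_nonneg (by positivity)
    (mul_nonneg zero_le_two (integral_nonneg hg0)), fun k F S hS hF => ?_⟩
  refine (norm_integral_le_of_norm_le ((hI k).const_mul (S * ((C₁ + 3 * C₀) * ‖k‖ ^ α)))
    (Filter.Eventually.of_forall fun z => ?_)).trans_eq ?_
  · refine (hF z).trans ?_
    rw [mul_assoc, mul_assoc]
    exact mul_le_mul_of_nonneg_left (hpt k z) hS
  · rw [integral_const_mul, integral_add (hgi.comp_sub_right k) hgi,
      integral_sub_right_eq_self g k]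
    ring

end KernelDifference

lemma HasDerivAt.fwdDiff_iter {A E : Type*} [AddCommMonoid A] [NormedAddCommGroup E]
    [NormedSpace ℝ E] {f : A → ℝ → E} {f' : A → E} {t : ℝ} (k : A) (n : ℕ) (z : A)
    (h : ∀ i, HasDerivAt (f i) (f' i) t) :
    HasDerivAt (fun s => (fwdDiff k)^[n] (fun i => f i s) z) ((fwdDiff k)^[n] f' z) t := by
  induction n generalizing z with
  | zero => exact h z
  | succ n ih =>
    simp only [Function.iterate_succ_apply', fwdDiff]
    exact (ih _).fun_sub (ih _)

lemma fwdDiff_iter_clm_comp {A E G : Type*} [AddCommMonoid A] [NormedAddCommGroup E]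
    [NormedSpace ℝ E] [NormedAddCommGroup G] [NormedSpace ℝ G] (L : E →L[ℝ] G) (k : A) (n : ℕ)
    (f : A → E) (z : A) :
    (fwdDiff k)^[n] (fun x => L (f x)) z = L ((fwdDiff k)^[n] f z) := by
  induction n generalizing z with
  | zero => rfl
  | succ n ih => simp only [Function.iterate_succ_apply', fwdDiff, ih, map_sub]

lemma fwdDiff_iter_comp_affine {E G : Type*} [AddCommGroup E] [Module ℝ E] [AddCommGroup G]
    (f : E → G) (X k : E) (σ : ℝ) (n : ℕ) (z : E) :
    (fwdDiff k)^[n] (fun z => f (X + σ • z)) z = (fwdDiff (σ • k))^[n] f (X + σ • z) := by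
  induction n generalizing z with
  | zero => rfl
  | succ n ih => simp only [Function.iterate_succ_apply', fwdDiff, ih, smul_add, add_assoc]

lemma fwdDiff_iter_nat_eq {E G : Type*} [AddCommMonoid E] [AddCommGroup G]
    (f : E → G) (x h : E) (n : ℕ) :
    (fwdDiff 1)^[n] (fun i : ℕ => f (x + i • h)) 0 = (fwdDiff h)^[n] f x := by
  rw [fwdDiff_iter_eq_sum_shift, fwdDiff_iter_eq_sum_shift]
  simp

lemma fwdDiff_iter_succ_sub_const {E G : Type*} [AddCommMonoid E] [AddCommGroup G]
    (f : E → G) (c : G) (h x : E) (n : ℕ) :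
    (fwdDiff h)^[n + 1] (fun x => f x - c) x = (fwdDiff h)^[n + 1] f x := by
  rw [Function.iterate_succ_apply, Function.iterate_succ_apply]
  have e : fwdDiff h (fun x => f x - c) = fwdDiff h f := funext fun y => by simp [fwdDiff]
  rw [e]

section Interaction

variable {E H : Type*} [NormedAddCommGroup E] [NormedSpace ℝ E] [NormedAddCommGroup H]
  [NormedSpace ℝ H]

/-- The quadratic expression in a Hölder function with controlled differences has controlled
differences. -/
lemma norm_fwdDiff_iter_quadratic_le (B : E →L[ℝ] E →L[ℝ] H) {n : ℕ} (hn : 1 ≤ n) {α c A ρ : ℝ}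
    (hc : 1 ≤ c) (hA : 0 ≤ A) (hρ : 0 < ρ) {W : E → E} {k z : E}
    (h0 : ∀ p ≤ n, ‖W (z + p • k)‖ ≤ c * A * (1 + ‖z‖) ^ α)
    (h : ∀ j, 1 ≤ j → j ≤ n → ∀ y, ‖(fwdDiff k)^[j] W y‖ ≤ c * A * ρ ^ (α * j)) (hα : 0 ≤ α) :
    ‖(fwdDiff k)^[n] (fun x => B (W x) (W x)) z‖
      ≤ 2 ^ n * (c * A) ^ 2 * ρ ^ (α * n) * ‖B‖ * (1 + ‖z‖) ^ α := by
  have hz : 1 ≤ (1 + ‖z‖) ^ α := Real.one_le_rpow (by linarith [norm_nonneg z]) hα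
  have key := norm_fwdDiff_iter_bilin_le B k n (f := W) (g := W) (z := z)
    (S := (c * A) ^ 2 * ρ ^ (α * n) * ‖B‖ * (1 + ‖z‖) ^ α) fun i j hij p q hp hq => by
      have hcA : 0 ≤ c * A := by positivity
      rcases Nat.eq_zero_or_pos i with rfl | hi
      · obtain rfl : j = n := by omega
        refine (B.le_opNorm₂ _ _).trans ?_
        calc _ ≤ ‖B‖ * (c * A * (1 + ‖z‖) ^ α) * (c * A * ρ ^ (α * j)) := by
              gcongr
              · exact h0 p (by omega)
              · exact h j hn le_rfl _
          _ = _ := by ring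
      rcases Nat.eq_zero_or_pos j with rfl | hj
      · obtain rfl : i = n := by omega
        refine (B.le_opNorm₂ _ _).trans ?_
        calc _ ≤ ‖B‖ * (c * A * ρ ^ (α * i)) * (c * A * (1 + ‖z‖) ^ α) := by
              gcongr
              · exact h i hn le_rfl _
              · exact h0 q (by omega)
          _ = _ := by ring
      · refine (B.le_opNorm₂ _ _).trans ?_
        calc _ ≤ ‖B‖ * (c * A * ρ ^ (α * i)) * (c * A * ρ ^ (α * j)) := by
              gcongr
              · exact h i hi (by omega) _
              · exact h j hj (by omega) _
          _ = (c * A) ^ 2 * (ρ ^ (α * i) * ρ ^ (α * j)) * ‖B‖ * 1 := by ring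
          _ = (c * A) ^ 2 * ρ ^ (α * n) * ‖B‖ * 1 := by
              rw [← Real.rpow_add hρ, ← mul_add, ← Nat.cast_add, hij]
          _ ≤ _ := by gcongr
  refine key.trans_eq (by ring)

end Interaction

/-- A velocity field solving the Navier–Stokes equations that is `α`-Hölder in space, together with
a time scale `δ` and a viscous length `ℓ` at which the viscosity dominates. -/
structure ViscousHolder {d : ℕ} (T ν M α δ ℓ : ℝ)
    (U : ℝ × EuclideanSpace ℝ (Fin d) → EuclideanSpace ℝ (Fin d))
    (P : ℝ × EuclideanSpace ℝ (Fin d) → ℝ) : Prop where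
  ns : NavierStokes T ν U P
  holder : ∀ t ∈ Ioo 0 T, ∀ x y, ‖U (t, x) - U (t, y)‖ ≤ M * ‖x - y‖ ^ α
  ν_pos : 0 < ν
  M_nonneg : 0 ≤ M
  δ_pos : 0 < δ
  ℓ_pos : 0 < ℓ
  sq_eq : ℓ ^ 2 = ν * δ
  small : M * ℓ ^ (1 + α) ≤ ν

namespace ViscousHolder

variable {d : ℕ} {T ν M α δ ℓ : ℝ} {U : ℝ × EuclideanSpace ℝ (Fin d) → EuclideanSpace ℝ (Fin d)}
  {P : ℝ × EuclideanSpace ℝ (Fin d) → ℝ}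

lemma norm_fwdDiff_iter_le_of_le (hU : ViscousHolder T ν M α δ ℓ U P) {t : ℝ} (ht : t ∈ Ioo 0 T)
    (n : ℕ) (h x : EuclideanSpace ℝ (Fin d)) :
    ‖(fwdDiff h)^[n + 1] (fun y => U (t, y)) x‖ ≤ 2 ^ n * (M * ℓ ^ α * (‖h‖ / ℓ) ^ α) := by
  rw [Function.iterate_succ_apply]
  refine norm_fwdDiff_iter_le_two_pow_mul _ _ fun p _ => ?_
  refine (hU.holder t ht _ _).trans_eq ?_
  have := hU.ℓ_pos
  rw [add_sub_cancel_left, Real.div_rpow (norm_nonneg _) this.le]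
  field_simp

lemma integrable_smul (hU : NavierStokes T ν U P) {t : ℝ} (ht : t ∈ Ioo 0 T)
    (X : EuclideanSpace ℝ (Fin d)) (σ : ℝ) :
    Integrable fun y => gauss d y • U (t, X + σ • y) := by
  obtain ⟨C, hC, hb⟩ := (kernelDecay_gauss (d := d) (d + 1) (by positivity)).bound
  obtain ⟨D, hD, hb'⟩ := hU.velocity.smooth.exists_bound ht.1 ht.2
  refine integrable_of_decay (a := d + 1) (C := C * D) (by linarith)
    ((kernelDecay_gauss (d := d) 0 le_rfl).1.continuous.smul
      (hU.velocity.smooth.contDiff_slice ht X σ).continuous) fun y => ?_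
  rw [norm_smul]
  calc _ ≤ (C * (1 + ‖y‖) ^ (-((d : ℝ) + 1))) * D := by
        gcongr
        · exact hb y
        · exact hb' t ⟨le_rfl, le_rfl⟩ _
    _ = _ := by ring

lemma integrable_stress (hd : 2 ≤ d) (hU : NavierStokes T ν U P) {t : ℝ} (ht : t ∈ Ioo 0 T)
    (X X' x : EuclideanSpace ℝ (Fin d)) (σ : ℝ) :
    Integrable fun y => stressKernel d y (U (t, X + σ • (y + x)) - X')
      (U (t, X + σ • (y + x)) - X') := by
  obtain ⟨C, hC, hb⟩ := (kernelDecay_stressKernel hd).bound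
  obtain ⟨D, hD, hb'⟩ := hU.velocity.smooth.exists_bound ht.1 ht.2
  have hc : Continuous fun y => U (t, X + σ • (y + x)) - X' :=
    ((hU.velocity.smooth.contDiff_slice ht X σ).continuous.comp
      (continuous_add_const x)).sub continuous_const
  refine integrable_of_decay (a := d + 1) (C := C * (D + ‖X'‖) ^ 2) (by linarith)
    (((kernelDecay_stressKernel hd).1.continuous.clm_apply hc).clm_apply hc) fun y => ?_
  have h1 : ‖U (t, X + σ • (y + x)) - X'‖ ≤ D + ‖X'‖ :=
    (norm_sub_le _ _).trans (by gcongr; exact hb' t ⟨le_rfl, le_rfl⟩ _)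
  refine ((stressKernel d y).le_opNorm₂ _ _).trans ?_
  calc _ ≤ (C * (1 + ‖y‖) ^ (-((d : ℝ) + 1))) * (D + ‖X'‖) * (D + ‖X'‖) := by
        gcongr
        exact hb y
    _ = _ := by ring

/-- The iterated difference in direction `h` of the Gaussian averages of `U` at scale `σ r` around
`X r`. -/
noncomputable def diffAverage (U : ℝ × EuclideanSpace ℝ (Fin d) → EuclideanSpace ℝ (Fin d))
    (X : ℝ → EuclideanSpace ℝ (Fin d)) (σ : ℝ → ℝ) (h : EuclideanSpace ℝ (Fin d)) (n : ℕ) (r : ℝ) :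
    EuclideanSpace ℝ (Fin d) :=
  (fwdDiff 1)^[n] (fun i : ℕ => ∫ y, gauss d y • U (r, X r + i • h + σ r • y)) 0

/-- The time derivative of `diffAverage` along a trajectory. -/
noncomputable def diffStress (U : EuclideanSpace ℝ (Fin d) → EuclideanSpace ℝ (Fin d))
    (X : EuclideanSpace ℝ (Fin d)) (σ : ℝ) (h : EuclideanSpace ℝ (Fin d)) (n : ℕ) :
    EuclideanSpace ℝ (Fin d) :=
  σ⁻¹ • ∫ z, (fwdDiff (σ⁻¹ • h))^[n]
    (fun x => (stressKernel d (z - σ⁻¹ • h) - stressKernel d z) (U (X + σ • x) - U X)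
      (U (X + σ • x) - U X)) z

lemma hasDerivAt_diffAverage (hd : 2 ≤ d) (hU : NavierStokes T ν U P) {t : ℝ} (ht : t ∈ Ioo 0 T)
    {X : ℝ → EuclideanSpace ℝ (Fin d)} (hX : HasDerivAt X (U (t, X t)) t)
    {σ : ℝ → ℝ} {σ' : ℝ} (hσ : HasDerivAt σ σ' t) (hσ0 : σ t ≠ 0)
    (hσ' : ν * (σ t)⁻¹ ^ 2 + 2 * σ' * (σ t)⁻¹ = 0) (h : EuclideanSpace ℝ (Fin d)) (n : ℕ) :
    HasDerivAt (diffAverage U X σ h (n + 1)) (diffStress (fun x => U (t, x)) (X t) (σ t) h n) t := by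
  set W : EuclideanSpace ℝ (Fin d) → EuclideanSpace ℝ (Fin d) :=
    fun x => U (t, X t + σ t • x) - U (t, X t) with hW
  set k := (σ t)⁻¹ • h with hk
  have hx : ∀ (i : ℕ) y, X t + i • h + σ t • y = X t + σ t • (y + i • k) := fun i y => by
    rw [hk, smul_add, smul_comm (σ t) i, smul_inv_smul₀ hσ0]; abel
  have key := HasDerivAt.fwdDiff_iter (1 : ℕ) (n + 1) 0 fun i : ℕ =>
    hU.hasDerivAt_average hd ht (hX.add_const (i • h)) hσ hσ0
  refine key.congr_deriv ?_
  rw [hσ']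
  simp only [zero_smul, add_zero, hx]
  refine (fwdDiff_iter_clm_comp ((σ t)⁻¹ • ContinuousLinearMap.id ℝ (EuclideanSpace ℝ (Fin d)))
    1 (n + 1) _ 0).trans ?_
  refine congrArg ((σ t)⁻¹ • ·) (fwdDiff_iter_integral_shift (μ := volume) (stressKernel d)
    (fun x => (ContinuousLinearMap.apply ℝ _ (W x)).comp (ContinuousLinearMap.apply ℝ _ (W x)))
    k n fun i => ?_)
  exact integrable_stress hd hU ht (X t) (U (t, X t)) (i • k) (σ t)

lemma exists_norm_diffStress_le (hd : 2 ≤ d) (hα : 0 < α) (hα1 : α < 1) {n : ℕ} (hn : 1 ≤ n)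
    {c : ℝ} (hc : 1 ≤ c) : ∃ C : ℝ, 0 ≤ C ∧ ∀ {M ℓ : ℝ}
      {U : EuclideanSpace ℝ (Fin d) → EuclideanSpace ℝ (Fin d)}, 0 ≤ M → 0 < ℓ →
      (∀ x y, ‖U x - U y‖ ≤ M * ‖x - y‖ ^ α) →
      (∀ j : ℕ, 1 ≤ j → j ≤ n → ∀ h x,
        ‖(fwdDiff h)^[j] U x‖ ≤ c * (M * ℓ ^ α) * (‖h‖ / ℓ) ^ (α * j)) →
      ∀ (X h : EuclideanSpace ℝ (Fin d)) {σ : ℝ}, 0 < σ → σ ≤ 2 * ℓ → h ≠ 0 → ‖h‖ ≤ ℓ →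
        ‖diffStress U X σ h n‖
          ≤ C * (M * ℓ ^ α) ^ 2 * (‖h‖ / ℓ) ^ (α * (n + 1)) * ℓ ^ α * σ ^ (-1 - α) := by
  obtain ⟨C, hC, hK⟩ := (kernelDecay_stressKernel hd).exists_integral_sub_le
    (H := EuclideanSpace ℝ (Fin d)) hα hα1
  refine ⟨2 ^ n * (c * (n + 2)) ^ 2 * C, by positivity, ?_⟩
  intro M ℓ U hM hℓ hH hj X h σ hσ hσℓ h0 hhℓ
  have hh : 0 < ‖h‖ := norm_pos_iff.2 h0
  have hρ : 0 < ‖h‖ / ℓ := by positivity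
  have hn1 : (1 : ℝ) ≤ n := by exact_mod_cast hn
  have hc' : 1 ≤ c * (n + 2) := by nlinarith
  have hk : ‖σ⁻¹ • h‖ = ‖h‖ / σ := by
    rw [norm_smul, Real.norm_of_nonneg (inv_pos.2 hσ).le, inv_mul_eq_div]
  rw [diffStress, norm_smul, Real.norm_of_nonneg (inv_pos.2 hσ).le]
  have key := hK (σ⁻¹ • h) (F := fun z => (fwdDiff (σ⁻¹ • h))^[n]
    (fun x => (stressKernel d (z - σ⁻¹ • h) - stressKernel d z) (U (X + σ • x) - U X)
      (U (X + σ • x) - U X)) z)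
    (S := 2 ^ n * (c * (n + 2) * (M * ℓ ^ α)) ^ 2 * (‖h‖ / ℓ) ^ (α * n)) (by positivity)
    fun z => by
      refine norm_fwdDiff_iter_quadratic_le _ hn hc' (by positivity) hρ (fun p hp => ?_)
        (fun j hj1 hjn y => ?_) hα.le
      · refine (hH _ _).trans ?_
        have h1 : ‖X + σ • (z + p • σ⁻¹ • h) - X‖ ≤ ((n : ℝ) + 2) * ℓ * (1 + ‖z‖) := by
          rw [add_sub_cancel_left, smul_add, smul_comm σ p, smul_inv_smul₀ hσ.ne']
          refine (norm_add_le _ _).trans ?_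
          rw [norm_smul, Real.norm_of_nonneg hσ.le, ← Nat.cast_smul_eq_nsmul ℝ, norm_smul,
            Real.norm_of_nonneg (Nat.cast_nonneg _)]
          have hp' : (p : ℝ) ≤ n := by exact_mod_cast hp
          have e1 : σ * ‖z‖ ≤ 2 * ℓ * ‖z‖ := by gcongr
          have e2 : (p : ℝ) * ‖h‖ ≤ n * ℓ := by gcongr
          have e3 : 0 ≤ (n : ℝ) * ℓ * ‖z‖ := by positivity
          nlinarith
        have h2 : ((n : ℝ) + 2) ^ α ≤ c * (n + 2) := by
          have : ((n : ℝ) + 2) ^ α ≤ ((n : ℝ) + 2) ^ (1 : ℝ) :=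
            Real.rpow_le_rpow_of_exponent_le (by linarith) hα1.le
          rw [Real.rpow_one] at this
          nlinarith
        calc M * ‖X + σ • (z + p • σ⁻¹ • h) - X‖ ^ α
            ≤ M * (((n : ℝ) + 2) * ℓ * (1 + ‖z‖)) ^ α := by gcongr
          _ = ((n : ℝ) + 2) ^ α * (M * ℓ ^ α) * (1 + ‖z‖) ^ α := by
              rw [Real.mul_rpow (by positivity) (by positivity),
                Real.mul_rpow (by positivity) hℓ.le]
              ring
          _ ≤ _ := by gcongr
      · obtain ⟨j, rfl⟩ := Nat.exists_eq_add_of_le' hj1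
        rw [fwdDiff_iter_succ_sub_const, fwdDiff_iter_comp_affine, smul_inv_smul₀ hσ.ne']
        refine (hj _ hj1 hjn _ _).trans ?_
        gcongr
        nlinarith
  rw [hk] at key
  refine (mul_le_mul_of_nonneg_left key (inv_pos.2 hσ).le).trans_eq ?_
  calc _ = 2 ^ n * (c * (n + 2)) ^ 2 * C * (M * ℓ ^ α) ^ 2 * (‖h‖ / ℓ) ^ (α * n)
          * (σ⁻¹ * (‖h‖ / σ) ^ α) := by ring
    _ = 2 ^ n * (c * (n + 2)) ^ 2 * C * (M * ℓ ^ α) ^ 2 * (‖h‖ / ℓ) ^ (α * n)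
          * ((‖h‖ / ℓ) ^ α * ℓ ^ α * σ ^ (-1 - α)) := by
        congr 1
        rw [Real.div_rpow hh.le hσ.le, Real.div_rpow hh.le hℓ.le, Real.rpow_sub hσ,
          Real.rpow_neg_one]
        field_simp
    _ = _ := by
        rw [show α * ((n : ℝ) + 1) = α * n + α by ring, Real.rpow_add hρ]
        ring

end ViscousHolder

lemma fwdDiff_iter_fun_sub {A G : Type*} [AddCommMonoid A] [AddCommGroup G] (k : A) (n : ℕ)
    (f g : A → G) (z : A) :
    (fwdDiff k)^[n] (fun x => f x - g x) z = (fwdDiff k)^[n] f z - (fwdDiff k)^[n] g z := by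
  induction n generalizing z with
  | zero => rfl
  | succ n ih => simp only [Function.iterate_succ_apply', fwdDiff, ih]; abel

/-- Integration of a singular bound on the derivative up to the singular time. -/
lemma norm_le_of_norm_deriv_le_rpow {E : Type*} [NormedAddCommGroup E] [NormedSpace ℝ E]
    {f f' : ℝ → E} {σ : ℝ → ℝ} {a b ν κ α : ℝ} (hab : a ≤ b) (hν : 0 < ν) (hα1 : α < 1)
    (hκ : 0 ≤ κ) (hσ0 : ∀ r ∈ Icc a b, 0 < σ r)
    (hσ : ∀ r ∈ Icc a b, HasDerivAt σ (-(ν / (2 * σ r))) r)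
    (hf : ∀ r ∈ Icc a b, HasDerivAt f (f' r) r)
    (hb : ∀ r ∈ Icc a b, ‖f' r‖ ≤ κ * σ r ^ (-1 - α)) :
    ‖f b‖ ≤ ‖f a‖ + κ * 2 / (ν * (1 - α)) * σ a ^ (1 - α) := by
  have hα' : 0 < 1 - α := by linarith
  have hB : ∀ r ∈ Icc a b, HasDerivAt
      (fun r => ‖f a‖ + κ * 2 / (ν * (1 - α)) * (σ a ^ (1 - α) - σ r ^ (1 - α)))
      (κ * σ r ^ (-1 - α)) r := fun r hr => by
    have h1 := ((((hσ r hr).rpow_const (p := 1 - α) (Or.inl (hσ0 r hr).ne')).const_sub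
      (σ a ^ (1 - α))).const_mul (κ * 2 / (ν * (1 - α)))).const_add ‖f a‖
    refine h1.congr_deriv ?_
    have h0 := hσ0 r hr
    rw [show 1 - α - 1 = (-1 - α) + 1 by ring, Real.rpow_add h0, Real.rpow_one]
    field_simp
  have key := image_norm_le_of_norm_deriv_right_le_deriv_boundary' (f := f) (f' := f') (a := a)
    (b := b) (fun r hr => (hf r hr).continuousAt.continuousWithinAt)
    (fun r hr => (hf r ⟨hr.1, hr.2.le⟩).hasDerivWithinAt) (by simp)
    (fun r hr => (hB r hr).continuousAt.continuousWithinAt)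
    (fun r hr => (hB r ⟨hr.1, hr.2.le⟩).hasDerivWithinAt)
    (fun r hr => hb r ⟨hr.1, hr.2.le⟩) ⟨hab, le_rfl⟩
  refine key.trans ?_
  have h2 : 0 ≤ σ b ^ (1 - α) := Real.rpow_nonneg (hσ0 b ⟨hab, le_rfl⟩).le _
  gcongr
  linarith

lemma hasDerivAt_sqrt_affine {ν η t r : ℝ} (h : 0 < ν * (t - r) + η) :
    HasDerivAt (fun r => √(ν * (t - r) + η)) (-(ν / (2 * √(ν * (t - r) + η)))) r := by
  have h1 : HasDerivAt (fun r => ν * (t - r) + η) (-ν) r :=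
    ((((hasDerivAt_id' r).const_sub t).const_mul ν).add_const η).congr_deriv (by ring)
  exact (h1.sqrt h.ne').congr_deriv (by ring)

namespace ViscousHolder

variable {d : ℕ} {T ν M α δ ℓ : ℝ} {U : ℝ × EuclideanSpace ℝ (Fin d) → EuclideanSpace ℝ (Fin d)}
  {P : ℝ × EuclideanSpace ℝ (Fin d) → ℝ}

/-- Gaussian averages at scale `σ` gain one difference quotient at scale `σ`. -/
lemma exists_norm_diffAverage_le (hα : 0 < α) (hα1 : α < 1) (n : ℕ) : ∃ C : ℝ, 0 ≤ C ∧
    ∀ {T ν : ℝ} {U : ℝ × EuclideanSpace ℝ (Fin d) → EuclideanSpace ℝ (Fin d)}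
      {P : ℝ × EuclideanSpace ℝ (Fin d) → ℝ}, NavierStokes T ν U P → ∀ {t : ℝ}, t ∈ Ioo 0 T →
      ∀ {h : EuclideanSpace ℝ (Fin d)} {D : ℝ},
      (∀ x, ‖(fwdDiff h)^[n] (fun y => U (t, y)) x‖ ≤ D) →
      ∀ (X : ℝ → EuclideanSpace ℝ (Fin d)) (σ : ℝ → ℝ), 0 < σ t →
        ‖diffAverage U X σ h (n + 1) t‖ ≤ C * D * (‖h‖ / σ t) ^ α := by
  obtain ⟨C, hC, hK⟩ := (kernelDecay_gauss (d := d) (d + 1) (by positivity)).exists_integral_sub_le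
    (H := EuclideanSpace ℝ (Fin d)) hα hα1
  refine ⟨C, hC, ?_⟩
  intro T ν U P hU t ht h D hD X σ hσ
  have hD0 : 0 ≤ D := (norm_nonneg _).trans (hD 0)
  set k := (σ t)⁻¹ • h with hk
  have hkn : ‖k‖ = ‖h‖ / σ t := by
    rw [hk, norm_smul, Real.norm_of_nonneg (inv_pos.2 hσ).le, inv_mul_eq_div]
  have hx : ∀ (i : ℕ) y, X t + i • h + σ t • y = X t + σ t • (y + i • k) := fun i y => by
    rw [hk, smul_add, smul_comm (σ t) i, smul_inv_smul₀ hσ.ne']; abel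
  have e1 := fwdDiff_iter_integral_shift (μ := volume) (gauss d)
    (fun x => ContinuousLinearMap.toSpanSingleton ℝ (U (t, X t + σ t • x))) k n fun i => by
      refine (integrable_smul hU ht (X t + i • h) (σ t)).congr
        (Filter.Eventually.of_forall fun y => ?_)
      simp only [ContinuousLinearMap.toSpanSingleton_apply, hx]
  have e2 : diffAverage U X σ h (n + 1) t = ∫ z, (fwdDiff k)^[n] (fun x =>
      (gauss d (z - k) - gauss d z) • U (t, X t + σ t • x)) z := by
    rw [diffAverage]
    simp only [hx]
    exact e1
  rw [e2, ← hkn]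
  refine (hK k hD0 fun z => ?_).trans_eq (by ring)
  have e3 := fwdDiff_iter_clm_comp ((gauss d (z - k) - gauss d z) •
    ContinuousLinearMap.id ℝ (EuclideanSpace ℝ (Fin d))) k n (fun x => U (t, X t + σ t • x)) z
  have e4 := fwdDiff_iter_comp_affine (fun y => U (t, y)) (X t) k (σ t) n z
  rw [hk, smul_inv_smul₀ hσ.ne', ← hk] at e4
  rw [e4] at e3
  refine (congrArg norm e3).trans_le ?_
  rw [smul_apply, ContinuousLinearMap.id_apply, norm_smul]
  have h1 : 1 ≤ (1 + ‖z‖) ^ α := Real.one_le_rpow (by linarith [norm_nonneg z]) hα.le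
  calc _ ≤ ‖gauss d (z - k) - gauss d z‖ * D * 1 := by
        rw [mul_one]; gcongr; exact hD _
    _ ≤ ‖gauss d (z - k) - gauss d z‖ * D * (1 + ‖z‖) ^ α := by gcongr
    _ = _ := by ring

/-- Gaussian averages of Hölder functions converge at the expected rate. -/
lemma exists_norm_average_sub_le (d : ℕ) (hα : 0 < α) (hα1 : α < 1) : ∃ C : ℝ, 0 ≤ C ∧
    ∀ {T ν : ℝ} {U : ℝ × EuclideanSpace ℝ (Fin d) → EuclideanSpace ℝ (Fin d)}
      {P : ℝ × EuclideanSpace ℝ (Fin d) → ℝ}, NavierStokes T ν U P → ∀ {t : ℝ}, t ∈ Ioo 0 T →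
      ∀ {M : ℝ}, 0 ≤ M → (∀ x y, ‖U (t, x) - U (t, y)‖ ≤ M * ‖x - y‖ ^ α) →
      ∀ X {σ : ℝ}, 0 ≤ σ →
        ‖(∫ y, gauss d y • U (t, X + σ • y)) - U (t, X)‖ ≤ C * M * σ ^ α := by
  obtain ⟨C, hC, hb⟩ := (kernelDecay_gauss (d := d) (d + 2) (by positivity)).bound
  set g : EuclideanSpace ℝ (Fin d) → ℝ := fun y => C * (1 + ‖y‖) ^ (-((d : ℝ) + 1)) with hg
  have hgi : Integrable g := (integrable_one_add_norm (E := EuclideanSpace ℝ (Fin d))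
    (μ := volume) (r := (d : ℝ) + 1) (by simp)).const_mul C
  refine ⟨∫ y, g y, integral_nonneg fun y => by positivity, ?_⟩
  intro T ν U P hU t ht M hM hH X σ hσ
  have hgi' : Integrable (gauss d) := integrable_of_decay (by linarith)
    (kernelDecay_gauss (d := d) 0 le_rfl).1.continuous hb
  have e : (∫ y, gauss d y • U (t, X + σ • y)) - U (t, X)
      = ∫ y, gauss d y • (U (t, X + σ • y) - U (t, X)) := by
    simp only [smul_sub]
    rw [integral_sub (integrable_smul hU ht X σ) (hgi'.smul_const _), integral_smul_const,
      integral_gauss, one_smul]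
  rw [e]
  refine (norm_integral_le_of_norm_le (hgi.mul_const (M * σ ^ α))
    (Filter.Eventually.of_forall fun y => ?_)).trans_eq (by rw [integral_mul_const, mul_assoc])
  have hy : 0 < 1 + ‖y‖ := by positivity
  have h1 : ‖U (t, X + σ • y) - U (t, X)‖ ≤ M * σ ^ α * (1 + ‖y‖) := by
    refine (hH _ _).trans ?_
    rw [add_sub_cancel_left, norm_smul, Real.norm_of_nonneg hσ,
      Real.mul_rpow hσ (norm_nonneg _), ← mul_assoc]
    gcongr
    refine (Real.rpow_le_rpow (norm_nonneg y) (le_add_of_nonneg_left zero_le_one) hα.le).trans ?_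
    exact (Real.rpow_le_rpow_of_exponent_le (by linarith [norm_nonneg y]) hα1.le).trans_eq
      (Real.rpow_one _)
  rw [norm_smul]
  calc _ ≤ (C * (1 + ‖y‖) ^ (-((d : ℝ) + 2))) * (M * σ ^ α * (1 + ‖y‖)) := by
        gcongr; exact hb y
    _ = g y * (M * σ ^ α) := by
        simp only [hg]
        rw [show -((d : ℝ) + 1) = -((d : ℝ) + 2) + 1 by ring, Real.rpow_add hy, Real.rpow_one]
        ring

/-- If the first `n` differences are controlled on `[t - δ, t]`, then so is the next one at `t`. -/
lemma exists_norm_fwdDiff_iter_succ_le (hd : 2 ≤ d) (hα : 0 < α) (hα1 : α < 1) {n : ℕ} (hn : 1 ≤ n)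
    {c : ℝ} (hc : 1 ≤ c) : ∃ C : ℝ, 0 ≤ C ∧ ∀ {T ν M δ ℓ : ℝ}
      {U : ℝ × EuclideanSpace ℝ (Fin d) → EuclideanSpace ℝ (Fin d)}
      {P : ℝ × EuclideanSpace ℝ (Fin d) → ℝ}, ViscousHolder T ν M α δ ℓ U P →
      ∀ {t : ℝ}, δ < t → t < T →
      (∀ r ∈ Icc (t - δ) t, ∀ j : ℕ, 1 ≤ j → j ≤ n → ∀ h x,
        ‖(fwdDiff h)^[j] (fun y => U (r, y)) x‖ ≤ c * (M * ℓ ^ α) * (‖h‖ / ℓ) ^ (α * j)) →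
      ∀ h x, h ≠ 0 → ‖h‖ ≤ ℓ → ‖(fwdDiff h)^[n + 1] (fun y => U (t, y)) x‖
        ≤ C * (M * ℓ ^ α) * (‖h‖ / ℓ) ^ (α * (n + 1)) := by
  obtain ⟨C₁, hC₁, h1⟩ := exists_norm_diffStress_le hd hα hα1 hn hc
  obtain ⟨C₂, hC₂, h2⟩ := exists_norm_diffAverage_le (d := d) hα hα1 n
  obtain ⟨C₃, hC₃, h3⟩ := exists_norm_average_sub_le d hα hα1
  have hα' : 0 < 1 - α := by linarith
  refine ⟨C₂ * c + C₁ * 4 / (1 - α), by positivity, ?_⟩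
  intro T ν M δ ℓ U P hU t htδ htT hj h x h0 hhℓ
  have hν := hU.ν_pos
  have hδ := hU.δ_pos
  have hℓ := hU.ℓ_pos
  have hM := hU.M_nonneg
  have hh : 0 < ‖h‖ := norm_pos_iff.2 h0
  have hρ : 0 < ‖h‖ / ℓ := by positivity
  have hA : 0 ≤ M * ℓ ^ α := by positivity
  obtain ⟨φ, hφ⟩ := hU.ns.velocity.exists_volumeFlow (A := (t - δ) / 2) (B := (t + T) / 2)
    (by linarith) (by linarith) (by linarith)
  have hJ : ∀ r ∈ Icc (t - δ) t, r ∈ Ioo ((t - δ) / 2) ((t + T) / 2) := fun r hr =>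
    ⟨by linarith [hr.1], by linarith [hr.2]⟩
  have hIT : ∀ r ∈ Icc (t - δ) t, r ∈ Ioo 0 T := fun r hr =>
    ⟨by linarith [hr.1], by linarith [hr.2]⟩
  have htI : t ∈ Icc (t - δ) t := ⟨by linarith, le_rfl⟩
  have haI : t - δ ∈ Icc (t - δ) t := ⟨le_rfl, by linarith⟩
  set X : ℝ → EuclideanSpace ℝ (Fin d) := fun r => φ t r x with hX
  have hXt : X t = x := hφ.start t (hJ t htI) x
  set Q := (M * ℓ ^ α) * (‖h‖ / ℓ) ^ (α * (n + 1)) with hQ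
  have hQ0 : 0 ≤ Q := by positivity
  have key : ∀ η : ℝ, 0 < η → η ≤ ℓ ^ 2 → ‖(fwdDiff h)^[n + 1] (fun y => U (t, y)) x‖
      ≤ (C₂ * c + C₁ * 4 / (1 - α)) * Q + 2 ^ (n + 1) * (C₃ * M * √η ^ α) := by
    intro η hη hηℓ
    set σ : ℝ → ℝ := fun r => √(ν * (t - r) + η) with hσ
    have hpos : ∀ r ∈ Icc (t - δ) t, 0 < ν * (t - r) + η := fun r hr => by
      have := mul_nonneg hν.le (sub_nonneg.2 hr.2); linarith
    have hσ0 : ∀ r ∈ Icc (t - δ) t, 0 < σ r := fun r hr => Real.sqrt_pos.2 (hpos r hr)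
    have hσd : ∀ r ∈ Icc (t - δ) t, HasDerivAt σ (-(ν / (2 * σ r))) r := fun r hr =>
      hasDerivAt_sqrt_affine (hpos r hr)
    have hσℓ : ∀ r ∈ Icc (t - δ) t, σ r ≤ 2 * ℓ := fun r hr => by
      refine Real.sqrt_le_iff.2 ⟨by positivity, ?_⟩
      have : ν * (t - r) ≤ ν * δ := by gcongr; linarith [hr.1]
      rw [← hU.sq_eq] at this
      nlinarith
    have hσa : ℓ ≤ σ (t - δ) := by
      refine Real.le_sqrt_of_sq_le ?_
      rw [sub_sub_cancel, hU.sq_eq]; linarith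
    have hσt : σ t = √η := by simp [hσ]
    set κ := C₁ * (M * ℓ ^ α) ^ 2 * (‖h‖ / ℓ) ^ (α * (n + 1)) * ℓ ^ α with hκ
    have i1 : ‖diffAverage U X σ h (n + 1) t‖ ≤ ‖diffAverage U X σ h (n + 1) (t - δ)‖
        + κ * 2 / (ν * (1 - α)) * σ (t - δ) ^ (1 - α) := by
      refine norm_le_of_norm_deriv_le_rpow (by linarith) hν hα1 (by positivity) hσ0 hσd
        (fun r hr => hasDerivAt_diffAverage hd hU.ns (hIT r hr)
          (hφ.hasDerivAt t (hJ t htI) r (hJ r hr) x) (hσd r hr) (hσ0 r hr).ne' ?_ h n) ?_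
      · have := (hσ0 r hr).ne'
        field_simp
        ring
      · exact fun r hr => h1 hM hℓ (hU.holder r (hIT r hr)) (hj r hr) _ h (hσ0 r hr) (hσℓ r hr)
          h0 hhℓ
    have i2 : ‖diffAverage U X σ h (n + 1) (t - δ)‖ ≤ C₂ * c * Q := by
      refine (h2 hU.ns (hIT _ haI) (hj _ haI n hn le_rfl h) X σ (hσ0 _ haI)).trans ?_
      calc _ ≤ C₂ * (c * (M * ℓ ^ α) * (‖h‖ / ℓ) ^ (α * n)) * (‖h‖ / ℓ) ^ α := by gcongr
        _ = _ := by
          rw [hQ, mul_add, mul_one, Real.rpow_add hρ]; ring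
    have i3 : κ * 2 / (ν * (1 - α)) * σ (t - δ) ^ (1 - α) ≤ C₁ * 4 / (1 - α) * Q := by
      have e1 : σ (t - δ) ^ (1 - α) ≤ 2 * ℓ ^ (1 - α) := by
        refine (Real.rpow_le_rpow (hσ0 _ haI).le (hσℓ _ haI) hα'.le).trans ?_
        rw [Real.mul_rpow zero_le_two hℓ.le]
        gcongr
        exact (Real.rpow_le_rpow_of_exponent_le one_le_two (by linarith)).trans_eq (Real.rpow_one 2)
      have e2 : M * ℓ ^ α * (ℓ ^ α * ℓ ^ (1 - α)) ≤ ν := by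
        refine le_trans (le_of_eq ?_) hU.small
        rw [← Real.rpow_add hℓ, mul_assoc, ← Real.rpow_add hℓ]
        ring_nf
      calc _ ≤ κ * 2 / (ν * (1 - α)) * (2 * ℓ ^ (1 - α)) := by gcongr
        _ = C₁ * 4 / (ν * (1 - α)) * Q * (M * ℓ ^ α * (ℓ ^ α * ℓ ^ (1 - α))) := by
            rw [hκ, hQ]; ring
        _ ≤ C₁ * 4 / (ν * (1 - α)) * Q * ν := by gcongr
        _ = _ := by field_simp
    have i4 : ‖diffAverage U X σ h (n + 1) t - (fwdDiff h)^[n + 1] (fun y => U (t, y)) x‖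
        ≤ 2 ^ (n + 1) * (C₃ * M * √η ^ α) := by
      rw [← fwdDiff_iter_nat_eq, diffAverage, ← fwdDiff_iter_fun_sub]
      refine norm_fwdDiff_iter_le_two_pow_mul _ _ fun p _ => ?_
      rw [hXt, ← hσt]
      exact h3 hU.ns (hIT t htI) hM (hU.holder t (hIT t htI)) _ (hσ0 t htI).le
    have i5 := norm_sub_norm_le ((fwdDiff h)^[n + 1] (fun y => U (t, y)) x)
      (diffAverage U X σ h (n + 1) t)
    rw [norm_sub_rev] at i5
    linarith
  have hlim : Filter.Tendsto (fun η : ℝ => (C₂ * c + C₁ * 4 / (1 - α)) * Q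
      + 2 ^ (n + 1) * (C₃ * M * √η ^ α)) (nhdsWithin 0 (Ioi 0))
      (nhds ((C₂ * c + C₁ * 4 / (1 - α)) * Q)) := by
    have : Continuous fun η : ℝ => (C₂ * c + C₁ * 4 / (1 - α)) * Q
      + 2 ^ (n + 1) * (C₃ * M * √η ^ α) := by
      have := Real.continuous_sqrt.rpow_const (p := α) fun _ => Or.inr hα.le
      fun_prop
    have h0 := (this.tendsto 0).mono_left (nhdsWithin_le_nhds (s := Ioi 0))
    simpa [Real.zero_rpow hα.ne'] using h0
  have := ge_of_tendsto hlim (by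
    filter_upwards [Ioc_mem_nhdsGT (show (0 : ℝ) < ℓ ^ 2 by positivity)] with η hη
    exact key η hη.1 hη.2)
  rwa [hQ, ← mul_assoc] at this

/-- Viscous smoothing: iterated differences gain a factor per difference after a waiting time. -/
theorem exists_norm_fwdDiff_iter_le (hd : 2 ≤ d) (hα : 0 < α) (hα1 : α < 1) (n : ℕ) :
    ∃ C : ℝ, 1 ≤ C ∧ ∀ {T ν M δ ℓ : ℝ}
      {U : ℝ × EuclideanSpace ℝ (Fin d) → EuclideanSpace ℝ (Fin d)}
      {P : ℝ × EuclideanSpace ℝ (Fin d) → ℝ}, ViscousHolder T ν M α δ ℓ U P →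
      ∀ t ∈ Ioo 0 T, n * δ < t → ∀ j : ℕ, 1 ≤ j → j ≤ n + 1 → ∀ h x,
        ‖(fwdDiff h)^[j] (fun y => U (t, y)) x‖
          ≤ C * (M * ℓ ^ α) * (‖h‖ / ℓ) ^ (α * j) := by
  induction n with
  | zero =>
    refine ⟨1, le_rfl, ?_⟩
    intro T ν M δ ℓ U P hU t ht _ j hj1 hj h x
    obtain rfl : j = 1 := by omega
    simpa using hU.norm_fwdDiff_iter_le_of_le ht 0 h x
  | succ n ih =>
    obtain ⟨c, hc, h1⟩ := ih
    obtain ⟨C, hC, h2⟩ := exists_norm_fwdDiff_iter_succ_le hd hα hα1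
      (Nat.le_add_left 1 n) hc
    have h20 : (0 : ℝ) < 2 ^ (n + 1) := by positivity
    refine ⟨c + C + 2 ^ (n + 1), by linarith, ?_⟩
    intro T ν M δ ℓ U P hU t ht htδ j hj1 hj h x
    have hδ := hU.δ_pos
    have hℓ := hU.ℓ_pos
    have hM := hU.M_nonneg
    have hnδ : 0 ≤ n * δ := by positivity
    push_cast at htδ
    rcases Nat.lt_or_ge j (n + 2) with hj' | hj'
    · refine (h1 hU t ht (by linarith) j hj1 (by omega) h x).trans ?_
      gcongr
      linarith
    obtain rfl : j = n + 1 + 1 := by omega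
    rcases eq_or_ne h 0 with rfl | h0
    · refine (hU.norm_fwdDiff_iter_le_of_le ht (n + 1) 0 x).trans ?_
      simp only [norm_zero, zero_div, Real.zero_rpow hα.ne', mul_zero]
      positivity
    have hh : 0 < ‖h‖ := norm_pos_iff.2 h0
    rcases le_total ‖h‖ ℓ with hhℓ | hhℓ
    · refine (h2 hU (by linarith) ht.2 (fun r hr j hj1 hj => h1 hU r
        ⟨by linarith [hr.1], by linarith [hr.2, ht.2]⟩ (by linarith [hr.1]) j hj1 hj)
        h x h0 hhℓ).trans ?_
      push_cast
      gcongr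
      linarith
    · refine (hU.norm_fwdDiff_iter_le_of_le ht (n + 1) h x).trans ?_
      have hρ : 1 ≤ ‖h‖ / ℓ := (one_le_div hℓ).2 hhℓ
      have e : (‖h‖ / ℓ) ^ α ≤ (‖h‖ / ℓ) ^ (α * ((n + 1 + 1 : ℕ) : ℝ)) := by
        refine Real.rpow_le_rpow_of_exponent_le hρ ?_
        push_cast
        have : (0 : ℝ) ≤ n := Nat.cast_nonneg n
        nlinarith
      rw [← mul_assoc]
      gcongr
      linarith

end ViscousHolder

section Dilation

lemma KernelDecay.dilate {E H : Type} [NormedAddCommGroup E] [NormedSpace ℝ E]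
    [NormedAddCommGroup H] [NormedSpace ℝ H] {a : ℝ} (ha : 0 ≤ a) {K : E → H}
    (h : KernelDecay a K) {r : ℝ} (hr : 0 < r) : KernelDecay a fun y => K (r • y) := by
  set L : E →L[ℝ] E := r • ContinuousLinearMap.id ℝ E with hL
  refine ⟨h.1.comp (contDiff_const_smul r), fun i => ?_⟩
  obtain ⟨C, hC, hb⟩ := h.2 i
  refine ⟨C * (1 + r⁻¹) ^ (a + i) * ‖L‖ ^ i, by positivity, fun y => ?_⟩
  have e : iteratedFDeriv ℝ i (fun y => K (r • y)) y
      = (iteratedFDeriv ℝ i K (r • y)).compContinuousLinearMap fun _ => L :=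
    L.iteratedFDeriv_comp_right h.1 y (by exact_mod_cast le_top)
  have h1 : 1 + ‖y‖ ≤ (1 + r⁻¹) * (1 + ‖r • y‖) := by
    rw [norm_smul, Real.norm_of_nonneg hr.le]
    have : r⁻¹ * (r * ‖y‖) = ‖y‖ := by field_simp
    have : 0 ≤ r * ‖y‖ := by positivity
    have : 0 < r⁻¹ := by positivity
    nlinarith
  have h2 := rpow_neg_le_of_le_mul (a := a + i) (by positivity) (by positivity)
    (by positivity) h1
  rw [e]
  refine (ContinuousMultilinearMap.norm_compContinuousLinearMap_le _ _).trans ?_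
  rw [Finset.prod_const, Finset.card_univ, Fintype.card_fin]
  have h3 := hb (r • y)
  rw [show -a - (i : ℝ) = -(a + i) by ring] at h3 ⊢
  calc _ ≤ (C * ((1 + r⁻¹) ^ (a + i) * (1 + ‖y‖) ^ (-(a + i)))) * ‖L‖ ^ i :=
        mul_le_mul_of_nonneg_right (h3.trans (mul_le_mul_of_nonneg_left h2 hC)) (by positivity)
    _ = _ := by ring

lemma KernelDecay.sum {E H : Type} [NormedAddCommGroup E] [NormedSpace ℝ E]
    [NormedAddCommGroup H] [NormedSpace ℝ H] {a : ℝ} {K : ℕ → E → H} (s : Finset ℕ)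
    (h : ∀ i, KernelDecay a (K i)) : KernelDecay a fun y => ∑ i ∈ s, K i y := by
  classical
  induction s using Finset.induction_on with
  | empty =>
    refine ⟨by simpa using contDiff_const, fun i => ⟨0, le_rfl, fun y => ?_⟩⟩
    simp [iteratedFDeriv_fun_zero]
  | insert i s hi ih =>
    simp only [Finset.sum_insert hi]
    exact (h i).add ih

end Dilation

section Richardson

variable {d : ℕ}

/-- The weights for which the average at scales `1, …, N` has vanishing moments up to order `N`. -/
noncomputable def richardsonCoeff (N i : ℕ) : ℝ := (-1) ^ i * (N.choose (i + 1) : ℝ)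

/-- The stress kernel of the extrapolated Gaussian average. -/
noncomputable def richardsonStress (d N : ℕ) (z : EuclideanSpace ℝ (Fin d)) :
    EuclideanSpace ℝ (Fin d) →L[ℝ] EuclideanSpace ℝ (Fin d) →L[ℝ] EuclideanSpace ℝ (Fin d) :=
  ∑ i ∈ Finset.range N, (richardsonCoeff N i * ((i : ℝ) + 1)⁻¹ * (((i : ℝ) + 1) ^ d)⁻¹) •
    stressKernel d (((i : ℝ) + 1)⁻¹ • z)

/-- The viscous kernel of the extrapolated Gaussian average. -/
noncomputable def richardsonLap (d N : ℕ) (z : EuclideanSpace ℝ (Fin d)) :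
    EuclideanSpace ℝ (Fin d) →L[ℝ] EuclideanSpace ℝ (Fin d) :=
  ∑ i ∈ Finset.range N, (richardsonCoeff N i * ((i : ℝ) + 1)⁻¹ ^ 2 * (((i : ℝ) + 1) ^ d)⁻¹) •
    lapKernel d (((i : ℝ) + 1)⁻¹ • z) • ContinuousLinearMap.id ℝ (EuclideanSpace ℝ (Fin d))

lemma kernelDecay_richardsonStress (hd : 2 ≤ d) (N : ℕ) :
    KernelDecay ((d : ℝ) + 1) (richardsonStress d N) :=
  KernelDecay.sum _ fun i =>
    ((kernelDecay_stressKernel hd).dilate (by positivity) (r := ((i : ℝ) + 1)⁻¹)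
      (by positivity)).clm_comp
      ((richardsonCoeff N i * ((i : ℝ) + 1)⁻¹ * (((i : ℝ) + 1) ^ d)⁻¹) •
        ContinuousLinearMap.id ℝ _)

lemma kernelDecay_richardsonLap (N : ℕ) :
    KernelDecay ((d : ℝ) + 1) (richardsonLap d N) :=
  KernelDecay.sum _ fun i =>
    ((kernelDecay_lapKernel (d := d) ((d : ℝ) + 1) (by positivity)).dilate (by positivity)
      (r := ((i : ℝ) + 1)⁻¹) (by positivity)).clm_comp
      ((richardsonCoeff N i * ((i : ℝ) + 1)⁻¹ ^ 2 * (((i : ℝ) + 1) ^ d)⁻¹) •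
        ContinuousLinearMap.smulRight (1 : ℝ →L[ℝ] ℝ)
          (ContinuousLinearMap.id ℝ (EuclideanSpace ℝ (Fin d))))

lemma sum_richardsonCoeff_smul {G : Type*} [AddCommGroup G] [Module ℝ G] (N : ℕ) (f : ℕ → G) :
    f 0 - ∑ i ∈ Finset.range N, richardsonCoeff N i • f (i + 1)
      = (-1 : ℝ) ^ N • (fwdDiff 1)^[N] f 0 := by
  rw [fwdDiff_iter_eq_sum_shift, Finset.sum_range_succ', smul_add, Finset.smul_sum, add_comm,
    sub_eq_add_neg, ← Finset.sum_neg_distrib]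
  congr 1
  · simp only [← Int.cast_smul_eq_zsmul ℝ, smul_smul, Nat.sub_zero, Nat.choose_zero_right]
    push_cast
    rw [mul_one, ← mul_pow]
    simp
  · refine Finset.sum_congr rfl fun i hi => ?_
    have hiN := Finset.mem_range.1 hi
    simp only [← Int.cast_smul_eq_zsmul ℝ, smul_smul, richardsonCoeff, ← neg_smul, zero_add,
      smul_eq_mul, mul_one]
    congr 1
    push_cast
    obtain ⟨k, rfl⟩ := Nat.exists_eq_add_of_lt hiN
    rw [show i + k + 1 - (i + 1) = k by omega]
    have h1 : ((-1 : ℝ) ^ k) * (-1) ^ k = 1 := by rw [← mul_pow]; simp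
    rw [pow_succ, pow_add]
    linear_combination ((-1 : ℝ) ^ i * ((i + k + 1).choose (i + 1) : ℝ)) * h1

lemma integral_interaction_richardson (hd : 2 ≤ d) (N : ℕ) (ν : ℝ)
    {W : EuclideanSpace ℝ (Fin d) → EuclideanSpace ℝ (Fin d)} (hW : Continuous W) {D : ℝ}
    (hD : ∀ z, ‖W z‖ ≤ D) :
    ∫ z, interaction (richardsonStress d N) ν (richardsonLap d N) z (W z)
      = ∑ i ∈ Finset.range N, richardsonCoeff N i • (((i : ℝ) + 1)⁻¹ •
          (∫ y, stressKernel d y (W (((i : ℝ) + 1) • y)) (W (((i : ℝ) + 1) • y)))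
        + (ν * ((i : ℝ) + 1)⁻¹ ^ 2) • ∫ y, lapKernel d y • W (((i : ℝ) + 1) • y)) := by
  have hD0 : 0 ≤ D := (norm_nonneg _).trans (hD 0)
  obtain ⟨C, hC, hb⟩ := (kernelDecay_stressKernel hd).bound
  obtain ⟨C', hC', hb'⟩ := (kernelDecay_lapKernel (d := d) ((d : ℝ) + 1) (by positivity)).bound
  set f : ℕ → EuclideanSpace ℝ (Fin d) → EuclideanSpace ℝ (Fin d) := fun i y =>
    stressKernel d y (W (((i : ℝ) + 1) • y)) (W (((i : ℝ) + 1) • y)) with hf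
  set g : ℕ → EuclideanSpace ℝ (Fin d) → EuclideanSpace ℝ (Fin d) := fun i y =>
    lapKernel d y • W (((i : ℝ) + 1) • y) with hg
  have hfi : ∀ i, Integrable (f i) := fun i => by
    have hc : Continuous fun y => W (((i : ℝ) + 1) • y) := hW.comp (continuous_const_smul _)
    refine integrable_of_decay (a := d + 1) (C := C * D ^ 2) (by linarith)
      (((kernelDecay_stressKernel hd).1.continuous.clm_apply hc).clm_apply hc) fun y => ?_
    refine ((stressKernel d y).le_opNorm₂ _ _).trans ?_
    have h1 := hD (((i : ℝ) + 1) • y)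
    calc _ ≤ (C * (1 + ‖y‖) ^ (-((d : ℝ) + 1))) * D * D := by
          gcongr
          exact hb y
      _ = _ := by ring
  have hgi : ∀ i, Integrable (g i) := fun i => by
    have hc : Continuous fun y => W (((i : ℝ) + 1) • y) := hW.comp (continuous_const_smul _)
    refine integrable_of_decay (a := d + 1) (C := C' * D) (by linarith)
      ((kernelDecay_lapKernel (d := d) 0 le_rfl).1.continuous.smul hc) fun y => ?_
    rw [norm_smul]
    have h1 := hD (((i : ℝ) + 1) • y)
    calc _ ≤ (C' * (1 + ‖y‖) ^ (-((d : ℝ) + 1))) * D := by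
          gcongr
          exact hb' y
      _ = _ := by ring
  have hpos : ∀ i : ℕ, (0 : ℝ) < (i : ℝ) + 1 := fun i => by positivity
  have e : ∀ z, interaction (richardsonStress d N) ν (richardsonLap d N) z (W z)
      = ∑ i ∈ Finset.range N, richardsonCoeff N i •
        ((((i : ℝ) + 1)⁻¹ * (((i : ℝ) + 1) ^ d)⁻¹) • f i (((i : ℝ) + 1)⁻¹ • z)
        + (ν * ((i : ℝ) + 1)⁻¹ ^ 2 * (((i : ℝ) + 1) ^ d)⁻¹) • g i (((i : ℝ) + 1)⁻¹ • z)) := by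
    intro z
    simp only [interaction, richardsonStress, richardsonLap, sum_apply, smul_apply, Finset.smul_sum,
      ← Finset.sum_add_distrib, hf, hg, ContinuousLinearMap.id_apply]
    refine Finset.sum_congr rfl fun i _ => ?_
    rw [smul_inv_smul₀ (hpos i).ne']
    module
  have hInt : ∀ i, (∫ z, f i (((i : ℝ) + 1)⁻¹ • z)) = (((i : ℝ) + 1) ^ d) • ∫ y, f i y := by
    intro i
    rw [Measure.integral_comp_inv_smul, finrank_euclideanSpace_fin,
      abs_of_nonneg (pow_nonneg (hpos i).le d)]
  have hInt' : ∀ i, (∫ z, g i (((i : ℝ) + 1)⁻¹ • z)) = (((i : ℝ) + 1) ^ d) • ∫ y, g i y := by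
    intro i
    rw [Measure.integral_comp_inv_smul, finrank_euclideanSpace_fin,
      abs_of_nonneg (pow_nonneg (hpos i).le d)]
  have hfs : ∀ i c, Integrable fun z => (c : ℝ) • f i (((i : ℝ) + 1)⁻¹ • z) := fun i c =>
    (((hfi i).comp_smul (inv_ne_zero (hpos i).ne'))).smul c
  have hgs : ∀ i c, Integrable fun z => (c : ℝ) • g i (((i : ℝ) + 1)⁻¹ • z) := fun i c =>
    (((hgi i).comp_smul (inv_ne_zero (hpos i).ne'))).smul c
  simp only [e]
  rw [integral_finsetSum _ fun i _ => ((hfs i _).fun_add (hgs i _)).fun_smul _]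
  refine Finset.sum_congr rfl fun i _ => ?_
  rw [integral_smul, integral_add (hfs i _) (hgs i _), integral_smul, integral_smul, hInt, hInt',
    smul_smul, smul_smul, mul_assoc, mul_assoc, inv_mul_cancel₀ (pow_pos (hpos i) d).ne', mul_one,
    mul_one]

end Richardson

section Rescaling

variable {d : ℕ}

/-- A solution observed on the time window `(c - s, c + s)` at the spatial scale `ρ`. -/
structure FlowWindow (T ν M α c s ρ : ℝ)
    (U : ℝ × EuclideanSpace ℝ (Fin d) → EuclideanSpace ℝ (Fin d))
    (P : ℝ × EuclideanSpace ℝ (Fin d) → ℝ)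
    (φ : ℝ → ℝ → EuclideanSpace ℝ (Fin d) → EuclideanSpace ℝ (Fin d)) : Prop where
  ns : NavierStokes T ν U P
  flow : VolumeFlow (Ioo (c - s) (c + s)) U φ
  holder : ∀ t ∈ Ioo (c - s) (c + s), ∀ x y, ‖U (t, x) - U (t, y)‖ ≤ M * ‖x - y‖ ^ α
  lower : 0 < c - s
  upper : c + s < T
  s_pos : 0 < s
  ρ_pos : 0 < ρ

namespace FlowWindow

variable {T ν M α c s ρ : ℝ} {U : ℝ × EuclideanSpace ℝ (Fin d) → EuclideanSpace ℝ (Fin d)}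
  {P : ℝ × EuclideanSpace ℝ (Fin d) → ℝ}
  {φ : ℝ → ℝ → EuclideanSpace ℝ (Fin d) → EuclideanSpace ℝ (Fin d)}

variable (c s ρ U φ) in
/-- Rescaled positions. -/
noncomputable def position (t : ℝ) (b : EuclideanSpace ℝ (Fin d)) : EuclideanSpace ℝ (Fin d) :=
  ρ⁻¹ • φ c (c + s * t) (ρ • b)

variable (c s ρ U φ) in
/-- Rescaled velocities. -/
noncomputable def velocity (t : ℝ) (b : EuclideanSpace ℝ (Fin d)) : EuclideanSpace ℝ (Fin d) :=
  (s / ρ) • U (c + s * t, φ c (c + s * t) (ρ • b))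

variable (c s ρ U φ) in
/-- Rescaled extrapolated averages of the velocity. -/
noncomputable def average (N : ℕ) (t : ℝ) (b : EuclideanSpace ℝ (Fin d)) :
    EuclideanSpace ℝ (Fin d) :=
  (s / ρ) • ∑ i ∈ Finset.range N, richardsonCoeff N i •
    ∫ y, gauss d y • U (c + s * t, φ c (c + s * t) (ρ • b) + (((i : ℝ) + 1) * ρ) • y)

lemma mem_window (hW : FlowWindow T ν M α c s ρ U P φ) {t : ℝ} (ht : t ∈ Ioo (-1 : ℝ) 1) :
    c + s * t ∈ Ioo (c - s) (c + s) := by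
  have := hW.s_pos
  constructor <;> nlinarith [ht.1, ht.2]

lemma center_mem (hW : FlowWindow T ν M α c s ρ U P φ) : c ∈ Ioo (c - s) (c + s) := by
  have := hW.s_pos
  constructor <;> linarith

lemma mem_Ioo (hW : FlowWindow T ν M α c s ρ U P φ) {t : ℝ} (ht : t ∈ Ioo (c - s) (c + s)) :
    t ∈ Ioo 0 T := ⟨hW.lower.trans ht.1, ht.2.trans hW.upper⟩

lemma smul_position (hW : FlowWindow T ν M α c s ρ U P φ) (t : ℝ) (b : EuclideanSpace ℝ (Fin d)) :
    ρ • position c s ρ φ t b = φ c (c + s * t) (ρ • b) := smul_inv_smul₀ hW.ρ_pos.ne' _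

lemma position_zero (hW : FlowWindow T ν M α c s ρ U P φ) (b : EuclideanSpace ℝ (Fin d)) :
    position c s ρ φ 0 b = b := by
  rw [position, mul_zero, add_zero, hW.flow.start c hW.center_mem, inv_smul_smul₀ hW.ρ_pos.ne']

lemma hasDerivAt_flow (hW : FlowWindow T ν M α c s ρ U P φ) {t : ℝ} (ht : t ∈ Ioo (-1 : ℝ) 1)
    (b : EuclideanSpace ℝ (Fin d)) :
    HasDerivAt (fun r => φ c r (ρ • b)) (U (c + s * t, φ c (c + s * t) (ρ • b))) (c + s * t) :=
  hW.flow.hasDerivAt c hW.center_mem _ (hW.mem_window ht) _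

lemma hasDerivAt_time (c s t : ℝ) : HasDerivAt (fun r : ℝ => c + s * r) s t := by
  simpa using ((hasDerivAt_id' t).const_mul s).const_add c

lemma hasDerivAt_position (hW : FlowWindow T ν M α c s ρ U P φ) {t : ℝ}
    (ht : t ∈ Ioo (-1 : ℝ) 1) (b : EuclideanSpace ℝ (Fin d)) :
    HasDerivAt (fun r => position c s ρ φ r b) (velocity c s ρ U φ t b) t := by
  refine (((hW.hasDerivAt_flow ht b).scomp t (hasDerivAt_time c s t)).const_smul
    ρ⁻¹).congr_deriv ?_
  rw [velocity, smul_smul, div_eq_inv_mul]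

lemma continuous_slice (hW : FlowWindow T ν M α c s ρ U P φ) {t : ℝ}
    (ht : t ∈ Ioo (c - s) (c + s)) : Continuous fun x => U (t, x) := by
  simpa using (hW.ns.velocity.smooth.contDiff_slice (hW.mem_Ioo ht) 0 1).continuous

lemma continuous_position (hW : FlowWindow T ν M α c s ρ U P φ) {t : ℝ}
    (ht : t ∈ Ioo (-1 : ℝ) 1) : Continuous (position c s ρ φ t) :=
  ((hW.flow.continuous c hW.center_mem _ (hW.mem_window ht)).comp
    (continuous_const_smul ρ)).const_smul ρ⁻¹

lemma continuous_velocity (hW : FlowWindow T ν M α c s ρ U P φ) {t : ℝ}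
    (ht : t ∈ Ioo (-1 : ℝ) 1) : Continuous (velocity c s ρ U φ t) :=
  ((hW.continuous_slice (hW.mem_window ht)).comp
    ((hW.flow.continuous c hW.center_mem _ (hW.mem_window ht)).comp
    (continuous_const_smul ρ))).const_smul (s / ρ)

lemma continuousOn_velocity (hW : FlowWindow T ν M α c s ρ U P φ) (b : EuclideanSpace ℝ (Fin d)) :
    ContinuousOn (fun t => velocity c s ρ U φ t b) (Ioo (-1) 1) := by
  intro t ht
  have h1 : ContinuousAt U (c + s * t, φ c (c + s * t) (ρ • b)) :=
    (hW.ns.velocity.smooth.hasFDerivAt (hW.mem_Ioo (hW.mem_window ht))).continuousAt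
  have h3 : ContinuousAt (fun r => φ c (c + s * r) (ρ • b)) t :=
    ContinuousAt.comp (g := fun r => φ c r (ρ • b)) (hW.hasDerivAt_flow ht b).continuousAt
      (hasDerivAt_time c s t).continuousAt
  have h2 := (hasDerivAt_time c s t).continuousAt.prodMk h3
  exact ((ContinuousAt.comp (f := fun r => (c + s * r, φ c (c + s * r) (ρ • b))) h1 h2).const_smul
    (s / ρ)).continuousWithinAt

lemma exists_velocity_bound (hW : FlowWindow T ν M α c s ρ U P φ) :
    ∃ D : ℝ, 0 ≤ D ∧ ∀ t ∈ Ioo (c - s) (c + s), ∀ x, ‖U (t, x)‖ ≤ D := by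
  obtain ⟨D, hD, h⟩ := hW.ns.velocity.smooth.exists_bound hW.lower hW.upper
  exact ⟨D, hD, fun t ht => h t (Ioo_subset_Icc_self ht)⟩

lemma norm_velocity_sub_le (hW : FlowWindow T ν M α c s ρ U P φ) {t : ℝ}
    (ht : t ∈ Ioo (-1 : ℝ) 1) (b b' : EuclideanSpace ℝ (Fin d)) :
    ‖velocity c s ρ U φ t b - velocity c s ρ U φ t b'‖
      ≤ M * s * ρ ^ (α - 1) * ‖position c s ρ φ t b - position c s ρ φ t b'‖ ^ α := by
  have hρ := hW.ρ_pos
  have hs := hW.s_pos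
  rw [velocity, velocity, ← smul_sub, norm_smul, Real.norm_of_nonneg (by positivity),
    ← hW.smul_position, ← hW.smul_position]
  refine (mul_le_mul_of_nonneg_left (hW.holder _ (hW.mem_window ht) _ _)
    (by positivity)).trans_eq ?_
  rw [← smul_sub, norm_smul, Real.norm_of_nonneg hρ.le, Real.mul_rpow hρ.le (norm_nonneg _),
    Real.rpow_sub_one hρ.ne']
  ring

lemma labelledMotion (hW : FlowWindow T ν M α c s ρ U P φ) (hα : 0 < α) (hα1 : α < 1)
    (hM : 0 < M) (hν : 0 ≤ ν) {μ : ℝ} (hμ : μ ≤ 1) (hMμ : M * s * ρ ^ (α - 1) ≤ μ)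
    (hνμ : ν * s / ρ ^ 2 ≤ μ) :
    LabelledMotion 0 α (M * s * ρ ^ (α - 1)) μ (ν * s / ρ ^ 2) 3 (position c s ρ φ)
      (velocity c s ρ U φ) := by
  have hρ := hW.ρ_pos
  have hs := hW.s_pos
  obtain ⟨D, hD, hb⟩ := hW.exists_velocity_bound
  refine labelledMotion_of_holder hα hα1 (by positivity) hMμ hμ (by positivity) hνμ
    (fun t ht b => hW.hasDerivAt_position ht b) (fun t ht => hW.continuous_position ht)
    (fun t ht => hW.continuous_velocity ht) hW.continuousOn_velocity hW.position_zero
    (fun t ht b b' => hW.norm_velocity_sub_le ht b b') (D := (s / ρ) * D) fun t ht b => ?_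
  rw [velocity, norm_smul, Real.norm_of_nonneg (by positivity)]
  exact mul_le_mul_of_nonneg_left (hb _ (hW.mem_window ht) _) (by positivity)

lemma integral_comp_position (hW : FlowWindow T ν M α c s ρ U P φ) {t : ℝ}
    (ht : t ∈ Ioo (-1 : ℝ) 1) (f : EuclideanSpace ℝ (Fin d) → EuclideanSpace ℝ (Fin d)) :
    ∫ b, f (position c s ρ φ t b) = ∫ b, f b := by
  have hρ := hW.ρ_pos
  have h1 := Measure.integral_comp_smul volume (fun b => f (ρ⁻¹ • φ c (c + s * t) b)) ρ
  simp only [position]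
  rw [h1, hW.flow.integral_comp (fun b => f (ρ⁻¹ • b)) c hW.center_mem _ (hW.mem_window ht),
    Measure.integral_comp_smul volume f ρ⁻¹, smul_smul, inv_pow, inv_inv, ← abs_mul,
    inv_mul_cancel₀ (pow_pos hρ _).ne', abs_one, one_smul]

lemma hasDerivAt_average (hd : 2 ≤ d) (hW : FlowWindow T ν M α c s ρ U P φ) (N : ℕ) {t : ℝ}
    (ht : t ∈ Ioo (-1 : ℝ) 1) (b : EuclideanSpace ℝ (Fin d)) :
    HasDerivAt (fun r => average c s ρ U φ N r b)
      (drift (richardsonStress d N) (ν * s / ρ ^ 2) (richardsonLap d N) (position c s ρ φ t)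
        (velocity c s ρ U φ t) b) t := by
  have hρ := hW.ρ_pos
  obtain ⟨D, hD, hb⟩ := hW.exists_velocity_bound
  have hr := hW.mem_window ht
  set r := c + s * t with hr_def
  set X := φ c r (ρ • b) with hX
  set W : EuclideanSpace ℝ (Fin d) → EuclideanSpace ℝ (Fin d) := fun z =>
    (s / ρ) • (U (r, X + ρ • z) - U (r, X)) with hWdef
  have hWc : Continuous W := by
    have := (hW.ns.velocity.smooth.contDiff_slice (hW.mem_Ioo hr) X ρ).continuous
    exact (this.sub continuous_const).const_smul (s / ρ)
  have hWb : ∀ z, ‖W z‖ ≤ |s / ρ| * (D + D) := fun z => by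
    rw [hWdef]
    simp only [norm_smul, Real.norm_eq_abs]
    exact mul_le_mul_of_nonneg_left ((norm_sub_le _ _).trans (add_le_add (hb _ hr _) (hb _ hr _)))
      (abs_nonneg _)
  have hdrift : drift (richardsonStress d N) (ν * s / ρ ^ 2) (richardsonLap d N)
      (position c s ρ φ t) (velocity c s ρ U φ t) b
      = ∫ z, interaction (richardsonStress d N) (ν * s / ρ ^ 2) (richardsonLap d N) z (W z) := by
    set G : EuclideanSpace ℝ (Fin d) → EuclideanSpace ℝ (Fin d) := fun z =>
      interaction (richardsonStress d N) (ν * s / ρ ^ 2) (richardsonLap d N) z (W z) with hG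
    rw [drift, ← integral_sub_right_eq_self G (position c s ρ φ t b),
      ← hW.integral_comp_position ht fun z => G (z - position c s ρ φ t b)]
    refine integral_congr_ae (Filter.Eventually.of_forall fun x => ?_)
    simp only [hG, hWdef, velocity]
    rw [smul_sub ρ, hW.smul_position, hW.smul_position, ← hr_def, ← hX, add_sub_cancel, smul_sub]
  have h := HasDerivAt.fun_const_smul (s / ρ) (HasDerivAt.fun_sum fun i (_ : i ∈ Finset.range N) =>
    ((hW.ns.hasDerivAt_average hd (hW.mem_Ioo hr) (hW.hasDerivAt_flow ht b)
      (hasDerivAt_const r (((i : ℝ) + 1) * ρ)) (by positivity)).scomp t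
      (hasDerivAt_time c s t)).fun_const_smul (richardsonCoeff N i))
  refine h.congr_deriv ?_
  rw [hdrift, integral_interaction_richardson hd N _ hWc hWb, Finset.smul_sum]
  refine Finset.sum_congr rfl fun i _ => ?_
  have hWi : ∀ y, W (((i : ℝ) + 1) • y)
      = (s / ρ) • (U (r, X + (((i : ℝ) + 1) * ρ) • y) - U (r, X)) := fun y => by
    simp only [hWdef, smul_smul, mul_comm ρ]
  simp only [hWi, map_smul, smul_apply, smul_comm (lapKernel d _) (s / ρ), integral_smul]
  simp only [← hr_def, ← hX, smul_add, smul_smul]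
  congr 2
  · field_simp
  · field_simp
    ring

end FlowWindow

end Rescaling

section Trajectories

variable {d : ℕ}

/-- The moment of order `N` of the heat kernel at time one. -/
noncomputable def gaussMoment (d N : ℕ) : ℝ := ∫ y, gauss d y * (1 + ‖y‖) ^ N

lemma integrable_gauss_mul_pow (N : ℕ) :
    Integrable fun y : EuclideanSpace ℝ (Fin d) => gauss d y * (1 + ‖y‖) ^ N := by
  have h := kernelDecay_gauss (d := d) (d + 1 + N) (by positivity)
  obtain ⟨C, hC, hb⟩ := h.bound
  refine integrable_of_decay (a := d + 1) (C := C) (by linarith) (h.1.continuous.mul (by fun_prop))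
    fun y => ?_
  have hy : 0 < 1 + ‖y‖ := by positivity
  rw [norm_mul, norm_pow, Real.norm_of_nonneg hy.le]
  refine (mul_le_mul_of_nonneg_right (hb y) (by positivity)).trans_eq ?_
  rw [neg_add, Real.rpow_add hy, Real.rpow_neg hy.le (N : ℝ), Real.rpow_natCast]
  field_simp

lemma gaussMoment_nonneg (N : ℕ) : 0 ≤ gaussMoment d N :=
  integral_nonneg fun y => mul_nonneg (gauss_nonneg y) (by positivity)

namespace FlowWindow

variable {T ν M α c s ρ : ℝ} {U : ℝ × EuclideanSpace ℝ (Fin d) → EuclideanSpace ℝ (Fin d)}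
  {P : ℝ × EuclideanSpace ℝ (Fin d) → ℝ}
  {φ : ℝ → ℝ → EuclideanSpace ℝ (Fin d) → EuclideanSpace ℝ (Fin d)}

lemma norm_velocity_sub_average_le (hW : FlowWindow T ν M α c s ρ U P φ) {N : ℕ}
    {e : ℝ} (he : ∀ t ∈ Ioo (c - s) (c + s), ∀ x y,
      s / ρ * ‖(fwdDiff (ρ • y))^[N] (fun x => U (t, x)) x‖ ≤ e * (1 + ‖y‖) ^ N)
    {t : ℝ} (ht : t ∈ Ioo (-1 : ℝ) 1) (b : EuclideanSpace ℝ (Fin d)) :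
    ‖velocity c s ρ U φ t b - average c s ρ U φ N t b‖ ≤ e * gaussMoment d N := by
  have hρ := hW.ρ_pos
  have hs := hW.s_pos
  have hr := hW.mem_window ht
  rw [velocity, average, ← smul_sub]
  set r := c + s * t
  set X := φ c r (ρ • b)
  have hgi : Integrable (gauss d) := by simpa using integrable_gauss_mul_pow (d := d) 0
  have hi : ∀ i : ℕ, Integrable fun y => gauss d y • U (r, X + (((i : ℝ) + 1) * ρ) • y) :=
    fun i => ViscousHolder.integrable_smul hW.ns (hW.mem_Ioo hr) X _
  have key : ∀ y, U (r, X) - ∑ i ∈ Finset.range N, richardsonCoeff N i •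
      U (r, X + (((i : ℝ) + 1) * ρ) • y)
      = (-1 : ℝ) ^ N • (fwdDiff (ρ • y))^[N] (fun x => U (r, x)) X := by
    intro y
    have h := sum_richardsonCoeff_smul N fun i : ℕ => U (r, X + i • (ρ • y))
    rw [fwdDiff_iter_nat_eq (fun x => U (r, x)) X (ρ • y) N] at h
    simpa [← Nat.cast_smul_eq_nsmul ℝ, smul_smul] using h
  have h1 : U (r, X) - ∑ i ∈ Finset.range N, richardsonCoeff N i •
      ∫ y, gauss d y • U (r, X + (((i : ℝ) + 1) * ρ) • y)
      = ∫ y, gauss d y • (U (r, X) - ∑ i ∈ Finset.range N, richardsonCoeff N i •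
        U (r, X + (((i : ℝ) + 1) * ρ) • y)) := by
    simp only [smul_sub, Finset.smul_sum, smul_comm (gauss d _) (richardsonCoeff N _)]
    rw [integral_sub (hgi.smul_const _)
      (integrable_finsetSum _ fun i _ => (hi i).fun_smul _), integral_smul_const, integral_gauss,
      one_smul, integral_finsetSum _ fun i _ => (hi i).fun_smul _]
    simp only [integral_smul]
  rw [h1, ← integral_smul]
  refine (norm_integral_le_of_norm_le ((integrable_gauss_mul_pow (d := d) N).const_mul e)
    (Filter.Eventually.of_forall fun y => ?_)).trans_eq (by rw [integral_const_mul, gaussMoment])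
  rw [key, norm_smul, norm_smul, norm_smul, Real.norm_of_nonneg (gauss_nonneg y),
    Real.norm_of_nonneg (by positivity : 0 ≤ s / ρ), norm_pow, norm_neg, norm_one, one_pow, one_mul]
  have := mul_le_mul_of_nonneg_left (he r hr X y) (gauss_nonneg y)
  linarith

lemma continuous_average_zero (hW : FlowWindow T ν M α c s ρ U P φ) (N : ℕ) :
    Continuous (average c s ρ U φ N 0) := by
  obtain ⟨D, hD, hb⟩ := hW.exists_velocity_bound
  have hgi : Integrable (gauss d) := by simpa using integrable_gauss_mul_pow (d := d) 0
  have hc := hW.continuous_slice hW.center_mem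
  have e : average c s ρ U φ N 0 = fun b => (s / ρ) • ∑ i ∈ Finset.range N, richardsonCoeff N i •
      ∫ y, gauss d y • U (c, ρ • b + (((i : ℝ) + 1) * ρ) • y) := funext fun b => by
    simp only [average, mul_zero, add_zero, hW.flow.start c hW.center_mem]
  rw [e]
  refine (continuous_finsetSum _ fun i _ => ?_).const_smul (s / ρ)
  refine Continuous.const_smul ?_ (richardsonCoeff N i)
  refine continuous_of_dominated (bound := fun y => gauss d y * D)
    (fun b => (ViscousHolder.integrable_smul hW.ns (hW.mem_Ioo hW.center_mem) _ _).1)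
    (fun b => Filter.Eventually.of_forall fun y => ?_) (hgi.mul_const D)
    (Filter.Eventually.of_forall fun y => ?_)
  · rw [norm_smul, Real.norm_of_nonneg (gauss_nonneg y)]
    exact mul_le_mul_of_nonneg_left (hb c hW.center_mem _) (gauss_nonneg y)
  · have h1 : Continuous fun b : EuclideanSpace ℝ (Fin d) => ρ • b + (((i : ℝ) + 1) * ρ) • y :=
      (continuous_const_smul ρ).add continuous_const
    exact (hc.comp h1).const_smul (gauss d y)

lemma nearDriftSolution (hd : 2 ≤ d) (hW : FlowWindow T ν M α c s ρ U P φ) (hα : 0 < α)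
    (hα1 : α < 1) (hM : 0 < M) (hν : 0 ≤ ν) {μ : ℝ} (hμ : μ ≤ 1) (hMμ : M * s * ρ ^ (α - 1) ≤ μ)
    (hνμ : ν * s / ρ ^ 2 ≤ μ) {N : ℕ} {e C : ℝ} (he0 : 0 ≤ e)
    (heC : e ≤ C * (M * s * ρ ^ (α - 1)))
    (he : ∀ t ∈ Ioo (c - s) (c + s), ∀ x y,
      s / ρ * ‖(fwdDiff (ρ • y))^[N] (fun x => U (t, x)) x‖ ≤ e * (1 + ‖y‖) ^ N) :
    NearDriftSolution (richardsonStress d N) (richardsonLap d N) α (M * s * ρ ^ (α - 1)) μ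
      (ν * s / ρ ^ 2) (max 3 (C * gaussMoment d N)) (e * gaussMoment d N) (position c s ρ φ)
      (velocity c s ρ U φ) (average c s ρ U φ N) where
  e_nonneg := mul_nonneg he0 (gaussMoment_nonneg N)
  e_le := by
    have hρ := hW.ρ_pos
    have hs := hW.s_pos
    calc e * gaussMoment d N ≤ C * (M * s * ρ ^ (α - 1)) * gaussMoment d N :=
          mul_le_mul_of_nonneg_right heC (gaussMoment_nonneg N)
      _ = C * gaussMoment d N * (M * s * ρ ^ (α - 1)) := by ring
      _ ≤ _ := mul_le_mul_of_nonneg_right (le_max_right _ _) (by positivity)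
  motion := (hW.labelledMotion hα hα1 hM hν hμ hMμ hνμ).mono_C (le_max_left _ _)
  label := hW.position_zero
  hasDeriv := fun t ht b => hW.hasDerivAt_average hd N ht b
  close := fun t ht b => hW.norm_velocity_sub_average_le he ht b
  cont := hW.continuous_average_zero N

/-- A trajectory is a rescaled label path. -/
lemma fwdDiff_iter_eq (hW : FlowWindow T ν M α c s ρ U P φ) {γ : ℝ → EuclideanSpace ℝ (Fin d)}
    (hγ : ∀ t ∈ Ioo (c - s) (c + s), HasDerivAt γ (U (t, γ t)) t) (n : ℕ) {t h : ℝ} (hh : 0 ≤ h)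
    (ht : t ∈ Ioo (-1 : ℝ) 1) (hth : t + n * h ∈ Ioo (-1 : ℝ) 1) :
    (fwdDiff (s * h))^[n] γ (c + s * t)
      = ρ • (fwdDiff h)^[n] (fun t => position c s ρ φ t (ρ⁻¹ • γ c)) t := by
  have e := fwdDiff_iter_comp_affine γ c h s n t
  simp only [smul_eq_mul] at e
  rw [← e, fwdDiff_iter_eq_sum_shift, fwdDiff_iter_eq_sum_shift, Finset.smul_sum]
  refine Finset.sum_congr rfl fun k hk => ?_
  have hk' : (k : ℝ) ≤ n := by exact_mod_cast Nat.lt_succ_iff.1 (Finset.mem_range.1 hk)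
  have hmem : t + k • h ∈ Ioo (-1 : ℝ) 1 := by
    rw [nsmul_eq_mul]
    have : (k : ℝ) * h ≤ n * h := mul_le_mul_of_nonneg_right hk' hh
    have : 0 ≤ (k : ℝ) * h := by positivity
    exact ⟨by linarith [ht.1], by linarith [hth.2]⟩
  rw [smul_comm ρ, hW.smul_position, smul_inv_smul₀ hW.ρ_pos.ne',
    ← hW.flow.eq_of_hasDerivAt γ hγ c hW.center_mem _ (hW.mem_window hmem)]

end FlowWindow

theorem exists_norm_fwdDiff_iter_trajectory_le (hd : 2 ≤ d) {α : ℝ} (hα : 0 < α) (hα1 : α < 1)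
    (j : ℕ) (hj : 0 < 1 - (j + 1) * (1 - α)) (hj' : 1 - (j + 2) * (1 - α) < 0) (N : ℕ)
    (C₀ : ℝ) : ∃ C : ℝ, 0 ≤ C ∧
      ∀ {T ν M c s ρ μ e : ℝ} {U : ℝ × EuclideanSpace ℝ (Fin d) → EuclideanSpace ℝ (Fin d)}
        {P : ℝ × EuclideanSpace ℝ (Fin d) → ℝ}, NavierStokes T ν U P →
      0 < c - s → c + s < T → 0 < s → 0 < ρ → 0 < M → 0 ≤ ν → μ ≤ 1 → M * s * ρ ^ (α - 1) ≤ μ →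
      ν * s / ρ ^ 2 ≤ μ → 0 ≤ e → e ≤ C₀ * (M * s * ρ ^ (α - 1)) →
      (∀ t ∈ Ioo (c - s) (c + s), ∀ x y, ‖U (t, x) - U (t, y)‖ ≤ M * ‖x - y‖ ^ α) →
      (∀ t ∈ Ioo (c - s) (c + s), ∀ x y,
        s / ρ * ‖(fwdDiff (ρ • y))^[N] (fun x => U (t, x)) x‖ ≤ e * (1 + ‖y‖) ^ N) →
      ∀ {γ : ℝ → EuclideanSpace ℝ (Fin d)},
      (∀ t ∈ Ioo (c - s) (c + s), HasDerivAt γ (U (t, γ t)) t) → ∀ {t h : ℝ}, 0 ≤ h →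
      t ∈ Ioo (c - s) (c + s) → t + (j + 2 : ℕ) * h ∈ Ioo (c - s) (c + s) →
      ‖(fwdDiff h)^[j + 2] γ t‖ ≤ C * (ρ * (e + M * s * ρ ^ (α - 1) * μ ^ (j + 1))) := by
  have : NeZero d := ⟨by omega⟩
  have h𝒦 : KernelDecay ((Module.finrank ℝ (EuclideanSpace ℝ (Fin d)) : ℝ) + 1)
      (richardsonStress d N) := by
    rw [finrank_euclideanSpace_fin]; exact kernelDecay_richardsonStress hd N
  have hℬ : KernelDecay ((Module.finrank ℝ (EuclideanSpace ℝ (Fin d)) : ℝ) + 1)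
      (richardsonLap d N) := by
    rw [finrank_euclideanSpace_fin]; exact kernelDecay_richardsonLap N
  obtain ⟨C, hC, hmain⟩ := exists_norm_fwdDiff_iter_le h𝒦 hℬ hα hα1 j hj hj'
    (C := max 3 (C₀ * gaussMoment d N)) (by positivity)
  refine ⟨C * (gaussMoment d N + 1), mul_nonneg hC (by linarith [gaussMoment_nonneg (d := d) N]),
    ?_⟩
  intro T ν M c s ρ μ e U P hns hlo hup hs hρ hM hν hμ hMμ hνμ he0 heC hH he γ hγ t h hh ht hth
  obtain ⟨φ, hφ⟩ := hns.velocity.exists_volumeFlow hlo (by linarith) hup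
  have hW : FlowWindow T ν M α c s ρ U P φ := ⟨hns, hφ, hH, hlo, hup, hs, hρ⟩
  have hsol := hW.nearDriftSolution hd hα hα1 hM hν hμ hMμ hνμ he0 heC he
  have hmem : ∀ r, r ∈ Ioo (c - s) (c + s) → (r - c) / s ∈ Ioo (-1 : ℝ) 1 := fun r hr => by
    constructor
    · rw [lt_div_iff₀ hs]; linarith [hr.1]
    · rw [div_lt_iff₀ hs]; linarith [hr.2]
  have h1 : (t - c) / s + (j + 2 : ℕ) * (h / s) = (t + (j + 2 : ℕ) * h - c) / s := by ring
  have ht' := hmem t ht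
  have hth' : (t - c) / s + (j + 2 : ℕ) * (h / s) ∈ Ioo (-1 : ℝ) 1 := by
    rw [h1]; exact hmem _ hth
  have e1 := hW.fwdDiff_iter_eq hγ (j + 2) (by positivity : 0 ≤ h / s) ht' hth'
  rw [mul_div_cancel₀ _ hs.ne', mul_div_cancel₀ _ hs.ne', add_sub_cancel] at e1
  rw [e1, norm_smul, Real.norm_of_nonneg hρ.le]
  have h2 := hmain hsol (by positivity : 0 ≤ h / s) ht' hth' (ρ⁻¹ • γ c)
  have hμ0 : 0 ≤ μ := le_trans (by positivity) hMμ
  have hI := gaussMoment_nonneg (d := d) N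
  refine (mul_le_mul_of_nonneg_left h2 hρ.le).trans ?_
  have h3 : e * gaussMoment d N + M * s * ρ ^ (α - 1) * μ ^ (j + 1)
      ≤ (gaussMoment d N + 1) * (e + M * s * ρ ^ (α - 1) * μ ^ (j + 1)) := by
    have : 0 ≤ gaussMoment d N * (M * s * ρ ^ (α - 1) * μ ^ (j + 1)) := by positivity
    linarith
  calc _ ≤ ρ * (C * ((gaussMoment d N + 1) * (e + M * s * ρ ^ (α - 1) * μ ^ (j + 1)))) := by gcongr
    _ = _ := by ring

end Trajectories

section Exponents

/-- The viscous time scale of velocities with Hölder seminorm `M`. -/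
noncomputable def viscousTime (α M ν : ℝ) : ℝ :=
  M ^ (-2 / (1 + α)) * ν ^ ((1 - α) / (1 + α))

variable {α M ν s : ℝ}

lemma viscousTime_pos (hM : 0 < M) (hν : 0 < ν) : 0 < viscousTime α M ν := by
  unfold viscousTime; positivity

lemma log_viscousTime (hα : 0 < α) (hM : 0 < M) (hν : 0 < ν) :
    (1 + α) * Real.log (viscousTime α M ν) = (1 - α) * Real.log ν - 2 * Real.log M := by
  rw [viscousTime, Real.log_mul (by positivity) (by positivity), Real.log_rpow hM,
    Real.log_rpow hν]
  field_simp
  ring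

lemma mul_rpow_self_rpow_eq_one (hα1 : α < 1) (hs : 0 < s) :
    s * (s ^ (1 / (1 - α))) ^ (α - 1) = 1 := by
  have h1 : 1 - α ≠ 0 := by linarith
  rw [← Real.rpow_mul hs.le, show 1 / (1 - α) * (α - 1) = -1 by field_simp; ring,
    Real.rpow_neg_one, mul_inv_cancel₀ hs.ne']

lemma viscosity_mul_le_of_viscousTime_le (hα : 0 < α) (hα1 : α < 1) (hM : 0 < M) (hν : 0 < ν)
    (hs : viscousTime α M ν ≤ s) : ν * s / ((M * s) ^ (1 / (1 - α))) ^ 2 ≤ 1 := by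
  have hτ := viscousTime_pos (α := α) hM hν
  have hs0 : 0 < s := hτ.trans_le hs
  have h1 : 0 < 1 - α := by linarith
  have hl := log_viscousTime hα hM hν
  have hl' := mul_le_mul_of_nonneg_left (Real.log_le_log hτ hs) (by linarith : 0 ≤ 1 + α)
  rw [div_le_one (by positivity), ← Real.log_le_log_iff (by positivity) (by positivity),
    Real.log_pow, Real.log_rpow (by positivity), Real.log_mul hν.ne' hs0.ne',
    Real.log_mul hM.ne' hs0.ne']
  rw [show ((2 : ℕ) : ℝ) * (1 / (1 - α) * (Real.log M + Real.log s))
    = 2 * (Real.log M + Real.log s) / (1 - α) by push_cast; ring, le_div_iff₀ h1]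
  nlinarith

lemma mul_sqrt_rpow_le_of_le_viscousTime (hα : 0 < α) (hM : 0 < M) (hν : 0 < ν) (hs0 : 0 < s)
    (hs : s ≤ viscousTime α M ν) : M * s * ((ν * s) ^ (1 / 2 : ℝ)) ^ (α - 1) ≤ 1 := by
  have hl := log_viscousTime hα hM hν
  have hl' := mul_le_mul_of_nonneg_left (Real.log_le_log hs0 hs) (by linarith : 0 ≤ 1 + α)
  rw [← Real.log_le_log_iff (by positivity) (by positivity), Real.log_mul (by positivity)
    (by positivity), Real.log_rpow (by positivity), Real.log_rpow (by positivity),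
    Real.log_mul hν.ne' hs0.ne', Real.log_mul hM.ne' hs0.ne', Real.log_one]
  nlinarith

lemma sqrt_mul_self_mul (hν : 0 < ν) (hs : 0 < s) :
    (ν * s) ^ (1 / 2 : ℝ) * (M * s * ((ν * s) ^ (1 / 2 : ℝ)) ^ (α - 1))
      = M * ν ^ (α / 2) * s ^ (1 + α / 2) := by
  have h0 : 0 < ν * s := by positivity
  rw [← Real.rpow_mul h0.le, mul_left_comm, ← Real.rpow_add h0,
    show 1 / 2 + 1 / 2 * (α - 1) = α / 2 by ring, Real.mul_rpow hν.le hs.le, Real.rpow_add hs,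
    Real.rpow_one]
  ring

lemma viscousTime_rpow (hα : 0 < α) (hα1 : α < 1) (hM : 0 < M) (hν : 0 < ν) :
    M * ν ^ (α / 2) * viscousTime α M ν ^ (1 + α / 2 - 1 / (1 - α)) = M ^ (1 / (1 - α)) := by
  have hτ := viscousTime_pos (α := α) hM hν
  have h1 : 0 < 1 - α := by linarith
  have hl := log_viscousTime hα hM hν
  refine Real.log_injOn_pos (mem_Ioi.2 (by positivity)) (mem_Ioi.2 (by positivity)) ?_
  rw [Real.log_mul (by positivity) (by positivity), Real.log_mul (by positivity) (by positivity),
    Real.log_rpow hν, Real.log_rpow hτ, Real.log_rpow hM]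
  have e : Real.log ν = ((1 + α) * Real.log (viscousTime α M ν) + 2 * Real.log M) / (1 - α) := by
    field_simp; linarith
  rw [e]
  field_simp
  ring

/-- The bound at the smoothing scale `D = k τ` in terms of the scale invariant quantities. -/
lemma mul_rpow_le_of_eq_mul_viscousTime (hα : 0 < α) (hα1 : α < 1) (hM : 0 < M) (hν : 0 < ν)
    {m : ℕ} (hm : 1 / (1 - α) < (m : ℝ) + 1) {a K : ℝ} (ha : 0 < a) (hK : 1 ≤ K) :
    M * ν ^ (α / 2) * (min a 1 / K * viscousTime α M ν) ^ (1 + α / 2 - 1 / (1 - α))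
      ≤ K ^ m * (a ^ (-(m : ℝ)) + 1) * M ^ (1 / (1 - α)) := by
  have hτ := viscousTime_pos (α := α) hM hν
  have hmin : 0 < min a 1 := lt_min ha one_pos
  have hK0 : 0 < K := by linarith
  have hk : 0 < min a 1 / K := by positivity
  have hk1 : min a 1 / K ≤ 1 := (div_le_one hK0).2 ((min_le_right _ _).trans hK)
  rw [Real.mul_rpow hk.le hτ.le, mul_left_comm, viscousTime_rpow hα hα1 hM hν]
  refine mul_le_mul_of_nonneg_right ?_ (by positivity)
  calc (min a 1 / K) ^ (1 + α / 2 - 1 / (1 - α)) ≤ (min a 1 / K) ^ (-(m : ℝ)) :=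
        Real.rpow_le_rpow_of_exponent_ge hk hk1 (by linarith)
    _ = K ^ m * (min a 1) ^ (-(m : ℝ)) := by
        rw [Real.rpow_neg hk.le, Real.rpow_neg hmin.le, Real.rpow_natCast, Real.rpow_natCast,
          div_pow, inv_div]
        ring
    _ ≤ _ := by
        refine mul_le_mul_of_nonneg_left ?_ (by positivity)
        rcases le_total a 1 with h | h
        · rw [min_eq_left h]; linarith
        · rw [min_eq_right h, Real.one_rpow]
          linarith [Real.rpow_pos_of_pos ha (-(m : ℝ))]

end Exponents

section Increment

/-- A particle trajectory `γ` of a Navier–Stokes velocity with Hölder seminorm at most `M`, and a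
time window `(c - s, c + s)`. -/
structure TrajectoryWindow {d : ℕ} (T ν M α c s : ℝ)
    (U : ℝ × EuclideanSpace ℝ (Fin d) → EuclideanSpace ℝ (Fin d))
    (P : ℝ × EuclideanSpace ℝ (Fin d) → ℝ) (γ : ℝ → EuclideanSpace ℝ (Fin d)) : Prop where
  ns : NavierStokes T ν U P
  holder : ∀ t ∈ Ioo 0 T, ∀ x y, ‖U (t, x) - U (t, y)‖ ≤ M * ‖x - y‖ ^ α
  hasDerivAt : ∀ t ∈ Ioo 0 T, HasDerivAt γ (U (t, γ t)) t
  ν_pos : 0 < ν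
  M_pos : 0 < M
  s_pos : 0 < s
  lower_pos : 0 < c - s
  upper_lt : c + s < T

variable {d : ℕ} {α : ℝ}

theorem exists_norm_fwdDiff_iter_le_of_scale (hd : 2 ≤ d) (hα : 0 < α) (hα1 : α < 1)
    (j : ℕ) (hj : 0 < 1 - (j + 1) * (1 - α)) (hj' : 1 - (j + 2) * (1 - α) < 0) :
    ∃ C : ℝ, 0 ≤ C ∧ ∀ {T ν M c s ρ : ℝ}
      {U : ℝ × EuclideanSpace ℝ (Fin d) → EuclideanSpace ℝ (Fin d)}
      {P : ℝ × EuclideanSpace ℝ (Fin d) → ℝ} {γ : ℝ → EuclideanSpace ℝ (Fin d)},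
      TrajectoryWindow T ν M α c s U P γ → 0 < ρ → M * s * ρ ^ (α - 1) ≤ 1 → ν * s / ρ ^ 2 ≤ 1 →
      ∀ {t h : ℝ}, 0 ≤ h → t ∈ Ioo (c - s) (c + s) → t + (j + 2 : ℕ) * h ∈ Ioo (c - s) (c + s) →
      ‖(fwdDiff h)^[j + 2] γ t‖ ≤ C * (ρ * (M * s * ρ ^ (α - 1))) := by
  obtain ⟨C, hC, hmain⟩ := exists_norm_fwdDiff_iter_trajectory_le hd hα hα1 j hj hj' 1 1
  refine ⟨C * 2, by positivity, fun {T ν M c s ρ U P γ} hW hρ hM1 hν1 {t h} hh ht hth => ?_⟩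
  have hM := hW.M_pos
  have hs := hW.s_pos
  have hsub : ∀ {t}, t ∈ Ioo (c - s) (c + s) → t ∈ Ioo 0 T :=
    fun ht => ⟨hW.lower_pos.trans ht.1, ht.2.trans hW.upper_lt⟩
  refine (hmain hW.ns hW.lower_pos hW.upper_lt hs hρ hM hW.ν_pos.le le_rfl hM1 hν1
    (e := M * s * ρ ^ (α - 1)) (by positivity) (by rw [one_mul])
    (fun t ht => hW.holder t (hsub ht)) (fun t ht x y => ?_)
    (fun t ht => hW.hasDerivAt t (hsub ht)) hh ht hth).trans_eq (by rw [one_pow]; ring)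
  have hH := hW.holder t (hsub ht) (x + ρ • y) x
  rw [add_sub_cancel_left, norm_smul, Real.norm_of_nonneg hρ.le,
    Real.mul_rpow hρ.le (norm_nonneg _)] at hH
  have hy : ‖y‖ ^ α ≤ 1 + ‖y‖ := by
    calc ‖y‖ ^ α ≤ (1 + ‖y‖) ^ α :=
          Real.rpow_le_rpow (norm_nonneg _) (by linarith) hα.le
      _ ≤ (1 + ‖y‖) ^ (1 : ℝ) :=
          Real.rpow_le_rpow_of_exponent_le (by linarith [norm_nonneg y]) hα1.le
      _ = _ := Real.rpow_one _
  simp only [Function.iterate_one, fwdDiff, pow_one]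
  calc s / ρ * ‖U (t, x + ρ • y) - U (t, x)‖ ≤ s / ρ * (M * (ρ ^ α * ‖y‖ ^ α)) := by gcongr
    _ = M * s * ρ ^ (α - 1) * ‖y‖ ^ α := by rw [Real.rpow_sub_one hρ.ne']; ring
    _ ≤ _ := by gcongr

set_option maxHeartbeats 800000 in
theorem exists_norm_fwdDiff_iter_le_of_smoothing (hd : 2 ≤ d) (hα : 0 < α) (hα1 : α < 1)
    (j : ℕ) (hj : 0 < 1 - (j + 1) * (1 - α)) (hj' : 1 - (j + 2) * (1 - α) < 0) :
    ∃ (n : ℕ) (C : ℝ), 0 ≤ C ∧ ∀ {T ν M c s D : ℝ}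
      {U : ℝ × EuclideanSpace ℝ (Fin d) → EuclideanSpace ℝ (Fin d)}
      {P : ℝ × EuclideanSpace ℝ (Fin d) → ℝ} {γ : ℝ → EuclideanSpace ℝ (Fin d)},
      TrajectoryWindow T ν M α c s U P γ → s ≤ D → D ≤ viscousTime α M ν → n * D < c - s →
      ∀ {t h : ℝ}, 0 ≤ h → t ∈ Ioo (c - s) (c + s) → t + (j + 2 : ℕ) * h ∈ Ioo (c - s) (c + s) →
      ‖(fwdDiff h)^[j + 2] γ t‖
        ≤ C * (M * ν ^ (α / 2) * D ^ (1 + α / 2 - 1 / (1 - α)) * s ^ (1 / (1 - α))) := by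
  have h1α : 0 < 1 - α := by linarith
  set g := 1 / (1 - α) with hg
  have hgl : (j : ℝ) + 1 < g := by rw [hg, lt_div_iff₀ h1α]; linarith
  have hgu : g < (j : ℝ) + 2 := by rw [hg, div_lt_iff₀ h1α]; linarith
  have hj0 : (0 : ℝ) ≤ j := j.cast_nonneg
  obtain ⟨θ, hθ⟩ : ∃ θ : ℝ, θ = (j + 2 - g) / (2 * (j + 1)) := ⟨_, rfl⟩
  have hθ0 : 0 < θ := by rw [hθ]; apply div_pos <;> linarith
  have hθ2 : (1 - 2 * θ) * (j + 1) = g - 1 := by rw [hθ]; field_simp; ring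
  have hθ1 : 0 ≤ 1 - 2 * θ := by
    by_contra! hneg
    nlinarith
  obtain ⟨n, hn⟩ := exists_nat_ge (g / (θ * α))
  rw [div_le_iff₀ (by positivity)] at hn
  obtain ⟨A, hA, hsmooth⟩ := ViscousHolder.exists_norm_fwdDiff_iter_le hd hα hα1 n
  obtain ⟨C, hC, hmain⟩ := exists_norm_fwdDiff_iter_trajectory_le hd hα hα1 j hj hj' (n + 1) A
  refine ⟨n, C * (A + 1), by positivity, fun {T ν M c s D U P γ} hW hsD hDτ hnD {t h} hh ht hth => ?_⟩
  have hM := hW.M_pos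
  have hs := hW.s_pos
  have hν := hW.ν_pos
  have hD : 0 < D := hs.trans_le hsD
  have hsub : ∀ {t}, t ∈ Ioo (c - s) (c + s) → t ∈ Ioo 0 T :=
    fun ht => ⟨hW.lower_pos.trans ht.1, ht.2.trans hW.upper_lt⟩
  obtain ⟨x, hx⟩ : ∃ x, x = s / D := ⟨_, rfl⟩
  have hx0 : 0 < x := by rw [hx]; positivity
  have hx1 : x ≤ 1 := by rw [hx]; exact (div_le_one hD).2 hsD
  have hsx : s = D * x := by rw [hx]; field_simp
  have hmono : ∀ {p q : ℝ}, q ≤ p → x ^ p ≤ x ^ q :=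
    fun h => Real.rpow_le_rpow_of_exponent_ge hx0 hx1 h
  obtain ⟨ℓ, hℓ⟩ : ∃ ℓ, ℓ = (ν * D) ^ (1 / 2 : ℝ) := ⟨_, rfl⟩
  have hℓ0 : 0 < ℓ := by rw [hℓ]; positivity
  have hℓ2 : ℓ ^ 2 = ν * D := by
    rw [hℓ, ← Real.rpow_mul_natCast (by positivity)]; norm_num
  obtain ⟨ε, hε⟩ : ∃ ε, ε = M * D * ℓ ^ (α - 1) := ⟨_, rfl⟩
  have hε0 : 0 < ε := by rw [hε]; positivity
  have hε1 : ε ≤ 1 := by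
    rw [hε, hℓ]; exact mul_sqrt_rpow_le_of_le_viscousTime hα hM hν hD hDτ
  have hℓα : ℓ ^ (1 + α) = ℓ ^ 2 * ℓ ^ (α - 1) := by
    rw [← Real.rpow_natCast ℓ 2, ← Real.rpow_add hℓ0]; congr 1; push_cast; ring
  have hV : ViscousHolder T ν M α D ℓ U P := by
    refine ⟨hW.ns, hW.holder, hν, hM.le, hD, hℓ0, hℓ2, ?_⟩
    rw [hℓα, hℓ2, show M * (ν * D * ℓ ^ (α - 1)) = ν * ε by rw [hε]; ring]
    exact mul_le_of_le_one_right hν.le hε1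
  have hρ0 : 0 < ℓ * x ^ θ := by positivity
  have hM' : M * s * (ℓ * x ^ θ) ^ (α - 1) = ε * x ^ (1 - θ * (1 - α)) := by
    rw [Real.mul_rpow hℓ0.le (by positivity), ← Real.rpow_mul hx0.le, hsx, hε,
      show 1 - θ * (1 - α) = 1 + θ * (α - 1) by ring, Real.rpow_add hx0, Real.rpow_one]
    ring
  have hsρ : s / (ℓ * x ^ θ) * (M * ℓ ^ α) = ε * x ^ (1 - θ) := by
    rw [hsx, hε, Real.rpow_sub_one hℓ0.ne', Real.rpow_sub hx0, Real.rpow_one]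
    field_simp
  have hνρ : ν * s / (ℓ * x ^ θ) ^ 2 = x ^ (1 - 2 * θ) := by
    rw [mul_pow, hℓ2, hsx, ← Real.rpow_mul_natCast hx0.le, Real.rpow_sub hx0, Real.rpow_one]
    push_cast
    rw [mul_comm θ 2]
    field_simp
  have hμ : x ^ (1 - 2 * θ) ≤ 1 := Real.rpow_le_one hx0.le hx1 hθ1
  refine (hmain hW.ns hW.lower_pos hW.upper_lt hs hρ0 hM hν.le hμ ?_ hνρ.le
    (e := A * (ε * x ^ (1 - θ + θ * (α * (n + 1 : ℕ))))) (by positivity) ?_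
    (fun t ht => hW.holder t (hsub ht)) (fun t ht z y => ?_)
    (fun t ht => hW.hasDerivAt t (hsub ht)) hh ht hth).trans ?_
  · rw [hM']
    exact (mul_le_of_le_one_left (by positivity) hε1).trans (hmono (by nlinarith))
  · rw [hM']
    have hn0 : (0 : ℝ) ≤ n := n.cast_nonneg
    have : (0 : ℝ) ≤ θ * α * n := by positivity
    gcongr A * (ε * ?_)
    refine hmono ?_
    push_cast
    nlinarith
  · have hN := hsmooth hV t (hsub ht) (hnD.trans ht.1) (n + 1) (by omega) le_rfl
      ((ℓ * x ^ θ) • y) z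
    have hy : ‖y‖ ^ (α * (n + 1 : ℕ)) ≤ (1 + ‖y‖) ^ (n + 1) := by
      calc ‖y‖ ^ (α * (n + 1 : ℕ)) ≤ (1 + ‖y‖) ^ (α * (n + 1 : ℕ)) :=
            Real.rpow_le_rpow (norm_nonneg _) (by linarith) (by positivity)
        _ ≤ (1 + ‖y‖) ^ ((n + 1 : ℕ) : ℝ) :=
            Real.rpow_le_rpow_of_exponent_le (by linarith [norm_nonneg y])
              (mul_le_of_le_one_left (by positivity) hα1.le)
        _ = _ := Real.rpow_natCast _ _
    have hq : (‖(ℓ * x ^ θ) • y‖ / ℓ) ^ (α * (n + 1 : ℕ))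
        = x ^ (θ * (α * (n + 1 : ℕ))) * ‖y‖ ^ (α * (n + 1 : ℕ)) := by
      rw [norm_smul, Real.norm_of_nonneg hρ0.le, mul_assoc, mul_div_cancel_left₀ _ hℓ0.ne',
        Real.mul_rpow (by positivity) (norm_nonneg _), ← Real.rpow_mul hx0.le]
    rw [hq] at hN
    calc _ ≤ s / (ℓ * x ^ θ) * (A * (M * ℓ ^ α)
          * (x ^ (θ * (α * (n + 1 : ℕ))) * ‖y‖ ^ (α * (n + 1 : ℕ)))) := by gcongr
      _ = s / (ℓ * x ^ θ) * (M * ℓ ^ α) * (A * x ^ (θ * (α * (n + 1 : ℕ))))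
          * ‖y‖ ^ (α * (n + 1 : ℕ)) := by ring
      _ = A * (ε * x ^ (1 - θ + θ * (α * (n + 1 : ℕ)))) * ‖y‖ ^ (α * (n + 1 : ℕ)) := by
          rw [hsρ, Real.rpow_add hx0]; ring
      _ ≤ _ := by gcongr
  · rw [hM', mul_assoc C]
    refine mul_le_mul_of_nonneg_left ?_ hC
    have hℓε : ℓ * ε = M * ν ^ (α / 2) * D ^ (1 + α / 2) := by
      rw [hε, hℓ]; exact sqrt_mul_self_mul hν hD
    have hxD : D ^ (1 + α / 2 - g) * s ^ g = D ^ (1 + α / 2) * x ^ g := by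
      rw [hsx, Real.mul_rpow hD.le hx0.le, Real.rpow_sub hD]
      field_simp
    have hpow : (x ^ (1 - 2 * θ)) ^ (j + 1) = x ^ (g - 1) := by
      rw [← Real.rpow_mul_natCast hx0.le]; push_cast; rw [hθ2]
    calc ℓ * x ^ θ * (A * (ε * x ^ (1 - θ + θ * (α * (n + 1 : ℕ))))
          + ε * x ^ (1 - θ * (1 - α)) * (x ^ (1 - 2 * θ)) ^ (j + 1))
        = ℓ * ε * (A * (x ^ θ * x ^ (1 - θ + θ * (α * (n + 1 : ℕ))))
          + x ^ θ * x ^ (1 - θ * (1 - α)) * x ^ (g - 1)) := by rw [hpow]; ring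
      _ = ℓ * ε * (A * x ^ (1 + θ * (α * (n + 1 : ℕ))) + x ^ (g + θ * α)) := by
          rw [← Real.rpow_add hx0, ← Real.rpow_add hx0, ← Real.rpow_add hx0]
          ring_nf
      _ ≤ ℓ * ε * (A * x ^ g + x ^ g) := by
          gcongr ℓ * ε * (A * ?_ + ?_)
          · refine hmono ?_
            push_cast
            nlinarith [mul_pos hθ0 hα]
          · exact hmono (by nlinarith [mul_pos hθ0 hα])
      _ = (A + 1) * (ℓ * ε * x ^ g) := by ring
      _ = (A + 1) * (M * ν ^ (α / 2) * (D ^ (1 + α / 2) * x ^ g)) := by rw [hℓε]; ring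
      _ = _ := by rw [← hxD]; ring

/-- The Zygmund-type estimate for the increments of order `j + 2` of a trajectory. -/
theorem exists_norm_fwdDiff_iter_le_of_viscousTime (hd : 2 ≤ d) (hα : 0 < α) (hα1 : α < 1)
    (j : ℕ) (hj : 0 < 1 - (j + 1) * (1 - α)) (hj' : 1 - (j + 2) * (1 - α) < 0) :
    ∃ C : ℝ, 0 < C ∧ ∀ {T ν M a : ℝ}
      {U : ℝ × EuclideanSpace ℝ (Fin d) → EuclideanSpace ℝ (Fin d)}
      {P : ℝ × EuclideanSpace ℝ (Fin d) → ℝ} {γ : ℝ → EuclideanSpace ℝ (Fin d)},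
      NavierStokes T ν U P → 0 < ν → 0 < M → 0 < a →
      (∀ t ∈ Ioo 0 T, ∀ x y, ‖U (t, x) - U (t, y)‖ ≤ M * ‖x - y‖ ^ α) →
      (∀ t ∈ Ioo 0 T, HasDerivAt γ (U (t, γ t)) t) →
      ∀ {t h : ℝ}, 0 < h → a * viscousTime α M ν ≤ t → t + (j + 2 : ℕ) * h < T →
      ‖(fwdDiff h)^[j + 2] γ t‖
        ≤ C * (a ^ (-((j + 1 : ℕ) : ℝ)) + 1) * M ^ (1 / (1 - α)) * h ^ (1 / (1 - α)) := by
  obtain ⟨C₁, hC₁, hrough⟩ := exists_norm_fwdDiff_iter_le_of_scale hd hα hα1 j hj hj'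
  obtain ⟨n, C₂, hC₂, hsmooth⟩ := exists_norm_fwdDiff_iter_le_of_smoothing hd hα hα1 j hj hj'
  have h1α : 0 < 1 - α := by linarith
  have hgm : 1 / (1 - α) < ((j + 1 : ℕ) : ℝ) + 1 := by
    rw [div_lt_iff₀ h1α]; push_cast; linarith
  set g := 1 / (1 - α) with hg
  have hg0 : 0 < g := by positivity
  have hgα : 1 + α / 2 - g ≤ 0 := by
    have : 1 + α ≤ g := by rw [hg, le_div_iff₀ h1α]; nlinarith
    linarith
  obtain ⟨K, hK⟩ : ∃ K : ℝ, K = 2 * (n + 1) := ⟨_, rfl⟩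
  have hn0 : (0 : ℝ) ≤ n := n.cast_nonneg
  have hK1 : 1 ≤ K := by linarith
  have hK0 : 0 < K := by linarith
  refine ⟨(C₁ + C₂ + 1) * K ^ (j + 1) * ((j + 2 : ℕ) : ℝ) ^ g, by positivity,
    fun {T ν M a U P γ} hNS hν hM ha hH hγ {t h} hh hat htT => ?_⟩
  have hτ := viscousTime_pos (α := α) hM hν
  have ht0 : 0 < t := lt_of_lt_of_le (by positivity) hat
  obtain ⟨L, hL⟩ : ∃ L : ℝ, L = (j + 2 : ℕ) * h := ⟨_, rfl⟩
  have hL0 : 0 < L := by rw [hL]; positivity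
  rw [← hL] at htT
  obtain ⟨r, hr⟩ : ∃ r : ℝ, r = min (L / 2) (min (t / 4) ((T - t - L) / 2)) := ⟨_, rfl⟩
  have hr0 : 0 < r := by
    rw [hr]; refine lt_min (by linarith) (lt_min (by linarith) (by linarith))
  have hrL : r ≤ L / 2 := hr ▸ min_le_left _ _
  have hrt : r ≤ t / 4 := hr ▸ (min_le_right _ _).trans (min_le_left _ _)
  have hrT : r ≤ (T - t - L) / 2 := hr ▸ (min_le_right _ _).trans (min_le_right _ _)
  obtain ⟨s, hs⟩ : ∃ s : ℝ, s = L / 2 + r := ⟨_, rfl⟩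
  obtain ⟨c, hc⟩ : ∃ c : ℝ, c = t + L / 2 := ⟨_, rfl⟩
  have hs0 : 0 < s := by linarith
  have hW : TrajectoryWindow T ν M α c s U P γ :=
    ⟨hNS, hH, hγ, hν, hM, hs0, by linarith, by linarith⟩
  have ht : t ∈ Ioo (c - s) (c + s) := ⟨by linarith, by linarith⟩
  have hth : t + (j + 2 : ℕ) * h ∈ Ioo (c - s) (c + s) := by
    rw [← hL]; exact ⟨by linarith, by linarith⟩
  have hsg : s ^ g ≤ ((j + 2 : ℕ) : ℝ) ^ g * h ^ g := by
    rw [← Real.mul_rpow (by positivity) hh.le, ← hL]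
    exact Real.rpow_le_rpow hs0.le (by linarith) hg0.le
  obtain ⟨D, hD⟩ : ∃ D : ℝ, D = min a 1 / K * viscousTime α M ν := ⟨_, rfl⟩
  have hmin : 0 < min a 1 := lt_min ha one_pos
  have hD0 : 0 < D := by rw [hD]; positivity
  have hDτ : D ≤ viscousTime α M ν := by
    rw [hD]
    exact mul_le_of_le_one_left hτ.le ((div_le_one hK0).2 ((min_le_right _ _).trans hK1))
  have hKD : K * D ≤ t := by
    calc K * D = min a 1 * viscousTime α M ν := by rw [hD]; field_simp
      _ ≤ a * viscousTime α M ν := by gcongr; exact min_le_left _ _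
      _ ≤ t := hat
  have hnD : n * D < c - s := by
    have : K * D = 2 * (n * D) + 2 * D := by rw [hK]; ring
    linarith
  have hQ := mul_rpow_le_of_eq_mul_viscousTime hα hα1 hM hν hgm ha hK1
  rw [← hD, ← hg] at hQ
  set Q := K ^ (j + 1) * (a ^ (-((j + 1 : ℕ) : ℝ)) + 1) * M ^ g with hQdef
  have hQ0 : 0 ≤ Q := by positivity
  have hMQ : M ^ g ≤ Q := by
    have ha' : 0 ≤ a ^ (-((j + 1 : ℕ) : ℝ)) := by positivity
    refine le_mul_of_one_le_left (by positivity) ?_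
    exact one_le_mul_of_one_le_of_one_le (one_le_pow₀ hK1) (by linarith)
  suffices hkey : ‖(fwdDiff h)^[j + 2] γ t‖ ≤ (C₁ + C₂ + 1) * (Q * s ^ g) by
    calc _ ≤ (C₁ + C₂ + 1) * (Q * s ^ g) := hkey
      _ ≤ (C₁ + C₂ + 1) * (Q * (((j + 2 : ℕ) : ℝ) ^ g * h ^ g)) := by gcongr
      _ = _ := by rw [hQdef]; ring
  have hX : 0 ≤ Q * s ^ g := by positivity
  rcases le_total (viscousTime α M ν) s with h1 | h1
  · have hρ0 : 0 < (M * s) ^ g := by positivity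
    have e := mul_rpow_self_rpow_eq_one hα1 (by positivity : 0 < M * s)
    rw [← hg] at e
    have hb := hrough hW hρ0 e.le (viscosity_mul_le_of_viscousTime_le hα hα1 hM hν h1) hh.le ht hth
    rw [e, mul_one, Real.mul_rpow hM.le hs0.le] at hb
    calc _ ≤ C₁ * (M ^ g * s ^ g) := hb
      _ ≤ C₁ * (Q * s ^ g) := by gcongr
      _ ≤ _ := by gcongr; linarith
  rcases le_total D s with h2 | h2
  · have hb := hrough hW (ρ := (ν * s) ^ (1 / 2 : ℝ)) (by positivity)
      (mul_sqrt_rpow_le_of_le_viscousTime hα hM hν hs0 h1)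
      (by rw [← Real.rpow_mul_natCast (by positivity)]; norm_num; exact div_self_le_one _)
      hh.le ht hth
    rw [sqrt_mul_self_mul hν hs0] at hb
    calc _ ≤ C₁ * (M * ν ^ (α / 2) * s ^ (1 + α / 2)) := hb
      _ = C₁ * (M * ν ^ (α / 2) * s ^ (1 + α / 2 - g) * s ^ g) := by
          rw [mul_assoc _ (s ^ _) (s ^ g), ← Real.rpow_add hs0, sub_add_cancel]
      _ ≤ C₁ * (M * ν ^ (α / 2) * D ^ (1 + α / 2 - g) * s ^ g) := by
          have := Real.rpow_le_rpow_of_nonpos hD0 h2 hgα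
          gcongr
      _ ≤ C₁ * (Q * s ^ g) := by gcongr
      _ ≤ _ := by gcongr; linarith
  · calc _ ≤ C₂ * (M * ν ^ (α / 2) * D ^ (1 + α / 2 - g) * s ^ g) :=
          hsmooth hW h2 hDτ hnD hh.le ht hth
      _ ≤ C₂ * (Q * s ^ g) := by gcongr
      _ ≤ _ := by gcongr; linarith

end Increment

lemma hasDerivAt_iteratedDeriv_of_contDiffOn {E : Type*} [NormedAddCommGroup E] [NormedSpace ℝ E]
    {f : ℝ → E} {s : Set ℝ} (hs : IsOpen s) (hf : ContDiffOn ℝ (⊤ : ℕ∞) f s) (i : ℕ) {t : ℝ}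
    (ht : t ∈ s) : HasDerivAt (iteratedDeriv i f) (iteratedDeriv (i + 1) f t) t := by
  have h1 : DifferentiableAt ℝ (iteratedDerivWithin i f s) t :=
    (hf.differentiableOn_iteratedDerivWithin (by exact_mod_cast ENat.natCast_lt_top i)
      hs.uniqueDiffOn t ht).differentiableAt (hs.mem_nhds ht)
  have h2 : iteratedDeriv i f =ᶠ[nhds t] iteratedDerivWithin i f s :=
    Filter.eventually_of_mem (hs.mem_nhds ht) fun y hy =>
      (iteratedDerivWithin_of_isOpen hs hy).symm
  rw [iteratedDeriv_succ]
  exact (h1.congr_of_eventuallyEq h2).hasDerivAt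

/-- Lagrangian estimate, non-integer case `m < 1/(1−α) < m+1`. -/
theorem stmt2 (d : ℕ) (hd : 2 ≤ d) (α : ℝ) (hα : 0 < α) (hα1 : α < 1)
    (m : ℕ) (hm1 : 1 ≤ m) (hml : (m : ℝ) < 1 / (1 - α)) (hmu : 1 / (1 - α) < (m : ℝ) + 1) :
    ∃ C : ℝ, 0 < C ∧
      ∀ T ν : ℝ, 0 < T → 0 < ν →
      ∀ (u : ℝ → EuclideanSpace ℝ (Fin d) → EuclideanSpace ℝ (Fin d)) (p : ℝ → EuclideanSpace ℝ (Fin d) → ℝ),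
        ContinuousOn (fun q : ℝ × EuclideanSpace ℝ (Fin d) => u q.1 q.2) (Ico 0 T ×ˢ univ) →
        ContDiffOn ℝ (⊤ : ℕ∞) (fun q : ℝ × EuclideanSpace ℝ (Fin d) => u q.1 q.2) (Ioo 0 T ×ˢ univ) →
        ContDiffOn ℝ (⊤ : ℕ∞) (fun q : ℝ × EuclideanSpace ℝ (Fin d) => p q.1 q.2) (Ioo 0 T ×ˢ univ) →
        (∀ (t : ℝ) (x : EuclideanSpace ℝ (Fin d)) (n : Fin d → ℤ), u t (x + (EuclideanSpace.equiv (Fin d) ℝ).symm (fun i => (n i : ℝ))) = u t x) →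
        (∀ (t : ℝ) (x : EuclideanSpace ℝ (Fin d)) (n : Fin d → ℤ), p t (x + (EuclideanSpace.equiv (Fin d) ℝ).symm (fun i => (n i : ℝ))) = p t x) →
        (∀ t ∈ Ioo (0 : ℝ) T, ∀ (x : EuclideanSpace ℝ (Fin d)) (i : Fin d),
          deriv (fun s => u s x i) t
              + ∑ j, u t x j * fderiv ℝ (fun y => u t y i) x (EuclideanSpace.single j 1)
              + fderiv ℝ (fun y => p t y) x (EuclideanSpace.single i 1)
            = ν * ∑ j, fderiv ℝ (fun y => fderiv ℝ (fun z => u t z i) y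
                (EuclideanSpace.single j 1)) x (EuclideanSpace.single j 1)) →
        (∀ t ∈ Ioo (0 : ℝ) T, ∀ x : EuclideanSpace ℝ (Fin d),
          ∑ i, fderiv ℝ (fun y => u t y i) x (EuclideanSpace.single i 1) = 0) →
        (∃ M₀ : ℝ, ∀ t ∈ Ico (0 : ℝ) T, ∀ x, ‖u t x‖ ≤ M₀) →
        ∀ M₁ : ℝ,
          IsLUB {r : ℝ | ∃ t ∈ Ico (0 : ℝ) T, ∃ x y : EuclideanSpace ℝ (Fin d),
            x ≠ y ∧ r = ‖u t x - u t y‖ / ‖x - y‖ ^ α} M₁ →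
          0 < M₁ →
          ∀ x : ℝ → EuclideanSpace ℝ (Fin d),
            ContDiffOn ℝ (⊤ : ℕ∞) x (Ioo 0 T) →
            (∀ t ∈ Ioo (0 : ℝ) T, HasDerivAt x (u t (x t)) t) →
            ∀ a : ℝ, 0 < a →
              ∀ t₁ t₂ : ℝ,
                t₁ ∈ Ico (a * M₁ ^ (-2 / (1 + α)) * ν ^ ((1 - α) / (1 + α))) T →
                t₂ ∈ Ico (a * M₁ ^ (-2 / (1 + α)) * ν ^ ((1 - α) / (1 + α))) T →
                  ‖iteratedDeriv m x t₁ - iteratedDeriv m x t₂‖ ≤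
                    C * (a ^ (-(m : ℝ)) + 1) * M₁ ^ (1 / (1 - α)) *
                      |t₁ - t₂| ^ (1 / (1 - α) - m) := by
  have h1α : 0 < 1 - α := by linarith
  obtain ⟨j, rfl⟩ : ∃ j, m = j + 1 := ⟨m - 1, by omega⟩
  obtain ⟨C₁, hC₁, hinc⟩ := exists_norm_fwdDiff_iter_le_of_viscousTime hd hα hα1 j
    (by rw [lt_div_iff₀ h1α] at hml; push_cast at hml; linarith)
    (by rw [div_lt_iff₀ h1α] at hmu; push_cast at hmu; linarith)
  obtain ⟨C₂, hC₂, hzyg⟩ := exists_holder_of_zygmund (E := EuclideanSpace ℝ (Fin d)) (j + 1) hml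
  refine ⟨C₂ * C₁, by positivity, ?_⟩
  intro T ν hT hν u p _ hu hp hup hpp hns hdiv _ M₁ hlub hM₁ x hx hxu a ha t₁ t₂ ht₁ ht₂
  have hNS := navierStokes_of_components hu hp hup hpp hns hdiv
  have hH : ∀ t ∈ Ioo 0 T, ∀ y z, ‖u t y - u t z‖ ≤ M₁ * ‖y - z‖ ^ α := by
    intro t ht y z
    rcases eq_or_ne y z with rfl | hyz
    · simp [Real.zero_rpow hα.ne']
    · have : 0 < ‖y - z‖ := norm_pos_iff.2 (sub_ne_zero.2 hyz)
      rw [← div_le_iff₀ (by positivity)]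
      exact hlub.1 ⟨t, ⟨ht.1.le, ht.2⟩, y, z, hyz, rfl⟩
  rw [mul_assoc a] at ht₁ ht₂
  change t₁ ∈ Ico (a * viscousTime α M₁ ν) T at ht₁
  change t₂ ∈ Ico (a * viscousTime α M₁ ν) T at ht₂
  have hτ := viscousTime_pos (α := α) hM₁ hν
  have hsub : ∀ {t}, t ∈ Ico (a * viscousTime α M₁ ν) T → t ∈ Ioo 0 T :=
    fun ht => ⟨(mul_pos ha hτ).trans_le ht.1, ht.2⟩
  refine (hzyg (fs := fun i => iteratedDeriv i x) ordConnected_Ico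
    (fun i _ t ht => hasDerivAt_iteratedDeriv_of_contDiffOn isOpen_Ioo hx i (hsub ht))
    (B := C₁ * (a ^ (-((j + 1 : ℕ) : ℝ)) + 1) * M₁ ^ (1 / (1 - α))) (by positivity)
    (fun t h hh ht hth => ?_) t₁ ht₁ t₂ ht₂).trans_eq (by ring)
  rw [iteratedDeriv_zero]
  refine hinc hNS hν hM₁ ha hH hxu hh ht.1 ?_
  rw [show ((j + 2 : ℕ) : ℝ) = ((j + 1 : ℕ) : ℝ) + 1 by push_cast; ring]
  exact hth.2
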